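/- For every real c > 0, there are infinitely many natural numbers m all of whose prime factors exceed c, with the property that (p_{n+1} − p_n)/2 = m − 1 for infinitely many n. -/

import Mathlib

set_option linter.unusedSectionVars false
set_option linter.unusedVariables false

namespace RG
open Finset

/-- product-expansion for functions on a product of `Option`-indexed factors -/
lemma sum_option_fun {ι A : Type} [Fintype ι] [DecidableEq ι] [DecidableEq (Option ι)]
    [Fintype A]
    (f : (Option ι → A) → ℝ) :
    ∑ σ : Option ι → A, f σ = ∑ x : A, ∑ τ : ι → A, f (fun o => o.elim x τ) := by
  rw [← Fintype.sum_prod_type']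
  refine (Fintype.sum_equiv (Equiv.piOptionEquivProd (β := fun _ : Option ι => A)) _ _ ?_)
  intro σ
  congr 1
  funext o
  cases o <;> rfl

lemma tensor_step {ι A T : Type} [Fintype ι] [DecidableEq ι] [DecidableEq (Option ι)]
    [Fintype A] [Fintype T]
    (w : Option ι → T → ℝ) (u : Option ι → A → T → ℝ) (D : Option ι → A → ℝ)
    (hw : ∀ i t, 0 ≤ w i t) (hD : ∀ i a, 0 ≤ D i a)
    (h : ∀ i (v : A → ℝ), ∑ t, w i t * (∑ a, v a * u i a t) ^ 2 ≤ ∑ a, D i a * v a ^ 2)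
    (IH' : ∀ c : (ι → A) → ℝ,
      ∑ σ : ι → T, (∏ i, w (some i) (σ i)) *
        (∑ a : ι → A, c a * ∏ i, u (some i) (a i) (σ i)) ^ 2
      ≤ ∑ a : ι → A, (∏ i, D (some i) (a i)) * c a ^ 2)
    (c : (Option ι → A) → ℝ) :
    ∑ σ : Option ι → T, (∏ i, w i (σ i)) *
        (∑ a : Option ι → A, c a * ∏ i, u i (a i) (σ i)) ^ 2
      ≤ ∑ a : Option ι → A, (∏ i, D i (a i)) * c a ^ 2 := by
  have e1 : ∑ σ : Option ι → T, (∏ i, w i (σ i)) *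
      (∑ a : Option ι → A, c a * ∏ i, u i (a i) (σ i)) ^ 2
    = ∑ x : T, w none x * ∑ τ : ι → T, (∏ i, w (some i) (τ i)) *
      (∑ b : ι → A, (∑ z : A, c (fun o => o.elim z b) * u none z x)
        * ∏ i, u (some i) (b i) (τ i)) ^ 2 := by
    rw [sum_option_fun (A := T)]
    refine sum_congr rfl fun x _ => ?_
    rw [mul_sum]
    refine sum_congr rfl fun τ _ => ?_
    rw [Fintype.prod_option, mul_assoc]
    congr 2
    congr 1
    symm
    rw [sum_option_fun (A := A)]
    rw [sum_comm]
    refine sum_congr rfl fun b _ => ?_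
    rw [sum_mul]
    refine sum_congr rfl fun z _ => ?_
    rw [Fintype.prod_option]
    simp [mul_assoc]
  have e2 : ∑ a : Option ι → A, (∏ i, D i (a i)) * c a ^ 2
    = ∑ b : ι → A, (∏ i, D (some i) (b i)) *
        ∑ z : A, D none z * c (fun o => o.elim z b) ^ 2 := by
    rw [sum_option_fun (A := A)]
    rw [sum_comm]
    refine sum_congr rfl fun x _ => ?_
    rw [mul_sum]
    refine sum_congr rfl fun τ _ => ?_
    rw [Fintype.prod_option]
    simp only [Option.elim]
    ring
  rw [e1, e2]
  calc _ ≤ ∑ x : T, w none x * ∑ b : ι → A, (∏ i, D (some i) (b i)) *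
            (∑ z : A, c (fun o => o.elim z b) * u none z x) ^ 2 := by
          refine sum_le_sum fun x _ => mul_le_mul_of_nonneg_left ?_ (hw _ _)
          exact IH' _
    _ = ∑ b : ι → A, (∏ i, D (some i) (b i)) * ∑ x : T, w none x *
            (∑ z : A, c (fun o => o.elim z b) * u none z x) ^ 2 := by
          simp_rw [mul_sum]
          rw [sum_comm]
          refine sum_congr rfl fun b _ => sum_congr rfl fun x _ => ?_
          ring
    _ ≤ _ := by
          refine sum_le_sum fun b _ => mul_le_mul_of_nonneg_left (h none _) ?_
          exact prod_nonneg fun i _ => hD _ _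


lemma tensor_le {ι A T : Type} [Fintype ι] [DecidableEq ι] [Fintype A] [Fintype T]
    (w : ι → T → ℝ) (u : ι → A → T → ℝ) (D : ι → A → ℝ)
    (hw : ∀ i t, 0 ≤ w i t) (hD : ∀ i a, 0 ≤ D i a)
    (h : ∀ i (v : A → ℝ), ∑ t, w i t * (∑ a, v a * u i a t) ^ 2 ≤ ∑ a, D i a * v a ^ 2)
    (c : (ι → A) → ℝ) :
    ∑ σ : ι → T, (∏ i, w i (σ i)) * (∑ a : ι → A, c a * ∏ i, u i (a i) (σ i)) ^ 2
      ≤ ∑ a : ι → A, (∏ i, D i (a i)) * c a ^ 2 := by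
  classical
  revert w u D
  suffices H : ∀ (w : ι → T → ℝ) (u : ι → A → T → ℝ) (D : ι → A → ℝ),
      (∀ i t, 0 ≤ w i t) → (∀ i a, 0 ≤ D i a) →
      (∀ i (v : A → ℝ), ∑ t, w i t * (∑ a, v a * u i a t) ^ 2 ≤ ∑ a, D i a * v a ^ 2) →
      ∀ c : (ι → A) → ℝ,
      ∑ σ : ι → T, (∏ i, w i (σ i)) * (∑ a : ι → A, c a * ∏ i, u i (a i) (σ i)) ^ 2
      ≤ ∑ a : ι → A, (∏ i, D i (a i)) * c a ^ 2 from
    fun w u D hw hD h => H w u D hw hD h c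
  clear c
  have key := @Fintype.induction_empty_option
    (fun ι hι => ∀ [DecidableEq ι] (w : ι → T → ℝ) (u : ι → A → T → ℝ) (D : ι → A → ℝ),
      (∀ i t, 0 ≤ w i t) → (∀ i a, 0 ≤ D i a) →
      (∀ i (v : A → ℝ), ∑ t, w i t * (∑ a, v a * u i a t) ^ 2 ≤ ∑ a, D i a * v a ^ 2) →
      ∀ c : (ι → A) → ℝ,
      ∑ σ : ι → T, (∏ i, w i (σ i)) * (∑ a : ι → A, c a * ∏ i, u i (a i) (σ i)) ^ 2
      ≤ ∑ a : ι → A, (∏ i, D i (a i)) * c a ^ 2) ?_ ?_ ?_ ι _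
  · exact fun w u D => key w u D
  · intro α β _ e IH _ w u D hw hD h c
    let _ : Fintype α := Fintype.ofEquiv β e.symm
    have : DecidableEq α := Classical.decEq _
    have h1 := IH (fun i => w (e i)) (fun i => u (e i)) (fun i => D (e i))
      (fun i => hw _) (fun i => hD _) (fun i => h _) (fun a => c (fun b => a (e.symm b)))
    convert h1 using 1
    · refine Fintype.sum_equiv (e.symm.arrowCongr (Equiv.refl T)) _ _ fun σ => ?_
      congr 1
      · refine Fintype.prod_equiv e.symm _ _ fun i => ?_
        simp [Equiv.arrowCongr]
      · congr 1
        refine Fintype.sum_equiv (e.symm.arrowCongr (Equiv.refl A)) _ _ fun a => ?_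
        congr 1
        · congr 1; funext b; simp [Equiv.arrowCongr]
        · refine Fintype.prod_equiv e.symm _ _ fun i => ?_
          simp [Equiv.arrowCongr]
    · refine Fintype.sum_equiv (e.symm.arrowCongr (Equiv.refl A)) _ _ fun a => ?_
      congr 1
      · refine Fintype.prod_equiv e.symm _ _ fun i => ?_
        simp [Equiv.arrowCongr]
      · congr 2; funext b; simp [Equiv.arrowCongr]
  · intro _ w u D hw hD h c
    simp
  · intro ι _ IH _ w u D hw hD h c
    have : DecidableEq ι := Classical.decEq _
    have IH' := IH (fun i => w (some i)) (fun i => u (some i)) (fun i => D (some i))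
      (fun i => hw _) (fun i => hD _) (fun i => h _)
    exact tensor_step w u D hw hD h IH' c

lemma tensor_step_ge {ι A T : Type} [Fintype ι] [DecidableEq ι] [DecidableEq (Option ι)]
    [Fintype A] [Fintype T]
    (w : Option ι → T → ℝ) (u : Option ι → A → T → ℝ) (D : Option ι → A → ℝ)
    (hw : ∀ i t, 0 ≤ w i t) (hD : ∀ i a, 0 ≤ D i a)
    (h : ∀ i (v : A → ℝ), ∑ a, D i a * v a ^ 2 ≤ ∑ t, w i t * (∑ a, v a * u i a t) ^ 2)
    (IH' : ∀ c : (ι → A) → ℝ,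
      ∑ σ : ι → T, (∏ i, w (some i) (σ i)) *
        (∑ a : ι → A, c a * ∏ i, u (some i) (a i) (σ i)) ^ 2
      ≥ ∑ a : ι → A, (∏ i, D (some i) (a i)) * c a ^ 2)
    (c : (Option ι → A) → ℝ) :
    ∑ σ : Option ι → T, (∏ i, w i (σ i)) *
        (∑ a : Option ι → A, c a * ∏ i, u i (a i) (σ i)) ^ 2
      ≥ ∑ a : Option ι → A, (∏ i, D i (a i)) * c a ^ 2 := by
  have e1 : ∑ σ : Option ι → T, (∏ i, w i (σ i)) *
      (∑ a : Option ι → A, c a * ∏ i, u i (a i) (σ i)) ^ 2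
    = ∑ x : T, w none x * ∑ τ : ι → T, (∏ i, w (some i) (τ i)) *
      (∑ b : ι → A, (∑ z : A, c (fun o => o.elim z b) * u none z x)
        * ∏ i, u (some i) (b i) (τ i)) ^ 2 := by
    rw [sum_option_fun (A := T)]
    refine sum_congr rfl fun x _ => ?_
    rw [mul_sum]
    refine sum_congr rfl fun τ _ => ?_
    rw [Fintype.prod_option, mul_assoc]
    congr 2
    congr 1
    symm
    rw [sum_option_fun (A := A)]
    rw [sum_comm]
    refine sum_congr rfl fun b _ => ?_
    rw [sum_mul]
    refine sum_congr rfl fun z _ => ?_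
    rw [Fintype.prod_option]
    simp [mul_assoc]
  have e2 : ∑ a : Option ι → A, (∏ i, D i (a i)) * c a ^ 2
    = ∑ b : ι → A, (∏ i, D (some i) (b i)) *
        ∑ z : A, D none z * c (fun o => o.elim z b) ^ 2 := by
    rw [sum_option_fun (A := A)]
    rw [sum_comm]
    refine sum_congr rfl fun x _ => ?_
    rw [mul_sum]
    refine sum_congr rfl fun τ _ => ?_
    rw [Fintype.prod_option]
    simp only [Option.elim]
    ring
  rw [e1, e2]
  calc _ ≥ ∑ x : T, w none x * ∑ b : ι → A, (∏ i, D (some i) (b i)) *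
            (∑ z : A, c (fun o => o.elim z b) * u none z x) ^ 2 := by
          refine sum_le_sum fun x _ => mul_le_mul_of_nonneg_left ?_ (hw _ _)
          exact IH' _
    _ = ∑ b : ι → A, (∏ i, D (some i) (b i)) * ∑ x : T, w none x *
            (∑ z : A, c (fun o => o.elim z b) * u none z x) ^ 2 := by
          simp_rw [mul_sum]
          rw [sum_comm]
          refine sum_congr rfl fun b _ => sum_congr rfl fun x _ => ?_
          ring
    _ ≥ _ := by
          refine sum_le_sum fun b _ => mul_le_mul_of_nonneg_left (h none _) ?_
          exact prod_nonneg fun i _ => hD _ _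


lemma tensor_ge {ι A T : Type} [Fintype ι] [DecidableEq ι] [Fintype A] [Fintype T]
    (w : ι → T → ℝ) (u : ι → A → T → ℝ) (D : ι → A → ℝ)
    (hw : ∀ i t, 0 ≤ w i t) (hD : ∀ i a, 0 ≤ D i a)
    (h : ∀ i (v : A → ℝ), ∑ a, D i a * v a ^ 2 ≤ ∑ t, w i t * (∑ a, v a * u i a t) ^ 2)
    (c : (ι → A) → ℝ) :
    ∑ σ : ι → T, (∏ i, w i (σ i)) * (∑ a : ι → A, c a * ∏ i, u i (a i) (σ i)) ^ 2
      ≥ ∑ a : ι → A, (∏ i, D i (a i)) * c a ^ 2 := by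
  classical
  revert w u D
  suffices H : ∀ (w : ι → T → ℝ) (u : ι → A → T → ℝ) (D : ι → A → ℝ),
      (∀ i t, 0 ≤ w i t) → (∀ i a, 0 ≤ D i a) →
      (∀ i (v : A → ℝ), ∑ a, D i a * v a ^ 2 ≤ ∑ t, w i t * (∑ a, v a * u i a t) ^ 2) →
      ∀ c : (ι → A) → ℝ,
      ∑ σ : ι → T, (∏ i, w i (σ i)) * (∑ a : ι → A, c a * ∏ i, u i (a i) (σ i)) ^ 2
      ≥ ∑ a : ι → A, (∏ i, D i (a i)) * c a ^ 2 from
    fun w u D hw hD h => H w u D hw hD h c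
  clear c
  have key := @Fintype.induction_empty_option
    (fun ι hι => ∀ [DecidableEq ι] (w : ι → T → ℝ) (u : ι → A → T → ℝ) (D : ι → A → ℝ),
      (∀ i t, 0 ≤ w i t) → (∀ i a, 0 ≤ D i a) →
      (∀ i (v : A → ℝ), ∑ a, D i a * v a ^ 2 ≤ ∑ t, w i t * (∑ a, v a * u i a t) ^ 2) →
      ∀ c : (ι → A) → ℝ,
      ∑ σ : ι → T, (∏ i, w i (σ i)) * (∑ a : ι → A, c a * ∏ i, u i (a i) (σ i)) ^ 2
      ≥ ∑ a : ι → A, (∏ i, D i (a i)) * c a ^ 2) ?_ ?_ ?_ ι _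
  · exact fun w u D => key w u D
  · intro α β _ e IH _ w u D hw hD h c
    let _ : Fintype α := Fintype.ofEquiv β e.symm
    have : DecidableEq α := Classical.decEq _
    have h1 := IH (fun i => w (e i)) (fun i => u (e i)) (fun i => D (e i))
      (fun i => hw _) (fun i => hD _) (fun i => h _) (fun a => c (fun b => a (e.symm b)))
    convert h1 using 1
    · refine Fintype.sum_equiv (e.symm.arrowCongr (Equiv.refl T)) _ _ fun σ => ?_
      congr 1
      · refine Fintype.prod_equiv e.symm _ _ fun i => ?_
        simp [Equiv.arrowCongr]
      · congr 1
        refine Fintype.sum_equiv (e.symm.arrowCongr (Equiv.refl A)) _ _ fun a => ?_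
        congr 1
        · congr 1; funext b; simp [Equiv.arrowCongr]
        · refine Fintype.prod_equiv e.symm _ _ fun i => ?_
          simp [Equiv.arrowCongr]
    · refine Fintype.sum_equiv (e.symm.arrowCongr (Equiv.refl A)) _ _ fun a => ?_
      congr 1
      · refine Fintype.prod_equiv e.symm _ _ fun i => ?_
        simp [Equiv.arrowCongr]
      · congr 2; funext b; simp [Equiv.arrowCongr]
  · intro _ w u D hw hD h c
    simp
  · intro ι _ IH _ w u D hw hD h c
    have : DecidableEq ι := Classical.decEq _
    have IH' := IH (fun i => w (some i)) (fun i => u (some i)) (fun i => D (some i))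
      (fun i => hw _) (fun i => hD _) (fun i => h _)
    exact tensor_step_ge w u D hw hD h IH' c

end RG


namespace RG
open Finset

/-- weights, local functions -/
def D0 {k : ℕ} (t : ℝ) : Option (Fin k) → ℝ
  | none => 1
  | some _ => t

def uu {k : ℕ} (t : ℝ) : Option (Fin k) → Option (Fin k) → ℝ
  | none, _ => 1
  | some j, s => t - if s = some j then 1 else 0

def ui {k : ℕ} (i : Fin k) (t : ℝ) : Option (Fin k) → Option (Fin k) → ℝ
  | none, _ => 1
  | some j, s => if j = i then t else t - if s = some j then 1 else 0

def uz {k : ℕ} (i : Fin k) (t : ℝ) : Option (Fin k) → Option (Fin k) → ℝ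
  | none, _ => 1
  | some j, s => if j = i then 0 else t - if s = some j then 1 else 0

def kap {k : ℕ} (i : Fin k) (t : ℝ) : Option (Fin k) → Option (Fin k) → ℝ
  | none, none => 1
  | none, some j => if j = i then t else 0
  | some j, y => if j ≠ i ∧ y = some j then 1 else 0

noncomputable def wf {k : ℕ} (t : ℝ) : Option (Fin k) → ℝ
  | none => 1 - k * (t / (1 + t))
  | some _ => t / (1 + t)

def wi {k : ℕ} (i : Fin k) (t : ℝ) : Option (Fin k) → ℝ
  | none => 1 - (k - 1) * t
  | some j => if j = i then 0 else t

lemma wf_eq {k : ℕ} (i : Fin k) (t : ℝ) (ht : 0 ≤ t) (s : Option (Fin k)) :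
    wf t s = t / (1 + t) * (if s = some i then 1 else 0) + 1 / (1 + t) * wi i t s := by
  have : (1 + t) ≠ 0 := by positivity
  cases s with
  | none => simp [wf, wi]; field_simp; ring
  | some j =>
    by_cases h : j = i
    · simp [wf, wi, h]
    · simp [wf, wi, h]; field_simp

lemma sum_uu {k : ℕ} (t : ℝ) (v : Option (Fin k) → ℝ) (s : Option (Fin k)) :
    ∑ a, v a * uu t a s = v none + t * ∑ j, v (some j) - s.elim 0 (fun j => v (some j)) := by
  rw [Fintype.sum_option]
  cases s with
  | none => simp [uu, mul_sum, mul_comm]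
  | some j =>
    simp only [uu, mul_sub, sum_sub_distrib, Option.some.injEq, mul_ite, mul_one, mul_zero,
      Option.elim, mul_sum]
    simp [mul_comm]
    ring

lemma local_full {k : ℕ} (t : ℝ) (ht : 0 ≤ t) (ht1 : t ≤ 1) (v : Option (Fin k) → ℝ) :
    ∑ s, wf t s * (∑ a, v a * uu t a s) ^ 2
      ≤ ∑ a, ((1 + k * t ^ 2) * D0 t a) * v a ^ 2 := by
  simp_rw [sum_uu]
  rw [Fintype.sum_option, Fintype.sum_option]
  simp only [wf, D0, Option.elim, sub_zero]
  have e : ∀ A : ℝ, ∑ j : Fin k, t / (1 + t) * (A - v (some j)) ^ 2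
      = t / (1 + t) * (k * A ^ 2 - 2 * A * ∑ j, v (some j) + ∑ j, v (some j) ^ 2) := by
    intro A
    rw [← mul_sum]
    congr 1
    simp_rw [sub_sq]
    rw [sum_add_distrib, sum_sub_distrib, mul_sum]
    simp
  rw [e]
  have hS : ∀ c : ℝ, 2 * v none * (c * ∑ j : Fin k, v (some j)) ≤
      |c| * (k * v none ^ 2 + ∑ j : Fin k, v (some j) ^ 2) := by
    intro c
    have : |c| * (k * v none ^ 2 + ∑ j : Fin k, v (some j) ^ 2) =
       ∑ j : Fin k, |c| * (v none ^ 2 + v (some j) ^ 2) := by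
      rw [← mul_sum, sum_add_distrib]; simp
    rw [this, mul_sum, mul_sum]
    refine sum_le_sum fun j _ => ?_
    rcases abs_cases c with ⟨h, h'⟩ | ⟨h, h'⟩ <;> rw [h]
    · nlinarith [mul_nonneg h' (sq_nonneg (v none - v (some j)))]
    · nlinarith [mul_nonneg (neg_nonneg.2 h'.le) (sq_nonneg (v none + v (some j)))]
  set s := ∑ j : Fin k, v (some j)
  set q := ∑ j : Fin k, v (some j) ^ 2 with hq
  have hq0 : 0 ≤ q := sum_nonneg fun j _ => sq_nonneg _
  have e2 : ∑ x : Fin k, (1 + (k:ℝ) * t ^ 2) * t * v (some x) ^ 2 = (1 + (k:ℝ) * t ^ 2) * t * q := by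
    rw [hq, mul_sum]
  rw [e2]
  have h1 : 0 < 1 + t := by positivity
  have hc := hS (t ^ 2 / (1 + t))
  rw [abs_of_nonneg (by positivity)] at hc
  have id1 : (1 - ↑k * (t / (1 + t))) * (v none + t * s) ^ 2 +
      t / (1 + t) * (↑k * (v none + t * s) ^ 2 - 2 * (v none + t * s) * s + q)
      = v none ^ 2 + 2 * v none * (t ^ 2 / (1 + t) * s) + t / (1 + t) * q
        - (t ^ 2 * (1 - t) / (1 + t)) * s ^ 2 := by
    field_simp
    ring
  rw [id1]
  have h2 : 0 ≤ (t ^ 2 * (1 - t) / (1 + t)) * s ^ 2 := by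
    have : 0 ≤ 1 - t := by linarith
    positivity
  have h3 : t ^ 2 / (1 + t) ≤ t ^ 2 := div_le_self (by positivity) (by linarith)
  have h4 : t / (1 + t) * q + t ^ 2 / (1 + t) * q = t * q := by field_simp
  have h5 : t ^ 2 / (1 + t) * (k * v none ^ 2) ≤ t ^ 2 * (k * v none ^ 2) :=
    mul_le_mul_of_nonneg_right h3 (by positivity)
  have h6 : 0 ≤ (k:ℝ) * t ^ 2 * t * q := by positivity
  nlinarith

lemma sum_uz {k : ℕ} (i : Fin k) (t : ℝ) (v : Option (Fin k) → ℝ) (s : Option (Fin k)) :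
    ∑ a, v a * uz i t a s = v none + t * ∑ j ∈ univ.erase i, v (some j)
      - s.elim 0 (fun j => if j = i then 0 else v (some j)) := by
  rw [Fintype.sum_option]
  have : ∑ j, v (some j) * uz i t (some j) s =
      ∑ j ∈ univ.erase i, (t * v (some j) - if s = some j then v (some j) else 0) := by
    rw [← sum_erase univ (a := i)]
    · refine sum_congr rfl fun j hj => ?_
      simp only [uz, (mem_erase.1 hj).1, if_false]
      split_ifs <;> ring
    · simp [uz]
  rw [this, sum_sub_distrib, mul_sum]
  cases s with
  | none => simp [uz]
  | some j =>
    by_cases h : j = i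
    · simp [uz, h]
    · simp [uz, h]; ring

lemma sum_wi {k : ℕ} (i : Fin k) (t : ℝ) (f : Option (Fin k) → ℝ) :
    ∑ s, wi i t s * f s = (1 - (k - 1) * t) * f none + t * ∑ j ∈ univ.erase i, f (some j) := by
  rw [Fintype.sum_option, ← sum_erase univ (a := i) (by simp [wi]), mul_sum]
  congr 1
  refine sum_congr rfl fun j hj => ?_
  simp [wi, (mem_erase.1 hj).1]

lemma local_i_eq {k : ℕ} (i : Fin k) (t : ℝ) (v : Option (Fin k) → ℝ) :
    ∑ s, wi i t s * (∑ a, v a * uz i t a s) ^ 2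
      = v none ^ 2 + t * ∑ j ∈ univ.erase i, v (some j) ^ 2
        - t ^ 2 * (∑ j ∈ univ.erase i, v (some j)) ^ 2 := by
  rw [sum_wi]
  simp_rw [sum_uz]
  simp only [Option.elim, sub_zero]
  have e : ∀ A : ℝ, ∑ j ∈ univ.erase i, (A - if j = i then 0 else v (some j)) ^ 2
      = (k - 1) * A ^ 2 - 2 * A * ∑ j ∈ univ.erase i, v (some j)
        + ∑ j ∈ univ.erase i, v (some j) ^ 2 := by
    intro A
    have hk : (((univ.erase i).card : ℕ) : ℝ) = k - 1 := by
      rw [card_erase_of_mem (mem_univ _), card_univ, Fintype.card_fin,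
        Nat.cast_sub (Fin.pos i)]; simp
    rw [← hk, mul_sum, ← nsmul_eq_mul, ← sum_const, ← sum_sub_distrib, ← sum_add_distrib]
    refine sum_congr rfl fun j hj => ?_
    simp only [(mem_erase.1 hj).1, if_false]
    ring
  rw [e]
  ring

lemma local_i_le {k : ℕ} (i : Fin k) (t : ℝ) (ht : 0 ≤ t) (v : Option (Fin k) → ℝ) :
    ∑ s, wi i t s * (∑ a, v a * uz i t a s) ^ 2 ≤ ∑ a, D0 t a * v a ^ 2 := by
  rw [local_i_eq, Fintype.sum_option]
  simp only [D0]
  rw [← mul_sum]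
  have : ∑ j ∈ univ.erase i, v (some j) ^ 2 ≤ ∑ j, v (some j) ^ 2 :=
    sum_le_sum_of_subset_of_nonneg (erase_subset _ _) fun _ _ _ => sq_nonneg _
  nlinarith [mul_le_mul_of_nonneg_left this ht,
    mul_nonneg (sq_nonneg t) (sq_nonneg (∑ j ∈ univ.erase i, v (some j)))]

lemma sq_sum_erase {k : ℕ} (i : Fin k) (v : Option (Fin k) → ℝ) :
    (∑ j ∈ univ.erase i, v (some j)) ^ 2 ≤ k * ∑ j ∈ univ.erase i, v (some j) ^ 2 := by
  refine (sq_sum_le_card_mul_sum_sq).trans ?_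
  refine mul_le_mul_of_nonneg_right ?_ (sum_nonneg fun _ _ => sq_nonneg _)
  exact_mod_cast (card_le_univ _).trans (by simp)

def Dl {k : ℕ} (i : Fin k) (t : ℝ) : Option (Fin k) → ℝ
  | none => 1
  | some j => if j = i then 0 else t * (1 - k * t)

lemma local_i_ge {k : ℕ} (i : Fin k) (t : ℝ) (v : Option (Fin k) → ℝ) :
    ∑ a, Dl i t a * v a ^ 2 ≤ ∑ s, wi i t s * (∑ a, v a * uz i t a s) ^ 2 := by
  rw [local_i_eq, Fintype.sum_option, ← sum_erase univ (a := i) (by simp [Dl])]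
  have : ∑ j ∈ univ.erase i, Dl i t (some j) * v (some j) ^ 2 =
      t * (1 - k * t) * ∑ j ∈ univ.erase i, v (some j) ^ 2 := by
    rw [mul_sum]
    refine sum_congr rfl fun j hj => ?_
    simp [Dl, (mem_erase.1 hj).1]
  rw [this]
  simp only [Dl]
  nlinarith [mul_le_mul_of_nonneg_left (sq_sum_erase i v) (sq_nonneg t)]

lemma local_pt {k : ℕ} (i : Fin k) (t : ℝ) (ht : 0 ≤ t) (hk : k * t ≤ 1)
    (v : Option (Fin k) → ℝ) :
    ∑ s, (if s = some i then 1 else 0) * (∑ a, v a * uz i t a s) ^ 2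
      ≤ ∑ a, (2 * D0 t a) * v a ^ 2 := by
  simp_rw [sum_uz]
  rw [Fintype.sum_option, Fintype.sum_option]
  simp only [D0]
  simp only [reduceCtorEq, if_false, Option.some.injEq, ite_mul, zero_mul, one_mul, zero_add,
    sum_ite_eq', mem_univ, if_true, Option.elim, sub_zero]
  rw [← mul_sum]
  have h1 : ∑ j ∈ univ.erase i, v (some j) ^ 2 ≤ ∑ j, v (some j) ^ 2 :=
    sum_le_sum_of_subset_of_nonneg (erase_subset _ _) fun _ _ _ => sq_nonneg _
  have h2 := sq_sum_erase i v
  have h0 : 0 ≤ ∑ j ∈ univ.erase i, v (some j) ^ 2 := sum_nonneg fun _ _ => sq_nonneg _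
  set s := ∑ j ∈ univ.erase i, v (some j)
  set q := ∑ j ∈ univ.erase i, v (some j) ^ 2
  have h3 : t ^ 2 * s ^ 2 ≤ t * q := by
    calc t ^ 2 * s ^ 2 ≤ t ^ 2 * (k * q) := mul_le_mul_of_nonneg_left h2 (sq_nonneg _)
      _ = (k * t) * (t * q) := by ring
      _ ≤ 1 * (t * q) := mul_le_mul_of_nonneg_right hk (by positivity)
      _ = t * q := one_mul _
  nlinarith [mul_le_mul_of_nonneg_left h1 ht, sq_nonneg (v none - t * s)]

lemma sum_kap {k : ℕ} (i : Fin k) (t : ℝ) (y s : Option (Fin k)) :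
    ∑ x, kap i t x y * uz i t x s = ui i t y s := by
  rw [Fintype.sum_option]
  cases y with
  | none => simp [kap, ui, uz]
  | some j =>
    by_cases h : j = i
    · subst h
      simp only [kap, uz, ui, if_true]
      rw [sum_eq_zero]
      · simp
      · intro l _
        by_cases hl : l = j <;> simp [hl]
        intro h'; exact absurd h'.symm hl
    · rw [sum_eq_single j]
      · simp [kap, uz, ui, h]
      · intro l _ hl
        simp [kap, hl.symm]
      · simp

end RG


namespace RG
open Finset

section model
variable {ι : Type} [Fintype ι] [DecidableEq ι] {k : ℕ}

/-- the quadratic form -/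
noncomputable def Zq (t : ι → ℝ) (G : (ι → Option (Fin k)) → ℝ) : ℝ :=
  ∑ a : ι → Option (Fin k), (∏ p, D0 (t p) (a p)) * G a ^ 2

/-- the sieve function on states -/
noncomputable def FF (t : ι → ℝ) (G : (ι → Option (Fin k)) → ℝ) (σ : ι → Option (Fin k)) : ℝ :=
  ∑ a : ι → Option (Fin k), G a * ∏ p, uu (t p) (a p) (σ p)

noncomputable def FI (i : Fin k) (t : ι → ℝ) (G : (ι → Option (Fin k)) → ℝ)
    (σ : ι → Option (Fin k)) : ℝ :=
  ∑ a : ι → Option (Fin k), G a * ∏ p, ui i (t p) (a p) (σ p)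

noncomputable def GI (i : Fin k) (t : ι → ℝ) (G : (ι → Option (Fin k)) → ℝ)
    (a' : ι → Option (Fin k)) : ℝ :=
  ∑ a : ι → Option (Fin k), G a * ∏ p, kap i (t p) (a' p) (a p)

def MonoG (G : (ι → Option (Fin k)) → ℝ) : Prop :=
  ∀ a p, G a ≤ G (Function.update a p none)

lemma D0_nonneg {t : ℝ} (ht : 0 ≤ t) (a : Option (Fin k)) : 0 ≤ D0 t a := by
  cases a <;> simp [D0, ht]

lemma kap_nonneg (i : Fin k) {t : ℝ} (ht : 0 ≤ t) (a b : Option (Fin k)) : 0 ≤ kap i t a b := by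
  cases a <;> cases b <;> simp only [kap] <;> (try split_ifs) <;> linarith

lemma wi_nonneg (i : Fin k) {t : ℝ} (ht : 0 ≤ t) (hk : k * t ≤ 1) (a : Option (Fin k)) :
    0 ≤ wi i t a := by
  cases a <;> simp only [wi]
  · nlinarith
  · split_ifs <;> linarith

lemma wf_nonneg {t : ℝ} (ht : 0 ≤ t) (hk : k * t ≤ 1) (a : Option (Fin k)) :
    0 ≤ wf t a := by
  have : t / (1 + t) ≤ t := div_le_self ht (by linarith)
  cases a <;> simp only [wf]
  · nlinarith [mul_le_mul_of_nonneg_left this (Nat.cast_nonneg k : (0:ℝ) ≤ k)]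
  · positivity

lemma FF_eq_FI (i : Fin k) (t : ι → ℝ) (G : (ι → Option (Fin k)) → ℝ)
    (σ : ι → Option (Fin k)) (h : ∀ p, σ p ≠ some i) : FF t G σ = FI i t G σ := by
  unfold FF FI
  refine sum_congr rfl fun a _ => ?_
  congr 1
  refine prod_congr rfl fun p _ => ?_
  cases ha : a p with
  | none => rfl
  | some j =>
    simp only [uu, ui]
    split_ifs with h1 h2 h2
    · exact absurd (h1.trans (by rw [h2])) (h p)
    · rfl
    · simp
    · rfl

lemma FI_eq (i : Fin k) (t : ι → ℝ) (G : (ι → Option (Fin k)) → ℝ)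
    (σ : ι → Option (Fin k)) :
    FI i t G σ = ∑ a, GI i t G a * ∏ p, uz i (t p) (a p) (σ p) := by
  unfold FI GI
  simp_rw [sum_mul]
  rw [sum_comm]
  refine sum_congr rfl fun b _ => ?_
  simp_rw [mul_assoc, ← mul_sum, ← prod_mul_distrib]
  congr 1
  have := (Finset.prod_univ_sum (fun _ : ι => (univ : Finset (Option (Fin k))))
    (fun p x => kap i (t p) x (b p) * uz i (t p) x (σ p)))
  rw [Fintype.piFinset_univ] at this
  rw [← this]
  exact prod_congr rfl fun p _ => (sum_kap i (t p) (b p) (σ p)).symm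

lemma GI_nonneg (i : Fin k) (t : ι → ℝ) (ht : ∀ p, 0 ≤ t p) (G : (ι → Option (Fin k)) → ℝ)
    (hG : ∀ a, 0 ≤ G a) (a) : 0 ≤ GI i t G a :=
  sum_nonneg fun b _ => mul_nonneg (hG b) (prod_nonneg fun p _ => kap_nonneg i (ht p) _ _)

lemma GI_eq_zero (i : Fin k) (t : ι → ℝ) (G : (ι → Option (Fin k)) → ℝ)
    (a : ι → Option (Fin k)) (p : ι) (h : a p = some i) : GI i t G a = 0 := by
  refine sum_eq_zero fun b _ => ?_
  rw [prod_eq_zero (mem_univ p), mul_zero]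
  simp [h, kap]

lemma GI_mono (i : Fin k) (t : ι → ℝ) (ht : ∀ p, 0 ≤ t p) (G : (ι → Option (Fin k)) → ℝ)
    (hG : ∀ a, 0 ≤ G a) (hm : MonoG G) : MonoG (GI i t G) := by
  intro a p
  cases hap : a p with
  | none => rw [← hap, Function.update_eq_self]
  | some j =>
    unfold GI
    have hnn : ∀ a b : ι → Option (Fin k), 0 ≤ G b * ∏ q, kap i (t q) (a q) (b q) := fun a b =>
      mul_nonneg (hG b) (prod_nonneg fun q _ => kap_nonneg i (ht q) _ _)
    calc ∑ b, G b * ∏ q, kap i (t q) (a q) (b q)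
        = ∑ b with b p = some j, G b * ∏ q, kap i (t q) (a q) (b q) := by
          rw [sum_filter_of_ne]
          intro b _ hb
          by_contra hne
          apply hb
          rw [prod_eq_zero (mem_univ p), mul_zero]
          simp [hap, kap, hne]
      _ ≤ ∑ b with b p = some j, G (Function.update b p none) *
            ∏ q, kap i (t q) (Function.update a p none q) (Function.update b p none q) := by
          refine sum_le_sum fun b hb => ?_
          refine mul_le_mul (hm b p) ?_ (prod_nonneg fun q _ => kap_nonneg i (ht q) _ _) (hG _)
          refine prod_le_prod (fun q _ => kap_nonneg i (ht q) _ _) fun q _ => ?_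
          by_cases hq : q = p
          · subst hq
            simp only [Function.update_self, hap, kap]
            split_ifs <;> norm_num
          · simp [Function.update_of_ne hq]
      _ = ∑ b ∈ (univ.filter fun b : ι → Option (Fin k) => b p = some j).image
            (fun b => Function.update b p none),
            G b * ∏ q, kap i (t q) (Function.update a p none q) (b q) := by
          rw [sum_image]
          intro b hb b' hb' h
          simp only [coe_filter, mem_univ, true_and, Set.mem_setOf_eq] at hb hb'
          funext q
          by_cases hq : q = p
          · subst hq; rw [hb, hb']
          · have := congrFun h q
            simpa [Function.update_of_ne hq] using this
      _ ≤ _ := sum_le_sum_of_subset_of_nonneg (subset_univ _) fun b _ _ => hnn _ b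

lemma mono_sum (t : ι → ℝ) (ht : ∀ p, 0 ≤ t p) (H : (ι → Option (Fin k)) → ℝ)
    (hH : ∀ a, 0 ≤ H a) (hm : MonoG H) (p : ι) :
    ∑ a : ι → Option (Fin k) with a p ≠ none, (∏ q, D0 (t q) (a q)) * H a ^ 2
      ≤ k * t p * Zq t H := by
  have hprod : ∀ a : ι → Option (Fin k), 0 ≤ ∏ q, D0 (t q) (a q) := fun a =>
    prod_nonneg fun q _ => D0_nonneg (ht q) _
  have key : ∀ j : Fin k, ∑ a : ι → Option (Fin k) with a p = some j,
      (∏ q, D0 (t q) (a q)) * H a ^ 2 ≤ t p * Zq t H := by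
    intro j
    unfold Zq
    calc _ ≤ ∑ a : ι → Option (Fin k) with a p = some j, t p *
          ((∏ q, D0 (t q) (Function.update a p none q)) * H (Function.update a p none) ^ 2) := by
          refine sum_le_sum fun a ha => ?_
          have ha' : a p = some j := by simpa using ha
          have e : (∏ q, D0 (t q) (a q)) = t p * ∏ q, D0 (t q) (Function.update a p none q) := by
            rw [← mul_prod_erase univ _ (mem_univ p),
              ← mul_prod_erase univ (fun q => D0 (t q) (Function.update a p none q)) (mem_univ p)]
            simp only [ha', D0, Function.update_self, one_mul]
            congr 1
            refine prod_congr rfl fun q hq => ?_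
            rw [Function.update_of_ne (mem_erase.1 hq).1]
          rw [e, mul_assoc]
          refine mul_le_mul_of_nonneg_left (mul_le_mul_of_nonneg_left ?_ (hprod _)) (ht p)
          exact pow_le_pow_left₀ (hH a) (hm a p) 2
      _ = t p * ∑ a ∈ (univ.filter fun b : ι → Option (Fin k) => b p = some j).image
            (fun b => Function.update b p none), (∏ q, D0 (t q) (a q)) * H a ^ 2 := by
          rw [← mul_sum, sum_image]
          intro b hb b' hb' h
          simp only [coe_filter, mem_univ, true_and, Set.mem_setOf_eq] at hb hb'
          funext q
          by_cases hq : q = p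
          · subst hq; rw [hb, hb']
          · have := congrFun h q
            simpa [Function.update_of_ne hq] using this
      _ ≤ _ := by
          refine mul_le_mul_of_nonneg_left ?_ (ht p)
          exact sum_le_sum_of_subset_of_nonneg (subset_univ _)
            fun b _ _ => mul_nonneg (hprod b) (sq_nonneg _)
  calc _ = ∑ j : Fin k, ∑ a : ι → Option (Fin k) with a p = some j,
      (∏ q, D0 (t q) (a q)) * H a ^ 2 := by
        simp_rw [sum_filter]
        rw [sum_comm]
        refine sum_congr rfl fun a _ => ?_
        cases hap : a p with
        | none => simp
        | some j => simp
    _ ≤ ∑ j : Fin k, t p * Zq t H := sum_le_sum fun j _ => key j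
    _ = _ := by simp; ring

lemma Zq_nonneg (t : ι → ℝ) (ht : ∀ p, 0 ≤ t p) (G : (ι → Option (Fin k)) → ℝ) : 0 ≤ Zq t G :=
  sum_nonneg fun a _ => mul_nonneg (prod_nonneg fun q _ => D0_nonneg (ht q) _) (sq_nonneg _)

lemma full_le (t : ι → ℝ) (ht : ∀ p, 0 ≤ t p) (ht1 : ∀ p, t p ≤ 1) (hk : ∀ p, k * t p ≤ 1)
    (G : (ι → Option (Fin k)) → ℝ) :
    ∑ σ : ι → Option (Fin k), (∏ p, wf (t p) (σ p)) * FF t G σ ^ 2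
      ≤ (∏ p, (1 + k * t p ^ 2)) * Zq t G := by
  have := tensor_le (fun p => wf (k := k) (t p)) (fun p => uu (t p))
    (fun p a => (1 + k * t p ^ 2) * D0 (t p) a)
    (fun p s => wf_nonneg (ht p) (hk p) s)
    (fun p a => mul_nonneg (by positivity) (D0_nonneg (ht p) a))
    (fun p v => local_full (t p) (ht p) (ht1 p) v) G
  refine this.trans (le_of_eq ?_)
  unfold Zq
  rw [mul_sum]
  refine sum_congr rfl fun a _ => ?_
  rw [prod_mul_distrib, mul_assoc]

/-- mean over states avoiding `i` -/
noncomputable def Ei (i : Fin k) (t : ι → ℝ) (f : (ι → Option (Fin k)) → ℝ) : ℝ :=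
  ∑ σ : ι → Option (Fin k), (∏ p, wi i (t p) (σ p)) * f σ

lemma Ei_sq_le (i : Fin k) (t : ι → ℝ) (ht : ∀ p, 0 ≤ t p) (hk : ∀ p, k * t p ≤ 1)
    (H : (ι → Option (Fin k)) → ℝ) :
    Ei i t (fun σ => (∑ a, H a * ∏ p, uz i (t p) (a p) (σ p)) ^ 2) ≤ Zq t H :=
  tensor_le (fun p => wi i (t p)) (fun p => uz i (t p)) (fun p => D0 (t p))
    (fun p s => wi_nonneg i (ht p) (hk p) s) (fun p a => D0_nonneg (ht p) a)
    (fun p v => local_i_le i (t p) (ht p) v) H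

lemma mu_le (i : Fin k) (t : ι → ℝ) (ht : ∀ p, 0 ≤ t p) (hk : ∀ p, k * t p ≤ 1)
    (G : (ι → Option (Fin k)) → ℝ) :
    Ei i t (fun σ => FI i t G σ ^ 2) ≤ Zq t (GI i t G) := by
  simp_rw [FI_eq]
  exact Ei_sq_le i t ht hk _

lemma one_sub_sum_le_prod {α : Type} (s : Finset α) (f : α → ℝ) (h0 : ∀ a ∈ s, 0 ≤ f a)
    (h1 : ∀ a ∈ s, f a ≤ 1) : 1 - ∑ a ∈ s, f a ≤ ∏ a ∈ s, (1 - f a) := by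
  classical
  induction s using Finset.induction_on with
  | empty => simp
  | insert a s ha ih =>
    rw [sum_insert ha, prod_insert ha]
    have ih' := ih (fun b hb => h0 b (mem_insert_of_mem hb)) (fun b hb => h1 b (mem_insert_of_mem hb))
    have hs : 0 ≤ ∑ a ∈ s, f a := sum_nonneg fun b hb => h0 b (mem_insert_of_mem hb)
    have := mul_le_mul_of_nonneg_left ih' (sub_nonneg.2 (h1 a (mem_insert_self _ _)))
    nlinarith [mul_nonneg (h0 a (mem_insert_self _ _)) hs]

lemma mu_ge (i : Fin k) (t : ι → ℝ) (ht : ∀ p, 0 ≤ t p) (hk : ∀ p, k * t p ≤ 1)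
    (G : (ι → Option (Fin k)) → ℝ) (hG : ∀ a, 0 ≤ G a) (hm : MonoG G) :
    (1 - ∑ p, (k * t p) ^ 2) * Zq t (GI i t G) ≤ Ei i t (fun σ => FI i t G σ ^ 2) := by
  simp_rw [FI_eq]
  have h1 := tensor_ge (fun p => wi i (t p)) (fun p => uz i (t p)) (fun p => Dl i (t p))
    (fun p s => wi_nonneg i (ht p) (hk p) s)
    (fun p a => by
      cases a with
      | none => simp [Dl]
      | some j =>
        simp only [Dl]; split_ifs
        · exact le_rfl
        · exact mul_nonneg (ht p) (by linarith [hk p]))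
    (fun p v => local_i_ge i (t p) v) (GI i t G)
  refine le_trans ?_ h1
  have hGI := GI_nonneg i t ht G hG
  have hmI := GI_mono i t ht G hG hm
  have hprod : ∀ a : ι → Option (Fin k), 0 ≤ ∏ q, D0 (t q) (a q) := fun a =>
    prod_nonneg fun q _ => D0_nonneg (ht q) _
  have h2 : ∀ a : ι → Option (Fin k), (∏ p, D0 (t p) (a p)) * GI i t G a ^ 2
      - ∑ p, (k * t p) * (if a p ≠ none then (∏ p, D0 (t p) (a p)) * GI i t G a ^ 2 else 0)
      ≤ (∏ p, Dl i (t p) (a p)) * GI i t G a ^ 2 := by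
    intro a
    by_cases hai : ∃ p, a p = some i
    · obtain ⟨p, hp⟩ := hai
      rw [GI_eq_zero i t G a p hp]; simp
    · push Not at hai
      have e1 : ∏ p, Dl i (t p) (a p) = (∏ p, D0 (t p) (a p)) *
          ∏ p, (1 - if a p ≠ none then k * t p else 0) := by
        rw [← prod_mul_distrib]
        refine prod_congr rfl fun p _ => ?_
        cases hap : a p with
        | none => simp [Dl, D0]
        | some j =>
          have : j ≠ i := fun h => hai p (by rw [hap, h])
          simp [Dl, D0, this]
      have e2 := one_sub_sum_le_prod univ (fun p => if a p ≠ none then k * t p else 0)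
        (fun p _ => by split_ifs; exacts [mul_nonneg (Nat.cast_nonneg _) (ht p), le_rfl])
        (fun p _ => by split_ifs; exacts [hk p, zero_le_one])
      rw [e1]
      have h0 : 0 ≤ (∏ p, D0 (t p) (a p)) * GI i t G a ^ 2 := mul_nonneg (hprod a) (sq_nonneg _)
      have h3 := mul_le_mul_of_nonneg_left e2 h0
      rw [mul_sub, mul_sum, mul_one] at h3
      calc _ = (∏ p, D0 (t p) (a p)) * GI i t G a ^ 2 - ∑ p, (∏ p, D0 (t p) (a p)) *
          GI i t G a ^ 2 * (if a p ≠ none then k * t p else 0) := by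
            congr 1
            refine sum_congr rfl fun p _ => ?_
            split_ifs <;> ring
        _ ≤ _ := h3
        _ = _ := by ring
  refine le_trans ?_ (sum_le_sum fun a _ => h2 a)
  rw [sum_sub_distrib, sum_comm, sub_mul, one_mul]
  refine sub_le_sub le_rfl ?_
  rw [sum_mul]
  refine sum_le_sum fun p _ => ?_
  rw [← mul_sum, ← sum_filter]
  have := mono_sum t ht _ hGI hmI p
  calc _ ≤ (k * t p) * (k * t p * Zq t (GI i t G)) :=
        mul_le_mul_of_nonneg_left this (mul_nonneg (Nat.cast_nonneg _) (ht p))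
    _ = _ := by ring

lemma H1_le (i : Fin k) (t : ι → ℝ) (ht : ∀ p, 0 ≤ t p) (hk : ∀ p, k * t p ≤ 1)
    (G : (ι → Option (Fin k)) → ℝ) (S : Finset ι) :
    ∑ σ : ι → Option (Fin k), (∏ p, if p ∈ S then (if σ p = some i then 1 else 0)
        else wi i (t p) (σ p)) * FI i t G σ ^ 2 ≤ 2 ^ S.card * Zq t (GI i t G) := by
  simp_rw [FI_eq]
  have := tensor_le (fun p s => if p ∈ S then (if s = some i then 1 else 0) else wi i (t p) s)
    (fun p => uz i (t p)) (fun p a => if p ∈ S then 2 * D0 (t p) a else D0 (t p) a)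
    (fun p s => by
      by_cases h : p ∈ S
      · simp only [h, if_true]; split_ifs <;> norm_num
      · simp only [h, if_false]; exact wi_nonneg i (ht p) (hk p) s)
    (fun p a => by
      have := D0_nonneg (ht p) a
      split_ifs <;> linarith)
    (fun p v => by
      by_cases h : p ∈ S
      · simp only [h, if_true]; exact local_pt i (t p) (ht p) (hk p) v
      · simp only [h, if_false]; exact local_i_le i (t p) (ht p) v) (GI i t G)
  refine this.trans (le_of_eq ?_)
  unfold Zq
  rw [mul_sum]
  refine sum_congr rfl fun a _ => ?_
  rw [← mul_assoc]
  congr 1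
  have : ∀ p, (if p ∈ S then 2 * D0 (t p) (a p) else D0 (t p) (a p))
      = (if p ∈ S then 2 else 1) * D0 (t p) (a p) := by
    intro p; split_ifs <;> ring
  simp_rw [this, prod_mul_distrib]
  congr 1
  rw [prod_ite_mem]
  simp

/-- part of `FI` with trivial label at `p` -/
noncomputable def FA (i : Fin k) (t : ι → ℝ) (G : (ι → Option (Fin k)) → ℝ) (p : ι)
    (σ : ι → Option (Fin k)) : ℝ :=
  ∑ a, (if a p = none then GI i t G a else 0) * ∏ q, uz i (t q) (a q) (σ q)

lemma FA_update (i : Fin k) (t : ι → ℝ) (G : (ι → Option (Fin k)) → ℝ) (p : ι)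
    (σ σ' : ι → Option (Fin k)) (h : ∀ q, q ≠ p → σ q = σ' q) : FA i t G p σ = FA i t G p σ' := by
  refine sum_congr rfl fun a _ => ?_
  split_ifs with ha
  · congr 1
    refine prod_congr rfl fun q _ => ?_
    by_cases hq : q = p
    · subst hq; rw [ha]; rfl
    · rw [h q hq]
  · simp

lemma diff_le (i : Fin k) (t : ι → ℝ) (ht : ∀ p, 0 ≤ t p) (hk : ∀ p, k * t p ≤ 1)
    (G : (ι → Option (Fin k)) → ℝ) (hG : ∀ a, 0 ≤ G a) (hm : MonoG G) (p : ι) :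
    Ei i t (fun σ => |FI i t G σ ^ 2 - FA i t G p σ ^ 2|)
      ≤ 3 * √(k * t p) * Zq t (GI i t G) := by
  set Z := Zq t (GI i t G) with hZ
  have hZ0 : 0 ≤ Z := Zq_nonneg t ht _
  set B : (ι → Option (Fin k)) → ℝ := fun σ =>
    ∑ a, (if a p ≠ none then GI i t G a else 0) * ∏ q, uz i (t q) (a q) (σ q) with hB
  have hsplit : ∀ σ, FI i t G σ = FA i t G p σ + B σ := by
    intro σ
    rw [FI_eq, FA, hB, ← sum_add_distrib]
    refine sum_congr rfl fun a _ => ?_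
    by_cases h : a p = none <;> simp [h]
  have hprod : ∀ a : ι → Option (Fin k), 0 ≤ ∏ q, D0 (t q) (a q) := fun a =>
    prod_nonneg fun q _ => D0_nonneg (ht q) _
  have hA2 : Ei i t (fun σ => FA i t G p σ ^ 2) ≤ Z := by
    refine (Ei_sq_le i t ht hk _).trans ?_
    refine sum_le_sum fun a _ => mul_le_mul_of_nonneg_left ?_ (hprod a)
    dsimp only
    split_ifs
    · exact le_rfl
    · simpa using sq_nonneg _
  have hB2 : Ei i t (fun σ => B σ ^ 2) ≤ k * t p * Z := by
    refine (Ei_sq_le i t ht hk _).trans ?_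
    refine le_trans (le_of_eq ?_) (mono_sum t ht _ (GI_nonneg i t ht G hG)
      (GI_mono i t ht G hG hm) p)
    rw [sum_filter]
    refine sum_congr rfl fun a _ => ?_
    by_cases h : a p = none <;> simp [h]
  set r := √(k * t p) with hr
  have hr0 : 0 ≤ r := Real.sqrt_nonneg _
  have hkt : 0 ≤ k * t p := mul_nonneg (Nat.cast_nonneg _) (ht p)
  have hr2 : r ^ 2 = k * t p := Real.sq_sqrt hkt
  have hr1 : r ≤ 1 := Real.sqrt_le_one.2 (hk p)
  have hw : ∀ σ : ι → Option (Fin k), 0 ≤ ∏ p, wi i (t p) (σ p) := fun σ =>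
    prod_nonneg fun q _ => wi_nonneg i (ht q) (hk q) _
  rcases hr0.eq_or_lt with hr00 | hrpos
  · -- degenerate case
    have hk0 : k * t p = 0 := by rw [← hr2, ← hr00]; ring
    have hB0 : ∀ σ, (∏ p, wi i (t p) (σ p)) * B σ ^ 2 = 0 := by
      have h0 : Ei i t (fun σ => B σ ^ 2) ≤ 0 := by simpa [hk0] using hB2
      have h1 : Ei i t (fun σ => B σ ^ 2) = 0 :=
        le_antisymm h0 (sum_nonneg fun σ _ => mul_nonneg (hw σ) (sq_nonneg _))
      intro σ
      exact (sum_eq_zero_iff_of_nonneg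
        (fun σ _ => mul_nonneg (hw σ) (sq_nonneg _))).1 h1 σ (mem_univ _)
    rw [← hr00]
    simp only [mul_zero, zero_mul]
    refine le_of_eq (sum_eq_zero fun σ _ => ?_)
    rcases mul_eq_zero.1 (hB0 σ) with h | h
    · rw [h, zero_mul]
    · have : B σ = 0 := by simpa using h
      simp [hsplit, this]
  · have hpt : ∀ σ, |FI i t G σ ^ 2 - FA i t G p σ ^ 2|
        ≤ r * FA i t G p σ ^ 2 + (1 / r + 1) * B σ ^ 2 := by
      intro σ
      rw [hsplit]
      have e : (FA i t G p σ + B σ) ^ 2 - FA i t G p σ ^ 2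
        = 2 * FA i t G p σ * B σ + B σ ^ 2 := by ring
      rw [e]
      have h1 : |2 * FA i t G p σ * B σ| ≤ r * FA i t G p σ ^ 2 + 1 / r * B σ ^ 2 := by
        rw [abs_le]
        have hi : r * FA i t G p σ ^ 2 + 1 / r * B σ ^ 2 =
          (r * FA i t G p σ) ^ 2 / r + B σ ^ 2 / r := by field_simp
        have e1 : 2 * FA i t G p σ * B σ = 2 * (r * FA i t G p σ) * B σ / r := by field_simp
        rw [hi, e1]
        constructor
        · rw [← add_div, ← neg_div]
          gcongr
          nlinarith [sq_nonneg (r * FA i t G p σ + B σ)]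
        · rw [← add_div]
          gcongr
          nlinarith [sq_nonneg (r * FA i t G p σ - B σ)]
      calc _ ≤ |2 * FA i t G p σ * B σ| + |B σ ^ 2| := abs_add_le _ _
        _ ≤ (r * FA i t G p σ ^ 2 + 1 / r * B σ ^ 2) + B σ ^ 2 := by
            rw [abs_of_nonneg (sq_nonneg (B σ))]; linarith
        _ = _ := by ring
    calc Ei i t (fun σ => |FI i t G σ ^ 2 - FA i t G p σ ^ 2|)
        ≤ ∑ σ, (∏ p, wi i (t p) (σ p)) * (r * FA i t G p σ ^ 2 + (1 / r + 1) * B σ ^ 2) :=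
          sum_le_sum fun σ _ => mul_le_mul_of_nonneg_left (hpt σ) (hw σ)
      _ = r * Ei i t (fun σ => FA i t G p σ ^ 2) + (1 / r + 1) * Ei i t (fun σ => B σ ^ 2) := by
          unfold Ei
          rw [mul_sum, mul_sum, ← sum_add_distrib]
          refine sum_congr rfl fun σ _ => ?_
          ring
      _ ≤ r * Z + (1 / r + 1) * (k * t p * Z) := by gcongr
      _ = 2 * r * Z + r ^ 2 * Z := by rw [← hr2]; field_simp; ring
      _ ≤ 3 * r * Z := by nlinarith [mul_nonneg (mul_nonneg hr0 (sub_nonneg.2 hr1)) hZ0]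

end model
end RG


namespace RG
open Finset

/-- average over a period -/
noncomputable def av {𝕜 : Type} [NormedField 𝕜] [NormedSpace ℝ 𝕜] (N : ℕ) (Φ : ℕ → 𝕜) : 𝕜 :=
  (1 / (N : ℝ)) • ∑ n ∈ range N, Φ n

section TI
variable {𝕜 : Type} [NormedField 𝕜] [NormedSpace ℝ 𝕜]

lemma sum_shift (q : ℕ) (Φ : ℕ → 𝕜) (hper : ∀ n, Φ (n + q) = Φ n) (x : ℕ) :
    ∑ i ∈ range q, Φ (x + i) = ∑ i ∈ range q, Φ i := by
  induction x with
  | zero => simp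
  | succ x ih =>
    rw [← ih]
    have h1 := sum_range_succ (fun i => Φ (x + i)) q
    have h2 := sum_range_succ' (fun i => Φ (x + i)) q
    rw [h1] at h2
    have h3 : Φ (x + q) = Φ (x + 0) := by rw [hper]; rfl
    rw [h3] at h2
    have h4 := add_right_cancel h2
    rw [h4]
    exact sum_congr rfl fun i _ => by ring_nf

lemma sum_mul_period (q : ℕ) (Φ : ℕ → 𝕜) (hper : ∀ n, Φ (n + q) = Φ n) (x m : ℕ) :
    ∑ i ∈ range (q * m), Φ (x + i) = (m : ℝ) • ∑ i ∈ range q, Φ i := by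
  induction m with
  | zero => simp
  | succ m ih =>
    rw [Nat.mul_succ, sum_range_add, ih]
    simp_rw [← add_assoc]
    rw [sum_shift q Φ hper]
    push_cast
    rw [add_smul, one_smul]

lemma av_period (N q : ℕ) (hN : 0 < N) (hq : q ∣ N) (Φ : ℕ → 𝕜)
    (hper : ∀ n, Φ (n + q) = Φ n) : av N Φ = av q Φ := by
  obtain ⟨m, rfl⟩ := hq
  have hm : 0 < m := Nat.pos_of_mul_pos_left hN
  have hq : 0 < q := Nat.pos_of_mul_pos_right hN
  have := sum_mul_period q Φ hper 0 m
  simp only [zero_add] at this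
  unfold av
  rw [this, smul_smul]
  congr 1
  push_cast
  field_simp

lemma av_norm_le (N : ℕ) (Φ : ℕ → 𝕜) (B : ℝ) (hN : 0 < N) (h : ∀ n, ‖Φ n‖ ≤ B) : ‖av N Φ‖ ≤ B := by
  unfold av
  rw [norm_smul]
  have := norm_sum_le_of_le (range N) (fun n _ => h n)
  simp at this
  rw [Real.norm_of_nonneg (by positivity), one_div, inv_mul_le_iff₀ (by positivity)]
  exact this

lemma abel_aux (g : ℕ → ℝ) (hg : Antitone g) (a : ℕ → 𝕜) (M : ℝ)
    (hM : ∀ m, ‖∑ j ∈ range m, a j‖ ≤ M) (m : ℕ) :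
    ‖∑ j ∈ range m, g j • a j - g m • ∑ j ∈ range m, a j‖ ≤ (g 0 - g m) * M := by
  induction m with
  | zero => simp
  | succ m ih =>
    have e : ∑ j ∈ range (m + 1), g j • a j - g (m + 1) • ∑ j ∈ range (m + 1), a j
        = (∑ j ∈ range m, g j • a j - g m • ∑ j ∈ range m, a j)
          + (g m - g (m + 1)) • ∑ j ∈ range (m + 1), a j := by
      simp only [sum_range_succ, smul_add, sub_smul]
      abel
    rw [e]
    refine (norm_add_le _ _).trans ?_
    rw [norm_smul, Real.norm_of_nonneg (sub_nonneg.2 (hg (Nat.le_succ m)))]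
    have := mul_le_mul_of_nonneg_left (hM (m + 1)) (sub_nonneg.2 (hg (Nat.le_succ m)))
    linarith

lemma abel_ineq (g : ℕ → ℝ) (hg : Antitone g) (hg0 : ∀ n, 0 ≤ g n) (a : ℕ → 𝕜) (M : ℝ)
    (hM : ∀ m, ‖∑ j ∈ range m, a j‖ ≤ M) (m : ℕ) :
    ‖∑ j ∈ range m, g j • a j‖ ≤ g 0 * M := by
  have h1 := abel_aux g hg a M hM m
  have h2 : ‖g m • ∑ j ∈ range m, a j‖ ≤ g m * M := by
    rw [norm_smul, Real.norm_of_nonneg (hg0 m)]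
    exact mul_le_mul_of_nonneg_left (hM m) (hg0 m)
  have h3 := norm_add_le (∑ j ∈ range m, g j • a j - g m • ∑ j ∈ range m, a j)
    (g m • ∑ j ∈ range m, a j)
  rw [sub_add_cancel] at h3
  linarith

/-- combinations of periodic functions with controlled total complexity -/
inductive TI (N : ℕ) : ℝ → (ℕ → 𝕜) → Prop
  | base (q : ℕ) (B : ℝ) (Φ : ℕ → 𝕜) (hq : q ∣ N) (hq0 : 0 < q) (hB : ∀ n, ‖Φ n‖ ≤ B)
      (hper : ∀ n, Φ (n + q) = Φ n) : TI N (B * q) Φ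
  | add (K₁ K₂ : ℝ) (Φ₁ Φ₂ : ℕ → 𝕜) (h₁ : TI N K₁ Φ₁) (h₂ : TI N K₂ Φ₂) :
      TI N (K₁ + K₂) (fun n => Φ₁ n + Φ₂ n)
  | mono (K₁ K₂ : ℝ) (Φ : ℕ → 𝕜) (h : K₁ ≤ K₂) (h₁ : TI N K₁ Φ) : TI N K₂ Φ

lemma TI.nonneg {N : ℕ} {K : ℝ} {Φ : ℕ → 𝕜} (h : TI N K Φ) : 0 ≤ K := by
  induction h with
  | base q B Φ hq hq0 hB hper => exact mul_nonneg ((norm_nonneg _).trans (hB 0)) (Nat.cast_nonneg _)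
  | add K₁ K₂ Φ₁ Φ₂ h₁ h₂ ih₁ ih₂ => exact add_nonneg ih₁ ih₂
  | mono K₁ K₂ Φ h h₁ ih => exact ih.trans h

lemma TI.zero (N : ℕ) : TI N 0 (fun _ => (0 : 𝕜)) := by
  have := TI.base (N := N) 1 0 (fun _ => (0 : 𝕜)) (one_dvd _) one_pos (by simp) (by simp)
  simpa using this

lemma TI.one (N : ℕ) : TI N 1 (fun _ => (1 : 𝕜)) := by
  have := TI.base (N := N) 1 1 (fun _ => (1 : 𝕜)) (one_dvd _) one_pos (by simp) (by simp)
  simpa using this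

lemma TI.sum {N : ℕ} {α : Type} (s : Finset α) (K : α → ℝ) (Φ : α → ℕ → 𝕜)
    (h : ∀ a ∈ s, TI N (K a) (Φ a)) : TI N (∑ a ∈ s, K a) (fun n => ∑ a ∈ s, Φ a n) := by
  classical
  induction s using Finset.induction_on with
  | empty => simpa using TI.zero N
  | insert a s ha ih =>
    simp_rw [sum_insert ha]
    exact TI.add _ _ _ _ (h a (mem_insert_self _ _)) (ih fun b hb => h b (mem_insert_of_mem hb))

lemma TI.base_mul {N : ℕ} {q : ℕ} {B : ℝ} {Φ : ℕ → 𝕜} (hq : q ∣ N) (hq0 : 0 < q)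
    (hB : ∀ n, ‖Φ n‖ ≤ B) (hper : ∀ n, Φ (n + q) = Φ n) {K : ℝ} {Ψ : ℕ → 𝕜} (h : TI N K Ψ) :
    TI N (B * q * K) (fun n => Φ n * Ψ n) := by
  have hB0 : 0 ≤ B := (norm_nonneg _).trans (hB 0)
  induction h with
  | base q' B' Ψ hq' hq0' hB' hper' =>
    have hB0' : 0 ≤ B' := (norm_nonneg _).trans (hB' 0)
    have hm : ∀ (q : ℕ) (Φ : ℕ → 𝕜) (h : ∀ n, Φ (n + q) = Φ n) (c n : ℕ), Φ (n + q * c) = Φ n := by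
      intro q Φ h c n
      induction c with
      | zero => simp
      | succ c ih => rw [Nat.mul_succ, ← add_assoc, h, ih]
    refine TI.mono (B * B' * (Nat.lcm q q' : ℕ)) _ _ ?_ (TI.base (Nat.lcm q q') (B * B') _
      (Nat.lcm_dvd hq hq') (Nat.lcm_pos hq0 hq0') ?_ ?_)
    · have h1 : ((Nat.lcm q q' : ℕ) : ℝ) ≤ q * q' := by
        exact_mod_cast Nat.le_of_dvd (Nat.mul_pos hq0 hq0') (Nat.lcm_dvd_mul q q')
      calc B * B' * (Nat.lcm q q' : ℕ) ≤ B * B' * (q * q') :=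
            mul_le_mul_of_nonneg_left h1 (mul_nonneg hB0 hB0')
        _ = _ := by ring
    · intro n
      rw [norm_mul]
      exact mul_le_mul (hB n) (hB' n) (norm_nonneg _) hB0
    · intro n
      obtain ⟨c, hc⟩ := Nat.dvd_lcm_left q q'
      obtain ⟨c', hc'⟩ := Nat.dvd_lcm_right q q'
      have e1 : Φ (n + Nat.lcm q q') = Φ n := by rw [hc]; exact hm q Φ hper c n
      have e2 : Ψ (n + Nat.lcm q q') = Ψ n := by rw [hc']; exact hm q' Ψ hper' c' n
      rw [e1, e2]
  | add K₁ K₂ Φ₁ Φ₂ h₁ h₂ ih₁ ih₂ =>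
    have := TI.add _ _ _ _ ih₁ ih₂
    simp_rw [← mul_add] at this
    exact this
  | mono K₁ K₂ Φ' h h₁ ih => exact TI.mono _ _ _ (mul_le_mul_of_nonneg_left h (by positivity)) ih

lemma TI.mul {N : ℕ} {K₁ K₂ : ℝ} {Φ Ψ : ℕ → 𝕜} (h : TI N K₁ Φ) (h' : TI N K₂ Ψ) :
    TI N (K₁ * K₂) (fun n => Φ n * Ψ n) := by
  have hK := h'.nonneg
  induction h with
  | base q B Φ hq hq0 hB hper => exact TI.base_mul hq hq0 hB hper h'
  | add _ _ _ _ h₁ h₂ ih₁ ih₂ =>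
    have := TI.add _ _ _ _ ih₁ ih₂
    simp_rw [← add_mul] at this
    exact this
  | mono K₁ K₂ Φ h h₁ ih => exact TI.mono _ _ _ (mul_le_mul_of_nonneg_right h hK) ih

lemma TI.prod {N : ℕ} {α : Type} (s : Finset α) (K : α → ℝ) (Φ : α → ℕ → 𝕜)
    (h : ∀ a ∈ s, TI N (K a) (Φ a)) : TI N (∏ a ∈ s, K a) (fun n => ∏ a ∈ s, Φ a n) := by
  classical
  induction s using Finset.induction_on with
  | empty => simpa using TI.one N
  | insert a s ha ih =>
    simp_rw [prod_insert ha]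
    exact TI.mul (h a (mem_insert_self _ _)) (ih fun b hb => h b (mem_insert_of_mem hb))

lemma TI.ofReal {N : ℕ} {K : ℝ} {Φ : ℕ → ℝ} (h : TI N K Φ) : TI N K (fun n => (Φ n : ℂ)) := by
  induction h with
  | base q B Φ hq hq0 hB hper =>
    exact TI.base q B _ hq hq0 (fun n => by simpa using hB n) (fun n => by rw [hper])
  | add _ _ _ _ h₁ h₂ ih₁ ih₂ =>
    have := TI.add _ _ _ _ ih₁ ih₂
    push_cast
    exact this
  | mono K₁ K₂ Φ h h₁ ih => exact TI.mono _ _ _ h ih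

lemma TI.count_aux {N : ℕ} (hN : 0 < N) {K : ℝ} {Φ : ℕ → 𝕜} (h : TI N K Φ) (g : ℕ → ℝ)
    (hg : Antitone g) (hg0 : ∀ n, 0 ≤ g n) (x m : ℕ) :
    ‖∑ j ∈ range m, g j • (Φ (x + j) - av N Φ)‖ ≤ 2 * K * g 0 := by
  induction h with
  | base q B Φ hq hq0 hB hper =>
    have hB0 : 0 ≤ B := (norm_nonneg _).trans (hB 0)
    rw [av_period N q hN hq Φ hper]
    rw [show 2 * (B * q) * g 0 = g 0 * (2 * B * q) by ring]
    refine abel_ineq g hg hg0 _ _ (fun m => ?_) m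
    set a := av q Φ with ha
    have haB : ‖a‖ ≤ B := av_norm_le q Φ B hq0 hB
    have hbd : ∀ n, ‖Φ n - a‖ ≤ 2 * B := fun n => (norm_sub_le _ _).trans (by linarith [hB n])
    have hper' : ∀ n, (fun n => Φ n - a) (n + q) = (fun n => Φ n - a) n := fun n => by
      simp [hper]
    have hz : ∑ i ∈ range q, (Φ i - a) = 0 := by
      rw [sum_sub_distrib, sum_const, card_range, ha, av, ← Nat.cast_smul_eq_nsmul ℝ, smul_smul]
      have : (q : ℝ) ≠ 0 := by positivity
      rw [mul_one_div_cancel this, one_smul, sub_self]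
    rw [← Nat.div_add_mod m q, sum_range_add]
    have h0 := sum_mul_period q (fun n => Φ n - a) hper' x (m / q)
    simp only [hz, smul_zero] at h0
    rw [h0, zero_add]
    refine (norm_sum_le_of_le _ fun n _ => hbd _).trans ?_
    rw [sum_const, card_range, nsmul_eq_mul, mul_comm]
    exact mul_le_mul_of_nonneg_left (by exact_mod_cast (Nat.mod_lt m hq0).le) (by positivity)
  | add K₁ K₂ Φ₁ Φ₂ h₁ h₂ ih₁ ih₂ =>
    have e : av N (fun n => Φ₁ n + Φ₂ n) = av N Φ₁ + av N Φ₂ := by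
      simp [av, sum_add_distrib]
    have e2 : ∑ j ∈ range m, g j • ((Φ₁ (x + j) + Φ₂ (x + j)) - (av N Φ₁ + av N Φ₂))
        = ∑ j ∈ range m, g j • (Φ₁ (x + j) - av N Φ₁)
          + ∑ j ∈ range m, g j • (Φ₂ (x + j) - av N Φ₂) := by
      rw [← sum_add_distrib]
      refine sum_congr rfl fun j _ => ?_
      rw [← smul_add]; congr 1; abel
    rw [e, e2]
    refine (norm_add_le _ _).trans ?_
    linarith
  | mono K₁ K₂ Φ h h₁ ih =>
    refine ih.trans ?_
    have := hg0 0
    nlinarith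

/-- main counting lemma -/
lemma TI.count {N : ℕ} (hN : 0 < N) {K : ℝ} {Φ : ℕ → 𝕜} (h : TI N K Φ) (g : ℕ → ℝ) (x X : ℕ)
    (hg : ∀ m n, x < m → m ≤ n → g n ≤ g m) (hg0 : ∀ n, x < n → 0 ≤ g n) :
    ‖∑ n ∈ Ioc x X, g n • Φ n - (∑ n ∈ Ioc x X, g n) • av N Φ‖ ≤ 2 * K * g (x + 1) := by
  have := h.count_aux hN (fun j => g (x + 1 + j)) (fun a b hab => hg _ _ (by omega) (by omega))
    (fun n => hg0 _ (by omega)) (x + 1) (X - x)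
  refine le_trans (le_of_eq ?_) this
  congr 1
  rw [sum_smul, ← sum_sub_distrib]
  have e : Ioc x X = (range (X - x)).image (fun j => x + 1 + j) := by
    ext n
    simp only [mem_Ioc, mem_image, mem_range]
    constructor
    · rintro ⟨h1, h2⟩; exact ⟨n - x - 1, by omega, by omega⟩
    · rintro ⟨j, h1, rfl⟩; omega
  rw [e, sum_image (by intro a _ b _ h; dsimp only at h; omega)]
  exact sum_congr rfl fun j _ => by rw [smul_sub]

end TI

end RG


namespace RG
open Finset

section push
variable {ι : Type} [Fintype ι] [DecidableEq ι]

lemma pi_sum_prod {X : ι → Type} [∀ i, Fintype (X i)] {𝕜 : Type} [CommSemiring 𝕜]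
    (f : ∀ i, X i → 𝕜) : ∑ x : ∀ i, X i, ∏ i, f i (x i) = ∏ i, ∑ z, f i z := by
  rw [prod_univ_sum, Fintype.piFinset_univ]

lemma push_sum {X : ι → Type} [∀ i, Fintype (X i)] {T : Type} [Fintype T] [DecidableEq T]
    (v : ∀ i, X i → ℝ) (st : ∀ i, X i → T) (Ψ : (ι → T) → ℝ) :
    ∑ x : ∀ i, X i, (∏ i, v i (x i)) * Ψ (fun i => st i (x i))
      = ∑ σ : ι → T, (∏ i, ∑ z with st i z = σ i, v i z) * Ψ σ := by
  classical
  rw [← sum_fiberwise (s := univ) (g := fun (x : ∀ i, X i) => fun i => st i (x i))]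
  refine sum_congr rfl fun σ _ => ?_
  rw [sum_filter]
  have : ∀ x : ∀ i, X i, (if (fun i => st i (x i)) = σ then
      (∏ i, v i (x i)) * Ψ (fun i => st i (x i)) else 0)
      = (∏ i, if st i (x i) = σ i then v i (x i) else 0) * Ψ σ := by
    intro x
    split_ifs with h
    · rw [h]; congr 1
      refine prod_congr rfl fun i _ => ?_
      rw [if_pos (congrFun h i)]
    · have : ∃ i, st i (x i) ≠ σ i := by
        by_contra hc; push Not at hc; exact h (funext hc)
      obtain ⟨i, hi⟩ := this
      rw [prod_eq_zero (mem_univ i) (if_neg hi), zero_mul]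
  simp_rw [this]
  rw [← sum_mul]
  congr 1
  rw [pi_sum_prod (fun i z => if st i z = σ i then v i z else 0)]
  refine prod_congr rfl fun i _ => ?_
  rw [sum_filter]

/-- if `φ` does not depend on coordinate `i` and `ψ i` sums to zero the sum vanishes -/
lemma sum_pi_zero {X : ι → Type} [∀ i, Fintype (X i)] [∀ i, DecidableEq (X i)] {𝕜 : Type} [CommRing 𝕜]
    (ψ : ∀ i, X i → 𝕜) (φ : (∀ i, X i) → 𝕜) (i : ι)
    (hφ : ∀ x z, φ (Function.update x i z) = φ x) (hψ : ∑ z, ψ i z = 0) :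
    ∑ x : ∀ i, X i, φ x * ∏ j, ψ j (x j) = 0 := by
  classical
  rw [← (Equiv.piSplitAt i X).symm.sum_comp, Fintype.sum_prod_type_right]
  refine sum_eq_zero fun y _ => ?_
  by_cases hne : Nonempty (X i)
  swap
  · have := not_nonempty_iff.1 hne
    simp
  obtain ⟨z0⟩ := hne
  have e : ∀ z, (Equiv.piSplitAt i X).symm (z, y)
      = Function.update ((Equiv.piSplitAt i X).symm (z0, y)) i z := by
    intro z
    funext j
    by_cases h : j = i
    · subst h; simp [Equiv.piSplitAt]
    · simp [Equiv.piSplitAt, h]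
  have e2 : ∀ z, φ ((Equiv.piSplitAt i X).symm (z, y)) * ∏ j, ψ j ((Equiv.piSplitAt i X).symm (z, y) j)
      = ψ i z * (φ ((Equiv.piSplitAt i X).symm (z0, y)) *
        ∏ j ∈ univ.erase i, ψ j ((Equiv.piSplitAt i X).symm (z0, y) j)) := by
    intro z
    rw [e z, hφ, ← mul_prod_erase univ _ (mem_univ i)]
    rw [Function.update_self]
    have : ∏ j ∈ univ.erase i, ψ j (Function.update ((Equiv.piSplitAt i X).symm (z0, y)) i z j)
      = ∏ j ∈ univ.erase i, ψ j ((Equiv.piSplitAt i X).symm (z0, y) j) := by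
      refine prod_congr rfl fun j hj => ?_
      rw [Function.update_of_ne (ne_of_mem_erase hj)]
    rw [this]; ring
  simp_rw [e2]
  rw [← sum_mul, hψ, zero_mul]

end push

section states
variable {k : ℕ} {q : ℕ} [Fact q.Prime]

open Classical in
/-- state of a residue relative to roots `r` -/
noncomputable def rst (r : Fin k → ZMod q) (z : ZMod q) : Option (Fin k) :=
  if h : ∃ j, z = r j then some h.choose else none

lemma rst_eq_some (r : Fin k → ZMod q) (hr : Function.Injective r) (z : ZMod q) (j : Fin k) :
    rst r z = some j ↔ z = r j := by
  unfold rst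
  split_ifs with h
  · rw [Option.some.injEq]
    constructor
    · intro h'; rw [← h']; exact h.choose_spec
    · intro h'; apply hr; rw [← h.choose_spec, h']
  · simp only [false_iff]
    intro h'; exact h ⟨j, h'⟩

lemma fib_some (r : Fin k → ZMod q) (hr : Function.Injective r) (v : ZMod q → ℝ) (j : Fin k) :
    ∑ z with rst r z = some j, v z = v (r j) := by
  rw [show (univ.filter fun z => rst r z = some j) = {r j} by
    ext z; simp [rst_eq_some r hr]]
  simp

lemma fib_none (r : Fin k → ZMod q) (hr : Function.Injective r) (v : ZMod q → ℝ) :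
    ∑ z with rst r z = none, v z = ∑ z, v z - ∑ j, v (r j) := by
  have h := sum_fiberwise (s := (univ : Finset (ZMod q))) (g := rst r) (f := v)
  rw [Fintype.sum_option] at h
  simp_rw [fib_some r hr] at h
  linarith

/-- `1/(q-1)` -/
noncomputable def tt (q : ℕ) : ℝ := 1 / ((q : ℝ) - 1)

lemma two_le_q (q : ℕ) [h : Fact q.Prime] : (2 : ℝ) ≤ q := by exact_mod_cast h.out.two_le

lemma tt_pos (q : ℕ) [h : Fact q.Prime] : 0 < tt q := by
  have := two_le_q q
  unfold tt; apply one_div_pos.2; linarith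

lemma tt_le_one (q : ℕ) [h : Fact q.Prime] : tt q ≤ 1 := by
  have := two_le_q q
  unfold tt; rw [div_le_one (by linarith)]; linarith

lemma fib_wf (r : Fin k → ZMod q) (hr : Function.Injective r) (s : Option (Fin k)) :
    ∑ z with rst r z = s, ((q : ℝ)⁻¹) = wf (tt q) s := by
  have h2 := two_le_q q
  have e : tt q / (1 + tt q) = (q : ℝ)⁻¹ := by
    unfold tt
    have : (q : ℝ) - 1 ≠ 0 := by linarith
    have : (q : ℝ) ≠ 0 := by linarith
    field_simp
    ring_nf
    exact mul_inv_cancel₀ this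
  cases s with
  | some j => rw [fib_some r hr (fun _ => (q:ℝ)⁻¹)]; simp [wf, e]
  | none =>
    rw [fib_none r hr (fun _ => (q:ℝ)⁻¹)]
    simp only [wf, e, sum_const, card_univ, ZMod.card, Fintype.card_fin, nsmul_eq_mul]
    rw [mul_inv_cancel₀ (by linarith)]

lemma fib_wi (r : Fin k → ZMod q) (hr : Function.Injective r) (i : Fin k) (hi : r i = 0)
    (s : Option (Fin k)) :
    ∑ z with rst r z = s, (if z = 0 then 0 else tt q) = wi i (tt q) s := by
  have h2 := two_le_q q
  have h0 : ∀ j, r j = 0 ↔ j = i := fun j => ⟨fun h => hr (h.trans hi.symm), fun h => h ▸ hi⟩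
  cases s with
  | some j =>
    rw [fib_some r hr (fun z => if z = 0 then 0 else tt q)]
    simp [wi, h0]
  | none =>
    rw [fib_none r hr (fun z => if z = 0 then 0 else tt q)]
    simp only [wi, h0]
    have a1 : ∑ z : ZMod q, (if z = 0 then 0 else tt q) = 1 := by
      have : ∀ z : ZMod q, (if z = 0 then 0 else tt q) = tt q - (if z = 0 then tt q else 0) := by
        intro z; split_ifs <;> simp
      simp_rw [this]
      rw [sum_sub_distrib]
      simp [ZMod.card, tt]
      have : (q : ℝ) - 1 ≠ 0 := by linarith
      field_simp
    have a2 : ∑ j : Fin k, (if j = i then 0 else tt q) = (k - 1) * tt q := by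
      have : ∀ z : Fin k, (if z = i then 0 else tt q) = tt q - (if z = i then tt q else 0) := by
        intro z; split_ifs <;> simp
      simp_rw [this]
      rw [sum_sub_distrib]
      simp
      ring
    rw [a1, a2]

lemma fib_pt (r : Fin k → ZMod q) (hr : Function.Injective r) (i : Fin k) (hi : r i = 0)
    (s : Option (Fin k)) :
    ∑ z with rst r z = s, (if z = 0 then 1 else 0 : ℝ) = if s = some i then 1 else 0 := by
  have h0 : ∀ j, r j = 0 ↔ j = i := fun j => ⟨fun h => hr (h.trans hi.symm), fun h => h ▸ hi⟩
  cases s with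
  | some j =>
    rw [fib_some r hr (fun z => if z = 0 then 1 else 0)]
    simp [h0]
  | none =>
    rw [fib_none r hr (fun z => if z = 0 then 1 else 0)]
    simp [h0]

end states

section crt
variable {ι : Type} [Fintype ι] [DecidableEq ι] (p : ι → ℕ) [hp : ∀ i, Fact (p i).Prime]

/-- residue vector -/
def rs (n : ℕ) : ∀ i, ZMod (p i) := fun i => (n : ZMod (p i))

lemma sum_range_zmod {M : Type} [AddCommMonoid M] (N : ℕ) [NeZero N] (h : ZMod N → M) :
    ∑ n ∈ range N, h (n : ZMod N) = ∑ z, h z := by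
  refine sum_bij' (fun n _ => (n : ZMod N)) (fun z _ => z.val) (by simp)
    (fun z _ => mem_range.2 (ZMod.val_lt z)) ?_ (by simp) (by simp)
  intro n hn
  exact ZMod.val_cast_of_lt (mem_range.1 hn)

lemma crt_sum {M : Type} [AddCommMonoid M] (hinj : Function.Injective p) (W : ℕ) [NeZero W]
    (hW : ∀ i, W.Coprime (p i)) (H : ZMod W → (∀ i, ZMod (p i)) → M) :
    ∑ n ∈ range (W * ∏ i, p i), H (n : ZMod W) (rs p n) = ∑ b, ∑ x, H b x := by
  have hco : Pairwise (Function.onFun Nat.Coprime p) := fun i j hij =>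
    (Nat.coprime_primes (hp i).out (hp j).out).2 fun h => hij (hinj h)
  have hWQ : W.Coprime (∏ i, p i) := Nat.Coprime.prod_right fun i _ => hW i
  have : NeZero (∏ i, p i) := ⟨prod_ne_zero_iff.2 fun i _ => (hp i).out.ne_zero⟩
  have : NeZero (W * ∏ i, p i) := ⟨mul_ne_zero (NeZero.ne _) (NeZero.ne _)⟩
  let e : ZMod (W * ∏ i, p i) ≃+* ZMod W × (∀ i, ZMod (p i)) :=
    (ZMod.chineseRemainder hWQ).trans (RingEquiv.prodCongr (RingEquiv.refl _) (ZMod.prodEquivPi p hco))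
  have h1 : ∀ n : ℕ, H (n : ZMod W) (rs p n)
      = (fun z => H (e z).1 (e z).2) (n : ZMod (W * ∏ i, p i)) := by
    intro n
    dsimp only
    rw [map_natCast]
    rfl
  rw [sum_congr rfl fun n _ => h1 n]
  rw [sum_range_zmod (W * ∏ i, p i) (fun z => H (e z).1 (e z).2), ← Fintype.sum_prod_type', ← e.toEquiv.sum_comp]
  rfl

/-- average over the product of the residue rings -/
noncomputable def avx {𝕜 : Type} [NormedField 𝕜] [NormedSpace ℝ 𝕜] (Φ : (∀ i, ZMod (p i)) → 𝕜) : 𝕜 :=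
  (∏ i, (p i : ℝ)⁻¹) • ∑ x, Φ x

lemma av_crt {𝕜 : Type} [NormedField 𝕜] [NormedSpace ℝ 𝕜] (hinj : Function.Injective p) (W : ℕ)
    [NeZero W] (hW : ∀ i, W.Coprime (p i)) (b : ZMod W) (Φ : (∀ i, ZMod (p i)) → 𝕜) :
    av (W * ∏ i, p i) (fun n => if (n : ZMod W) = b then Φ (rs p n) else 0)
      = (1 / (W : ℝ)) • avx p Φ := by
  unfold av avx
  rw [crt_sum p hinj W hW (fun b' x => if b' = b then Φ x else 0)]
  have : ∑ b' : ZMod W, ∑ x, (if b' = b then Φ x else 0) = ∑ x, Φ x := by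
    rw [sum_comm]; simp
  rw [this, smul_smul]
  congr 1
  push_cast
  rw [prod_inv_distrib, one_div, one_div, mul_inv]

lemma avx_wf {k : ℕ} (r : ∀ i, Fin k → ZMod (p i)) (hr : ∀ i, Function.Injective (r i))
    (Ψ : (ι → Option (Fin k)) → ℝ) :
    avx p (fun x => Ψ (fun i => rst (r i) (x i)))
      = ∑ σ : ι → Option (Fin k), (∏ i, wf (tt (p i)) (σ i)) * Ψ σ := by
  unfold avx
  rw [smul_eq_mul, mul_sum]
  have := push_sum (fun i (_ : ZMod (p i)) => (p i : ℝ)⁻¹) (fun i => rst (r i)) Ψ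
  rw [this]
  refine sum_congr rfl fun σ _ => ?_
  congr 1
  exact prod_congr rfl fun i _ => fib_wf (r i) (hr i) (σ i)

end crt

end RG


namespace RG
open Finset

section chars
variable {ι : Type} [Fintype ι] [DecidableEq ι] (p : ι → ℕ) [hp : ∀ i, Fact (p i).Prime]

/-- Fourier coefficient on the product of unit groups -/
noncomputable def cch (φ : (∀ i, ZMod (p i)) → ℝ) (χ : ∀ i, DirichletCharacter ℂ (p i)) : ℂ :=
  (∏ i, (tt (p i) : ℂ)) * ∑ x, (φ x : ℂ) * ∏ i, (χ i)⁻¹ (x i)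

/-- average over the product of unit groups -/
noncomputable def mux (φ : (∀ i, ZMod (p i)) → ℝ) : ℝ :=
  ∑ x, (∏ i, if x i = 0 then 0 else tt (p i)) * φ x

lemma orth_local (q : ℕ) [h : Fact q.Prime] (x y : ZMod q) (hx : x ≠ 0) :
    (tt q : ℂ) * ∑ χ : DirichletCharacter ℂ q, χ⁻¹ y * χ x = if y = x then 1 else 0 := by
  by_cases hy : y = 0
  · subst hy
    rw [if_neg (Ne.symm hx)]
    have : ∀ χ : DirichletCharacter ℂ q, χ⁻¹ 0 = 0 := fun χ => MulChar.map_zero _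
    simp [this]
  · simp_rw [MulChar.inv_apply']
    rw [DirichletCharacter.sum_char_inv_mul_char_eq ℂ (IsUnit.mk0 y hy) x]
    split_ifs
    · rw [Nat.totient_prime h.out, tt]
      have := two_le_q q
      have h1 : (q : ℂ) - 1 ≠ 0 := by
        have : (q : ℝ) - 1 ≠ 0 := by linarith
        exact_mod_cast this
      push_cast [h.out.one_le]
      field_simp
    · simp

lemma expand (φ : (∀ i, ZMod (p i)) → ℝ) (x : ∀ i, ZMod (p i)) (hx : ∀ i, x i ≠ 0) :
    (φ x : ℂ) = ∑ χ : ∀ i, DirichletCharacter ℂ (p i), cch p φ χ * ∏ i, χ i (x i) := by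
  classical
  have h1 : ∀ χ : ∀ i, DirichletCharacter ℂ (p i), cch p φ χ * ∏ i, χ i (x i)
      = ∑ y, (φ y : ℂ) * ∏ i, ((tt (p i) : ℂ) * ((χ i)⁻¹ (y i) * χ i (x i))) := by
    intro χ
    unfold cch
    rw [mul_assoc, sum_mul, mul_sum]
    refine sum_congr rfl fun y _ => ?_
    rw [prod_mul_distrib, prod_mul_distrib]
    ring
  simp_rw [h1]
  rw [sum_comm]
  simp_rw [← mul_sum]
  have h2 : ∀ y : ∀ i, ZMod (p i), ∑ χ : ∀ i, DirichletCharacter ℂ (p i),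
      ∏ i, ((tt (p i) : ℂ) * ((χ i)⁻¹ (y i) * χ i (x i))) = if y = x then 1 else 0 := by
    intro y
    rw [pi_sum_prod (fun i (χ : DirichletCharacter ℂ (p i)) =>
      (tt (p i) : ℂ) * (χ⁻¹ (y i) * χ (x i)))]
    simp_rw [← mul_sum]
    simp_rw [fun i => orth_local (p i) (x i) (y i) (hx i)]
    rw [Fintype.prod_ite_zero]
    simp [funext_iff]
  simp_rw [h2]
  simp

lemma mul_prod_ne (φ : (∀ i, ZMod (p i)) → ℝ) (x : ∀ i, ZMod (p i)) :
    (∏ i, if x i = 0 then 0 else tt (p i)) * φ x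
      = (∏ i, tt (p i)) * (φ x * ∏ i, if x i = 0 then 0 else 1) := by
  have : (∏ i, if x i = 0 then 0 else tt (p i))
      = (∏ i, tt (p i)) * ∏ i, (if x i = 0 then (0:ℝ) else 1) := by
    rw [← prod_mul_distrib]
    refine prod_congr rfl fun i _ => ?_
    split_ifs <;> simp
  rw [this]; ring

lemma cch_one (φ : (∀ i, ZMod (p i)) → ℝ) : cch p φ 1 = (mux p φ : ℂ) := by
  unfold cch mux
  simp_rw [mul_prod_ne]
  rw [← mul_sum]
  push_cast
  congr 1
  refine sum_congr rfl fun x _ => ?_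
  congr 1
  refine prod_congr rfl fun i _ => ?_
  simp only [Pi.one_apply, inv_one]
  split_ifs with h
  · rw [h]; exact MulChar.map_zero _
  · rw [MulChar.one_apply (IsUnit.mk0 _ h)]; simp

lemma cch_add_indep (φ φ' : (∀ i, ZMod (p i)) → ℝ) (χ : ∀ i, DirichletCharacter ℂ (p i)) (j : ι)
    (hχ : χ j ≠ 1) (hφ' : ∀ x z, φ' (Function.update x j z) = φ' x) :
    ‖cch p φ χ‖ ≤ mux p (fun x => |φ x - φ' x|) := by
  have h0 : ∑ x, (φ' x : ℂ) * ∏ i, (χ i)⁻¹ (x i) = 0 := by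
    refine sum_pi_zero (fun i z => (χ i)⁻¹ z) (fun x => (φ' x : ℂ)) j (fun x z => by rw [hφ']) ?_
    exact MulChar.sum_eq_zero_of_ne_one (inv_ne_one.2 hχ)
  have h1 : cch p φ χ = (∏ i, (tt (p i) : ℂ)) *
      ∑ x, ((φ x - φ' x : ℝ) : ℂ) * ∏ i, (χ i)⁻¹ (x i) := by
    unfold cch
    congr 1
    push_cast
    simp_rw [sub_mul]
    rw [sum_sub_distrib, h0, sub_zero]
  rw [h1, norm_mul]
  have hm : mux p (fun x => |φ x - φ' x|)
      = (∏ i, tt (p i)) * ∑ x, (|φ x - φ' x| * ∏ i, if x i = 0 then 0 else 1) := by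
    unfold mux
    rw [mul_sum]
    exact sum_congr rfl fun x _ => mul_prod_ne p (fun x => |φ x - φ' x|) x
  rw [hm]
  have h2 : ‖∏ i, (tt (p i) : ℂ)‖ = ∏ i, tt (p i) := by
    rw [norm_prod]
    refine prod_congr rfl fun i _ => ?_
    rw [Complex.norm_real, Real.norm_of_nonneg (tt_pos _).le]
  rw [h2]
  refine mul_le_mul_of_nonneg_left ?_ (prod_nonneg fun i _ => (tt_pos _).le)
  refine norm_sum_le_of_le _ fun x _ => ?_
  rw [norm_mul, Complex.norm_real, Real.norm_eq_abs]
  refine mul_le_mul_of_nonneg_left ?_ (abs_nonneg _)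
  rw [norm_prod]
  refine prod_le_prod (fun i _ => norm_nonneg _) fun i _ => ?_
  split_ifs with h
  · rw [h, MulChar.map_zero]; simp
  · exact DirichletCharacter.norm_le_one _ _

/-- conductor of a family -/
noncomputable def cnd (χ : ∀ i, DirichletCharacter ℂ (p i)) : ℕ := by
  classical exact ∏ i, if χ i = 1 then 1 else p i

/-- extended character value -/
noncomputable def xt (χ : ∀ i, DirichletCharacter ℂ (p i)) (x : ∀ i, ZMod (p i)) : ℂ := by
  classical exact ∏ i, if χ i = 1 then 1 else χ i (x i)

lemma xt_eq (χ : ∀ i, DirichletCharacter ℂ (p i)) (x : ∀ i, ZMod (p i)) (hx : ∀ i, x i ≠ 0) :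
    xt p χ x = ∏ i, χ i (x i) := by
  classical
  unfold xt
  refine prod_congr rfl fun i _ => ?_
  split_ifs with h
  · rw [h, MulChar.one_apply (IsUnit.mk0 _ (hx i))]
  · rfl

lemma xt_norm (χ : ∀ i, DirichletCharacter ℂ (p i)) (x : ∀ i, ZMod (p i)) : ‖xt p χ x‖ ≤ 1 := by
  classical
  unfold xt
  rw [norm_prod]
  refine prod_le_one (fun i _ => norm_nonneg _) fun i _ => ?_
  split_ifs with h
  · simp
  · exact DirichletCharacter.norm_le_one _ _

lemma xt_mul (χ : ∀ i, DirichletCharacter ℂ (p i)) (x y : ∀ i, ZMod (p i)) :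
    xt p χ (x * y) = xt p χ x * xt p χ y := by
  classical
  unfold xt
  rw [← prod_mul_distrib]
  refine prod_congr rfl fun i _ => ?_
  split_ifs with h <;> simp

lemma rs_mul (m n : ℕ) : rs p (m * n) = rs p m * rs p n := by
  funext i; simp [rs]

lemma xt_TI (N : ℕ) (hN : ∏ i, p i ∣ N) (χ : ∀ i, DirichletCharacter ℂ (p i)) :
    TI N (cnd p χ) (fun n => xt p χ (rs p n)) := by
  classical
  rw [← one_mul (cnd p χ : ℝ)]
  have hd : ∀ i, χ i ≠ 1 → p i ∣ cnd p χ := by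
    intro i hi
    unfold cnd
    exact dvd_trans (by rw [if_neg hi]) (dvd_prod_of_mem _ (mem_univ i))
  refine TI.base _ _ _ ?_ ?_ (fun n => xt_norm p χ _) ?_
  · refine dvd_trans ?_ hN
    unfold cnd
    refine prod_dvd_prod_of_dvd _ _ fun i _ => ?_
    split_ifs <;> simp
  · unfold cnd
    refine prod_pos fun i _ => ?_
    split_ifs
    · simp
    · exact (hp i).out.pos
  · intro n
    unfold xt
    refine prod_congr rfl fun i _ => ?_
    split_ifs with h
    · rfl
    · congr 1
      unfold rs
      push_cast
      rw [(ZMod.natCast_eq_zero_iff _ _).2 (hd i h), add_zero]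

/-- off-diagonal orthogonality -/
lemma xt_orth (A : (∀ i, ZMod (p i)) → ℝ)
    (hA : ∀ u x : ∀ i, ZMod (p i), (∀ i, u i ≠ 0) → A (u * x) = A x)
    (χ χ' : ∀ i, DirichletCharacter ℂ (p i)) (h : χ ≠ χ') :
    ∑ x, (A x : ℂ) * (xt p χ x * star (xt p χ' x)) = 0 := by
  classical
  obtain ⟨i, hi⟩ := Function.ne_iff.1 h
  obtain ⟨g, hg⟩ : ∃ g : (ZMod (p i))ˣ, χ i g ≠ χ' i g := by
    by_contra hc
    push Not at hc
    exact hi (MulChar.ext hc)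
  let U : (∀ i, ZMod (p i))ˣ := MulEquiv.piUnits.symm (Function.update 1 i g)
  have hUi : ∀ j, (U : ∀ i, ZMod (p i)) j = ((Function.update (1 : ∀ i, (ZMod (p i))ˣ) i g j : (ZMod (p j))ˣ) : ZMod (p j)) := fun j => rfl
  have hU0 : ∀ j, (U : ∀ i, ZMod (p i)) j ≠ 0 := fun j => by rw [hUi]; exact Units.ne_zero _
  have hxt : ∀ χ : ∀ i, DirichletCharacter ℂ (p i), xt p χ (U : ∀ i, ZMod (p i)) = χ i g := by
    intro χ
    rw [xt_eq p χ _ hU0, prod_eq_single i]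
    · rw [hUi, Function.update_self]
    · intro j _ hj
      rw [hUi, Function.update_of_ne hj]; simp
    · simp
  set S := ∑ x, (A x : ℂ) * (xt p χ x * star (xt p χ' x)) with hS
  have e : S = (χ i g * star (χ' i g)) * S := by
    conv_lhs => rw [hS]
    rw [← Equiv.sum_comp (Units.mulLeft U)]
    rw [hS, mul_sum]
    refine sum_congr rfl fun x _ => ?_
    simp only [Units.mulLeft_apply]
    rw [hA _ _ hU0, xt_mul, xt_mul, hxt, hxt, star_mul]
    ring
  have hn : χ i g * star (χ' i g) ≠ 1 := by
    intro h1
    have h2 : ‖χ' i g‖ = 1 := DirichletCharacter.unit_norm_eq_one _ _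
    have h3 : χ' i g * star (χ' i g) = 1 := by
      rw [Complex.star_def, Complex.mul_conj, Complex.normSq_eq_norm_sq, h2]; simp
    have h4 : star (χ' i g) ≠ 0 := by
      intro h5; rw [h5] at h3; simp at h3
    exact hg (mul_right_cancel₀ h4 (h1.trans h3.symm))
  have : (1 - χ i g * star (χ' i g)) * S = 0 := by
    rw [sub_mul, one_mul, ← e, sub_self]
  rcases mul_eq_zero.1 this with h | h
  · exact absurd (sub_eq_zero.1 h).symm hn
  · exact h

end chars
end RG


namespace RG
open Finset

section ls
variable {ι : Type} [Fintype ι] [DecidableEq ι] (p : ι → ℕ) [hp : ∀ i, Fact (p i).Prime]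

lemma ind_TI {𝕜 : Type} [NormedField 𝕜] [NormedSpace ℝ 𝕜] (N W : ℕ) [NeZero W] (hN : W ∣ N) (v : ZMod W) :
    TI N W (fun n => if (n : ZMod W) = v then (1 : 𝕜) else 0) := by
  rw [← one_mul (W : ℝ)]
  refine TI.base W 1 _ hN (NeZero.pos W) (fun n => ?_) (fun n => ?_)
  · split_ifs <;> simp
  · simp

lemma Qpos : 0 < ∏ i, p i := prod_pos fun i _ => (hp i).out.pos

lemma cauchy_card {α : Type} (s : Finset α) (f : α → ℝ) : (∑ a ∈ s, f a) ^ 2 ≤ s.card * ∑ a ∈ s, f a ^ 2 :=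
  sq_sum_le_card_mul_sum_sq

lemma norm_sq_sum {α : Type} (s : Finset α) (z w : α → ℂ) :
    ((‖∑ a ∈ s, z a * w a‖ ^ 2 : ℝ) : ℂ)
      = ∑ a ∈ s, ∑ b ∈ s, (z a * star (z b)) * (w a * star (w b)) := by
  push_cast
  rw [← Complex.mul_conj', ← Complex.star_def, star_sum, sum_mul_sum]
  refine sum_congr rfl fun a _ => sum_congr rfl fun b _ => ?_
  rw [star_mul]; ring

lemma avx_norm_le {𝕜 : Type} [NormedField 𝕜] [NormedSpace ℝ 𝕜] (Φ : (∀ i, ZMod (p i)) → 𝕜)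
    (Ψ : (∀ i, ZMod (p i)) → ℝ) (h : ∀ x, ‖Φ x‖ ≤ Ψ x) : ‖avx p Φ‖ ≤ avx p Ψ := by
  unfold avx
  rw [norm_smul, smul_eq_mul, Real.norm_of_nonneg (prod_nonneg fun i _ => by positivity)]
  exact mul_le_mul_of_nonneg_left (norm_sum_le_of_le _ fun x _ => h x)
    (prod_nonneg fun i _ => by positivity)

lemma star_xt (χ : ∀ i, DirichletCharacter ℂ (p i)) (x : ∀ i, ZMod (p i)) :
    star (xt p χ x) = xt p χ⁻¹ x := by
  classical
  unfold xt
  rw [Complex.star_def, map_prod]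
  refine prod_congr rfl fun i _ => ?_
  simp only [Pi.inv_apply, inv_eq_one]
  split_ifs with h
  · simp
  · rw [← Complex.star_def, MulChar.star_apply']

lemma cnd_inv (χ : ∀ i, DirichletCharacter ℂ (p i)) : cnd p χ⁻¹ = cnd p χ := by
  classical
  unfold cnd; refine prod_congr rfl fun i _ => ?_
  simp

lemma pair_TI (W : ℕ) [NeZero W] (D : ℝ) (A : (∀ i, ZMod (p i)) → ℝ) (KA : ℝ)
    (hAT : TI (W * ∏ i, p i) KA (fun n => A (rs p n))) (v : ZMod W)
    (χ χ' : ∀ i, DirichletCharacter ℂ (p i)) (hχ : (cnd p χ : ℝ) ≤ D) (hχ' : (cnd p χ' : ℝ) ≤ D) :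
    TI (W * ∏ i, p i) (W * KA * (D * D)) (fun m => if (m : ZMod W) = v then
      (A (rs p m) : ℂ) * (xt p χ (rs p m) * star (xt p χ' (rs p m))) else 0) := by
  have hKA := hAT.nonneg
  have h1 := xt_TI p (W * ∏ i, p i) (dvd_mul_left _ _) χ
  have h2 := xt_TI p (W * ∏ i, p i) (dvd_mul_left _ _) χ'⁻¹
  rw [cnd_inv] at h2
  have h3 := TI.mul (TI.mul (ind_TI (𝕜 := ℂ) (W * ∏ i, p i) W (dvd_mul_right _ _) v) hAT.ofReal)
    (TI.mul h1 h2)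
  have h4 : (W * KA * (cnd p χ * cnd p χ') : ℝ) ≤ W * KA * (D * D) := by
    have hD0 : 0 ≤ D := le_trans (Nat.cast_nonneg _) hχ
    refine mul_le_mul_of_nonneg_left ?_ (by positivity)
    exact mul_le_mul hχ hχ' (Nat.cast_nonneg _) hD0
  refine TI.mono _ _ _ h4 ?_
  have e : (fun m : ℕ => if (m : ZMod W) = v then
      (A (rs p m) : ℂ) * (xt p χ (rs p m) * star (xt p χ' (rs p m))) else 0) =
      (fun m : ℕ => (if (m : ZMod W) = v then (1 : ℂ) else 0) * (A (rs p m) : ℂ) *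
        (xt p χ (rs p m) * xt p χ'⁻¹ (rs p m))) := by
    funext m
    rw [star_xt]
    split_ifs
    · rw [one_mul]
    · rw [zero_mul, zero_mul]
  rw [e]
  exact h3

lemma pair_av (hinj : Function.Injective p) (W : ℕ) [NeZero W] (hW : ∀ i, W.Coprime (p i))
    (A : (∀ i, ZMod (p i)) → ℝ) (v : ZMod W)
    (χ χ' : ∀ i, DirichletCharacter ℂ (p i)) :
    av (W * ∏ i, p i) (fun m => if (m : ZMod W) = v then
      (A (rs p m) : ℂ) * (xt p χ (rs p m) * star (xt p χ' (rs p m))) else 0)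
      = (1 / (W : ℝ)) • avx p (fun x => (A x : ℂ) * (xt p χ x * star (xt p χ' x))) :=
  av_crt p hinj W hW v (fun x => (A x : ℂ) * (xt p χ x * star (xt p χ' x)))

lemma ls_dual (hinj : Function.Injective p) (W : ℕ) [NeZero W] (hW : ∀ i, W.Coprime (p i))
    (X : Finset (∀ i, DirichletCharacter ℂ (p i))) (D : ℝ) (hD : ∀ χ ∈ X, (cnd p χ : ℝ) ≤ D)
    (A : (∀ i, ZMod (p i)) → ℝ) (hA0 : ∀ x, 0 ≤ A x)
    (hA : ∀ u x : ∀ i, ZMod (p i), (∀ i, u i ≠ 0) → A (u * x) = A x) (KA : ℝ)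
    (hAT : TI (W * ∏ i, p i) KA (fun n => A (rs p n))) (v : ZMod W) (g : ℕ → ℝ) (y Y : ℕ)
    (hg : ∀ m n, y < m → m ≤ n → g n ≤ g m) (hg0 : ∀ n, y < n → 0 ≤ g n)
    (z : (∀ i, DirichletCharacter ℂ (p i)) → ℂ) :
    ∑ m ∈ Ioc y Y, g m * (if (m : ZMod W) = v then A (rs p m) else 0) *
        ‖∑ χ ∈ X, z χ * xt p χ (rs p m)‖ ^ 2
      ≤ (avx p A / W * ∑ m ∈ Ioc y Y, g m + X.card * (2 * (W * KA * (D * D)) * g (y + 1)))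
        * ∑ χ ∈ X, ‖z χ‖ ^ 2 := by
  classical
  have hN : 0 < W * ∏ i, p i := Nat.mul_pos (NeZero.pos W) (Qpos p)
  have hgs : 0 ≤ ∑ m ∈ Ioc y Y, g m := sum_nonneg fun m hm => hg0 m (mem_Ioc.1 hm).1
  set Φ : (∀ i, DirichletCharacter ℂ (p i)) → (∀ i, DirichletCharacter ℂ (p i)) → ℕ → ℂ :=
    fun χ χ' m => if (m : ZMod W) = v then
      (A (rs p m) : ℂ) * (xt p χ (rs p m) * star (xt p χ' (rs p m))) else 0 with hΦ
  set ε : ℝ := 2 * (W * KA * (D * D)) * g (y + 1) with hε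
  set M : ℝ := avx p A / W * ∑ m ∈ Ioc y Y, g m with hM
  have hKA := hAT.nonneg
  have hpair : ∀ χ ∈ X, ∀ χ' ∈ X, ‖∑ m ∈ Ioc y Y, g m • Φ χ χ' m‖ ≤ (if χ = χ' then M else 0) + ε := by
    intro χ hχ χ' hχ'
    have hTI : TI (W * ∏ i, p i) (W * KA * (D * D)) (Φ χ χ') :=
      pair_TI p W D A KA hAT v χ χ' (hD χ hχ) (hD χ' hχ')
    have hc := hTI.count hN g y Y hg hg0
    have hav : av (W * ∏ i, p i) (Φ χ χ')
        = (1 / (W : ℝ)) • avx p (fun x => (A x : ℂ) * (xt p χ x * star (xt p χ' x))) :=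
      pair_av p hinj W hW A v χ χ'
    have hn : ‖(∑ m ∈ Ioc y Y, g m) • av (W * ∏ i, p i) (Φ χ χ')‖ ≤ if χ = χ' then M else 0 := by
      rw [hav]
      split_ifs with h
      · rw [norm_smul, norm_smul, Real.norm_of_nonneg hgs, Real.norm_of_nonneg (by positivity), hM]
        rw [mul_comm, one_div, inv_mul_eq_div]
        refine mul_le_mul_of_nonneg_right ?_ hgs
        refine div_le_div_of_nonneg_right ?_ (Nat.cast_nonneg _)
        refine avx_norm_le p _ _ fun x => ?_
        rw [norm_mul, Complex.norm_real, Real.norm_of_nonneg (hA0 x), norm_mul, norm_star]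
        have := mul_le_one₀ (xt_norm p χ x) (norm_nonneg _) (xt_norm p χ' x)
        exact mul_le_of_le_one_right (hA0 x) this
      · rw [avx, xt_orth p A hA χ χ' h]
        simp
    have := norm_add_le (∑ m ∈ Ioc y Y, g m • Φ χ χ' m
      - (∑ m ∈ Ioc y Y, g m) • av (W * ∏ i, p i) (Φ χ χ')) ((∑ m ∈ Ioc y Y, g m) • av (W * ∏ i, p i) (Φ χ χ'))
    rw [sub_add_cancel] at this
    linarith
  have hcast : ((∑ m ∈ Ioc y Y, g m * (if (m : ZMod W) = v then A (rs p m) else 0) *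
        ‖∑ χ ∈ X, z χ * xt p χ (rs p m)‖ ^ 2 : ℝ) : ℂ)
      = ∑ χ ∈ X, ∑ χ' ∈ X, (z χ * star (z χ')) * ∑ m ∈ Ioc y Y, g m • Φ χ χ' m := by
    simp_rw [mul_sum]
    rw [Complex.ofReal_sum]
    have h1 : ∀ m ∈ Ioc y Y, ((g m * (if (m : ZMod W) = v then A (rs p m) else 0) *
        ‖∑ χ ∈ X, z χ * xt p χ (rs p m)‖ ^ 2 : ℝ) : ℂ)
        = ∑ χ ∈ X, ∑ χ' ∈ X, (z χ * star (z χ')) * (g m • Φ χ χ' m) := by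
      intro m _
      rw [Complex.ofReal_mul, norm_sq_sum, mul_sum]
      refine sum_congr rfl fun χ _ => ?_
      rw [mul_sum]
      refine sum_congr rfl fun χ' _ => ?_
      simp only [hΦ, Complex.real_smul]
      split_ifs <;> push_cast <;> ring
    rw [sum_congr rfl h1, sum_comm]
    refine sum_congr rfl fun χ _ => ?_
    rw [sum_comm]
  have hle : ∑ m ∈ Ioc y Y, g m * (if (m : ZMod W) = v then A (rs p m) else 0) *
        ‖∑ χ ∈ X, z χ * xt p χ (rs p m)‖ ^ 2
      ≤ ∑ χ ∈ X, ∑ χ' ∈ X, (‖z χ‖ * ‖z χ'‖) * ((if χ = χ' then M else 0) + ε) := by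
    refine (le_abs_self _).trans ?_
    rw [← Real.norm_eq_abs, ← Complex.norm_real, hcast]
    refine norm_sum_le_of_le _ fun χ hχ => norm_sum_le_of_le _ fun χ' hχ' => ?_
    rw [norm_mul, norm_mul, norm_star]
    exact mul_le_mul_of_nonneg_left (hpair χ hχ χ' hχ') (by positivity)
  refine hle.trans ?_
  have e1 : ∑ χ ∈ X, ∑ χ' ∈ X, (‖z χ‖ * ‖z χ'‖) * ((if χ = χ' then M else 0) + ε)
      = M * ∑ χ ∈ X, ‖z χ‖ ^ 2 + ε * (∑ χ ∈ X, ‖z χ‖) ^ 2 := by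
    simp_rw [mul_add, sum_add_distrib]
    congr 1
    · rw [mul_sum]
      refine sum_congr rfl fun χ hχ => ?_
      simp [hχ]
      ring
    · rw [sq, sum_mul_sum, mul_sum]
      refine sum_congr rfl fun χ hχ => ?_
      rw [mul_sum]
      refine sum_congr rfl fun χ' hχ' => ?_
      ring
  rw [e1]
  have hε0 : 0 ≤ ε := by
    rw [hε]
    have := hg0 (y + 1) (by omega)
    have hDD : 0 ≤ D * D := mul_self_nonneg D
    positivity
  have := mul_le_mul_of_nonneg_left (cauchy_card X fun χ => ‖z χ‖) hε0
  nlinarith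

lemma ls_primal (W : ℕ) [NeZero W]
    (X : Finset (∀ i, DirichletCharacter ℂ (p i))) (Δ : ℝ) (hΔ : 0 ≤ Δ)
    (A : (∀ i, ZMod (p i)) → ℝ) (hA0 : ∀ x, 0 ≤ A x) (hA1 : ∀ x, (∀ i, x i ≠ 0) → 1 ≤ A x)
    (v : ZMod W) (g : ℕ → ℝ) (y Y : ℕ) (hg0 : ∀ n, y < n → 0 ≤ g n)
    (hdual : ∀ z : (∀ i, DirichletCharacter ℂ (p i)) → ℂ,
      ∑ m ∈ Ioc y Y, g m * (if (m : ZMod W) = v then A (rs p m) else 0) *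
        ‖∑ χ ∈ X, z χ * xt p χ (rs p m)‖ ^ 2 ≤ Δ * ∑ χ ∈ X, ‖z χ‖ ^ 2)
    (β : ℕ → ℝ) (hβ : ∀ m, β m ≠ 0 → (∀ i, rs p m i ≠ 0) ∧ (m : ZMod W) = v) :
    ∑ χ ∈ X, ‖∑ m ∈ Ioc y Y, ((g m * β m : ℝ) : ℂ) * xt p χ (rs p m)‖ ^ 2
      ≤ Δ * ∑ m ∈ Ioc y Y, g m * β m ^ 2 := by
  set T : (∀ i, DirichletCharacter ℂ (p i)) → ℂ :=
    fun χ => ∑ m ∈ Ioc y Y, ((g m * β m : ℝ) : ℂ) * xt p χ (rs p m) with hT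
  set E := ∑ χ ∈ X, ‖T χ‖ ^ 2 with hE
  have hE0 : 0 ≤ E := sum_nonneg fun _ _ => sq_nonneg _
  set S : ℕ → ℂ := fun m => ∑ χ ∈ X, star (T χ) * xt p χ (rs p m) with hS
  have h1 : E ≤ ∑ m ∈ Ioc y Y, (g m * |β m|) * ‖S m‖ := by
    have e : ((E : ℝ) : ℂ) = ∑ m ∈ Ioc y Y, ((g m * β m : ℝ) : ℂ) * S m := by
      rw [hE]
      push_cast
      simp_rw [← Complex.conj_mul', hS, mul_sum]
      rw [sum_comm]
      refine sum_congr rfl fun χ _ => ?_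
      rw [show (starRingEnd ℂ) (T χ) * T χ = (starRingEnd ℂ) (T χ) *
        ∑ m ∈ Ioc y Y, ((g m * β m : ℝ) : ℂ) * xt p χ (rs p m) from rfl, mul_sum]
      refine sum_congr rfl fun m _ => ?_
      rw [← Complex.star_def]
      push_cast
      ring
    have : E = ‖((E : ℝ) : ℂ)‖ := by rw [Complex.norm_real, Real.norm_of_nonneg hE0]
    rw [this, e]
    refine norm_sum_le_of_le _ fun m hm => ?_
    rw [norm_mul, Complex.norm_real, Real.norm_eq_abs, abs_mul, abs_of_nonneg (hg0 m (mem_Ioc.1 hm).1)]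
  have h2 : (∑ m ∈ Ioc y Y, (g m * |β m|) * ‖S m‖) ^ 2
      ≤ (∑ m ∈ Ioc y Y, g m * β m ^ 2) *
        ∑ m ∈ Ioc y Y, g m * (if (m : ZMod W) = v then A (rs p m) else 0) * ‖S m‖ ^ 2 := by
    refine sum_sq_le_sum_mul_sum_of_sq_le_mul _ (fun m hm => ?_) (fun m hm => ?_) (fun m hm => ?_)
    · exact mul_nonneg (hg0 m (mem_Ioc.1 hm).1) (sq_nonneg _)
    · refine mul_nonneg (mul_nonneg (hg0 m (mem_Ioc.1 hm).1) ?_) (sq_nonneg _)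
      split_ifs
      · exact hA0 _
      · exact le_rfl
    · have hgm := hg0 m (mem_Ioc.1 hm).1
      by_cases hb : β m = 0
      · simp [hb]
      · obtain ⟨hr, hv⟩ := hβ m hb
        rw [if_pos hv]
        have hA := hA1 _ hr
        have h3 : 0 ≤ g m ^ 2 * β m ^ 2 * ‖S m‖ ^ 2 := by positivity
        calc (g m * |β m| * ‖S m‖) ^ 2 = g m ^ 2 * β m ^ 2 * ‖S m‖ ^ 2 := by
              rw [mul_pow, mul_pow, sq_abs]
          _ ≤ (g m ^ 2 * β m ^ 2 * ‖S m‖ ^ 2) * A (rs p m) := le_mul_of_one_le_right h3 hA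
          _ = _ := by ring
  have h3 := hdual (fun χ => star (T χ))
  simp only [norm_star] at h3
  change ∑ m ∈ Ioc y Y, g m * (if (m : ZMod W) = v then A (rs p m) else 0) * ‖S m‖ ^ 2 ≤ Δ * E at h3
  have hB0 : 0 ≤ ∑ m ∈ Ioc y Y, g m * β m ^ 2 :=
    sum_nonneg fun m hm => mul_nonneg (hg0 m (mem_Ioc.1 hm).1) (sq_nonneg _)
  have h4 : E ^ 2 ≤ (∑ m ∈ Ioc y Y, g m * β m ^ 2) * (Δ * E) :=
    (pow_le_pow_left₀ hE0 h1 2).trans (h2.trans (mul_le_mul_of_nonneg_left h3 hB0))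
  rcases hE0.eq_or_lt with h0 | h0
  · rw [← h0]; positivity
  · nlinarith

end ls
end RG


namespace RG
open Finset

section bil
variable {ι : Type} [Fintype ι] [DecidableEq ι] (p : ι → ℕ) [hp : ∀ i, Fact (p i).Prime]

lemma expand_sub (φ : (∀ i, ZMod (p i)) → ℝ) (X : Finset (∀ i, DirichletCharacter ℂ (p i)))
    (hX : ∀ χ, χ ∉ X → cch p φ χ = 0) (d m : ℕ) (hd : ∀ i, rs p d i ≠ 0) (hm : ∀ i, rs p m i ≠ 0) :
    ((φ (rs p (d * m)) - mux p φ : ℝ) : ℂ) = ∑ χ ∈ X, (if χ = 1 then 0 else cch p φ χ) *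
      (xt p χ (rs p d) * xt p χ (rs p m)) := by
  classical
  have hdm : ∀ i, rs p (d * m) i ≠ 0 := fun i => by
    rw [rs_mul]; exact mul_ne_zero (hd i) (hm i)
  have h1 : (φ (rs p (d * m)) : ℂ) = ∑ χ, cch p φ χ * (xt p χ (rs p d) * xt p χ (rs p m)) := by
    rw [expand p φ _ hdm]
    refine sum_congr rfl fun χ _ => ?_
    rw [← xt_eq p χ _ hdm, rs_mul, xt_mul]
  have h2 : ∀ x, xt p 1 x = 1 := fun x => by
    unfold xt; exact prod_eq_one fun i _ => by simp
  push_cast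
  rw [h1, ← cch_one, ← add_sum_erase univ _ (mem_univ 1), h2, h2, mul_one, mul_one,
    add_sub_cancel_left]
  have h3 : ∑ χ ∈ X, (if χ = 1 then 0 else cch p φ χ) * (xt p χ (rs p d) * xt p χ (rs p m))
      = ∑ χ, (if χ = 1 then 0 else cch p φ χ) * (xt p χ (rs p d) * xt p χ (rs p m)) := by
    refine sum_subset (subset_univ _) fun χ _ hχ => ?_
    rw [hX χ hχ]; simp
  rw [h3, ← add_sum_erase univ _ (mem_univ 1), if_pos rfl, zero_mul, zero_add]
  refine sum_congr rfl fun χ hχ => ?_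
  rw [if_neg (ne_of_mem_erase hχ)]

lemma bilinear (φ : (∀ i, ZMod (p i)) → ℝ) (X : Finset (∀ i, DirichletCharacter ℂ (p i)))
    (hX : ∀ χ, χ ∉ X → cch p φ χ = 0) (κ : ℝ) (hκ0 : 0 ≤ κ) (hκ : ∀ χ, χ ≠ 1 → ‖cch p φ χ‖ ≤ κ)
    (g α β : ℕ → ℝ) (y Y : ℕ) (hα : ∀ m, α m ≠ 0 → ∀ i, rs p m i ≠ 0)
    (hβ : ∀ m, β m ≠ 0 → ∀ i, rs p m i ≠ 0) (Ba Bb : ℝ)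
    (hBa : ∑ χ ∈ X, ‖∑ m ∈ Ioc y Y, ((g m * α m : ℝ) : ℂ) * xt p χ (rs p m)‖ ^ 2 ≤ Ba)
    (hBb : ∑ χ ∈ X, ‖∑ m ∈ Ioc y Y, ((g m * β m : ℝ) : ℂ) * xt p χ (rs p m)‖ ^ 2 ≤ Bb) :
    |∑ d ∈ Ioc y Y, ∑ m ∈ Ioc y Y, (g d * α d) * (g m * β m) * (φ (rs p (d * m)) - mux p φ)|
      ≤ κ * √(Ba * Bb) := by
  classical
  set Ta : (∀ i, DirichletCharacter ℂ (p i)) → ℂ :=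
    fun χ => ∑ m ∈ Ioc y Y, ((g m * α m : ℝ) : ℂ) * xt p χ (rs p m) with hTa
  set Tb : (∀ i, DirichletCharacter ℂ (p i)) → ℂ :=
    fun χ => ∑ m ∈ Ioc y Y, ((g m * β m : ℝ) : ℂ) * xt p χ (rs p m) with hTb
  have e : ((∑ d ∈ Ioc y Y, ∑ m ∈ Ioc y Y, (g d * α d) * (g m * β m) *
      (φ (rs p (d * m)) - mux p φ) : ℝ) : ℂ)
      = ∑ χ ∈ X, (if χ = 1 then 0 else cch p φ χ) * (Ta χ * Tb χ) := by
    have h1 : ∀ d ∈ Ioc y Y, ∀ m ∈ Ioc y Y, (((g d * α d) * (g m * β m) *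
        (φ (rs p (d * m)) - mux p φ) : ℝ) : ℂ)
        = ∑ χ ∈ X, (if χ = 1 then 0 else cch p φ χ) * ((((g d * α d : ℝ) : ℂ) * xt p χ (rs p d)) *
          (((g m * β m : ℝ) : ℂ) * xt p χ (rs p m))) := by
      intro d _ m _
      by_cases ha : α d = 0
      · simp [ha]
      by_cases hb : β m = 0
      · simp [hb]
      rw [Complex.ofReal_mul, expand_sub p φ X hX d m (hα d ha) (hβ m hb), mul_sum]
      refine sum_congr rfl fun χ _ => ?_
      push_cast; ring
    rw [Complex.ofReal_sum]
    simp_rw [Complex.ofReal_sum]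
    rw [sum_congr rfl fun d hd => sum_congr rfl fun m hm => h1 d hd m hm]
    rw [sum_congr rfl fun d hd => sum_comm, sum_comm]
    refine sum_congr rfl fun χ _ => ?_
    rw [hTa, hTb]
    dsimp only
    rw [sum_mul_sum, mul_sum]
    refine sum_congr rfl fun d _ => ?_
    rw [mul_sum]
  rw [← Real.norm_eq_abs, ← Complex.norm_real, e]
  have h2 : ‖∑ χ ∈ X, (if χ = 1 then 0 else cch p φ χ) * (Ta χ * Tb χ)‖
      ≤ ∑ χ ∈ X, κ * (‖Ta χ‖ * ‖Tb χ‖) := by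
    refine norm_sum_le_of_le _ fun χ _ => ?_
    rw [norm_mul, norm_mul]
    refine mul_le_mul_of_nonneg_right ?_ (by positivity)
    split_ifs with h
    · simpa using hκ0
    · exact hκ χ h
  refine h2.trans ?_
  rw [← mul_sum]
  refine mul_le_mul_of_nonneg_left ?_ hκ0
  refine Real.le_sqrt_of_sq_le ?_
  refine (sum_mul_sq_le_sq_mul_sq X (fun χ => ‖Ta χ‖) (fun χ => ‖Tb χ‖)).trans ?_
  exact mul_le_mul hBa hBb (sum_nonneg fun _ _ => sq_nonneg _)
    ((sum_nonneg fun _ _ => sq_nonneg _).trans hBa)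

end bil

section sievefn
variable {ι : Type} [Fintype ι] [DecidableEq ι] (p : ι → ℕ) [hp : ∀ i, Fact (p i).Prime]
variable {k : ℕ}

/-- vector of states -/
noncomputable def sv (r : ∀ q, Fin k → ZMod (p q)) (x : ∀ q, ZMod (p q)) : ι → Option (Fin k) :=
  fun q => rst (r q) (x q)

/-- support modulus -/
def qa (a : ι → Option (Fin k)) : ℕ := ∏ q, if a q = none then 1 else p q

lemma qa_pos (a : ι → Option (Fin k)) : 0 < qa p a := by
  unfold qa
  refine prod_pos fun i _ => ?_
  split_ifs
  · simp
  · exact (hp i).out.pos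

/-- general product function `Σ_a G a ∏ u` as a TI function -/
lemma gen_TI (N : ℕ) (hN : ∏ i, p i ∣ N) (r : ∀ q, Fin k → ZMod (p q)) (G : (ι → Option (Fin k)) → ℝ)
    (hG : ∀ a, 0 ≤ G a) (u : ι → Option (Fin k) → Option (Fin k) → ℝ)
    (hu1 : ∀ q s, u q none s = 1) (hu : ∀ q a s, |u q a s| ≤ 1) :
    TI N (∑ a, G a * qa p a) (fun n => ∑ a, G a * ∏ q, u q (a q) (sv p r (rs p n) q)) := by
  refine TI.sum univ (fun a => G a * qa p a) (fun a n => G a * ∏ q, u q (a q) (sv p r (rs p n) q)) fun a _ => ?_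
  have hd : ∀ q, a q ≠ none → p q ∣ qa p a := by
    intro q hq
    unfold qa
    exact dvd_trans (by rw [if_neg hq]) (dvd_prod_of_mem _ (mem_univ q))
  refine TI.base (qa p a) (G a) _ ?_ (qa_pos p a) (fun n => ?_) (fun n => ?_)
  · refine dvd_trans ?_ hN
    unfold qa
    refine prod_dvd_prod_of_dvd _ _ fun i _ => ?_
    split_ifs <;> simp
  · rw [norm_mul, Real.norm_of_nonneg (hG a), Real.norm_eq_abs, abs_prod]
    exact mul_le_of_le_one_right (hG a) (prod_le_one (fun _ _ => abs_nonneg _) fun q _ => hu _ _ _)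
  · congr 1
    refine prod_congr rfl fun q _ => ?_
    by_cases h : a q = none
    · rw [h, hu1, hu1]
    · unfold sv rs
      push_cast
      rw [(ZMod.natCast_eq_zero_iff _ _).2 (hd q h), add_zero]

lemma uu_abs (t : ℝ) (h0 : 0 ≤ t) (h1 : t ≤ 1) (a s : Option (Fin k)) : |uu t a s| ≤ 1 := by
  cases a with
  | none => simp [uu]
  | some j =>
    simp only [uu]
    split_ifs <;> rw [abs_le] <;> constructor <;> linarith

lemma ui_abs (i : Fin k) (t : ℝ) (h0 : 0 ≤ t) (h1 : t ≤ 1) (a s : Option (Fin k)) : |ui i t a s| ≤ 1 := by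
  cases a with
  | none => simp [ui]
  | some j =>
    simp only [ui]
    split_ifs <;> rw [abs_le] <;> constructor <;> linarith

lemma FF_TI (N : ℕ) (hN : ∏ i, p i ∣ N) (r : ∀ q, Fin k → ZMod (p q)) (G : (ι → Option (Fin k)) → ℝ)
    (hG : ∀ a, 0 ≤ G a) :
    TI N (∑ a, G a * qa p a) (fun n => FF (fun q => tt (p q)) G (sv p r (rs p n))) :=
  gen_TI p N hN r G hG (fun q => uu (tt (p q))) (fun _ _ => rfl)
    (fun q => uu_abs _ (tt_pos _).le (tt_le_one _))

lemma FI_TI (i : Fin k) (N : ℕ) (hN : ∏ i, p i ∣ N) (r : ∀ q, Fin k → ZMod (p q)) (G : (ι → Option (Fin k)) → ℝ)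
    (hG : ∀ a, 0 ≤ G a) :
    TI N (∑ a, G a * qa p a) (fun n => FI i (fun q => tt (p q)) G (sv p r (rs p n))) :=
  gen_TI p N hN r G hG (fun q => ui i (tt (p q))) (fun _ _ => rfl)
    (fun q => ui_abs i _ (tt_pos _).le (tt_le_one _))

/-- `mux` is the conditional expectation `Ei` -/
lemma mux_eq (i : Fin k) (r : ∀ q, Fin k → ZMod (p q)) (hr : ∀ q, Function.Injective (r q))
    (hi : ∀ q, r q i = 0) (Ψ : (ι → Option (Fin k)) → ℝ) :
    mux p (fun x => Ψ (sv p r x)) = Ei i (fun q => tt (p q)) Ψ := by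
  unfold mux Ei
  have := push_sum (fun q (z : ZMod (p q)) => if z = 0 then 0 else tt (p q)) (fun q => rst (r q)) Ψ
  unfold sv
  rw [this]
  refine sum_congr rfl fun σ _ => ?_
  congr 1
  exact prod_congr rfl fun q _ => fib_wi (r q) (hr q) i (hi q) (σ q)

lemma cch_small (i : Fin k) (r : ∀ q, Fin k → ZMod (p q)) (hr : ∀ q, Function.Injective (r q))
    (hi : ∀ q, r q i = 0) (G : (ι → Option (Fin k)) → ℝ) (hG : ∀ a, 0 ≤ G a) (hm : MonoG G)
    (δ : ℝ) (hδ : ∀ q, k * tt (p q) ≤ δ) (hδ1 : δ ≤ 1)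
    (χ : ∀ q, DirichletCharacter ℂ (p q)) (hχ : χ ≠ 1) :
    ‖cch p (fun x => FI i (fun q => tt (p q)) G (sv p r x) ^ 2) χ‖
      ≤ 3 * √δ * Zq (fun q => tt (p q)) (GI i (fun q => tt (p q)) G) := by
  obtain ⟨j, hj⟩ := Function.ne_iff.1 hχ
  have ht : ∀ q, 0 ≤ tt (p q) := fun q => (tt_pos _).le
  refine (cch_add_indep p _ (fun x => FA i (fun q => tt (p q)) G j (sv p r x) ^ 2) χ j hj ?_).trans ?_
  · intro x z
    rw [FA_update i _ G j (sv p r (Function.update x j z)) (sv p r x)]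
    intro q hq
    unfold sv
    rw [Function.update_of_ne hq]
  · rw [mux_eq p i r hr hi (fun σ => |FI i (fun q => tt (p q)) G σ ^ 2 - FA i (fun q => tt (p q)) G j σ ^ 2|)]
    refine (diff_le i _ ht (fun q => (hδ q).trans hδ1) G hG hm j).trans ?_
    refine mul_le_mul_of_nonneg_right ?_ (Zq_nonneg _ ht _)
    have := Real.sqrt_le_sqrt (hδ j)
    linarith

lemma cch_supp (i : Fin k) (r : ∀ q, Fin k → ZMod (p q)) (G : (ι → Option (Fin k)) → ℝ) (R : ℕ)
    (hGR : ∀ a, G a ≠ 0 → qa p a ≤ R) (χ : ∀ q, DirichletCharacter ℂ (p q))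
    (hχ : R * R < cnd p χ) :
    cch p (fun x => FI i (fun q => tt (p q)) G (sv p r x) ^ 2) χ = 0 := by
  classical
  unfold cch
  rw [mul_eq_zero]
  right
  have h1 : ∀ x, ((FI i (fun q => tt (p q)) G (sv p r x) ^ 2 : ℝ) : ℂ) = ∑ a, ∑ b,
      ((G a * G b * ∏ q, (ui i (tt (p q)) (a q) (sv p r x q) * ui i (tt (p q)) (b q) (sv p r x q)) : ℝ) : ℂ) := by
    intro x
    unfold FI
    rw [sq, sum_mul_sum]
    push_cast
    refine sum_congr rfl fun a _ => sum_congr rfl fun b _ => ?_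
    rw [prod_mul_distrib]; ring
  simp_rw [h1, sum_mul]
  rw [sum_comm]
  refine sum_eq_zero fun a _ => ?_
  rw [sum_comm]
  refine sum_eq_zero fun b _ => ?_
  by_cases ha : G a = 0
  · simp [ha]
  by_cases hb : G b = 0
  · simp [hb]
  obtain ⟨j, hj, hja, hjb⟩ : ∃ j, χ j ≠ 1 ∧ a j = none ∧ b j = none := by
    by_contra hc
    push Not at hc
    have : cnd p χ ≤ qa p a * qa p b := by
      unfold cnd qa
      rw [← prod_mul_distrib]
      refine prod_le_prod' fun q _ => ?_
      have hpq := (hp q).out.one_le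
      by_cases h : χ q = 1
      · rw [if_pos h]
        split_ifs <;> simp <;> nlinarith
      · rw [if_neg h]
        by_cases h' : a q = none
        · rw [if_neg (hc q h h')]; split_ifs; simp
        · rw [if_neg h']
          split_ifs
          · simp
          · nlinarith
    have := this.trans (Nat.mul_le_mul (hGR a ha) (hGR b hb))
    omega
  refine sum_pi_zero (fun q z => (χ q)⁻¹ z) (fun x => ((G a * G b * ∏ q, (ui i (tt (p q)) (a q) (sv p r x q) * ui i (tt (p q)) (b q) (sv p r x q)) : ℝ) : ℂ)) j (fun x z => ?_) ?_
  · congr 2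
    refine prod_congr rfl fun q _ => ?_
    by_cases h : q = j
    · subst h; rw [hja, hjb]; rfl
    · unfold sv
      rw [Function.update_of_ne h]
  · exact MulChar.sum_eq_zero_of_ne_one (inv_ne_one.2 hj)

end sievefn
end RG


namespace RG
open Finset

/-- harmonic sum over integers up to `x` free of the primes in `A` -/
noncomputable def NN (A : Finset ℕ) (x : ℕ) : ℝ :=
  ∑ n ∈ (Icc 1 x).filter (fun n => ∀ q ∈ A, ¬ q ∣ n), (1 : ℝ) / n

lemma NN_nonneg (A : Finset ℕ) (x : ℕ) : 0 ≤ NN A x := sum_nonneg fun n _ => by positivity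

lemma NN_mono (A : Finset ℕ) {x y : ℕ} (h : x ≤ y) : NN A x ≤ NN A y := by
  unfold NN
  apply sum_le_sum_of_subset_of_nonneg
  · intro n hn
    simp only [mem_filter, mem_Icc] at hn ⊢
    exact ⟨⟨hn.1.1, hn.1.2.trans h⟩, hn.2⟩
  · intros; positivity

lemma NN_step (A : Finset ℕ) (hA : ∀ q ∈ A, q.Prime) (q : ℕ) (hq : q.Prime) (hqA : q ∉ A) (x : ℕ) :
    NN A x = NN (insert q A) x + 1 / (q : ℝ) * NN A (x / q) := by
  unfold NN
  rw [← sum_filter_add_sum_filter_not ((Icc 1 x).filter (fun n => ∀ q ∈ A, ¬ q ∣ n)) (fun n => ¬ q ∣ n)]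
  congr 1
  · apply sum_congr _ fun _ _ => rfl
    ext n
    simp only [mem_filter, mem_insert, forall_eq_or_imp]
    tauto
  · rw [mul_sum]
    symm
    refine sum_bij (fun n _ => q * n) ?_ ?_ ?_ ?_
    · intro n hn
      simp only [mem_filter, mem_Icc, not_not] at hn ⊢
      refine ⟨⟨⟨Nat.mul_pos hq.pos (by omega), ?_⟩, ?_⟩, dvd_mul_right _ _⟩
      · have := (Nat.le_div_iff_mul_le hq.pos).1 hn.1.2
        linarith
      · intro r hr hd
        rcases (hA r hr).dvd_mul.1 hd with h | h
        · rw [(Nat.prime_dvd_prime_iff_eq (hA r hr) hq).1 h] at hr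
          exact hqA hr
        · exact hn.2 r hr h
    · intro a _ b _ h
      exact Nat.eq_of_mul_eq_mul_left hq.pos h
    · intro n hn
      simp only [mem_filter, mem_Icc, not_not] at hn
      obtain ⟨m, rfl⟩ := hn.2
      refine ⟨m, ?_, rfl⟩
      simp only [mem_filter, mem_Icc]
      refine ⟨⟨Nat.pos_of_mul_pos_left (by omega : 0 < q * m), ?_⟩, fun r hr hd => hn.1.2 r hr (hd.mul_left q)⟩
      rw [Nat.le_div_iff_mul_le hq.pos]
      linarith [hn.1.1.2]
    · intro n hn
      push_cast
      have : (0 : ℝ) < q := by exact_mod_cast hq.pos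
      field_simp

lemma NN_le (A : Finset ℕ) (hA : ∀ q ∈ A, q.Prime) (q : ℕ) (hq : q.Prime) (hqA : q ∉ A) (x : ℕ) :
    (1 - 1 / (q : ℝ)) * NN A x ≤ NN (insert q A) x := by
  have h := NN_step A hA q hq hqA x
  have h2 := NN_mono A (Nat.div_le_self x q)
  have : (0 : ℝ) ≤ 1 / q := by positivity
  nlinarith

lemma NN_le' (A : Finset ℕ) (hA : ∀ q ∈ A, q.Prime) (q : ℕ) (hq : q.Prime) (hqA : q ∉ A) (x : ℕ) :
    NN A x ≤ NN (insert q A) x + tt q * NN (insert q A) (x / q) := by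
  have h := NN_step A hA q hq hqA x
  have h2 := NN_le A hA q hq hqA (x / q)
  have hq2 : (2 : ℝ) ≤ q := by exact_mod_cast hq.two_le
  have h3 : 1 / (q : ℝ) * NN A (x / q) ≤ tt q * NN (insert q A) (x / q) := by
    have : 1 / (q : ℝ) = tt q * (1 - 1 / (q : ℝ)) := by
      unfold tt
      have : (q : ℝ) - 1 ≠ 0 := by linarith
      field_simp
    rw [this, mul_assoc]
    apply mul_le_mul_of_nonneg_left h2
    unfold tt
    apply div_nonneg zero_le_one; linarith
  linarith

lemma NN_prod (P A : Finset ℕ) (hP : ∀ q ∈ P, q.Prime) (hA : ∀ q ∈ A, q.Prime) (hd : Disjoint P A) (x : ℕ) :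
    (∏ q ∈ P, (1 - 1 / (q : ℝ))) * NN A x ≤ NN (P ∪ A) x := by
  induction P using Finset.induction_on with
  | empty => simp
  | insert q P hq ih =>
    rw [prod_insert hq, insert_union, mul_assoc]
    have hq' := hP q (mem_insert_self _ _)
    have h1 := ih (fun r hr => hP r (mem_insert_of_mem hr)) (disjoint_of_subset_left (subset_insert _ _) hd)
    refine le_trans (mul_le_mul_of_nonneg_left h1 ?_) (NN_le _ ?_ q hq' ?_ x)
    · have hq2 : (1 : ℝ) ≤ q := by exact_mod_cast hq'.one_lt.le
      rw [sub_nonneg, div_le_one (by linarith)]; exact hq2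
    · intro r hr
      rcases mem_union.1 hr with h | h
      · exact hP r (mem_insert_of_mem h)
      · exact hA r h
    · intro hr
      rcases mem_union.1 hr with h | h
      · exact hq h
      · exact (disjoint_left.1 hd) (mem_insert_self _ _) h

lemma NN_expand (P A : Finset ℕ) (hP : ∀ q ∈ P, q.Prime) (hA : ∀ q ∈ A, q.Prime) (hd : Disjoint P A) (x : ℕ) :
    NN A x ≤ ∑ U ∈ P.powerset, (∏ q ∈ U, tt q) * NN (P ∪ A) (x / ∏ q ∈ U, q) := by
  induction P using Finset.induction_on with
  | empty => simp
  | insert q P hq ih =>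
    have hq' := hP q (mem_insert_self _ _)
    have h1 := ih (fun r hr => hP r (mem_insert_of_mem hr)) (disjoint_of_subset_left (subset_insert _ _) hd)
    refine h1.trans ?_
    rw [sum_powerset_insert hq, ← sum_add_distrib, insert_union]
    refine sum_le_sum fun U hU => ?_
    have hqU : q ∉ U := fun h => hq (mem_powerset.1 hU h)
    rw [prod_insert hqU, prod_insert hqU]
    have h2 := NN_le' (P ∪ A) ?_ q hq' ?_ (x / ∏ q ∈ U, q)
    · have h3 : 0 ≤ ∏ q ∈ U, tt q := prod_nonneg fun r hr => by
        have := (hP r (mem_insert_of_mem (mem_powerset.1 hU hr)))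
        haveI := Fact.mk this
        exact (tt_pos r).le
      have := mul_le_mul_of_nonneg_left h2 h3
      rw [Nat.div_div_eq_div_mul, mul_comm _ q] at this
      calc _ ≤ _ := this
        _ = _ := by ring
    · intro r hr
      rcases mem_union.1 hr with h | h
      · exact hP r (mem_insert_of_mem h)
      · exact hA r h
    · intro hr
      rcases mem_union.1 hr with h | h
      · exact hq h
      · exact (disjoint_left.1 hd) (mem_insert_self _ _) h

lemma NN_full (A : Finset ℕ) (x y : ℕ) (hA : ∀ q, q.Prime → q ≤ y → q ∈ A) (hxy : x ≤ y) : NN A x ≤ if 1 ≤ x then 1 else 0 := by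
  unfold NN
  split_ifs with h
  · calc _ ≤ ∑ n ∈ ({1} : Finset ℕ), (1 : ℝ) / n := by
          apply sum_le_sum_of_subset_of_nonneg
          · intro n hn
            simp only [mem_filter, mem_Icc, mem_singleton] at hn ⊢
            by_contra h1
            have hp := Nat.minFac_prime h1
            exact hn.2 _ (hA _ hp ((Nat.minFac_le (by omega)).trans (hn.1.2.trans hxy))) (Nat.minFac_dvd n)
          · intros; positivity
      _ = 1 := by simp
  · have : x = 0 := by omega
    subst this; simp

lemma NN_empty (x : ℕ) : Real.log x ≤ NN ∅ x := by
  have h : NN ∅ x = (harmonic x : ℝ) := by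
    unfold NN
    rw [harmonic_eq_sum_Icc]
    push_cast
    simp
  rw [h]
  rcases Nat.eq_zero_or_pos x with rfl | hx
  · simp
  refine le_trans ?_ (log_add_one_le_harmonic x)
  have : (0:ℝ) < x := by exact_mod_cast hx
  apply Real.log_le_log this
  push_cast; linarith

/-- Mertens type bound -/
lemma mertens (P : Finset ℕ) (hP : ∀ q ∈ P, q.Prime) (y : ℕ) (hy : 2 ≤ y) (hc : ∀ q, q.Prime → q ≤ y → q ∈ P) :
    ∏ q ∈ P, (1 - 1 / (q : ℝ)) ≤ 1 / Real.log y := by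
  have h1 := NN_prod P ∅ hP (by simp) (disjoint_empty_right _) y
  have h2 := NN_full (P ∪ ∅) y y (by simpa using hc) le_rfl
  rw [if_pos (by omega)] at h2
  have h3 := NN_empty y
  have h4 : 0 < Real.log y := Real.log_pos (by exact_mod_cast hy)
  have h5 : 0 ≤ ∏ q ∈ P, (1 - 1 / (q : ℝ)) := prod_nonneg fun q hq => by
    have hq2 : (1 : ℝ) ≤ q := by exact_mod_cast (hP q hq).one_lt.le
    rw [sub_nonneg, div_le_one (by linarith)]; exact hq2
  rw [le_div_iff₀ h4]
  nlinarith

/-- Selberg sum lower bound -/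
lemma S_lower (P A : Finset ℕ) (hP : ∀ q ∈ P, q.Prime) (hA : ∀ q ∈ A, q.Prime) (hd : Disjoint P A) (x y : ℕ) (hxy : x ≤ y)
    (hc : ∀ q, q.Prime → q ≤ y → q ∈ P ∪ A) :
    (∏ q ∈ A, (1 - 1 / (q : ℝ))) * Real.log x
      ≤ ∑ U ∈ P.powerset with ∏ q ∈ U, q ≤ x, ∏ q ∈ U, tt q := by
  have h1 := NN_prod A ∅ hA (by simp) (disjoint_empty_right _) x
  rw [union_empty] at h1
  have h5 : 0 ≤ ∏ q ∈ A, (1 - 1 / (q : ℝ)) := prod_nonneg fun q hq => by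
    have hq2 : (1 : ℝ) ≤ q := by exact_mod_cast (hA q hq).one_lt.le
    rw [sub_nonneg, div_le_one (by linarith)]; exact hq2
  refine (mul_le_mul_of_nonneg_left (NN_empty x) h5).trans (h1.trans ((NN_expand P A hP hA hd x).trans ?_))
  rw [sum_filter]
  refine sum_le_sum fun U hU => ?_
  have h3 : 0 ≤ ∏ q ∈ U, tt q := prod_nonneg fun r hr => by
    have := (hP r ((mem_powerset.1 hU hr)))
    haveI := Fact.mk this
    exact (tt_pos r).le
  have h6 : 0 < ∏ q ∈ U, q := prod_pos fun r hr => (hP r (mem_powerset.1 hU hr)).pos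
  have h4 := NN_full (P ∪ A) (x / ∏ q ∈ U, q) y hc ((Nat.div_le_self _ _).trans hxy)
  refine (mul_le_mul_of_nonneg_left h4 h3).trans ?_
  have : 1 ≤ x / ∏ q ∈ U, q ↔ ∏ q ∈ U, q ≤ x := by
    rw [Nat.le_div_iff_mul_le h6, one_mul]
  simp only [this]
  split_ifs <;> simp

end RG


namespace RG
open Finset

/-- the weight n^{-(1+η)} -/
noncomputable def gw (η : ℝ) (n : ℕ) : ℝ := (n : ℝ) ^ (-(1 + η))

lemma gw_nonneg (η : ℝ) (n : ℕ) : 0 ≤ gw η n := by unfold gw; positivity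

lemma gw_pos (η : ℝ) (n : ℕ) (hn : 0 < n) : 0 < gw η n := by unfold gw; positivity

lemma gw_mul (η : ℝ) (m n : ℕ) : gw η (m * n) = gw η m * gw η n := by
  unfold gw
  rw [Nat.cast_mul, Real.mul_rpow (by positivity) (by positivity)]

lemma gw_anti (η : ℝ) (hη : 0 ≤ η) (m n : ℕ) (hm : 0 < m) (h : m ≤ n) : gw η n ≤ gw η m := by
  unfold gw
  apply Real.rpow_le_rpow_of_nonpos
  · exact_mod_cast hm
  · exact_mod_cast h
  · linarith

lemma gw_le_inv (η : ℝ) (hη : 0 ≤ η) (n : ℕ) : gw η n ≤ 1 / n := by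
  rcases Nat.eq_zero_or_pos n with rfl | hn
  · unfold gw
    simp only [Nat.cast_zero, div_zero]
    rw [Real.zero_rpow (by linarith)]
  · unfold gw
    rw [one_div, ← Real.rpow_neg_one]
    apply Real.rpow_le_rpow_of_exponent_le
    · exact_mod_cast hn
    · linarith

lemma gw_tel (η : ℝ) (hη : 0 < η) (n : ℕ) (hn : 1 ≤ n) :
    gw η (n + 1) ≤ 1 / η * ((n : ℝ) ^ (-η) - ((n + 1 : ℕ) : ℝ) ^ (-η)) := by
  unfold gw
  have hn0 : (0 : ℝ) < n := by exact_mod_cast hn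
  push_cast
  have h1 : (0 : ℝ) < n + 1 := by linarith
  rw [neg_add, Real.rpow_add h1, Real.rpow_neg_one]
  have key : (1 + η / (n + 1)) * (n + 1 : ℝ) ^ (-η) ≤ (n : ℝ) ^ (-η) := by
    have e : (n : ℝ) ^ (-η) = Real.exp (η * Real.log ((n + 1) / n)) * (n + 1 : ℝ) ^ (-η) := by
      rw [Real.rpow_def_of_pos hn0, Real.rpow_def_of_pos h1, ← Real.exp_add, Real.log_div h1.ne' hn0.ne']
      ring_nf
    rw [e]
    apply mul_le_mul_of_nonneg_right _ (by positivity)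
    refine le_trans ?_ (Real.add_one_le_exp _)
    have h2 : 1 / ((n : ℝ) + 1) ≤ Real.log ((n + 1) / n) := by
      have := Real.one_sub_inv_le_log_of_pos (x := ((n : ℝ) + 1) / n) (by positivity)
      refine le_trans (le_of_eq ?_) this
      field_simp
      ring
    have := mul_le_mul_of_nonneg_left h2 hη.le
    rw [mul_one_div] at this
    linarith
  have : (n + 1 : ℝ)⁻¹ * (n + 1 : ℝ) ^ (-η) = 1 / η * (η / (n + 1) * (n + 1 : ℝ) ^ (-η)) := by
    field_simp
  rw [this]
  apply mul_le_mul_of_nonneg_left _ (by positivity)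
  linarith

lemma sum_gw_le (η : ℝ) (hη : 0 < η) (X : ℕ) : ∑ n ∈ Ioc 1 X, gw η n ≤ 1 / η := by
  have h : ∀ X : ℕ, 1 ≤ X → ∑ n ∈ Ioc 1 X, gw η n ≤ 1 / η * (1 - (X : ℝ) ^ (-η)) := by
    intro X hX
    induction X, hX using Nat.le_induction with
    | base => simp
    | succ n hn ih =>
      rw [sum_Ioc_succ_top (by omega)]
      have := gw_tel η hη n hn
      have h3 : 1 / η * (1 - ((n + 1 : ℕ) : ℝ) ^ (-η)) = 1 / η * (1 - (n : ℝ) ^ (-η)) + 1 / η * ((n : ℝ) ^ (-η) - ((n + 1 : ℕ) : ℝ) ^ (-η)) := by ring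
      rw [h3]; linarith
  rcases Nat.lt_or_ge X 1 with h1 | h1
  · rw [Ioc_eq_empty (by omega)]; simp; positivity
  · refine (h X h1).trans ?_
    have h2 : (0 : ℝ) ≤ (X : ℝ) ^ (-η) := by positivity
    have h3 : 0 < 1 / η := by positivity
    nlinarith

lemma sum_gw_le' (η : ℝ) (hη : 0 < η) (y X : ℕ) (hy : 1 ≤ y) : ∑ n ∈ Ioc y X, gw η n ≤ 1 / η := by
  refine le_trans (sum_le_sum_of_subset_of_nonneg (Ioc_subset_Ioc_left hy) ?_) (sum_gw_le η hη X)
  intros; exact gw_nonneg _ _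

lemma log_gw_le (η : ℝ) (hη : 0 < η) (n : ℕ) : Real.log n * gw η n ≤ 2 / η * gw (η / 2) n := by
  have h := Real.log_le_rpow_div (x := n) (Nat.cast_nonneg n) (half_pos hη)
  rcases Nat.eq_zero_or_pos n with rfl | hn
  · simp
    have := gw_nonneg (η / 2) 0
    positivity
  have hn0 : (0 : ℝ) < n := by exact_mod_cast hn
  have e : gw (η / 2) n = (n : ℝ) ^ (η / 2) * gw η n := by
    unfold gw
    rw [← Real.rpow_add hn0]; ring_nf
  rw [e]
  have := mul_le_mul_of_nonneg_right h (gw_nonneg η n)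
  calc _ ≤ _ := this
    _ = _ := by field_simp

lemma log_sq_gw_le (η : ℝ) (hη : 0 < η) (n : ℕ) : Real.log n ^ 2 * gw η n ≤ 16 / η ^ 2 * gw (η / 2) n := by
  have h := Real.log_le_rpow_div (x := n) (Nat.cast_nonneg n) (show 0 < η / 4 by positivity)
  rcases Nat.eq_zero_or_pos n with rfl | hn
  · simp
    have := gw_nonneg (η / 2) 0
    positivity
  have hn0 : (0 : ℝ) < n := by exact_mod_cast hn
  have e : gw (η / 2) n = ((n : ℝ) ^ (η / 4)) ^ 2 * gw η n := by
    unfold gw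
    rw [← Real.rpow_natCast, ← Real.rpow_mul hn0.le, ← Real.rpow_add hn0]; ring_nf
  rw [e]
  have h0 : 0 ≤ Real.log n := Real.log_natCast_nonneg n
  have h2 := pow_le_pow_left₀ h0 h 2
  have := mul_le_mul_of_nonneg_right h2 (gw_nonneg η n)
  calc _ ≤ _ := this
    _ = _ := by field_simp; ring

lemma sum_log_gw_le (η : ℝ) (hη : 0 < η) (y X : ℕ) (hy : 1 ≤ y) :
    ∑ n ∈ Ioc y X, Real.log n * gw η n ≤ 4 / η ^ 2 := by
  calc _ ≤ ∑ n ∈ Ioc y X, 2 / η * gw (η / 2) n := sum_le_sum fun n _ => log_gw_le η hη n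
    _ = 2 / η * ∑ n ∈ Ioc y X, gw (η / 2) n := by rw [mul_sum]
    _ ≤ 2 / η * (1 / (η / 2)) := by
        apply mul_le_mul_of_nonneg_left (sum_gw_le' _ (by positivity) y X hy) (by positivity)
    _ = _ := by field_simp; ring

lemma gw_summable (η : ℝ) (hη : 0 < η) : Summable (gw η) := by
  unfold gw
  rw [Real.summable_nat_rpow]; linarith

lemma log_gw_summable (η : ℝ) (hη : 0 < η) : Summable (fun n : ℕ => Real.log n * gw η n) := by
  refine Summable.of_nonneg_of_le (fun n => mul_nonneg (Real.log_natCast_nonneg n) (gw_nonneg _ _)) (log_gw_le η hη) ?_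
  exact (gw_summable _ (half_pos hη)).mul_left _

lemma log_gw_anti (η : ℝ) (hη : 0 ≤ η) (m n : ℕ) (hm : 3 ≤ m) (h : m ≤ n) :
    Real.log n * gw η n ≤ Real.log m * gw η m := by
  have hm0 : (0 : ℝ) < m := by positivity
  have hn0 : (0 : ℝ) < n := lt_of_lt_of_le hm0 (by exact_mod_cast h)
  have e : ∀ n : ℕ, 0 < (n : ℝ) → Real.log n * gw η n = (Real.log n / n) * (n : ℝ) ^ (-η) := by
    intro n hn
    unfold gw
    rw [neg_add, Real.rpow_add hn, Real.rpow_neg_one]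
    ring
  rw [e n hn0, e m hm0]
  have he : Real.exp 1 ≤ m := by
    have := Real.exp_one_lt_d9
    have : (3 : ℝ) ≤ m := by exact_mod_cast hm
    linarith
  have hmn : (m : ℝ) ≤ n := by exact_mod_cast h
  have h1 : Real.log n / n ≤ Real.log m / m :=
    Real.log_div_self_antitoneOn (by simpa using he) (by simpa using he.trans hmn) hmn
  apply mul_le_mul h1 _ (by positivity) (div_nonneg (Real.log_natCast_nonneg m) hm0.le)
  exact Real.rpow_le_rpow_of_nonpos hm0 hmn (by linarith)

lemma sum_inv_le (x : ℕ) (y : ℕ) (hy : 1 ≤ y) : ∑ n ∈ Ioc y x, (1 : ℝ) / n ≤ Real.log x := by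
  rcases Nat.lt_or_ge x 1 with h1 | h1
  · rw [Ioc_eq_empty (by omega)]; simp; exact Real.log_natCast_nonneg x
  have h2 := harmonic_le_one_add_log x
  rw [harmonic_eq_sum_Icc] at h2
  push_cast at h2
  rw [← add_sum_Ioc_eq_sum_Icc h1] at h2
  simp at h2
  refine le_trans (sum_le_sum_of_subset_of_nonneg (Ioc_subset_Ioc_left hy) ?_) (by simpa using h2)
  intros; positivity

/-- dyadic prime sum -/
lemma dyadic (a : ℕ) (ha : 1 ≤ a) :
    ∑ q ∈ (Ioc (2 ^ a) (2 ^ (a + 1))).filter Nat.Prime, (1 : ℝ) / q ≤ 4 / a := by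
  have h := Chebyshev.theta_le_log4_mul_x (x := ((2 ^ (a + 1) : ℕ) : ℝ)) (by positivity)
  rw [Chebyshev.theta_eq_sum_Icc] at h
  rw [Nat.floor_natCast] at h
  have ha0 : (0 : ℝ) < a := by exact_mod_cast ha
  have hl2 : 0 < Real.log 2 := Real.log_pos (by norm_num)
  have h4 : Real.log 4 = 2 * Real.log 2 := by
    rw [show (4 : ℝ) = 2 ^ 2 by norm_num, Real.log_pow]; norm_num
  have h1 : ∀ q ∈ (Ioc (2 ^ a) (2 ^ (a + 1))).filter Nat.Prime, (1 : ℝ) / q ≤ 1 / (2 ^ a * (a * Real.log 2)) * Real.log q := by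
    intro q hq
    simp only [mem_filter, mem_Ioc] at hq
    have hq1 : (2 : ℝ) ^ a ≤ q := by exact_mod_cast hq.1.1.le
    have hq0 : (0 : ℝ) < q := lt_of_lt_of_le (by positivity) hq1
    have hlog : a * Real.log 2 ≤ Real.log q := by
      rw [← Real.log_pow]
      exact Real.log_le_log (by positivity) hq1
    rw [div_mul_eq_mul_div, one_mul, div_le_div_iff₀ hq0 (by positivity), one_mul, mul_comm (Real.log q)]
    exact mul_le_mul hq1 hlog (by positivity) hq0.le
  refine (sum_le_sum h1).trans ?_
  rw [← mul_sum]
  have h2 : ∑ q ∈ (Ioc (2 ^ a) (2 ^ (a + 1))).filter Nat.Prime, Real.log q ≤ 2 * Real.log 2 * ((2 ^ (a + 1) : ℕ) : ℝ) := by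
    rw [h4] at h
    refine le_trans (sum_le_sum_of_subset_of_nonneg ?_ ?_) h
    · intro q hq
      simp only [mem_filter, mem_Ioc, mem_Icc] at hq ⊢
      exact ⟨⟨by omega, hq.1.2⟩, hq.2⟩
    · intros; exact Real.log_natCast_nonneg _
  refine (mul_le_mul_of_nonneg_left h2 (by positivity)).trans (le_of_eq ?_)
  push_cast
  rw [pow_succ]
  field_simp
  ring

lemma sum_union_le_aux (s t : Finset ℕ) (f : ℕ → ℝ) (hf : ∀ q, 0 ≤ f q) :
    ∑ q ∈ s ∪ t, f q ≤ ∑ q ∈ s, f q + ∑ q ∈ t, f q := by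
  rw [← sum_union_inter]
  have : 0 ≤ ∑ q ∈ s ∩ t, f q := sum_nonneg fun q _ => hf q
  linarith

lemma block_sum (j : ℕ) :
    ∑ q ∈ (Ioc (2 ^ 2 ^ j) (2 ^ 2 ^ (j + 1))).filter Nat.Prime, tt q ≤ 8 := by
  have h1 : ∀ b : ℕ, ∑ q ∈ (Ioc (2 ^ 2 ^ j) (2 ^ (2 ^ j + b))).filter Nat.Prime, (1 : ℝ) / q ≤ b * (4 / (2 ^ j : ℝ)) := by
    intro b
    induction b with
    | zero => simp
    | succ b ih =>
      have hsub : (Ioc (2 ^ 2 ^ j) (2 ^ (2 ^ j + (b + 1)))).filter Nat.Prime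
          ⊆ (Ioc (2 ^ 2 ^ j) (2 ^ (2 ^ j + b))).filter Nat.Prime ∪ (Ioc (2 ^ (2 ^ j + b)) (2 ^ (2 ^ j + b + 1))).filter Nat.Prime := by
        intro q hq
        simp only [mem_filter, mem_Ioc, mem_union] at hq ⊢
        have e : 2 ^ j + (b + 1) = 2 ^ j + b + 1 := by ring
        rw [e] at hq
        rcases le_or_gt q (2 ^ (2 ^ j + b)) with h | h
        · left; exact ⟨⟨hq.1.1, h⟩, hq.2⟩
        · right; exact ⟨⟨h, hq.1.2⟩, hq.2⟩
      have hpos : 1 ≤ 2 ^ j + b := Nat.le_add_right_of_le Nat.one_le_two_pow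
      have h2 := dyadic (2 ^ j + b) hpos
      have h3 : (4 : ℝ) / ((2 ^ j + b : ℕ) : ℝ) ≤ 4 / 2 ^ j := by
        apply div_le_div_of_nonneg_left (by norm_num) (by positivity)
        push_cast
        have : (0 : ℝ) ≤ b := by positivity
        linarith
      calc _ ≤ _ := sum_le_sum_of_subset_of_nonneg hsub (by intros; positivity)
        _ ≤ _ := sum_union_le_aux _ _ _ (fun q => by positivity)
        _ ≤ _ := by push_cast; linarith
  have h2 := h1 (2 ^ j)
  have e : 2 ^ j + 2 ^ j = 2 ^ (j + 1) := by ring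
  rw [e] at h2
  have h3 : (((2 ^ j : ℕ) : ℝ)) * (4 / 2 ^ j) = 4 := by push_cast; field_simp
  rw [h3] at h2
  calc _ ≤ ∑ q ∈ (Ioc (2 ^ 2 ^ j) (2 ^ 2 ^ (j + 1))).filter Nat.Prime, 2 * ((1 : ℝ) / q) := by
        refine sum_le_sum fun q hq => ?_
        have hq2 : (2 : ℝ) ≤ q := by exact_mod_cast (mem_filter.1 hq).2.two_le
        unfold tt
        rw [mul_one_div, div_le_div_iff₀ (by linarith) (by linarith)]
        linarith
    _ = 2 * ∑ q ∈ (Ioc (2 ^ 2 ^ j) (2 ^ 2 ^ (j + 1))).filter Nat.Prime, ((1 : ℝ) / q) := by rw [mul_sum]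
    _ ≤ _ := by linarith

end RG


namespace RG
open Finset

section maj
variable {ι : Type} [Fintype ι] [DecidableEq ι] (p : ι → ℕ) [hp : ∀ i, Fact (p i).Prime]

lemma inv_sq_le (q : ℕ) [h : Fact q.Prime] : ((q : ℝ)⁻¹) ^ 2 ≤ tt q ^ 2 := by
  have h2 := two_le_q q
  apply pow_le_pow_left₀ (by positivity)
  unfold tt
  rw [inv_eq_one_div]
  apply one_div_le_one_div_of_le <;> linarith

lemma count_qa {k : ℕ} (R : ℕ) (h1 : ∏ q, (1 + k * tt (p q) ^ 2) ≤ 2) :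
    (((univ.filter fun a : ι → Option (Fin k) => qa p a ≤ R).card : ℕ) : ℝ) ≤ 2 * R ^ 2 := by
  have e : ∀ a : ι → Option (Fin k), (1 / (qa p a : ℝ)) ^ 2 = ∏ q, (if a q = none then 1 else ((p q : ℝ)⁻¹) ^ 2) := by
    intro a
    unfold qa
    push_cast
    rw [one_div, ← prod_inv_distrib, ← prod_pow]
    refine prod_congr rfl fun q _ => ?_
    split_ifs <;> simp
  calc (((univ.filter fun a : ι → Option (Fin k) => qa p a ≤ R).card : ℕ) : ℝ)
      = ∑ a : ι → Option (Fin k) with qa p a ≤ R, (1 : ℝ) := by simp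
    _ ≤ ∑ a : ι → Option (Fin k) with qa p a ≤ R, (R : ℝ) ^ 2 * (1 / (qa p a : ℝ)) ^ 2 := by
        refine sum_le_sum fun a ha => ?_
        have h0 : (0 : ℝ) < qa p a := by exact_mod_cast qa_pos p a
        have : (qa p a : ℝ) ≤ R := by exact_mod_cast (mem_filter.1 ha).2
        rw [← mul_pow]
        apply one_le_pow₀
        rw [mul_one_div, one_le_div h0]; exact this
    _ ≤ ∑ a : ι → Option (Fin k), (R : ℝ) ^ 2 * (1 / (qa p a : ℝ)) ^ 2 := by
        apply sum_le_sum_of_subset_of_nonneg (filter_subset _ _)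
        intros; positivity
    _ = R ^ 2 * ∏ q, (1 + k * ((p q : ℝ)⁻¹) ^ 2) := by
        rw [← mul_sum, sum_congr rfl fun a _ => e a]
        rw [pi_sum_prod (fun q (s : Option (Fin k)) => if s = none then (1 : ℝ) else ((p q : ℝ)⁻¹) ^ 2)]
        congr 1
        refine prod_congr rfl fun q _ => ?_
        rw [Fintype.sum_option]
        simp
    _ ≤ R ^ 2 * 2 := by
        apply mul_le_mul_of_nonneg_left _ (by positivity)
        refine le_trans (prod_le_prod (fun q _ => by positivity) fun q _ => ?_) h1
        have := inv_sq_le (p q)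
        gcongr
    _ = _ := by ring

lemma K_bound {k : ℕ} (R : ℕ) (h1 : ∏ q, (1 + k * tt (p q) ^ 2) ≤ 2) (G : (ι → Option (Fin k)) → ℝ)
    (M : ℝ) (hM : 0 ≤ M) (hG : ∀ a, G a ≤ M) (hGR : ∀ a, G a ≠ 0 → qa p a ≤ R) :
    ∑ a, G a * qa p a ≤ M * (2 * R ^ 3) := by
  calc ∑ a, G a * qa p a ≤ ∑ a, if qa p a ≤ R then M * R else 0 := by
        refine sum_le_sum fun a _ => ?_
        split_ifs with h
        · have : (qa p a : ℝ) ≤ R := by exact_mod_cast h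
          exact mul_le_mul (hG a) this (by positivity) hM
        · have : G a = 0 := by
            by_contra h'; exact h (hGR a h')
          rw [this]; simp
    _ = (((univ.filter fun a : ι → Option (Fin k) => qa p a ≤ R).card : ℕ) : ℝ) * (M * R) := by
        rw [← sum_filter, sum_const, nsmul_eq_mul]
    _ ≤ (2 * R ^ 2) * (M * R) := by
        apply mul_le_mul_of_nonneg_right (count_qa p R h1) (by positivity)
    _ = _ := by ring

open Classical in
lemma count_chi (D : ℕ) (h1 : ∏ q, (1 + tt (p q) ^ 2) ≤ 2) :
    (((univ.filter fun χ : ∀ i, DirichletCharacter ℂ (p i) => cnd p χ ≤ D).card : ℕ) : ℝ) ≤ 2 * D ^ 3 := by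
  have e : ∀ χ : ∀ i, DirichletCharacter ℂ (p i), (1 / (cnd p χ : ℝ)) ^ 3 = ∏ q, (if χ q = 1 then 1 else ((p q : ℝ)⁻¹) ^ 3) := by
    intro a
    unfold cnd
    push_cast
    rw [one_div, ← prod_inv_distrib, ← prod_pow]
    refine prod_congr rfl fun q _ => ?_
    split_ifs <;> simp
  have hpos : ∀ χ, 0 < cnd p χ := by
    intro χ
    unfold cnd
    refine prod_pos fun i _ => ?_
    split_ifs
    · norm_num
    · exact (hp i).out.pos
  have hc : ∀ q : ι, (∑ s : DirichletCharacter ℂ (p q), if s = 1 then (1 : ℝ) else ((p q : ℝ)⁻¹) ^ 3) ≤ 1 + tt (p q) ^ 2 := by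
    intro q
    rw [← add_sum_erase univ _ (mem_univ (1 : DirichletCharacter ℂ (p q)))]
    rw [if_pos rfl]
    rw [sum_congr rfl (fun s hs => if_neg (ne_of_mem_erase hs)), sum_const, nsmul_eq_mul]
    have hcard : ((univ.erase (1 : DirichletCharacter ℂ (p q))).card : ℝ) ≤ p q := by
      rw [card_erase_of_mem (mem_univ _), card_univ, ← Nat.card_eq_fintype_card,
        DirichletCharacter.card_eq_totient_of_hasEnoughRootsOfUnity ℂ (p q)]
      exact_mod_cast (Nat.sub_le _ _).trans (Nat.totient_le _)
    have h2 := two_le_q (p q)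
    have h3 := inv_sq_le (p q)
    have h4 : (p q : ℝ) * ((p q : ℝ)⁻¹) ^ 3 = ((p q : ℝ)⁻¹) ^ 2 := by
      field_simp
    have h5 := mul_le_mul_of_nonneg_right hcard (show (0 : ℝ) ≤ ((p q : ℝ)⁻¹) ^ 3 by positivity)
    linarith
  calc _ = ∑ a : (∀ i, DirichletCharacter ℂ (p i)) with cnd p a ≤ D, (1 : ℝ) := by simp
    _ ≤ ∑ a : (∀ i, DirichletCharacter ℂ (p i)) with cnd p a ≤ D, (D : ℝ) ^ 3 * (1 / (cnd p a : ℝ)) ^ 3 := by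
        refine sum_le_sum fun a ha => ?_
        have h0 : (0 : ℝ) < cnd p a := by exact_mod_cast hpos a
        have : (cnd p a : ℝ) ≤ D := by exact_mod_cast (mem_filter.1 ha).2
        rw [← mul_pow]
        apply one_le_pow₀
        rw [mul_one_div, one_le_div h0]; exact this
    _ ≤ ∑ a : (∀ i, DirichletCharacter ℂ (p i)), (D : ℝ) ^ 3 * (1 / (cnd p a : ℝ)) ^ 3 := by
        apply sum_le_sum_of_subset_of_nonneg (filter_subset _ _)
        intros; positivity
    _ = D ^ 3 * ∏ q, ∑ s : DirichletCharacter ℂ (p q), if s = 1 then (1 : ℝ) else ((p q : ℝ)⁻¹) ^ 3 := by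
        rw [← mul_sum, sum_congr rfl fun a _ => e a]
        rw [pi_sum_prod (fun q (s : DirichletCharacter ℂ (p q)) => if s = 1 then (1 : ℝ) else ((p q : ℝ)⁻¹) ^ 3)]
    _ ≤ D ^ 3 * 2 := by
        apply mul_le_mul_of_nonneg_left _ (by positivity)
        refine le_trans (prod_le_prod (fun q _ => ?_) fun q _ => hc q) h1
        refine sum_nonneg fun s _ => ?_
        split_ifs <;> positivity
    _ = _ := by ring

/-- one dimensional indicator weights -/
noncomputable def G1 (R : ℕ) (a : ι → Option (Fin 1)) : ℝ := if qa p a ≤ R then 1 else 0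

lemma G1_sum_ge (hinj : Function.Injective p) (R : ℕ) :
    ∑ U ∈ (univ.image p).powerset with ∏ q ∈ U, q ≤ R, ∏ q ∈ U, tt q
      ≤ Zq (fun q => tt (p q)) (G1 p R) := by
  unfold Zq
  have key : ∀ U ∈ (univ.image p).powerset, ∀ f : ℕ → ℝ, ∏ q : ι, (if p q ∈ U then f (p q) else 1) = ∏ q ∈ U, f q := by
    intro U hU f
    rw [← prod_filter]
    rw [← prod_image (f := f) (s := univ.filter fun q => p q ∈ U) (g := p) (fun a _ b _ h => hinj h)]
    apply prod_congr _ fun _ _ => rfl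
    ext m
    simp only [mem_image, mem_filter, mem_univ, true_and]
    constructor
    · rintro ⟨a, h, rfl⟩; exact h
    · intro hm
      obtain ⟨a, _, rfl⟩ := mem_image.1 (mem_powerset.1 hU hm)
      exact ⟨a, hm, rfl⟩
  let ψ : Finset ℕ → (ι → Option (Fin 1)) := fun U q => if p q ∈ U then some 0 else none
  have hψ : Set.InjOn ψ ((univ.image p).powerset.filter fun U => ∏ q ∈ U, q ≤ R) := by
    intro U hU V hV h
    simp only [coe_filter, mem_powerset, Set.mem_setOf_eq] at hU hV
    have hh : ∀ q, p q ∈ U ↔ p q ∈ V := by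
      intro q
      have := congrFun h q
      simp only [ψ] at this
      by_cases h1 : p q ∈ U <;> by_cases h2 : p q ∈ V <;> simp_all
    ext m
    constructor
    · intro hm
      obtain ⟨a, _, rfl⟩ := mem_image.1 (hU.1 hm)
      exact (hh a).1 hm
    · intro hm
      obtain ⟨a, _, rfl⟩ := mem_image.1 (hV.1 hm)
      exact (hh a).2 hm
  calc _ = ∑ U ∈ (univ.image p).powerset with ∏ q ∈ U, q ≤ R,
        (∏ q, D0 (tt (p q)) (ψ U q)) * G1 p R (ψ U) ^ 2 := by
        refine sum_congr rfl fun U hU => ?_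
        rw [mem_filter] at hU
        have h1 : qa p (ψ U) ≤ R := by
          have := key U hU.1 (fun n => (n : ℝ))
          have e : ((qa p (ψ U) : ℕ) : ℝ) = ((∏ q ∈ U, q : ℕ) : ℝ) := by
            push_cast
            rw [← this]
            unfold qa
            push_cast
            refine prod_congr rfl fun q _ => ?_
            simp only [ψ]
            split_ifs <;> simp_all
          have e' : qa p (ψ U) = ∏ q ∈ U, q := by exact_mod_cast e
          rw [e']; exact hU.2
        unfold G1
        rw [if_pos h1, one_pow, mul_one, ← key U hU.1]
        refine prod_congr rfl fun q _ => ?_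
        simp only [ψ]
        split_ifs <;> rfl
    _ = ∑ a ∈ ((univ.image p).powerset.filter fun U => ∏ q ∈ U, q ≤ R).image ψ, (∏ q, D0 (tt (p q)) (a q)) * G1 p R a ^ 2 := by
        rw [sum_image hψ]
    _ ≤ _ := by
        apply sum_le_sum_of_subset_of_nonneg (subset_univ _)
        intro a _ _
        refine mul_nonneg (prod_nonneg fun q _ => D0_nonneg (tt_pos _).le _) (sq_nonneg _)

lemma majorant (hinj : Function.Injective p) (W : ℕ) (R : ℕ) (hR : 1 ≤ R) (h1 : ∏ q, (1 + tt (p q) ^ 2) ≤ 2) :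
    ∃ (A : (∀ i, ZMod (p i)) → ℝ) (S : ℝ), 1 ≤ S ∧ S ≤ 2 * R ^ 2 ∧ (∀ x, 0 ≤ A x) ∧
      (∀ x, (∀ i, x i ≠ 0) → 1 ≤ A x) ∧
      (∀ u x : ∀ i, ZMod (p i), (∀ i, u i ≠ 0) → A (u * x) = A x) ∧
      avx p A ≤ 2 / S ∧ TI (W * ∏ i, p i) (4 * R ^ 6) (fun n => A (rs p n)) ∧
      (∀ (B : Finset ℕ) (y : ℕ), (∀ q ∈ B, q.Prime) → Disjoint (univ.image p) B → R ≤ y →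
        (∀ q, q.Prime → q ≤ y → q ∈ (univ.image p) ∪ B) → (∏ q ∈ B, (1 - 1 / (q : ℝ))) * Real.log R ≤ S) := by
  have h1' : ∏ q, (1 + (1 : ℕ) * tt (p q) ^ 2) ≤ 2 := by simpa using h1
  set t : ι → ℝ := fun q => tt (p q) with ht
  set G : (ι → Option (Fin 1)) → ℝ := G1 p R with hG
  have hG0 : ∀ a, 0 ≤ G a := fun a => by rw [hG]; unfold G1; split_ifs <;> norm_num
  have hG1 : ∀ a, G a ≤ 1 := fun a => by rw [hG]; unfold G1; split_ifs <;> norm_num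
  have hGR : ∀ a, G a ≠ 0 → qa p a ≤ R := by
    intro a h; by_contra h'; apply h; rw [hG]; unfold G1; rw [if_neg h']
  set S := Zq t G with hS
  have hD : ∀ a : ι → Option (Fin 1), 0 ≤ ∏ q, D0 (t q) (a q) := fun a => prod_nonneg fun q _ => D0_nonneg (tt_pos _).le _
  have hD1 : ∀ a : ι → Option (Fin 1), ∏ q, D0 (t q) (a q) ≤ 1 := fun a =>
    prod_le_one (fun q _ => D0_nonneg (tt_pos _).le _) fun q _ => by
      cases a q
      · exact le_rfl
      · exact tt_le_one _
  have hS1 : 1 ≤ S := by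
    rw [hS]; unfold Zq
    refine le_trans ?_ (single_le_sum (f := fun a => (∏ q, D0 (t q) (a q)) * G a ^ 2) (fun a _ => mul_nonneg (hD a) (sq_nonneg _)) (mem_univ (fun _ => none)))
    rw [hG]; unfold G1 qa D0
    simp [hR]
  have hSR : S ≤ 2 * R ^ 2 := by
    refine le_trans ?_ (count_qa p (k := 1) R h1')
    rw [hS]; unfold Zq
    rw [card_filter]
    push_cast
    refine sum_le_sum fun a _ => ?_
    rw [hG]; unfold G1
    have := hD1 a
    split_ifs
    · simpa using this
    · simp
  let r : ∀ q, Fin 1 → ZMod (p q) := fun q _ => 0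
  have hr : ∀ q, Function.Injective (r q) := fun q a b _ => Subsingleton.elim _ _
  have hS0 : 0 < S := by linarith
  have hk : ∀ q : ι, ((1 : ℕ) : ℝ) * t q ≤ 1 := fun q => by simpa using tt_le_one (p q)
  refine ⟨fun x => (FF t G (sv p r x) * FF t G (sv p r x)) * (1 / S ^ 2), S, hS1, hSR, fun x => ?_, fun x hx => ?_, fun u x hu => ?_, ?_, ?_, ?_⟩
  · exact mul_nonneg (mul_self_nonneg _) (by positivity)
  · have hs : sv p r x = fun _ => none := by
      funext q
      unfold sv
      rw [Option.eq_none_iff_forall_ne_some]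
      intro j h
      rw [rst_eq_some _ (hr q)] at h
      exact hx q h
    have : FF t G (sv p r x) = S := by
      rw [hs, hS]
      unfold FF Zq
      refine sum_congr rfl fun a _ => ?_
      have e : ∏ q, uu (t q) (a q) none = ∏ q, D0 (t q) (a q) := by
        refine prod_congr rfl fun q _ => ?_
        cases a q
        · rfl
        · simp [uu, D0]
      rw [e]
      have : G a ^ 2 = G a := by rw [hG]; unfold G1; split_ifs <;> norm_num
      rw [this]; ring
    simp only [this]
    apply le_of_eq
    field_simp
  · have : sv p r (u * x) = sv p r x := by
      funext q
      unfold sv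
      have : ∀ j, rst (r q) ((u * x) q) = some j ↔ rst (r q) (x q) = some j := by
        intro j
        rw [rst_eq_some _ (hr q), rst_eq_some _ (hr q)]
        simp [r, hu q]
      exact Option.ext this
    simp only [this]
  · have e : avx p (fun x => (FF t G (sv p r x) * FF t G (sv p r x)) * (1 / S ^ 2))
        = ∑ σ : ι → Option (Fin 1), (∏ i, wf (tt (p i)) (σ i)) * ((FF t G σ * FF t G σ) * (1 / S ^ 2)) :=
      avx_wf p r hr (fun σ => (FF t G σ * FF t G σ) * (1 / S ^ 2))
    rw [e]
    have h2 := full_le t (fun q => (tt_pos _).le) (fun q => tt_le_one _) hk G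
    have h3 : ∑ σ : ι → Option (Fin 1), (∏ i, wf (tt (p i)) (σ i)) * ((FF t G σ * FF t G σ) * (1 / S ^ 2))
        = (∑ σ : ι → Option (Fin 1), (∏ i, wf (tt (p i)) (σ i)) * FF t G σ ^ 2) * (1 / S ^ 2) := by
      rw [sum_mul]
      refine sum_congr rfl fun σ _ => ?_
      ring
    rw [h3]
    have h4 : ∑ σ : ι → Option (Fin 1), (∏ i, wf (tt (p i)) (σ i)) * FF t G σ ^ 2 ≤ 2 * S :=
      h2.trans (mul_le_mul_of_nonneg_right h1' hS0.le)
    refine (mul_le_mul_of_nonneg_right h4 (by positivity)).trans (le_of_eq ?_)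
    field_simp
  · have hT := FF_TI p (W * ∏ i, p i) (dvd_mul_left _ _) r G hG0
    have hK := K_bound p R h1' G 1 zero_le_one hG1 hGR
    have hK0 := hT.nonneg
    have h3 := (hT.mul hT).mul (TI.base (N := W * ∏ i, p i) 1 (1 / S ^ 2) (fun _ => 1 / S ^ 2) (one_dvd _) one_pos (fun n => by
      rw [Real.norm_of_nonneg (by positivity)]) (fun _ => rfl))
    refine TI.mono _ _ _ ?_ h3
    have h5 : 1 / S ^ 2 ≤ 1 := by
      rw [div_le_one (by positivity)]
      exact one_le_pow₀ hS1
    have h6 := mul_le_mul hK hK hK0 (hK0.trans hK)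
    have h7 : 0 ≤ (∑ a, G a * (qa p a : ℝ)) * ∑ a, G a * (qa p a : ℝ) := mul_nonneg hK0 hK0
    calc _ ≤ ((∑ a, G a * (qa p a : ℝ)) * ∑ a, G a * (qa p a : ℝ)) * 1 := by
          apply mul_le_mul_of_nonneg_left _ h7
          simpa using h5
      _ ≤ _ := by rw [mul_one]; refine h6.trans (le_of_eq ?_); ring
  · intro B y hB hd hRy hc
    refine le_trans (S_lower (univ.image p) B ?_ hB hd R y hRy hc) (G1_sum_ge p hinj R)
    intro q hq
    obtain ⟨i, _, rfl⟩ := mem_image.1 hq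
    exact (hp i).out

end maj
end RG


namespace RG
open Finset

section bt
variable {ι : Type} [Fintype ι] [DecidableEq ι] (p : ι → ℕ) [hp : ∀ i, Fact (p i).Prime]

open Classical in
/-- rough indicator -/
noncomputable def rho (n : ℕ) : ℝ := if ∀ i, rs p n i ≠ 0 then 1 else 0

lemma rho_nonneg (n : ℕ) : 0 ≤ rho p n := by unfold rho; split_ifs <;> norm_num
lemma rho_le_one (n : ℕ) : rho p n ≤ 1 := by unfold rho; split_ifs <;> norm_num
lemma rho_sq (n : ℕ) : rho p n ^ 2 = rho p n := by unfold rho; split_ifs <;> norm_num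
lemma rho_ne {n : ℕ} (h : rho p n ≠ 0) : ∀ i, rs p n i ≠ 0 := by
  unfold rho at h; by_contra h'; exact h (if_neg h')
lemma rho_one {n : ℕ} (h : ∀ i, rs p n i ≠ 0) : rho p n = 1 := by
  unfold rho; exact if_pos h
lemma rho_mul (m n : ℕ) : rho p (m * n) = rho p m * rho p n := by
  by_cases h : ∀ i, rs p (m * n) i ≠ 0
  · have h1 : ∀ i, rs p m i ≠ 0 := fun i hi => h i (by rw [rs_mul, Pi.mul_apply, hi, zero_mul])
    have h2 : ∀ i, rs p n i ≠ 0 := fun i hi => h i (by rw [rs_mul, Pi.mul_apply, hi, mul_zero])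
    rw [rho_one p h, rho_one p h1, rho_one p h2]; norm_num
  · have h0 : rho p (m * n) = 0 := by unfold rho; exact if_neg h
    rw [h0]
    push Not at h
    obtain ⟨i, hi⟩ := h
    rw [rs_mul, Pi.mul_apply, mul_eq_zero] at hi
    symm
    rcases hi with hi | hi
    · have : rho p m = 0 := by unfold rho; exact if_neg (fun h => h i hi)
      rw [this, zero_mul]
    · have : rho p n = 0 := by unfold rho; exact if_neg (fun h => h i hi)
      rw [this, mul_zero]
lemma rs_zero_iff (n : ℕ) (i : ι) : rs p n i = 0 ↔ p i ∣ n := by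
  unfold rs; exact ZMod.natCast_eq_zero_iff n (p i)

/-- standing assumptions -/
structure Env (W y R : ℕ) : Prop where
  hinj : Function.Injective p
  hW : ∀ i, W.Coprime (p i)
  cov : ∀ q, q.Prime → q ≤ y → q ∣ W ∨ ∃ i, p i = q
  h1 : ∏ q, (1 + tt (p q) ^ 2) ≤ 2
  hR : 2 ≤ R
  hWR : W ≤ R
  hW0 : 0 < W
  hRy : R ^ 1024 ≤ y

variable {p} {W y R : ℕ}

lemma Env.rough_gt (e : Env p W y R) (n : ℕ) (hn : 1 < n) (hr : rho p n ≠ 0) (hu : IsUnit (n : ZMod W)) : y < n := by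
  by_contra h
  have hq := Nat.minFac_prime (show n ≠ 1 by omega)
  rcases e.cov _ hq ((Nat.minFac_le (by omega)).trans (by omega)) with h1 | ⟨i, hi⟩
  · rw [ZMod.isUnit_iff_coprime] at hu
    have := Nat.dvd_gcd (Nat.minFac_dvd n) h1
    rw [hu.gcd_eq_one] at this
    exact hq.one_lt.ne' (Nat.dvd_one.1 this)
  · exact rho_ne p hr i ((rs_zero_iff p n i).2 (hi ▸ Nat.minFac_dvd n))

lemma Env.pow_le (e : Env p W y R) (c j : ℕ) (hc : c ≤ 1000) (hj : j ≤ 24) : (2 ^ j * R ^ c : ℝ) ≤ y := by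
  have h1 : 2 ^ j ≤ R ^ j := Nat.pow_le_pow_left e.hR j
  have h2 : 2 ^ j * R ^ c ≤ R ^ j * R ^ c := Nat.mul_le_mul_right _ h1
  rw [← pow_add] at h2
  have h3 : R ^ (j + c) ≤ R ^ 1024 := Nat.pow_le_pow_right (by have := e.hR; omega) (by omega)
  exact_mod_cast h2.trans (h3.trans e.hRy)

lemma Env.y_pos (e : Env p W y R) : 1 ≤ y := by
  have := e.hRy
  have h2 : 1 ≤ R ^ 1024 := Nat.one_le_pow _ _ (by have := e.hR; omega)
  omega

/-- the package of facts on the majorant -/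
structure Maj (p : ι → ℕ) [∀ i, Fact (p i).Prime] (W R : ℕ) (A : (∀ i, ZMod (p i)) → ℝ) (S : ℝ) : Prop where
  S1 : 1 ≤ S
  SR : S ≤ 2 * R ^ 2
  A0 : ∀ x, 0 ≤ A x
  A1 : ∀ x, (∀ i, x i ≠ 0) → 1 ≤ A x
  Ainv : ∀ u x : ∀ i, ZMod (p i), (∀ i, u i ≠ 0) → A (u * x) = A x
  Aav : avx p A ≤ 2 / S
  AT : TI (W * ∏ i, p i) (4 * R ^ 6) (fun n => A (rs p n))

lemma small_err (e : Env p W y R) {A : (∀ i, ZMod (p i)) → ℝ} {S : ℝ} (hM : Maj p W R A S) (η : ℝ) (hη : 0 < η) (hη1 : η ≤ 1) (c j : ℕ) (hc : c ≤ 900) (hj : j ≤ 23) (t : ℝ) (ht : t ≤ 2 ^ j * R ^ c) :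
    W * t * (1 / y) ≤ 1 / (η * (W * S)) := by
  have hy : (0 : ℝ) < y := by exact_mod_cast e.y_pos
  have hW : (0 : ℝ) < W := by exact_mod_cast e.hW0
  have hS := hM.S1
  have hS0 : 0 < S := by linarith
  have hWR : (W : ℝ) ≤ R := by exact_mod_cast e.hWR
  have hR0 : (0 : ℝ) ≤ R := by positivity
  rw [mul_one_div, div_le_div_iff₀ hy (by positivity), one_mul]
  have h := e.pow_le (c + 4) (j + 1) (by omega) (by omega)
  refine le_trans ?_ h
  calc (W : ℝ) * t * (η * (W * S)) ≤ W * (2 ^ j * R ^ c) * (η * (W * S)) := by gcongr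
    _ ≤ R * (2 ^ j * R ^ c) * (1 * (R * (2 * R ^ 2))) := by
      have := hM.SR
      gcongr
    _ = _ := by ring

/-- upper bound sums with the majorant -/
lemma A_sum (e : Env p W y R) [NeZero W] {A : (∀ i, ZMod (p i)) → ℝ} {S : ℝ} (hM : Maj p W R A S) (η : ℝ) (hη : 0 < η) (hη1 : η ≤ 1)
    (v : ZMod W) (X : ℕ) (g : ℕ → ℝ) (H : ℝ) (hH : ∑ n ∈ Ioc y X, g n ≤ H) (hH1 : 1 ≤ η * H)
    (hg : ∀ m n, y < m → m ≤ n → g n ≤ g m) (hg0 : ∀ n, y < n → 0 ≤ g n) (hgy : g (y + 1) ≤ 1 / y) :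
    ∑ n ∈ Ioc y X, g n * (if (n : ZMod W) = v then A (rs p n) else 0) ≤ 3 * H / (W * S) := by
  have hWT := ind_TI (𝕜 := ℝ) (W * ∏ i, p i) W (dvd_mul_right _ _) v
  have hT := hWT.mul hM.AT
  have hW : (0 : ℝ) < W := by exact_mod_cast e.hW0
  have hS := hM.S1
  have hS0 : 0 < S := by linarith
  have hH0 : 0 ≤ H := by
    by_contra h; push Not at h; nlinarith
  have hfun : (fun n : ℕ => (if (n : ZMod W) = v then (1 : ℝ) else 0) * A (rs p n)) = fun n : ℕ => if (n : ZMod W) = v then A (rs p n) else 0 := by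
    funext n; split_ifs <;> simp
  rw [hfun] at hT
  have hc := hT.count (Nat.mul_pos e.hW0 (Qpos p)) g y X hg hg0
  rw [av_crt p e.hinj W e.hW v A] at hc
  simp only [smul_eq_mul, Real.norm_eq_abs] at hc
  have h2 := (abs_le.1 hc).2
  have h3 : (∑ n ∈ Ioc y X, g n) * (1 / W * avx p A) ≤ H * (1 / W * (2 / S)) := by
    have hav := hM.Aav
    have hav0 : 0 ≤ avx p A := by
      unfold avx
      exact smul_nonneg (prod_nonneg fun i _ => by positivity) (sum_nonneg fun x _ => hM.A0 x)
    gcongr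
  have h4 : 2 * (W * (4 * R ^ 6 : ℝ)) * g (y + 1) ≤ 1 / (η * (W * S)) := by
    refine le_trans ?_ (small_err e hM η hη hη1 6 3 (by omega) (by omega) (2 ^ 3 * R ^ 6) le_rfl)
    calc _ = W * (2 ^ 3 * R ^ 6) * g (y + 1) := by ring
      _ ≤ _ := by gcongr
  have h5 : 1 / (η * (W * S)) ≤ H / (W * S) := by
    rw [div_le_div_iff₀ (by positivity) (by positivity)]
    have : 0 < (W : ℝ) * S := by positivity
    nlinarith
  have h6 : H * (1 / W * (2 / S)) = 2 * (H / (W * S)) := by field_simp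
  have h7 : 3 * H / (W * S) = 3 * (H / (W * S)) := by ring
  rw [h7]
  linarith

lemma gw_cond (η : ℝ) (hη : 0 < η) (y : ℕ) (hy : 1 ≤ y) : (∀ m n, y < m → m ≤ n → gw η n ≤ gw η m) ∧ (∀ n, y < n → 0 ≤ gw η n) ∧ gw η (y + 1) ≤ 1 / y := by
  refine ⟨fun m n h1 h2 => gw_anti η hη.le m n (by omega) h2, fun n _ => gw_nonneg _ _, ?_⟩
  refine (gw_anti η hη.le y (y + 1) (by omega) (by omega)).trans (gw_le_inv η hη.le y)

open Classical in
lemma Delta_bound (e : Env p W y R) [NeZero W] {A : (∀ i, ZMod (p i)) → ℝ} {S : ℝ} (hM : Maj p W R A S) (η : ℝ) (hη : 0 < η) (hη1 : η ≤ 1)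
    (v : ZMod W) (Y : ℕ) (β : ℕ → ℝ) (hβ : ∀ m, β m ≠ 0 → (∀ i, rs p m i ≠ 0) ∧ (m : ZMod W) = v) :
    ∑ χ : (∀ i, DirichletCharacter ℂ (p i)) with cnd p χ ≤ R * R,
        ‖∑ m ∈ Ioc y Y, ((gw η m * β m : ℝ) : ℂ) * xt p χ (rs p m)‖ ^ 2
      ≤ 3 / (η * (W * S)) * ∑ m ∈ Ioc y Y, gw η m * β m ^ 2 := by
  obtain ⟨hg, hg0, hgy⟩ := gw_cond η hη y e.y_pos
  have hW : (0 : ℝ) < W := by exact_mod_cast e.hW0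
  have hS := hM.S1
  have hS0 : 0 < S := by linarith
  refine ls_primal p W _ _ (by positivity) A hM.A0 hM.A1 v (gw η) y Y hg0 (fun z => ?_) β hβ
  refine (ls_dual p e.hinj W e.hW _ ((R * R : ℕ) : ℝ) (fun χ hχ => by exact_mod_cast (mem_filter.1 hχ).2) A hM.A0 hM.Ainv _ hM.AT v (gw η) y Y hg hg0 z).trans ?_
  refine mul_le_mul_of_nonneg_right ?_ (sum_nonneg fun _ _ => sq_nonneg _)
  have h1 := count_chi p (R * R) e.h1
  have h2 := sum_gw_le' η hη y Y e.y_pos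
  have hav := hM.Aav
  have hav0 : 0 ≤ avx p A := by
    unfold avx
    exact smul_nonneg (prod_nonneg fun i _ => by positivity) (sum_nonneg fun x _ => hM.A0 x)
  have h3 : avx p A / W * ∑ m ∈ Ioc y Y, gw η m ≤ 2 / S / W * (1 / η) := by
    have := sum_nonneg (s := Ioc y Y) fun m _ => gw_nonneg η m
    gcongr
  have h4 : (((univ.filter fun χ : ∀ i, DirichletCharacter ℂ (p i) => cnd p χ ≤ R * R).card : ℕ) : ℝ) * (2 * (W * (4 * R ^ 6) * (((R * R : ℕ) : ℝ) * ((R * R : ℕ) : ℝ))) * gw η (y + 1)) ≤ 1 / (η * (W * S)) := by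
    refine le_trans ?_ (small_err e hM η hη hη1 16 4 (by omega) (by omega) (2 ^ 4 * R ^ 16) le_rfl)
    have h5 := gw_nonneg η (y + 1)
    calc _ ≤ (2 * ((R * R : ℕ) : ℝ) ^ 3) * (2 * (W * (4 * R ^ 6) * (((R * R : ℕ) : ℝ) * ((R * R : ℕ) : ℝ))) * (1 / y)) := by
          gcongr
      _ = _ := by push_cast; ring
  refine (add_le_add h3 h4).trans (le_of_eq ?_)
  field_simp
  ring

open Classical in
lemma bil_class (e : Env p W y R) [NeZero W] {A : (∀ i, ZMod (p i)) → ℝ} {S : ℝ} (hM : Maj p W R A S) (η : ℝ) (hη : 0 < η) (hη1 : η ≤ 1)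
    (φ : (∀ i, ZMod (p i)) → ℝ) (hX : ∀ χ, R * R < cnd p χ → cch p φ χ = 0) (κ : ℝ) (hκ0 : 0 ≤ κ)
    (hκ : ∀ χ, χ ≠ 1 → ‖cch p φ χ‖ ≤ κ) (u v : ZMod W) (Y : ℕ) :
    |∑ d ∈ Ioc y Y, ∑ m ∈ Ioc y Y, (gw η d * (if (d : ZMod W) = u then rho p d * ArithmeticFunction.vonMangoldt d else 0))
        * (gw η m * (if (m : ZMod W) = v then rho p m else 0)) * (φ (rs p (d * m)) - mux p φ)|
      ≤ κ * (60 / (η ^ 3 * (W * S) ^ 2)) := by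
  obtain ⟨hg, hg0, hgy⟩ := gw_cond η hη y e.y_pos
  have hη2 : 0 < η / 2 := by positivity
  obtain ⟨hg', hg0', hgy'⟩ := gw_cond (η / 2) hη2 y e.y_pos
  have hW : (0 : ℝ) < W := by exact_mod_cast e.hW0
  have hS := hM.S1
  have hS0 : 0 < S := by linarith
  have hWS : 0 < (W : ℝ) * S := by positivity
  set α : ℕ → ℝ := fun d => if (d : ZMod W) = u then rho p d * ArithmeticFunction.vonMangoldt d else 0 with hα
  set β : ℕ → ℝ := fun m => if (m : ZMod W) = v then rho p m else 0 with hβ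
  have ha : ∀ m, α m ≠ 0 → (∀ i, rs p m i ≠ 0) ∧ (m : ZMod W) = u := by
    intro m hm
    simp only [hα] at hm
    split_ifs at hm with h
    · exact ⟨rho_ne p (left_ne_zero_of_mul hm), h⟩
    · exact absurd rfl hm
  have hb : ∀ m, β m ≠ 0 → (∀ i, rs p m i ≠ 0) ∧ (m : ZMod W) = v := by
    intro m hm
    simp only [hβ] at hm
    split_ifs at hm with h
    · exact ⟨rho_ne p hm, h⟩
    · exact absurd rfl hm
  have hBa := Delta_bound e hM η hη hη1 u Y α ha
  have hBb := Delta_bound e hM η hη hη1 v Y β hb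
  have hrA : ∀ n, rho p n ≤ A (rs p n) := by
    intro n
    by_cases h : ∀ i, rs p n i ≠ 0
    · exact (rho_le_one p n).trans (hM.A1 _ h)
    · have : rho p n = 0 := by unfold rho; exact if_neg h
      rw [this]; exact hM.A0 _
  have sb : ∑ m ∈ Ioc y Y, gw η m * β m ^ 2 ≤ 3 / (η * (W * S)) := by
    have := A_sum e hM η hη hη1 v Y (gw η) (1 / η) (sum_gw_le' η hη y Y e.y_pos) (by field_simp; exact le_rfl) hg hg0 hgy
    have e1 : 3 * (1 / η) / (W * S) = 3 / (η * (W * S)) := by field_simp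
    rw [e1] at this
    refine le_trans (sum_le_sum fun m _ => ?_) this
    apply mul_le_mul_of_nonneg_left _ (gw_nonneg _ _)
    simp only [hβ]
    split_ifs
    · rw [rho_sq]; exact hrA m
    · simp
  have sa : ∑ m ∈ Ioc y Y, gw η m * α m ^ 2 ≤ 96 / (η ^ 3 * (W * S)) := by
    have := A_sum e hM (η / 2) hη2 (by linarith) u Y (gw (η / 2)) (1 / (η / 2)) (sum_gw_le' _ hη2 y Y e.y_pos) (by field_simp; exact le_rfl) hg' hg0' hgy'
    calc ∑ m ∈ Ioc y Y, gw η m * α m ^ 2 ≤ ∑ m ∈ Ioc y Y, 16 / η ^ 2 * (gw (η / 2) m * (if (m : ZMod W) = u then A (rs p m) else 0)) := by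
          refine sum_le_sum fun m _ => ?_
          simp only [hα]
          split_ifs
          · rw [mul_pow, rho_sq]
            have h1 : ArithmeticFunction.vonMangoldt m ^ 2 ≤ Real.log m ^ 2 :=
              pow_le_pow_left₀ ArithmeticFunction.vonMangoldt_nonneg ArithmeticFunction.vonMangoldt_le_log 2
            have h2 := log_sq_gw_le η hη m
            have h3 := rho_nonneg p m
            have h4 := hrA m
            have h5 := gw_nonneg η m
            have h6 := gw_nonneg (η / 2) m
            calc gw η m * (rho p m * ArithmeticFunction.vonMangoldt m ^ 2) ≤ gw η m * (rho p m * Real.log m ^ 2) := by gcongr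
              _ = (Real.log m ^ 2 * gw η m) * rho p m := by ring
              _ ≤ (16 / η ^ 2 * gw (η / 2) m) * A (rs p m) := by gcongr
              _ = _ := by ring
          · simp
      _ = 16 / η ^ 2 * ∑ m ∈ Ioc y Y, (gw (η / 2) m * (if (m : ZMod W) = u then A (rs p m) else 0)) := by rw [mul_sum]
      _ ≤ 16 / η ^ 2 * (3 * (1 / (η / 2)) / (W * S)) := by gcongr
      _ = _ := by field_simp; ring
  have hD0 : 0 ≤ 3 / (η * (W * S)) := by positivity
  have h := bilinear p φ (univ.filter fun χ : ∀ i, DirichletCharacter ℂ (p i) => cnd p χ ≤ R * R) (fun χ hχ => hX χ (by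
    simpa using hχ)) κ hκ0 hκ (gw η) α β y Y (fun m hm => (ha m hm).1) (fun m hm => (hb m hm).1) _ _
    (hBa.trans (mul_le_mul_of_nonneg_left sa hD0)) (hBb.trans (mul_le_mul_of_nonneg_left sb hD0))
  refine h.trans (mul_le_mul_of_nonneg_left ?_ hκ0)
  rw [Real.sqrt_le_left (by positivity), div_pow]
  rw [← mul_div_mul_comm, ← mul_div_mul_comm, ← mul_div_mul_comm, div_le_div_iff₀ (by positivity) (by positivity)]
  have h9 : 0 < η ^ 6 * (W * S) ^ 4 := by positivity
  nlinarith

lemma bil_total (e : Env p W y R) [NeZero W] {A : (∀ i, ZMod (p i)) → ℝ} {S : ℝ} (hM : Maj p W R A S) (η : ℝ) (hη : 0 < η) (hη1 : η ≤ 1)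
    (φ : (∀ i, ZMod (p i)) → ℝ) (hX : ∀ χ, R * R < cnd p χ → cch p φ χ = 0) (κ : ℝ) (hκ0 : 0 ≤ κ)
    (hκ : ∀ χ, χ ≠ 1 → ‖cch p φ χ‖ ≤ κ) (b : ZMod W) (hb : IsUnit b) (Y : ℕ) :
    |∑ d ∈ Ioc y Y, ∑ m ∈ Ioc y Y, (if ((d * m : ℕ) : ZMod W) = b then gw η (d * m) * (rho p d * ArithmeticFunction.vonMangoldt d * rho p m)
        * (φ (rs p (d * m)) - mux p φ) else 0)|
      ≤ W.totient * (κ * (60 / (η ^ 3 * (W * S) ^ 2))) := by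
  have key : ∑ d ∈ Ioc y Y, ∑ m ∈ Ioc y Y, (if ((d * m : ℕ) : ZMod W) = b then gw η (d * m) * (rho p d * ArithmeticFunction.vonMangoldt d * rho p m)
        * (φ (rs p (d * m)) - mux p φ) else 0)
      = ∑ u : (ZMod W)ˣ, ∑ d ∈ Ioc y Y, ∑ m ∈ Ioc y Y, (gw η d * (if (d : ZMod W) = (u : ZMod W) then rho p d * ArithmeticFunction.vonMangoldt d else 0))
        * (gw η m * (if (m : ZMod W) = ((u⁻¹ : (ZMod W)ˣ) : ZMod W) * b then rho p m else 0)) * (φ (rs p (d * m)) - mux p φ) := by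
    rw [sum_comm (s := (univ : Finset (ZMod W)ˣ))]
    refine sum_congr rfl fun d _ => ?_
    rw [sum_comm (s := (univ : Finset (ZMod W)ˣ))]
    refine sum_congr rfl fun m _ => ?_
    by_cases h : ((d * m : ℕ) : ZMod W) = b
    · rw [if_pos h]
      push_cast at h
      have hd : IsUnit (d : ZMod W) := by
        rw [← h] at hb; exact isUnit_of_mul_isUnit_left hb
      obtain ⟨u, hu⟩ := hd
      rw [sum_eq_single u]
      · rw [if_pos hu.symm, if_pos (by rw [← h, ← hu]; simp), gw_mul]; ring
      · intro u' _ hne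
        rw [if_neg (fun h' => hne (Units.ext (by rw [hu, h'])))]; simp
      · intro h'; exact absurd (mem_univ _) h'
    · rw [if_neg h]
      symm
      refine sum_eq_zero fun u _ => ?_
      by_cases h1 : (d : ZMod W) = u
      · by_cases h2 : (m : ZMod W) = ((u⁻¹ : (ZMod W)ˣ) : ZMod W) * b
        · exact absurd (by push_cast; rw [h1, h2]; simp) h
        · rw [if_neg h2]; simp
      · rw [if_neg h1]; simp
  rw [key]
  refine (abs_sum_le_sum_abs _ _).trans ?_
  refine (sum_le_sum fun u _ => bil_class e hM η hη hη1 φ hX κ hκ0 hκ _ _ Y).trans (le_of_eq ?_)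
  rw [sum_const, card_univ, ZMod.card_units_eq_totient, nsmul_eq_mul]

end bt
end RG


namespace RG
open Finset

/-- Bonferroni sums -/
noncomputable def Xf (m ν : ℕ) : ℝ := ∑ i ∈ range (2 * m + 1), (-1) ^ i * (ν.choose i : ℝ)
noncomputable def Tf (m ν : ℕ) : ℝ := (ν.choose (2 * m + 1) : ℝ)
noncomputable def uf (ν : ℕ) : ℝ := if ν = 0 then 1 else 0

lemma uf_nonneg (ν : ℕ) : 0 ≤ uf ν := by unfold uf; split_ifs <;> norm_num

lemma Xf_zero (m : ℕ) : Xf m 0 = 1 := by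
  unfold Xf
  rw [sum_range_succ']
  simp [Nat.choose_zero_succ]

lemma Xf_succ (m ν : ℕ) : Xf m (ν + 1) = ν.choose (2 * m) := by
  have h := Int.alternating_sum_range_choose_eq_choose (n := ν) (m := 2 * m)
  have h2 : ((∑ i ∈ range (2 * m + 1), ((-1) ^ i * ((ν + 1).choose i : ℤ)) : ℤ) : ℝ)
      = ((-1) ^ (2 * m) * (ν.choose (2 * m) : ℤ) : ℤ) := by rw [h]
  push_cast at h2
  unfold Xf
  rw [h2]
  simp

lemma uf_le_Xf (m ν : ℕ) : uf ν ≤ Xf m ν := by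
  cases ν with
  | zero => rw [Xf_zero]; simp [uf]
  | succ ν => rw [Xf_succ]; simp [uf]

lemma Xf_le (m ν : ℕ) : Xf m ν ≤ uf ν + Tf m ν := by
  cases ν with
  | zero => rw [Xf_zero]; simp [uf, Tf]
  | succ ν =>
    rw [Xf_succ]
    simp only [uf, Tf, Nat.choose_succ_succ]
    push_cast
    simp

lemma Tf_nonneg (m ν : ℕ) : 0 ≤ Tf m ν := by unfold Tf; positivity

lemma Tf_le (m ν : ℕ) : Tf m ν ≤ 4 ^ ν * (1 / 2) ^ (2 * m + 1) := by
  unfold Tf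
  rcases lt_or_ge ν (2 * m + 1) with h | h
  · rw [Nat.choose_eq_zero_of_lt h]; push_cast; positivity
  · have h1 : (ν.choose (2 * m + 1) : ℝ) ≤ 2 ^ ν := by exact_mod_cast Nat.choose_le_two_pow ν _
    have h2 : (2 : ℝ) ^ (2 * m + 1) ≤ 2 ^ ν := pow_le_pow_right₀ (by norm_num) h
    have h3 : (4 : ℝ) ^ ν = 2 ^ ν * 2 ^ ν := by rw [← mul_pow]; norm_num
    rw [h3, one_div, inv_pow, ← div_eq_mul_inv, le_div_iff₀ (by positivity)]
    exact mul_le_mul h1 h2 (by positivity) (by positivity)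

lemma prod_super {α : Type} (s : Finset α) (u X T : α → ℝ) (hu : ∀ a, 0 ≤ u a)
    (h1 : ∀ a, u a ≤ X a) (h2 : ∀ a, X a ≤ u a + T a) :
    2 * ∏ a ∈ s, X a ≤ ∏ a ∈ s, u a + ∏ a ∈ s, (X a + T a) := by
  classical
  induction s using Finset.induction_on with
  | empty => norm_num
  | insert a s ha ih =>
    rw [prod_insert ha, prod_insert ha, prod_insert ha]
    have e1 : ∏ a ∈ s, u a ≤ ∏ a ∈ s, (X a + T a) :=
      prod_le_prod (fun a _ => hu a) (fun a _ => by linarith [h1 a, h2 a])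
    have e0 : 0 ≤ ∏ a ∈ s, u a := prod_nonneg fun a _ => hu a
    have h0 : 0 ≤ X a := (hu a).trans (h1 a)
    have h3 : 0 ≤ T a := by linarith [h1 a, h2 a]
    have k1 := mul_le_mul_of_nonneg_left ih h0
    have k2 := mul_le_mul_of_nonneg_right (show X a - u a ≤ T a by linarith [h2 a]) e0
    have k3 := mul_le_mul_of_nonneg_left e1 h3
    nlinarith

section bh
variable {ι : Type} [Fintype ι] [DecidableEq ι] (p : ι → ℕ) [hp : ∀ i, Fact (p i).Prime]

/-- hypothesis on nonnegative functions -/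
def HB (f : (∀ i, ZMod (p i)) → ℝ) (C : ℝ) : Prop :=
  ∀ Z : Finset ι, ∑ x : ∀ i, ZMod (p i), (∏ i, if i ∈ Z then (if x i = 0 then 1 else 0)
    else (if x i = 0 then 0 else tt (p i))) * f x ≤ 2 ^ Z.card * C

lemma HB_FI {k : ℕ} (i : Fin k) (r : ∀ q, Fin k → ZMod (p q)) (hr : ∀ q, Function.Injective (r q))
    (hi : ∀ q, r q i = 0) (hk : ∀ q, k * tt (p q) ≤ 1) (G : (ι → Option (Fin k)) → ℝ) :
    HB p (fun x => FI i (fun q => tt (p q)) G (sv p r x) ^ 2)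
      (Zq (fun q => tt (p q)) (GI i (fun q => tt (p q)) G)) := by
  intro Z
  have := push_sum (fun q (z : ZMod (p q)) => if q ∈ Z then (if z = 0 then 1 else 0 : ℝ)
    else (if z = 0 then 0 else tt (p q))) (fun q => rst (r q))
    (fun σ => FI i (fun q => tt (p q)) G σ ^ 2)
  refine (le_of_eq this).trans ?_
  refine le_trans (le_of_eq ?_) (H1_le i (fun q => tt (p q)) (fun q => (tt_pos (p q)).le) hk G Z)
  refine sum_congr rfl fun σ _ => ?_
  congr 1
  refine prod_congr rfl fun q _ => ?_
  by_cases h : q ∈ Z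
  · simp only [h, if_true]
    exact fib_pt (r q) (hr q) i (hi q) (σ q)
  · simp only [h, if_false]
    exact fib_wi (r q) (hr q) i (hi q) (σ q)

lemma sum_ne_zero_tt (q : ℕ) [Fact q.Prime] : ∑ z : ZMod q, (if z = 0 then 0 else tt q) = 1 := by
  have h2 := two_le_q q
  have e : ∀ z : ZMod q, (if z = 0 then 0 else tt q) = tt q - (if z = 0 then tt q else 0) := by
    intro z; split_ifs <;> simp
  simp_rw [e]
  rw [sum_sub_distrib]
  simp only [sum_const, card_univ, ZMod.card, nsmul_eq_mul, sum_ite_eq', mem_univ, if_true]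
  unfold tt
  have : (q : ℝ) - 1 ≠ 0 := by linarith
  field_simp

lemma HB_one : HB p (fun _ => 1) 1 := by
  intro Z
  simp only [mul_one]
  rw [pi_sum_prod (fun i (z : ZMod (p i)) => if i ∈ Z then (if z = 0 then 1 else 0 : ℝ)
    else (if z = 0 then 0 else tt (p i)))]
  refine le_trans (prod_le_one ?_ ?_) (one_le_pow₀ (by norm_num))
  · intro i _
    refine sum_nonneg fun z _ => ?_
    have := (tt_pos (p i)).le
    split_ifs <;> simp [this]
  · intro i _
    by_cases h : i ∈ Z
    · simp [h]
    · simp only [h, if_false]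
      exact (sum_ne_zero_tt (p i)).le

/-- density of rough residues -/
noncomputable def VV : ℝ := ∏ i, (1 - (p i : ℝ)⁻¹)

lemma one_sub_pos (i : ι) : 0 < 1 - (p i : ℝ)⁻¹ := by
  have h2 := two_le_q (p i)
  have : (p i : ℝ)⁻¹ ≤ 1 / 2 := by rw [one_div]; exact inv_anti₀ (by norm_num) h2
  linarith

lemma VV_pos : 0 < VV p := prod_pos fun i _ => one_sub_pos p i

lemma inv_eq_tt (i : ι) : (p i : ℝ)⁻¹ = (1 - (p i : ℝ)⁻¹) * tt (p i) := by
  have h2 := two_le_q (p i)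
  unfold tt
  have : (p i : ℝ) - 1 ≠ 0 := by linarith
  have : (p i : ℝ) ≠ 0 := by linarith
  field_simp

lemma avx_mult (f : (∀ i, ZMod (p i)) → ℝ) (C : ℝ) (h : HB p f C) (c : ι → ℝ) (hc : ∀ i, 0 ≤ c i) :
    avx p (fun x => (∏ i, if x i = 0 then c i else 1) * f x)
      ≤ VV p * C * ∏ i, (1 + 2 * (c i * tt (p i))) := by
  unfold avx
  rw [smul_eq_mul, mul_sum]
  have e : ∀ x : ∀ i, ZMod (p i), (∏ i, (p i : ℝ)⁻¹) * ((∏ i, if x i = 0 then c i else 1) * f x)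
      = VV p * ∑ Z : Finset ι, (∏ i ∈ Z, c i * tt (p i)) *
        ((∏ i, if i ∈ Z then (if x i = 0 then 1 else 0)
          else (if x i = 0 then 0 else tt (p i))) * f x) := by
    intro x
    have e1 : (∏ i, (p i : ℝ)⁻¹) * (∏ i, if x i = 0 then c i else 1)
        = VV p * ∏ i, (c i * tt (p i) * (if x i = 0 then 1 else 0) + (if x i = 0 then 0 else tt (p i))) := by
      unfold VV
      rw [← prod_mul_distrib, ← prod_mul_distrib]
      refine prod_congr rfl fun i _ => ?_
      have := inv_eq_tt p i
      split_ifs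
      · linear_combination c i * this
      · linear_combination this
    rw [← mul_assoc, e1, prod_add, mul_assoc, sum_mul]
    congr 1
    rw [← powerset_univ]
    refine sum_congr rfl fun Z _ => ?_
    have e2 : (∏ i, if i ∈ Z then (if x i = 0 then 1 else 0)
          else (if x i = 0 then 0 else tt (p i))) = (∏ i ∈ Z, if x i = 0 then (1 : ℝ) else 0)
          * ∏ i ∈ univ \ Z, if x i = 0 then 0 else tt (p i) := by
      rw [← prod_mul_prod_compl Z]
      congr 1
      · exact prod_congr rfl fun i hi => by simp [hi]
      · rw [← compl_eq_univ_sdiff]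
        exact prod_congr rfl fun i hi => by rw [if_neg (mem_compl.1 hi)]
    rw [e2, prod_mul_distrib]
    ring
  simp_rw [e]
  rw [← mul_sum, sum_comm, mul_assoc]
  refine mul_le_mul_of_nonneg_left ?_ (VV_pos p).le
  rw [prod_one_add, mul_sum, powerset_univ]
  refine sum_le_sum fun Z _ => ?_
  rw [← mul_sum]
  have h1 : 0 ≤ ∏ i ∈ Z, c i * tt (p i) := prod_nonneg fun i _ => mul_nonneg (hc i) (tt_pos (p i)).le
  refine (mul_le_mul_of_nonneg_left (h Z) h1).trans (le_of_eq ?_)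
  rw [prod_mul_distrib (f := fun _ => (2 : ℝ)), prod_const]
  ring


variable (β : ι → ℕ)

/-- number of block primes dividing -/
def nu (x : ∀ i, ZMod (p i)) (j : ℕ) : ℕ := #{i | β i = j ∧ x i = 0}

noncomputable def aS (J B : ℕ) (x : ∀ i, ZMod (p i)) : ℝ :=
  ∏ j ∈ range J, Xf (B + (J - 1 - j)) (nu p β x j)

noncomputable def eS (J B : ℕ) (x : ∀ i, ZMod (p i)) : ℝ :=
  ∏ j ∈ range J, (Xf (B + (J - 1 - j)) (nu p β x j) + Tf (B + (J - 1 - j)) (nu p β x j)) - aS p β J B x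

open Classical in
noncomputable def rhox (x : ∀ i, ZMod (p i)) : ℝ := if ∀ i, x i ≠ 0 then 1 else 0

lemma rhox_rs (n : ℕ) : rhox p (rs p n) = rho p n := rfl

lemma rhox_nonneg (x : ∀ i, ZMod (p i)) : 0 ≤ rhox p x := by unfold rhox; split_ifs <;> norm_num

lemma rhox_eq_prod (x : ∀ i, ZMod (p i)) : rhox p x = ∏ i, if x i = 0 then 0 else 1 := by
  unfold rhox
  split_ifs with h
  · exact (prod_eq_one fun i _ => by rw [if_neg (h i)]).symm
  · push Not at h
    obtain ⟨i, hi⟩ := h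
    exact (prod_eq_zero (mem_univ i) (by rw [if_pos hi])).symm

lemma uf_nu (x : ∀ i, ZMod (p i)) (j : ℕ) :
    uf (nu p β x j) = ∏ i with β i = j, if x i = 0 then 0 else 1 := by
  unfold uf
  split_ifs with h
  · refine (prod_eq_one fun i hi => ?_).symm
    rw [if_neg]
    intro h0
    unfold nu at h
    rw [card_eq_zero] at h
    have : i ∈ ({i | β i = j ∧ x i = 0} : Finset ι) := by simp [h0, (mem_filter.1 hi).2]
    rw [h] at this
    simp at this
  · obtain ⟨i, hi⟩ := card_pos.1 (Nat.pos_of_ne_zero h)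
    rw [mem_filter] at hi
    exact (prod_eq_zero (i := i) (by simp [hi.2.1]) (by rw [if_pos hi.2.2])).symm

lemma four_nu (x : ∀ i, ZMod (p i)) (j : ℕ) :
    (4 : ℝ) ^ nu p β x j = ∏ i with β i = j, if x i = 0 then 4 else 1 := by
  unfold nu
  rw [← prod_const, ← filter_filter, prod_filter]

lemma prod_blocks (J : ℕ) (hβ : ∀ i, β i < J) (f : ι → ℝ) :
    ∏ i, f i = ∏ j ∈ range J, ∏ i with β i = j, f i :=
  (prod_fiberwise_of_maps_to (fun i _ => mem_range.2 (hβ i)) _).symm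

lemma rhox_blocks (J : ℕ) (hβ : ∀ i, β i < J) (x : ∀ i, ZMod (p i)) :
    rhox p x = ∏ j ∈ range J, uf (nu p β x j) := by
  rw [rhox_eq_prod, prod_blocks β J hβ]
  exact prod_congr rfl fun j _ => (uf_nu p β x j).symm

lemma rhox_le_aS (J B : ℕ) (hβ : ∀ i, β i < J) (x : ∀ i, ZMod (p i)) :
    rhox p x ≤ aS p β J B x := by
  rw [rhox_blocks p β J hβ]
  exact prod_le_prod (fun j _ => uf_nonneg _) fun j _ => uf_le_Xf _ _

lemma aS_sub_le (J B : ℕ) (hβ : ∀ i, β i < J) (x : ∀ i, ZMod (p i)) :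
    aS p β J B x - eS p β J B x ≤ rhox p x := by
  rw [rhox_blocks p β J hβ]
  have := prod_super (range J) (fun j => uf (nu p β x j)) (fun j => Xf (B + (J - 1 - j)) (nu p β x j))
    (fun j => Tf (B + (J - 1 - j)) (nu p β x j)) (fun _ => uf_nonneg _) (fun _ => uf_le_Xf _ _)
    (fun _ => Xf_le _ _)
  unfold eS aS
  linarith

lemma eS_le (J B : ℕ) (hβ : ∀ i, β i < J) (x : ∀ i, ZMod (p i)) :
    eS p β J B x ≤ ∏ j ∈ range J, ((1 / 4 : ℝ) ^ (B + (J - 1 - j)) * 4 ^ nu p β x j + uf (nu p β x j))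
      - rhox p x := by
  have h := rhox_le_aS p β J B hβ x
  have h2 : ∏ j ∈ range J, (Xf (B + (J - 1 - j)) (nu p β x j) + Tf (B + (J - 1 - j)) (nu p β x j))
      ≤ ∏ j ∈ range J, ((1 / 4 : ℝ) ^ (B + (J - 1 - j)) * 4 ^ nu p β x j + uf (nu p β x j)) := by
    refine prod_le_prod (fun j _ => ?_) fun j _ => ?_
    · have := (uf_nonneg (nu p β x j)).trans (uf_le_Xf (B + (J - 1 - j)) (nu p β x j))
      have := Tf_nonneg (B + (J - 1 - j)) (nu p β x j)
      linarith
    · have h1 := Xf_le (B + (J - 1 - j)) (nu p β x j)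
      have h2 := Tf_le (B + (J - 1 - j)) (nu p β x j)
      have h3 : (1 / 2 : ℝ) ^ (2 * (B + (J - 1 - j)) + 1) = (1 / 4 : ℝ) ^ (B + (J - 1 - j)) * (1 / 2) := by
        rw [pow_succ, pow_mul]; norm_num
      rw [h3] at h2
      linarith
  unfold eS
  linarith

lemma avx_mono (f g : (∀ i, ZMod (p i)) → ℝ) (h : ∀ x, f x ≤ g x) : avx p f ≤ avx p g := by
  unfold avx
  rw [smul_eq_mul, smul_eq_mul]
  exact mul_le_mul_of_nonneg_left (sum_le_sum fun x _ => h x) (prod_nonneg fun i _ => by positivity)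

lemma avx_sum {α : Type} (s : Finset α) (f : α → (∀ i, ZMod (p i)) → ℝ) :
    avx p (fun x => ∑ a ∈ s, f a x) = ∑ a ∈ s, avx p (f a) := by
  unfold avx
  rw [sum_comm, smul_sum]

lemma avx_smul (c : ℝ) (f : (∀ i, ZMod (p i)) → ℝ) : avx p (fun x => c * f x) = c * avx p f := by
  unfold avx
  simp only [smul_eq_mul]
  rw [← mul_sum]; ring

lemma avx_sub (f g : (∀ i, ZMod (p i)) → ℝ) : avx p (fun x => f x - g x) = avx p f - avx p g := by
  unfold avx
  rw [sum_sub_distrib, smul_sub]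

lemma avx_rhox (f : (∀ i, ZMod (p i)) → ℝ) : avx p (fun x => rhox p x * f x) = VV p * mux p f := by
  unfold avx mux VV
  rw [smul_eq_mul, mul_sum, mul_sum]
  refine sum_congr rfl fun x _ => ?_
  rw [rhox_eq_prod, ← mul_assoc, ← prod_mul_distrib, ← mul_assoc, ← prod_mul_distrib]
  congr 1
  refine prod_congr rfl fun i _ => ?_
  split_ifs
  · simp
  · rw [mul_one]; exact inv_eq_tt p i

lemma avx_eS (J B : ℕ) (hβ : ∀ i, β i < J) (hbl : ∀ j, ∑ i with β i = j, tt (p i) ≤ 8)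
    (f : (∀ i, ZMod (p i)) → ℝ) (C : ℝ) (hC : 0 ≤ C) (hf : ∀ x, 0 ≤ f x) (h : HB p f C) :
    avx p (fun x => eS p β J B x * f x)
      ≤ VV p * C * (∏ j ∈ range J, (1 + (1 / 4 : ℝ) ^ (B + (J - 1 - j)) * Real.exp 64) - 1) := by
  set c : ℕ → ℝ := fun j => (1 / 4 : ℝ) ^ (B + (J - 1 - j)) with hc
  have hc0 : ∀ j, 0 ≤ c j := fun j => by positivity
  have e : ∀ x, (∏ j ∈ range J, (c j * 4 ^ nu p β x j + uf (nu p β x j)) - rhox p x) * f x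
      = ∑ U ∈ (range J).powerset.erase ∅, (∏ j ∈ U, c j) *
        ((∏ i, if x i = 0 then (if β i ∈ U then 4 else 0) else 1) * f x) := by
    intro x
    rw [prod_add, ← add_sum_erase _ _ (empty_mem_powerset (range J))]
    simp only [prod_empty, sdiff_empty, one_mul]
    rw [← rhox_blocks p β J hβ, add_sub_cancel_left, sum_mul]
    refine sum_congr rfl fun U hU => ?_
    have hU' := mem_powerset.1 (mem_of_mem_erase hU)
    rw [prod_mul_distrib, ← mul_assoc, mul_assoc (∏ j ∈ U, c j)]
    congr 2
    rw [prod_blocks β J hβ, ← prod_sdiff hU', mul_comm]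
    congr 1
    · refine prod_congr rfl fun j hj => ?_
      rw [uf_nu]
      refine prod_congr rfl fun i hi => ?_
      rw [(mem_filter.1 hi).2, if_neg (mem_sdiff.1 hj).2]
    · refine prod_congr rfl fun j hj => ?_
      rw [four_nu]
      refine prod_congr rfl fun i hi => ?_
      rw [(mem_filter.1 hi).2, if_pos hj]
  refine (avx_mono p _ _ fun x =>
    (mul_le_mul_of_nonneg_right (eS_le p β J B hβ x) (hf x)).trans (le_of_eq (e x))).trans ?_
  rw [avx_sum]
  have e2 : ∏ j ∈ range J, (1 + c j * Real.exp 64) - 1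
      = ∑ U ∈ (range J).powerset.erase ∅, (∏ j ∈ U, c j) * ∏ j ∈ U, Real.exp 64 := by
    rw [prod_one_add, ← add_sum_erase _ _ (empty_mem_powerset (range J))]
    simp only [prod_empty, prod_mul_distrib]
    ring
  rw [e2, mul_sum]
  refine sum_le_sum fun U hU => ?_
  have hU' := mem_powerset.1 (mem_of_mem_erase hU)
  rw [avx_smul, mul_left_comm]
  refine mul_le_mul_of_nonneg_left ?_ (prod_nonneg fun j _ => hc0 j)
  refine (avx_mult p f C h (fun i => if β i ∈ U then 4 else 0) (fun i => by split_ifs <;> norm_num)).trans ?_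
  refine mul_le_mul_of_nonneg_left ?_ (mul_nonneg (VV_pos p).le hC)
  rw [prod_blocks β J hβ, ← prod_sdiff hU']
  have hA : ∏ j ∈ range J \ U, ∏ i with β i = j, (1 + 2 * ((if β i ∈ U then 4 else 0) * tt (p i))) = 1 := by
    refine prod_eq_one fun j hj => prod_eq_one fun i hi => ?_
    rw [(mem_filter.1 hi).2, if_neg (mem_sdiff.1 hj).2]; ring
  rw [hA, one_mul]
  refine prod_le_prod (fun j _ => prod_nonneg fun i _ => ?_) fun j hj => ?_
  · have := (tt_pos (p i)).le
    split_ifs <;> positivity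
  · calc ∏ i with β i = j, (1 + 2 * ((if β i ∈ U then 4 else 0) * tt (p i)))
        ≤ ∏ i with β i = j, Real.exp (8 * tt (p i)) := by
          refine prod_le_prod (fun i _ => ?_) fun i hi => ?_
          · have := (tt_pos (p i)).le
            split_ifs <;> positivity
          · rw [(mem_filter.1 hi).2, if_pos hj]
            have := Real.add_one_le_exp (8 * tt (p i))
            linarith
      _ = Real.exp (8 * ∑ i with β i = j, tt (p i)) := by rw [← Real.exp_sum, mul_sum]
      _ ≤ Real.exp 64 := Real.exp_le_exp.2 (by linarith [hbl j])

/-- main sieve term inequality -/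
lemma bh_main (J B : ℕ) (hβ : ∀ i, β i < J) (hbl : ∀ j, ∑ i with β i = j, tt (p i) ≤ 8)
    (f : (∀ i, ZMod (p i)) → ℝ) (C : ℝ) (hC : 0 ≤ C) (hf : ∀ x, 0 ≤ f x) (h : HB p f C)
    (ε : ℝ) (hε : ∏ j ∈ range J, (1 + (1 / 4 : ℝ) ^ (B + (J - 1 - j)) * Real.exp 64) - 1 ≤ ε)
    (hε0 : 0 ≤ ε) (hμ0 : 0 ≤ mux p f) (hμ : mux p f ≤ C) :
    -(2 * ε * VV p * C) ≤ avx p (fun x => (aS p β J B x - eS p β J B x) * f x - mux p f * aS p β J B x) := by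
  have hV := (VV_pos p).le
  have h1 := avx_eS p β J B hβ hbl f C hC hf h
  have h2 := avx_eS p β J B hβ hbl (fun _ => 1) 1 zero_le_one (fun _ => zero_le_one) (HB_one p)
  have h3 : avx p (fun x => rhox p x * f x) ≤ avx p (fun x => aS p β J B x * f x) :=
    avx_mono p _ _ fun x => mul_le_mul_of_nonneg_right (rhox_le_aS p β J B hβ x) (hf x)
  have h4 : avx p (fun x => aS p β J B x) - avx p (fun x => eS p β J B x * 1) ≤ avx p (fun x => rhox p x * 1) := by
    rw [← avx_sub]
    exact avx_mono p _ _ fun x => by simpa using aS_sub_le p β J B hβ x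
  have h5 : mux p (fun _ => 1) = 1 := by
    unfold mux
    simp only [mul_one]
    rw [pi_sum_prod (fun i (z : ZMod (p i)) => if z = 0 then 0 else tt (p i))]
    exact prod_eq_one fun i _ => sum_ne_zero_tt (p i)
  rw [avx_rhox] at h3 h4
  rw [h5] at h4
  have e1 := avx_sub p (fun x => (aS p β J B x - eS p β J B x) * f x) (fun x => mux p f * aS p β J B x)
  have e2 := avx_sub p (fun x => aS p β J B x * f x) (fun x => eS p β J B x * f x)
  have e3 := avx_smul p (mux p f) (fun x => aS p β J B x)
  have e4 : (fun x => (aS p β J B x - eS p β J B x) * f x)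
      = fun x => aS p β J B x * f x - eS p β J B x * f x := by funext x; ring
  rw [e4, e2, e3] at e1
  rw [e1]
  have k1 := mul_le_mul_of_nonneg_left hε (mul_nonneg hV hC)
  have k2 := mul_le_mul_of_nonneg_left hε (mul_nonneg hV (zero_le_one (α := ℝ)))
  have k3 : avx p (fun x => aS p β J B x) ≤ VV p * (1 + ε) := by linarith
  have k4 := mul_le_mul_of_nonneg_left k3 hμ0
  have k5 := mul_le_mul_of_nonneg_left hμ (mul_nonneg hV hε0)
  linarith

end bh
end RG


namespace RG
open Finset

lemma eps_bound (B J : ℕ) (δ : ℝ) (hδ : 2 * ((1 / 4 : ℝ) ^ B * Real.exp 64) ≤ δ) (hδ1 : δ ≤ 1) :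
    ∏ j ∈ range J, (1 + (1 / 4 : ℝ) ^ (B + (J - 1 - j)) * Real.exp 64) - 1 ≤ 2 * δ := by
  have h1 : ∏ j ∈ range J, (1 + (1 / 4 : ℝ) ^ (B + (J - 1 - j)) * Real.exp 64)
      ≤ ∏ j ∈ range J, Real.exp ((1 / 4 : ℝ) ^ (B + (J - 1 - j)) * Real.exp 64) :=
    prod_le_prod (fun j _ => by positivity) fun j _ => by
      have := Real.add_one_le_exp ((1 / 4 : ℝ) ^ (B + (J - 1 - j)) * Real.exp 64)
      linarith
  rw [← Real.exp_sum] at h1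
  have h2 : ∑ j ∈ range J, (1 / 4 : ℝ) ^ (B + (J - 1 - j)) * Real.exp 64 ≤ δ := by
    rw [sum_range_reflect (fun j => (1 / 4 : ℝ) ^ (B + j) * Real.exp 64) J]
    simp_rw [pow_add]
    rw [← sum_mul, ← mul_sum]
    have h3 : ∑ j ∈ range J, (1 / 4 : ℝ) ^ j ≤ 2 := by
      rw [geom_sum_eq (by norm_num)]
      have : (0 : ℝ) ≤ (1 / 4) ^ J := by positivity
      rw [div_le_iff_of_neg (by norm_num)]
      linarith
    have : 0 ≤ (1 / 4 : ℝ) ^ B * Real.exp 64 := by positivity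
    have := mul_le_mul_of_nonneg_left h3 this
    linarith
  have hδ0 : 0 ≤ δ := le_trans (by positivity) hδ
  have h4 := Real.exp_le_exp.2 h2
  have h5 := Real.abs_exp_sub_one_le (x := δ) (by rw [abs_of_nonneg hδ0]; exact hδ1)
  rw [abs_of_nonneg hδ0] at h5
  have := le_abs_self (Real.exp δ - 1)
  linarith

lemma exists_block (q J : ℕ) (hq : 2 < q) (hJ : q ≤ 2 ^ 2 ^ J) :
    ∃ j, j < J ∧ 2 ^ 2 ^ j < q ∧ q ≤ 2 ^ 2 ^ (j + 1) := by
  have h1 : 1 ≤ Nat.log 2 (q - 1) := by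
    exact Nat.log_pos (by norm_num) (by omega)
  refine ⟨Nat.log 2 (Nat.log 2 (q - 1)), ?_, ?_, ?_⟩
  · have a1 := Nat.pow_log_le_self 2 (x := Nat.log 2 (q - 1)) (by omega)
    have a2 := Nat.pow_log_le_self 2 (x := q - 1) (by omega)
    have a3 : 2 ^ Nat.log 2 (q - 1) < 2 ^ 2 ^ J := by omega
    have a4 := (Nat.pow_lt_pow_iff_right (by norm_num)).1 a3
    exact (Nat.pow_lt_pow_iff_right (by norm_num)).1 (lt_of_le_of_lt a1 a4)
  · have a1 := Nat.pow_log_le_self 2 (x := Nat.log 2 (q - 1)) (by omega)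
    have a2 := Nat.pow_log_le_self 2 (x := q - 1) (by omega)
    have := Nat.pow_le_pow_right (n := 2) (by norm_num) a1
    omega
  · have a1 := Nat.lt_pow_succ_log_self (b := 2) (by norm_num) (Nat.log 2 (q - 1))
    have a2 := Nat.lt_pow_succ_log_self (b := 2) (by norm_num) (q - 1)
    have := Nat.pow_le_pow_right (n := 2) (by norm_num) (Nat.succ_le_of_lt a1)
    simp only [Nat.succ_eq_add_one] at *
    omega

lemma exp_sum (B J : ℕ) : ∑ j ∈ range J, 2 ^ (j + 1) * (4 * (B + (J - 1 - j)) + 3) ≤ 2 ^ J * (8 * B + 14) := by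
  induction J with
  | zero => simp
  | succ J ih =>
    rw [sum_range_succ]
    have e : ∑ j ∈ range J, 2 ^ (j + 1) * (4 * (B + (J + 1 - 1 - j)) + 3)
        = ∑ j ∈ range J, 2 ^ (j + 1) * (4 * (B + (J - 1 - j)) + 3) + 8 * ∑ j ∈ range J, 2 ^ j := by
      rw [mul_sum, ← sum_add_distrib]
      refine sum_congr rfl fun j hj => ?_
      have := mem_range.1 hj
      rw [show J + 1 - 1 - j = (J - 1 - j) + 1 by omega]
      ring
    rw [e]
    have h2 : ∑ j ∈ range J, 2 ^ j ≤ 2 ^ J := by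
      have := Nat.geomSum_lt (m := 2) (n := J) (s := range J) (by norm_num) (fun k hk => mem_range.1 hk)
      exact this.le
    rw [show J + 1 - 1 - J = 0 by omega, pow_succ]
    nlinarith

section bh
variable {ι : Type} [Fintype ι] [DecidableEq ι] (p : ι → ℕ) [hp : ∀ i, Fact (p i).Prime] (β : ι → ℕ)

lemma choose_nu (x : ∀ i, ZMod (p i)) (j i : ℕ) : ((nu p β x j).choose i : ℝ)
    = ∑ S ∈ powersetCard i ({a | β a = j} : Finset ι), if ∀ a ∈ S, x a = 0 then 1 else 0 := by
  unfold nu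
  rw [← card_powersetCard, sum_boole]
  congr 2
  ext S
  simp only [mem_powersetCard, mem_filter, subset_iff, mem_univ, true_and]
  constructor
  · rintro ⟨h1, h2⟩; exact ⟨⟨fun a ha => (h1 ha).1, h2⟩, fun a ha => (h1 ha).2⟩
  · rintro ⟨⟨h1, h2⟩, h3⟩; exact ⟨fun a ha => ⟨h1 ha, h3 a ha⟩, h2⟩

lemma choose_TI (N : ℕ) (hN : (∏ i, p i) ∣ N) (Y : ℕ) (j i : ℕ) (hY : ∀ a, β a = j → p a ≤ Y)
    (hc : #({a | β a = j} : Finset ι) ≤ Y) :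
    TI N ((Y : ℝ) ^ (2 * i)) (fun n => ((nu p β (rs p n) j).choose i : ℝ)) := by
  simp_rw [choose_nu]
  refine TI.mono _ _ _ ?_ (TI.sum _ (fun S => 1 * ((∏ a ∈ S, p a : ℕ) : ℝ)) _ fun S hS =>
    TI.base (∏ a ∈ S, p a) 1 _ ?_ ?_ ?_ ?_)
  · calc ∑ S ∈ powersetCard i ({a | β a = j} : Finset ι), 1 * ((∏ a ∈ S, p a : ℕ) : ℝ)
        ≤ ∑ S ∈ powersetCard i ({a | β a = j} : Finset ι), (Y : ℝ) ^ i := by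
          refine sum_le_sum fun S hS => ?_
          rw [mem_powersetCard] at hS
          rw [one_mul, ← hS.2]
          have : ∏ a ∈ S, p a ≤ Y ^ #S := prod_le_pow_card S _ _ fun a ha => hY a (by simpa using hS.1 ha)
          exact_mod_cast this
      _ = (#({a | β a = j} : Finset ι)).choose i * (Y : ℝ) ^ i := by
          rw [sum_const, card_powersetCard, nsmul_eq_mul]
      _ ≤ (Y : ℝ) ^ i * (Y : ℝ) ^ i := by
          refine mul_le_mul_of_nonneg_right ?_ (by positivity)
          have : (#({a | β a = j} : Finset ι)).choose i ≤ Y ^ i :=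
            (Nat.choose_le_pow _ _).trans (Nat.pow_le_pow_left hc i)
          exact_mod_cast this
      _ = (Y : ℝ) ^ (2 * i) := by rw [two_mul, pow_add]
  · exact (prod_dvd_prod_of_subset S univ _ (subset_univ S)).trans hN
  · exact prod_pos fun a _ => (hp a).out.pos
  · intro n; split_ifs <;> simp
  · intro n
    have : ∀ a ∈ S, rs p (n + ∏ a ∈ S, p a) a = rs p n a := by
      intro a ha
      unfold rs
      push_cast
      rw [← Nat.cast_prod, (ZMod.natCast_eq_zero_iff _ _).2 (dvd_prod_of_mem p ha), add_zero]
    congr 1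
    exact propext ⟨fun h a ha => by rw [← this a ha]; exact h a ha, fun h a ha => by rw [this a ha]; exact h a ha⟩

lemma XT_TI (N : ℕ) (hN : (∏ i, p i) ∣ N) (Y : ℕ) (j m : ℕ) (hY2 : 2 ≤ Y) (hY : ∀ a, β a = j → p a ≤ Y)
    (hc : #({a | β a = j} : Finset ι) ≤ Y) :
    TI N ((Y : ℝ) ^ (4 * m + 3)) (fun n => Xf m (nu p β (rs p n) j)) ∧
    TI N ((Y : ℝ) ^ (4 * m + 3)) (fun n => Xf m (nu p β (rs p n) j) + Tf m (nu p β (rs p n) j)) := by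
  have hY' : (2 : ℝ) ≤ Y := by exact_mod_cast hY2
  have h1 : TI N (∑ i ∈ range (2 * m + 1), (Y : ℝ) ^ (2 * i)) (fun n => Xf m (nu p β (rs p n) j)) := by
    unfold Xf
    refine TI.sum _ _ _ fun i _ => ?_
    have := TI.base_mul (N := N) (q := 1) (B := 1) (Φ := fun _ => ((-1 : ℝ)) ^ i) (one_dvd _) one_pos
      (fun n => by simp) (fun n => rfl) (choose_TI p β N hN Y j i hY hc)
    simpa using this
  have h2 : TI N ((Y : ℝ) ^ (2 * (2 * m + 1))) (fun n => Tf m (nu p β (rs p n) j)) :=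
    choose_TI p β N hN Y j _ hY hc
  have h3 := TI.add _ _ _ _ h1 h2
  have h4 : ∀ l : ℕ, ∑ i ∈ range (l + 1), (Y : ℝ) ^ (2 * i) ≤ Y ^ (2 * l + 1) := by
    intro l
    induction l with
    | zero => simp; linarith
    | succ l ih =>
      rw [sum_range_succ]
      have a1 : (Y : ℝ) ^ (2 * l + 1) ≤ Y ^ (2 * (l + 1)) := pow_le_pow_right₀ (by linarith) (by omega)
      have a2 : (Y : ℝ) ^ (2 * (l + 1) + 1) = Y ^ (2 * (l + 1)) * Y := pow_succ _ _
      have a3 : (0 : ℝ) ≤ Y ^ (2 * (l + 1)) := by positivity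
      nlinarith
  have h5 := h4 (2 * m + 1)
  refine ⟨TI.mono _ _ _ ?_ h1, TI.mono _ _ _ ?_ h3⟩
  · refine (h4 (2 * m)).trans (pow_le_pow_right₀ (by linarith) (by omega))
  · rw [← sum_range_succ (fun i => (Y : ℝ) ^ (2 * i))]
    refine h5.trans (pow_le_pow_right₀ (by linarith) (by omega))

lemma aS_TI (N : ℕ) (hN : (∏ i, p i) ∣ N) (hinj : Function.Injective p) (J B : ℕ)
    (hβ : ∀ i, p i ≤ 2 ^ 2 ^ (β i + 1)) :
    TI N (((2 ^ 2 ^ J : ℕ) : ℝ) ^ (8 * B + 14)) (fun n => aS p β J B (rs p n)) ∧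
    TI N (((2 ^ 2 ^ J : ℕ) : ℝ) ^ (8 * B + 14)) (fun n => aS p β J B (rs p n) + eS p β J B (rs p n)) := by
  have hj : ∀ j, #({a | β a = j} : Finset ι) ≤ 2 ^ 2 ^ (j + 1) := by
    intro j
    have : (({a | β a = j} : Finset ι).image p) ⊆ Icc 1 (2 ^ 2 ^ (j + 1)) := by
      intro q hq
      rw [mem_image] at hq
      obtain ⟨a, ha, rfl⟩ := hq
      have h2 := hβ a
      rw [(mem_filter.1 ha).2] at h2
      exact mem_Icc.2 ⟨(hp a).out.one_lt.le, h2⟩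
    have h3 := card_le_card this
    rw [card_image_of_injective _ hinj, Nat.card_Icc] at h3
    simpa using h3
  have key := fun j => XT_TI p β N hN (2 ^ 2 ^ (j + 1)) j (B + (J - 1 - j))
    (by calc 2 = 2 ^ 1 := by norm_num
          _ ≤ _ := Nat.pow_le_pow_right (by norm_num) Nat.one_le_two_pow) (fun a ha => ha ▸ hβ a) (hj j)
  have hK : ∏ j ∈ range J, (((2 ^ 2 ^ (j + 1) : ℕ) : ℝ)) ^ (4 * (B + (J - 1 - j)) + 3)
      ≤ ((2 ^ 2 ^ J : ℕ) : ℝ) ^ (8 * B + 14) := by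
    push_cast
    simp_rw [← pow_mul]
    rw [prod_pow_eq_pow_sum]
    exact pow_le_pow_right₀ (by norm_num) (exp_sum B J)
  constructor
  · exact TI.mono _ _ _ hK (TI.prod _ _ _ fun j _ => (key j).1)
  · have := TI.mono _ _ _ hK (TI.prod (range J) _ _ fun j _ => (key j).2)
    simpa [eS] using this

end bh
end RG


namespace RG
open Finset

section asm
variable {ι : Type} [Fintype ι] [DecidableEq ι] (p : ι → ℕ) [hp : ∀ i, Fact (p i).Prime]

local notation "Λv" => ArithmeticFunction.vonMangoldt

/-- bilinear coefficient -/
noncomputable def Tdm (x : ℕ × ℕ) : ℝ := rho p x.1 * Λv x.1 * rho p x.2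

lemma Tdm_nonneg (x : ℕ × ℕ) : 0 ≤ Tdm p x :=
  mul_nonneg (mul_nonneg (rho_nonneg p _) ArithmeticFunction.vonMangoldt_nonneg) (rho_nonneg p _)

noncomputable def TII (y n : ℕ) : ℝ :=
  ∑ x ∈ n.divisorsAntidiagonal, if y < x.1 ∧ y < x.2 then Tdm p x else 0

lemma TII_nonneg (y n : ℕ) : 0 ≤ TII p y n :=
  sum_nonneg fun x _ => by split_ifs <;> simp [Tdm_nonneg]

variable {p} {W y R : ℕ}

lemma rho_log (e : Env p W y R) (n : ℕ) (hn : 1 < n) (hu : IsUnit (n : ZMod W)) :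
    rho p n * Real.log n = rho p n * Λv n + TII p y n := by
  have h1 : Real.log n = ∑ x ∈ n.divisorsAntidiagonal, Λv x.1 := by
    rw [← ArithmeticFunction.vonMangoldt_sum]
    exact (Nat.sum_divisorsAntidiagonal (fun d _ => Λv d)).symm
  have h2 : rho p n * Λv n = ∑ x ∈ n.divisorsAntidiagonal, if x.2 = 1 then rho p n * Λv n else 0 := by
    rw [sum_eq_single (n, 1)]
    · simp
    · intro x hx hne
      rw [if_neg]
      intro h
      apply hne
      have := (Nat.mem_divisorsAntidiagonal.1 hx).1
      rw [h, mul_one] at this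
      exact Prod.ext this h
    · intro h
      exact absurd (Nat.mem_divisorsAntidiagonal.2 ⟨by simp, by omega⟩) h
  rw [h1, h2, TII, mul_sum, ← sum_add_distrib]
  refine sum_congr rfl fun x hx => ?_
  obtain ⟨hx1, hx0⟩ := Nat.mem_divisorsAntidiagonal.1 hx
  have hy := e.y_pos
  rcases eq_or_ne x.2 1 with h | h
  · rw [if_pos h, if_neg (by omega)]
    rw [h, mul_one] at hx1
    rw [hx1, add_zero]
  · rw [if_neg h, zero_add]
    unfold Tdm
    rw [← hx1, rho_mul]
    rcases eq_or_ne x.1 1 with h' | h'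
    · rw [h']; simp
    · by_cases hr : rho p x.1 * rho p x.2 = 0
      · rw [hr, zero_mul]
        split_ifs
        · rw [mul_right_comm, hr, zero_mul]
        · rfl
      · have hr1 := left_ne_zero_of_mul hr
        have hr2 := right_ne_zero_of_mul hr
        rw [← hx1, Nat.cast_mul, IsUnit.mul_iff] at hu
        have hp1 : 0 < x.1 := Nat.pos_of_ne_zero fun h => hx0 (by rw [← hx1, h, zero_mul])
        have hp2 : 0 < x.2 := Nat.pos_of_ne_zero fun h => hx0 (by rw [← hx1, h, mul_zero])
        rw [if_pos ⟨e.rough_gt _ (by omega) hr1 hu.1, e.rough_gt _ (by omega) hr2 hu.2⟩]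
        ring

lemma pair_sum (hy : 1 ≤ y) (N : ℕ) (F : ℕ × ℕ → ℝ) :
    ∑ n ∈ Ioc y N, ∑ x ∈ n.divisorsAntidiagonal, (if y < x.1 ∧ y < x.2 then F x else 0)
      = ∑ x ∈ Ioc y N ×ˢ Ioc y N, if x.1 * x.2 ≤ N then F x else 0 := by
  rw [← sum_filter, ← sum_fiberwise_of_maps_to (s := (Ioc y N ×ˢ Ioc y N).filter fun x => x.1 * x.2 ≤ N)
    (t := Ioc y N) (g := fun x => x.1 * x.2)]
  · refine sum_congr rfl fun n hn => ?_
    rw [← sum_filter]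
    refine sum_congr ?_ fun _ _ => rfl
    ext x
    simp only [mem_filter, Nat.mem_divisorsAntidiagonal, mem_product, mem_Ioc] at hn ⊢
    constructor
    · rintro ⟨⟨h1, h0⟩, h2, h3⟩
      have a1 : x.1 ≤ x.1 * x.2 := Nat.le_mul_of_pos_right _ (by omega)
      have a2 : x.2 ≤ x.1 * x.2 := Nat.le_mul_of_pos_left _ (by omega)
      refine ⟨⟨⟨⟨h2, by omega⟩, h3, by omega⟩, by omega⟩, h1⟩
    · rintro ⟨⟨⟨⟨h1, _⟩, h2, _⟩, h3⟩, h4⟩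
      exact ⟨⟨h4, by omega⟩, h1, h2⟩
  · intro x hx
    simp only [mem_filter, mem_product, mem_Ioc] at hx
    have a1 : x.1 ≤ x.1 * x.2 := Nat.le_mul_of_pos_right _ (by omega)
    exact mem_Ioc.2 ⟨by omega, hx.2⟩

lemma TII_sum (hy : 1 ≤ y) (N : ℕ) (h : ℕ → ℝ) :
    ∑ n ∈ Ioc y N, TII p y n * h n = ∑ x ∈ Ioc y N ×ˢ Ioc y N,
      if x.1 * x.2 ≤ N then Tdm p x * h (x.1 * x.2) else 0 := by
  rw [← pair_sum hy N (fun x => Tdm p x * h (x.1 * x.2))]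
  refine sum_congr rfl fun n _ => ?_
  unfold TII
  rw [sum_mul]
  refine sum_congr rfl fun x hx => ?_
  rw [(Nat.mem_divisorsAntidiagonal.1 hx).1]
  split_ifs <;> simp

lemma TII_le (hy : 1 ≤ y) (N : ℕ) (h : ℕ → ℝ) (h0 : ∀ n, 0 ≤ h n) :
    ∑ n ∈ Ioc y N, TII p y n * h n ≤ ∑ x ∈ Ioc y N ×ˢ Ioc y N, Tdm p x * h (x.1 * x.2) := by
  rw [TII_sum hy]
  refine sum_le_sum fun x _ => ?_
  split_ifs
  · exact le_rfl
  · exact mul_nonneg (Tdm_nonneg p x) (h0 _)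

lemma le_TII (hy : 1 ≤ y) (N : ℕ) (h : ℕ → ℝ) (h0 : ∀ n, 0 ≤ h n) :
    ∑ x ∈ Ioc y N ×ˢ Ioc y N, Tdm p x * h (x.1 * x.2) ≤ ∑ n ∈ Ioc y (N ^ 2), TII p y n * h n := by
  rw [TII_sum hy]
  rcases Nat.lt_or_ge N 1 with hN | hN
  · rw [Ioc_eq_empty (by omega)]
    simp only [empty_product, sum_empty]
    exact sum_nonneg fun x _ => by split_ifs <;> simp [mul_nonneg (Tdm_nonneg p x) (h0 _)]
  have hNN : N ≤ N ^ 2 := Nat.le_self_pow (by norm_num) N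
  have hs : Ioc y N ×ˢ Ioc y N ⊆ Ioc y (N ^ 2) ×ˢ Ioc y (N ^ 2) :=
    product_subset_product (Ioc_subset_Ioc_right hNN) (Ioc_subset_Ioc_right hNN)
  calc ∑ x ∈ Ioc y N ×ˢ Ioc y N, Tdm p x * h (x.1 * x.2)
      = ∑ x ∈ Ioc y N ×ˢ Ioc y N, if x.1 * x.2 ≤ N ^ 2 then Tdm p x * h (x.1 * x.2) else 0 := by
        refine sum_congr rfl fun x hx => ?_
        simp only [mem_product, mem_Ioc] at hx
        rw [if_pos]
        rw [pow_two]
        exact Nat.mul_le_mul hx.1.2 hx.2.2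
    _ ≤ _ := sum_le_sum_of_subset_of_nonneg hs fun x _ _ => by
        split_ifs <;> simp [mul_nonneg (Tdm_nonneg p x) (h0 _)]

/-- combination of the pieces -/
lemma asm (e : Env p W y R) (η : ℝ) (b : ZMod W) (hb : IsUnit b) (f : (∀ i, ZMod (p i)) → ℝ)
    (hf : ∀ x, 0 ≤ f x) (μ : ℝ) (hμ : 0 ≤ μ) (x0 X : ℕ) (hyx : y ≤ x0) (hxX : x0 ≤ X) (e1 e2 e3 : ℝ)
    (h1 : |∑ d ∈ Ioc y X, ∑ m ∈ Ioc y X, (if ((d * m : ℕ) : ZMod W) = b then gw η (d * m) *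
      (rho p d * Λv d * rho p m) * (f (rs p (d * m)) - μ) else 0)| ≤ e1)
    (h2 : μ * (∑ n ∈ Ioc x0 X, rho p n * Real.log n * (if (n : ZMod W) = b then gw η n else 0)) - e2
      ≤ ∑ n ∈ Ioc x0 X, rho p n * Real.log n * (if (n : ZMod W) = b then f (rs p n) * gw η n else 0))
    (h3 : ∑ n ∈ Ioc y x0, rho p n * Real.log n * (if (n : ZMod W) = b then gw η n else 0) ≤ e3) :
    μ * (∑ n ∈ Ioc y X, rho p n * Λv n * (if (n : ZMod W) = b then gw η n else 0)) - e1 - e2 - μ * e3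
      - μ * ∑ n ∈ Ioc X (X ^ 2), Real.log n * gw η n
      ≤ ∑ n ∈ Ioc y X, rho p n * Λv n * (if (n : ZMod W) = b then f (rs p n) * gw η n else 0) := by
  have hy := e.y_pos
  have hX2 : X ≤ X ^ 2 := Nat.le_self_pow (by norm_num) X
  set g : ℕ → ℝ := fun n => if (n : ZMod W) = b then gw η n else 0 with hg
  set gf : ℕ → ℝ := fun n => if (n : ZMod W) = b then f (rs p n) * gw η n else 0 with hgf
  have hg0 : ∀ n, 0 ≤ g n := fun n => by rw [hg]; dsimp only; split_ifs <;> simp [gw_nonneg]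
  have hgf0 : ∀ n, 0 ≤ gf n := fun n => by
    rw [hgf]; dsimp only; split_ifs <;> simp [mul_nonneg (hf _) (gw_nonneg η n)]
  have hrl : ∀ (h : ℕ → ℝ), (∀ n : ℕ, (n : ZMod W) ≠ b → h n = 0) → ∀ N, ∑ n ∈ Ioc y N, rho p n * Λv n * h n
      = ∑ n ∈ Ioc y N, rho p n * Real.log n * h n - ∑ n ∈ Ioc y N, TII p y n * h n := by
    intro h hh N
    rw [← sum_sub_distrib]
    refine sum_congr rfl fun n hn => ?_
    have hn1 := (mem_Ioc.1 hn).1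
    by_cases hc : (n : ZMod W) = b
    · rw [rho_log e n (by omega) (hc ▸ hb)]; ring
    · rw [hh n hc]; ring
  have hgz : ∀ n : ℕ, (n : ZMod W) ≠ b → g n = 0 := fun n hn => if_neg hn
  have hgfz : ∀ n : ℕ, (n : ZMod W) ≠ b → gf n = 0 := fun n hn => if_neg hn
  have hrlog : ∀ n : ℕ, 0 ≤ rho p n * Real.log n := fun n => mul_nonneg (rho_nonneg p n) (Real.log_natCast_nonneg n)
  have k1 := hrl gf hgfz X
  have k2 := hrl g hgz (X ^ 2)
  have t1 := TII_le (p := p) hy X gf hgf0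
  have t2 := le_TII (p := p) hy X g hg0
  -- bilinear
  have hb1 : ∑ x ∈ Ioc y X ×ˢ Ioc y X, Tdm p x * gf (x.1 * x.2)
      - μ * ∑ x ∈ Ioc y X ×ˢ Ioc y X, Tdm p x * g (x.1 * x.2) ≤ e1 := by
    refine le_trans (le_of_eq ?_) ((le_abs_self _).trans h1)
    rw [mul_sum, ← sum_sub_distrib, sum_product]
    refine sum_congr rfl fun d _ => sum_congr rfl fun m _ => ?_
    simp only [hg, hgf, Tdm]
    split_ifs <;> ring
  -- splitting
  have s1 : ∑ n ∈ Ioc y X, rho p n * Real.log n * gf n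
      = ∑ n ∈ Ioc y x0, rho p n * Real.log n * gf n + ∑ n ∈ Ioc x0 X, rho p n * Real.log n * gf n :=
    (sum_Ioc_consecutive _ hyx hxX).symm
  have s1' : 0 ≤ ∑ n ∈ Ioc y x0, rho p n * Real.log n * gf n :=
    sum_nonneg fun n _ => mul_nonneg (hrlog n) (hgf0 n)
  have s2 : ∑ n ∈ Ioc y (X ^ 2), rho p n * Real.log n * g n
      = ∑ n ∈ Ioc y x0, rho p n * Real.log n * g n + ∑ n ∈ Ioc x0 X, rho p n * Real.log n * g n
        + ∑ n ∈ Ioc X (X ^ 2), rho p n * Real.log n * g n := by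
    rw [sum_Ioc_consecutive _ hyx hxX, sum_Ioc_consecutive _ (hyx.trans hxX) hX2]
  have s3 : ∑ n ∈ Ioc X (X ^ 2), rho p n * Real.log n * g n ≤ ∑ n ∈ Ioc X (X ^ 2), Real.log n * gw η n := by
    refine sum_le_sum fun n _ => ?_
    have a1 : g n ≤ gw η n := by rw [hg]; dsimp only; split_ifs; exacts [le_rfl, gw_nonneg _ _]
    have a2 : rho p n * Real.log n ≤ Real.log n :=
      mul_le_of_le_one_left (Real.log_natCast_nonneg n) (rho_le_one p n)
    exact mul_le_mul a2 a1 (hg0 n) (Real.log_natCast_nonneg n)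
  have s4 : ∑ n ∈ Ioc y X, rho p n * Λv n * g n ≤ ∑ n ∈ Ioc y (X ^ 2), rho p n * Λv n * g n :=
    sum_le_sum_of_subset_of_nonneg (Ioc_subset_Ioc_right hX2) fun n _ _ =>
      mul_nonneg (mul_nonneg (rho_nonneg p n) ArithmeticFunction.vonMangoldt_nonneg) (hg0 n)
  have m1 := mul_le_mul_of_nonneg_left s4 hμ
  have m2 := mul_le_mul_of_nonneg_left h3 hμ
  have m3 := mul_le_mul_of_nonneg_left s3 hμ
  have m4 := mul_le_mul_of_nonneg_left t2 hμ
  have m5 : μ * ∑ n ∈ Ioc y (X ^ 2), rho p n * Λv n * g n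
      = μ * ∑ n ∈ Ioc y (X ^ 2), rho p n * Real.log n * g n - μ * ∑ n ∈ Ioc y (X ^ 2), TII p y n * g n := by
    rw [k2]; ring
  have m6 : μ * ∑ n ∈ Ioc y (X ^ 2), rho p n * Real.log n * g n
      = μ * (∑ n ∈ Ioc y x0, rho p n * Real.log n * g n) + μ * (∑ n ∈ Ioc x0 X, rho p n * Real.log n * g n)
        + μ * ∑ n ∈ Ioc X (X ^ 2), rho p n * Real.log n * g n := by
    rw [s2]; ring
  linarith

end asm
end RG


namespace RG
open Finset

section core
variable {ι : Type} [Fintype ι] [DecidableEq ι] {p : ι → ℕ} [hp : ∀ i, Fact (p i).Prime]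
variable {W y R : ℕ}

local notation "Λv" => ArithmeticFunction.vonMangoldt

lemma totient_prod (W : ℕ) (hW : 0 < W) :
    (∏ q ∈ W.primeFactors, (1 - 1 / (q : ℝ))) * W = W.totient := by
  have h := Nat.totient_eq_mul_prod_factors W
  have h2 : ((W.totient : ℚ) : ℝ) = ((W * ∏ q ∈ W.primeFactors, (1 - (q : ℚ)⁻¹) : ℚ) : ℝ) := by rw [h]
  push_cast at h2
  rw [h2, mul_comm]
  simp only [one_div]

lemma Env.disj (e : Env p W y R) : Disjoint (univ.image p) W.primeFactors := by
  rw [disjoint_left]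
  intro q hq hq2
  obtain ⟨i, _, rfl⟩ := mem_image.1 hq
  have h1 := Nat.dvd_of_mem_primeFactors hq2
  have h2 := Nat.dvd_gcd h1 dvd_rfl
  rw [(e.hW i).gcd_eq_one] at h2
  exact (hp i).out.one_lt.ne' (Nat.dvd_one.1 h2)

lemma Env.cov' (e : Env p W y R) (q : ℕ) (hq : q.Prime) (h : q ≤ y) : q ∈ (univ.image p) ∪ W.primeFactors := by
  rcases e.cov q hq h with h1 | ⟨i, hi⟩
  · exact mem_union_right _ (Nat.mem_primeFactors.2 ⟨hq, h1, e.hW0.ne'⟩)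
  · exact mem_union_left _ (mem_image.2 ⟨i, mem_univ _, hi⟩)

lemma Env.R_le_y (e : Env p W y R) : R ≤ y :=
  (Nat.le_self_pow (by norm_num) R).trans e.hRy

lemma Env.V_le (e : Env p W y R) : VV p * W.totient ≤ W / Real.log y := by
  have h2 : 2 ≤ y := e.hR.trans e.R_le_y
  have h := mertens ((univ.image p) ∪ W.primeFactors) (fun q hq => by
    rcases mem_union.1 hq with h | h
    · obtain ⟨i, _, rfl⟩ := mem_image.1 h
      exact (hp i).out
    · exact Nat.prime_of_mem_primeFactors h) y h2 e.cov'
  rw [prod_union e.disj, prod_image (fun a _ b _ h => e.hinj h)] at h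
  have hV : VV p = ∏ i, (1 - 1 / (p i : ℝ)) := by unfold VV; simp only [one_div]
  rw [← hV] at h
  rw [← totient_prod W e.hW0, ← mul_assoc]
  have hW : (0 : ℝ) ≤ W := by positivity
  calc _ ≤ 1 / Real.log y * W := mul_le_mul_of_nonneg_right h hW
    _ = _ := by ring

lemma Env.exists_maj (e : Env p W y R) : ∃ A S, Maj p W R A S ∧ W.totient * Real.log R ≤ W * S := by
  obtain ⟨A, S, h1, h2, h3, h4, h5, h6, h7, h8⟩ := majorant p e.hinj W R (by have := e.hR; omega) e.h1
  refine ⟨A, S, ⟨h1, h2, h3, h4, h5, h6, h7⟩, ?_⟩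
  have := h8 W.primeFactors y (fun q hq => Nat.prime_of_mem_primeFactors hq) e.disj e.R_le_y e.cov'
  rw [← totient_prod W e.hW0]
  have hW : (0 : ℝ) ≤ W := by positivity
  have := mul_le_mul_of_nonneg_right this hW
  linarith

/-- first range -/
lemma first_range (e : Env p W y R) [NeZero W] {A : (∀ i, ZMod (p i)) → ℝ} {S : ℝ} (hM : Maj p W R A S)
    (η : ℝ) (hη : 0 ≤ η) (b : ZMod W) (x0 : ℕ) (hx0 : 3 ≤ x0) :
    ∑ n ∈ Ioc y x0, rho p n * Real.log n * (if (n : ZMod W) = b then gw η n else 0)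
      ≤ Real.log x0 * (3 * Real.log x0 / (W * S)) := by
  have hl : 1 ≤ Real.log x0 := by
    rw [Real.le_log_iff_exp_le (by positivity)]
    have h3 : (3 : ℝ) ≤ x0 := by exact_mod_cast hx0
    linarith [Real.exp_one_lt_d9]
  have hy := e.y_pos
  have hy0 : (0 : ℝ) < y := by exact_mod_cast hy
  have h := A_sum e hM (1 / Real.log x0) (by positivity) (by rw [div_le_one (by linarith)]; exact hl) b x0
    (fun n => 1 / (n : ℝ)) (Real.log x0) (sum_inv_le x0 y hy)
    (by rw [one_div_mul_cancel (by linarith)])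
    (fun m n hm hn => by
      have : (0 : ℝ) < m := by exact_mod_cast (by omega : 0 < m)
      exact one_div_le_one_div_of_le this (by exact_mod_cast hn))
    (fun n _ => by positivity) (by
      push_cast
      exact one_div_le_one_div_of_le hy0 (by linarith))
  refine le_trans ?_ (mul_le_mul_of_nonneg_left h (by linarith))
  rw [mul_sum]
  refine sum_le_sum fun n hn => ?_
  have hn' := mem_Ioc.1 hn
  have hln : Real.log n ≤ Real.log x0 :=
    Real.log_le_log (by exact_mod_cast (by omega : 0 < n)) (by exact_mod_cast hn'.2)
  have hln0 := Real.log_natCast_nonneg n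
  have hA : rho p n ≤ A (rs p n) := by
    by_cases h : ∀ i, rs p n i ≠ 0
    · rw [rho_one p h]; exact hM.A1 _ h
    · have : rho p n = 0 := by unfold rho; exact if_neg h
      rw [this]; exact hM.A0 _
  have hg := gw_le_inv η hη n
  have hg0 := gw_nonneg η n
  have hr := rho_nonneg p n
  split_ifs
  · calc rho p n * Real.log n * gw η n ≤ A (rs p n) * Real.log x0 * (1 / n) := by
          have := hM.A0 (rs p n)
          gcongr
      _ = _ := by ring
  · simp

/-- main range by the sieve -/
lemma second_range (e : Env p W y R) [NeZero W] (J B : ℕ) (hyJ : y = 2 ^ 2 ^ J) (hp2 : ∀ i, 2 < p i)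
    (hpy : ∀ i, p i ≤ y) (η : ℝ) (hη : 0 < η) (b : ZMod W) (f : (∀ i, ZMod (p i)) → ℝ) (C Kf : ℝ)
    (hC : 1 ≤ C) (hf : ∀ x, 0 ≤ f x) (h : HB p f C) (hμ0 : 0 ≤ mux p f) (hμ : mux p f ≤ C)
    (hfT : TI (W * ∏ i, p i) Kf (fun n => f (rs p n))) (hKf : Kf ≤ 4 * R ^ 8)
    (ε : ℝ) (hε : 4 * ((1 / 4 : ℝ) ^ B * Real.exp 64) ≤ ε) (hε1 : ε ≤ 1) (hyB : 8 * B + 19 ≤ y) (X : ℕ) :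
    mux p f * (∑ n ∈ Ioc (y ^ (8 * B + 18)) X, rho p n * Real.log n * (if (n : ZMod W) = b then gw η n else 0))
      - C * (8 * ε * (VV p / W) / η ^ 2 + 1 / y)
      ≤ ∑ n ∈ Ioc (y ^ (8 * B + 18)) X, rho p n * Real.log n * (if (n : ZMod W) = b then f (rs p n) * gw η n else 0) := by
  set x0 := y ^ (8 * B + 18) with hx0
  have hN := Nat.mul_pos e.hW0 (Qpos p)
  have hW0 : (0 : ℝ) < W := by exact_mod_cast e.hW0
  choose β hβ1 hβ2 hβ3 using fun i => exists_block (p i) J (hp2 i) (hyJ ▸ hpy i)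
  have hbl : ∀ j, ∑ i with β i = j, tt (p i) ≤ 8 := by
    intro j
    refine le_trans ?_ (block_sum j)
    rw [← sum_image (g := p) (f := tt) (fun a _ b _ h => e.hinj h)]
    refine sum_le_sum_of_subset_of_nonneg ?_ ?_
    · intro q hq
      obtain ⟨i, hi, rfl⟩ := mem_image.1 hq
      have hi' := (mem_filter.1 hi).2
      rw [mem_filter, mem_Ioc]
      exact ⟨⟨hi' ▸ hβ2 i, hi' ▸ hβ3 i⟩, (hp i).out⟩
    · intro q hq _
      have : Fact q.Prime := ⟨(mem_filter.1 hq).2⟩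
      exact (tt_pos q).le
  have hε0 : 0 ≤ ε := le_trans (by positivity) hε
  have hmain := bh_main p β J B hβ1 hbl f C (by linarith) hf h ε
    (by have := eps_bound B J (ε / 2) (by linarith) (by linarith); linarith) hε0 hμ0 hμ
  set μ := mux p f with hμdef
  set Φ : (∀ i, ZMod (p i)) → ℝ := fun x => (aS p β J B x - eS p β J B x) * f x - μ * aS p β J B x with hΦ
  obtain ⟨ha, hae⟩ := aS_TI p β (W * ∏ i, p i) (dvd_mul_left _ _) e.hinj J B hβ3
  rw [← hyJ] at ha hae
  set Q : ℝ := (y : ℝ) ^ (8 * B + 14) with hQ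
  have hcst : ∀ c : ℝ, TI (W * ∏ i, p i) |c| (fun _ => c) := by
    intro c
    have := TI.base (N := W * ∏ i, p i) 1 |c| (fun _ => c) (one_dvd _) one_pos (fun n => by simp) (fun n => rfl)
    simpa using this
  have hT : TI (W * ∏ i, p i) (W * ((|2| * Q + |(-1)| * Q) * Kf + |-μ| * Q))
      (fun n => if (n : ZMod W) = b then Φ (rs p n) else 0) := by
    have t1 := ((TI.add _ _ _ _ ((hcst 2).mul ha) ((hcst (-1)).mul hae)).mul hfT)
    have t2 := TI.add _ _ _ _ t1 ((hcst (-μ)).mul ha)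
    have t3 := (ind_TI (𝕜 := ℝ) (W * ∏ i, p i) W (dvd_mul_right _ _) b).mul t2
    convert t3 using 2 with n
    rw [hΦ]
    dsimp only
    split_ifs <;> ring
  have hc := hT.count hN (fun n => Real.log n * gw η n) x0 X
    (fun m n hm hn => log_gw_anti η hη.le m n (by
      have : 2 ≤ x0 := by
        have h2 : 2 ≤ y := e.hR.trans e.R_le_y
        exact h2.trans (Nat.le_self_pow (by omega) y)
      omega) hn) (fun n _ => mul_nonneg (Real.log_natCast_nonneg n) (gw_nonneg η n))
  rw [av_crt p e.hinj W e.hW b Φ] at hc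
  simp only [smul_eq_mul, Real.norm_eq_abs] at hc
  have hc1 := (abs_le.1 hc).1
  -- pointwise lower bound
  have hpt : ∑ n ∈ Ioc x0 X, Real.log n * gw η n * (if (n : ZMod W) = b then Φ (rs p n) else 0)
      ≤ ∑ n ∈ Ioc x0 X, rho p n * Real.log n * (if (n : ZMod W) = b then f (rs p n) * gw η n else 0)
        - μ * (∑ n ∈ Ioc x0 X, rho p n * Real.log n * (if (n : ZMod W) = b then gw η n else 0)) := by
    rw [mul_sum, ← sum_sub_distrib]
    refine sum_le_sum fun n _ => ?_
    have hlg : 0 ≤ Real.log n * gw η n := mul_nonneg (Real.log_natCast_nonneg n) (gw_nonneg η n)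
    split_ifs
    · have b1 := aS_sub_le p β J B hβ1 (rs p n)
      have b2 := rhox_le_aS p β J B hβ1 (rs p n)
      rw [rhox_rs] at b1 b2
      have b3 : Φ (rs p n) ≤ rho p n * f (rs p n) - μ * rho p n := by
        have c1 := mul_le_mul_of_nonneg_right b1 (hf (rs p n))
        have c2 := mul_le_mul_of_nonneg_left b2 hμ0
        rw [hΦ]; dsimp only; linarith
      have := mul_le_mul_of_nonneg_left b3 hlg
      linarith
    · simp
  have hsum := sum_log_gw_le η hη x0 X (by rw [hx0]; exact Nat.one_le_pow _ _ (by have := e.y_pos; omega))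
  have hsum0 : 0 ≤ ∑ n ∈ Ioc x0 X, Real.log n * gw η n :=
    sum_nonneg fun n _ => mul_nonneg (Real.log_natCast_nonneg n) (gw_nonneg η n)
  have hlow : -(C * (8 * ε * (VV p / W) / η ^ 2)) ≤ (∑ n ∈ Ioc x0 X, Real.log n * gw η n) * (1 / W * avx p Φ) := by
    have d1 : -(2 * ε * VV p * C) / W ≤ 1 / W * avx p Φ := by
      rw [div_eq_mul_one_div, mul_comm]
      exact mul_le_mul_of_nonneg_left hmain (by positivity)
    have hV := (VV_pos p).le
    calc -(C * (8 * ε * (VV p / W) / η ^ 2)) = 4 / η ^ 2 * (-(2 * ε * VV p * C) / W) := by ring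
      _ ≤ (∑ n ∈ Ioc x0 X, Real.log n * gw η n) * (-(2 * ε * VV p * C) / W) := by
          apply mul_le_mul_of_nonpos_right hsum
          have : 0 ≤ 2 * ε * VV p * C / W := by positivity
          rw [neg_div]; linarith
      _ ≤ _ := mul_le_mul_of_nonneg_left d1 hsum0
  have hsm : 2 * (W * ((|2| * Q + |(-1)| * Q) * Kf + |-μ| * Q)) * (Real.log ((x0 + 1 : ℕ) : ℝ) * gw η (x0 + 1)) ≤ C * (1 / y) := by
    have hy1 := e.y_pos
    have hy0 : (0 : ℝ) < y := by exact_mod_cast hy1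
    have hy1' : (1 : ℝ) ≤ y := by exact_mod_cast hy1
    have hR0 : (0 : ℝ) ≤ R := by positivity
    have hR1 : (1 : ℝ) ≤ R := by exact_mod_cast (by have := e.hR; omega : 1 ≤ R)
    have hWR : (W : ℝ) ≤ R := by exact_mod_cast e.hWR
    have hQ0 : 0 < Q := by positivity
    have a1 : (|2| * Q + |(-1)| * Q) * Kf + |-μ| * Q ≤ 13 * R ^ 8 * Q * C := by
      rw [abs_neg, abs_neg, abs_of_nonneg hμ0, abs_one, abs_of_pos (by norm_num : (0 : ℝ) < 2)]
      have hR8 : (1 : ℝ) ≤ R ^ 8 := one_le_pow₀ hR1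
      have hK : Kf ≤ 4 * R ^ 8 * C := hKf.trans (le_mul_of_one_le_right (by positivity) hC)
      have hm2 : μ ≤ R ^ 8 * C := hμ.trans (le_mul_of_one_le_left (by linarith) hR8)
      calc (2 * Q + 1 * Q) * Kf + μ * Q ≤ (2 * Q + 1 * Q) * (4 * R ^ 8 * C) + (R ^ 8 * C) * Q := by gcongr
        _ = _ := by ring
    have a2 : Real.log ((x0 + 1 : ℕ) : ℝ) ≤ y * y := by
      have hx1 : ((x0 + 1 : ℕ) : ℝ) ≤ (y : ℝ) ^ (8 * B + 19) := by
        have h2 : 2 ≤ y := e.hR.trans e.R_le_y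
        have : x0 + 1 ≤ y ^ (8 * B + 19) := by
          have h7 : y ^ (8 * B + 19) = y ^ (8 * B + 18) * y := pow_succ _ _
          rw [hx0, h7]
          have h5 : 1 ≤ y ^ (8 * B + 18) := Nat.one_le_pow _ _ hy1
          have h6 := Nat.mul_le_mul_left (y ^ (8 * B + 18)) h2
          omega
        exact_mod_cast this
      have := Real.log_le_log (by positivity) hx1
      rw [Real.log_pow] at this
      refine this.trans ?_
      have b1 : ((8 * B + 19 : ℕ) : ℝ) ≤ y := by exact_mod_cast hyB
      have b2 : Real.log y ≤ y := (Real.log_le_sub_one_of_pos hy0).trans (by linarith)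
      exact mul_le_mul b1 b2 (Real.log_natCast_nonneg _) hy0.le
    have a3 : gw η (x0 + 1) ≤ 1 / (Q * y ^ 4) := by
      refine (gw_le_inv η hη.le _).trans (one_div_le_one_div_of_le (by positivity) ?_)
      rw [hQ, ← pow_add, show 8 * B + 14 + 4 = 8 * B + 18 by ring]
      have : y ^ (8 * B + 18) ≤ x0 + 1 := by omega
      exact_mod_cast this
    have a4 := e.pow_le 9 5 (by norm_num) (by norm_num)
    have hlog0 : 0 ≤ Real.log ((x0 + 1 : ℕ) : ℝ) := Real.log_natCast_nonneg _
    calc _ ≤ 2 * (R * (13 * R ^ 8 * Q * C)) * (y * y * (1 / (Q * y ^ 4))) := by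
          have h8 := gw_nonneg η (x0 + 1)
          have h9 : 0 ≤ (|2| * Q + |(-1)| * Q) * Kf + |-μ| * Q :=
            add_nonneg (mul_nonneg (by positivity) hfT.nonneg) (by positivity)
          gcongr
      _ = (26 * R ^ 9) * C / y ^ 2 := by field_simp; ring
      _ ≤ y * C / y ^ 2 := by
          gcongr
          refine le_trans ?_ a4
          have : (0 : ℝ) ≤ R ^ 9 := by positivity
          linarith
      _ = C * (1 / y) := by field_simp
  linarith

end core
end RG

namespace RG
open Finset

section coreT
variable {ι : Type} [Fintype ι] [DecidableEq ι] {p : ι → ℕ} [hp : ∀ i, Fact (p i).Prime] {W y R : ℕ}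

local notation "Λv" => ArithmeticFunction.vonMangoldt

set_option maxHeartbeats 1600000 in
theorem coreT (e : Env p W y R) [NeZero W] (J B : ℕ) (hyJ : y = 2 ^ 2 ^ J) (hyR : y = R ^ 1024) (hp2 : ∀ i, 2 < p i)
    (hpy : ∀ i, p i ≤ y) {k : ℕ} (i : Fin k) (r : ∀ q, Fin k → ZMod (p q)) (hr : ∀ q, Function.Injective (r q))
    (hi : ∀ q, r q i = 0) (G : (ι → Option (Fin k)) → ℝ) (hG : ∀ a, 0 ≤ G a) (hm : MonoG G)
    (hGM : ∀ a, G a ≤ R) (hGR : ∀ a, G a ≠ 0 → qa p a ≤ R)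
    (h1k : ∏ q, (1 + k * tt (p q) ^ 2) ≤ 2)
    (δ : ℝ) (hδ : ∀ q, k * tt (p q) ≤ δ) (hδ0 : 0 ≤ δ) (hδ1 : δ ≤ 1) (E : ℝ) (hE : 1 ≤ E)
    (ε : ℝ) (hε : 4 * ((1 / 4 : ℝ) ^ B * Real.exp 64) ≤ ε) (hε1 : ε ≤ 1) (hyB : 8 * B + 19 ≤ y)
    (b : ZMod W) (hb : IsUnit b) (X : ℕ) (hX : y ^ (8 * B + 18) ≤ X) (ℓ : ℝ) (hℓ : ℓ = E * Real.log y)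
    (Z : ℝ) (hZ : Z = Zq (fun q => tt (p q)) (GI i (fun q => tt (p q)) G)) (hZ1 : 1 ≤ Z) :
    Ei i (fun q => tt (p q)) (fun σ => FI i (fun q => tt (p q)) G σ ^ 2)
      * (∑ n ∈ Ioc y X, rho p n * Λv n * (if (n : ZMod W) = b then gw (1 / ℓ) n else 0))
      - Z * ((180 * 1024 ^ 2 * √δ * E ^ 2 + 8 * ε * E + 3073 * (8 * B + 18) ^ 2 / E) * (ℓ / W.totient))
      - Z * ∑ n ∈ Ioc X (X ^ 2), Real.log n * gw (1 / ℓ) n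
      ≤ ∑ n ∈ Ioc y X, rho p n * Λv n *
        (if (n : ZMod W) = b then FI i (fun q => tt (p q)) G (sv p r (rs p n)) ^ 2 * gw (1 / ℓ) n else 0) := by
  set t : ι → ℝ := fun q => tt (p q) with ht
  have ht0 : ∀ q, 0 ≤ t q := fun q => (tt_pos _).le
  have hk1 : ∀ q, k * t q ≤ 1 := fun q => (hδ q).trans hδ1
  set f : (∀ q, ZMod (p q)) → ℝ := fun x => FI i t G (sv p r x) ^ 2 with hf
  have hμeq : mux p f = Ei i t (fun σ => FI i t G σ ^ 2) := mux_eq p i r hr hi (fun σ => FI i t G σ ^ 2)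
  set μ := Ei i t (fun σ => FI i t G σ ^ 2) with hμ
  have hμ0 : 0 ≤ μ := sum_nonneg fun σ _ => mul_nonneg (prod_nonneg fun q _ => wi_nonneg i (ht0 q) (hk1 q) _) (sq_nonneg _)
  have hμZ : μ ≤ Z := hZ ▸ mu_le i t ht0 hk1 G
  have hy1 := e.y_pos
  have hR2 := e.hR
  -- L
  have hRy : R ≤ y := e.R_le_y
  have hyexp : (3 : ℝ) ≤ y := by
    have h4 : 2 ^ 2 ≤ y := by
      rw [hyR]
      exact (Nat.pow_le_pow_left hR2 2).trans (Nat.pow_le_pow_right (by omega) (by norm_num))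
    have h3 : 3 ≤ y := by omega
    exact_mod_cast h3
  set L := Real.log y with hL
  have hL1 : 1 ≤ L := by
    rw [hL, Real.le_log_iff_exp_le (by linarith)]
    linarith [Real.exp_one_lt_d9]
  have hLR : L = 1024 * Real.log R := by
    have h5 : (y : ℝ) = (R : ℝ) ^ 1024 := by rw [hyR]; exact Nat.cast_pow _ _
    rw [hL, h5, Real.log_pow]; norm_num
  have hL0 : 0 < L := by linarith
  have hE0 : 0 < E := by linarith
  have hℓ0 : 0 < ℓ := by rw [hℓ]; positivity
  have hℓ1 : 1 ≤ ℓ := by rw [hℓ]; nlinarith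
  set η := 1 / ℓ with hη
  have hη0 : 0 < η := by positivity
  have hη1 : η ≤ 1 := by rw [hη, div_le_one hℓ0]; exact hℓ1
  obtain ⟨A, S, hM, hS⟩ := e.exists_maj
  have hT0 : (0 : ℝ) < W.totient := by exact_mod_cast Nat.totient_pos.2 e.hW0
  have hW0 : (0 : ℝ) < W := by exact_mod_cast e.hW0
  set T : ℝ := (W.totient : ℝ) with hT
  have hWS : T * L / 1024 ≤ W * S := by rw [hLR]; linarith
  have hWS0 : 0 < T * L / 1024 := by positivity
  -- e1
  have E1 := bil_total e hM η hη0 hη1 f (fun χ hχ => cch_supp p i r G R hGR χ hχ) (3 * √δ * Z) (by positivity)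
    (fun χ hχ => hZ ▸ cch_small p i r hr hi G hG hm δ hδ hδ1 χ hχ) b hb X
  rw [hμeq] at E1
  -- e2
  have hfT : TI (W * ∏ i, p i) ((∑ a, G a * qa p a) * (∑ a, G a * qa p a)) (fun n => f (rs p n)) := by
    have h := FI_TI p i (W * ∏ i, p i) (dvd_mul_left _ _) r G hG
    have h2 := h.mul h
    simpa [hf, sq] using h2
  have hKf : (∑ a, G a * qa p a) * (∑ a, G a * qa p a) ≤ 4 * (R : ℝ) ^ 8 := by
    have h := K_bound p R h1k G R (by positivity) hGM hGR
    have h0 : 0 ≤ ∑ a, G a * qa p a := sum_nonneg fun a _ => mul_nonneg (hG a) (by positivity)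
    calc _ ≤ (R * (2 * (R : ℝ) ^ 3)) * (R * (2 * (R : ℝ) ^ 3)) := mul_le_mul h h h0 (h0.trans h)
      _ = _ := by ring
  have hHB : HB p f Z := hZ ▸ HB_FI p i r hr hi hk1 G
  have E2 := second_range e J B hyJ hp2 hpy η hη0 b f Z _ hZ1 (fun x => sq_nonneg _) hHB
    (by rw [hμeq]; exact hμ0) (by rw [hμeq]; exact hμZ) hfT hKf ε hε hε1 hyB X
  rw [hμeq] at E2
  have hyx : y ≤ y ^ (8 * B + 18) := Nat.le_self_pow (by omega) y
  have hy3 : 3 ≤ y := by exact_mod_cast hyexp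
  have E3 := first_range e hM η hη0.le b (y ^ (8 * B + 18)) (by omega)
  have main := asm e η b hb f (fun x => sq_nonneg _) μ hμ0 (y ^ (8 * B + 18)) X hyx hX _ _ _ E1 E2 E3
  -- bounds
  have hlx : Real.log ((y ^ (8 * B + 18) : ℕ) : ℝ) = (8 * B + 18) * L := by
    push_cast; rw [Real.log_pow]; push_cast; rfl
  have b1 : T * (3 * √δ * Z * (60 / (η ^ 3 * (W * S) ^ 2))) ≤ Z * (180 * 1024 ^ 2 * √δ * E ^ 2 * (ℓ / T)) := by
    have : η ^ 3 * (T * L / 1024) ^ 2 ≤ η ^ 3 * (W * S) ^ 2 := by gcongr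
    calc T * (3 * √δ * Z * (60 / (η ^ 3 * (W * S) ^ 2)))
        ≤ T * (3 * √δ * Z * (60 / (η ^ 3 * (T * L / 1024) ^ 2))) := by gcongr
      _ = Z * (180 * 1024 ^ 2 * √δ * E ^ 2 * (ℓ / T)) := by
          rw [hη, hℓ]
          field_simp
          ring
  have b2 : VV p / W ≤ 1 / (T * L) := by
    rw [div_le_div_iff₀ hW0 (by positivity)]
    have := e.V_le
    rw [le_div_iff₀ hL0] at this
    linarith
  have b2' : (1 : ℝ) / y ≤ 1 / E * (ℓ / T) := by
    have : T ≤ y := by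
      have h5 : W.totient ≤ y := (Nat.totient_le W).trans (e.hWR.trans hRy)
      rw [hT]; exact_mod_cast h5
    have h6 : 1 / E * (ℓ / T) = L / T := by rw [hℓ]; field_simp
    rw [h6, div_le_div_iff₀ (by linarith) hT0]
    nlinarith
  have b3 : Z * (8 * ε * (VV p / W) / η ^ 2 + 1 / y) ≤ Z * (8 * ε * E * (ℓ / T) + 1 / E * (ℓ / T)) := by
    have hε0 : 0 ≤ ε := le_trans (by positivity) hε
    refine mul_le_mul_of_nonneg_left (add_le_add ?_ b2') (by linarith)
    calc 8 * ε * (VV p / W) / η ^ 2 ≤ 8 * ε * (1 / (T * L)) / η ^ 2 := by gcongr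
      _ = 8 * ε * E * (ℓ / T) := by
          rw [hη, hℓ]
          field_simp
  have b4 : μ * (Real.log ((y ^ (8 * B + 18) : ℕ) : ℝ) * (3 * Real.log ((y ^ (8 * B + 18) : ℕ) : ℝ) / (W * S)))
      ≤ Z * (3072 * (8 * B + 18) ^ 2 / E * (ℓ / T)) := by
    rw [hlx]
    have hc0 : (0 : ℝ) ≤ (8 * B + 18) * L * (3 * ((8 * B + 18) * L) / (T * L / 1024)) := by positivity
    calc _ ≤ μ * ((8 * B + 18) * L * (3 * ((8 * B + 18) * L) / (T * L / 1024))) := by gcongr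
      _ ≤ Z * ((8 * B + 18) * L * (3 * ((8 * B + 18) * L) / (T * L / 1024))) := by gcongr
      _ = _ := by
          rw [hℓ]; field_simp; ring
  have b5 : μ * ∑ n ∈ Ioc X (X ^ 2), Real.log n * gw η n ≤ Z * ∑ n ∈ Ioc X (X ^ 2), Real.log n * gw η n :=
    mul_le_mul_of_nonneg_right hμZ (sum_nonneg fun n _ => mul_nonneg (Real.log_natCast_nonneg n) (gw_nonneg η n))
  have b6 : (1 : ℝ) / E * (ℓ / T) ≤ (8 * B + 18) ^ 2 / E * (ℓ / T) := by
    gcongr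
    have : (0 : ℝ) ≤ B := by positivity
    nlinarith
  have b7 := mul_le_mul_of_nonneg_left b6 (by linarith : 0 ≤ Z)
  have b8 : Z * ((180 * 1024 ^ 2 * √δ * E ^ 2 + 8 * ε * E + 3073 * (8 * B + 18) ^ 2 / E) * (ℓ / T))
      = Z * (180 * 1024 ^ 2 * √δ * E ^ 2 * (ℓ / T)) + Z * (8 * ε * E * (ℓ / T)) + Z * (3072 * (8 * B + 18) ^ 2 / E * (ℓ / T))
        + Z * ((8 * B + 18) ^ 2 / E * (ℓ / T)) := by ring
  rw [b8]
  rw [mul_add] at b3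
  linarith

end coreT
end RG

namespace RG
open Finset

section dirichlet
open ArithmeticFunction.vonMangoldt

variable {W : ℕ} [NeZero W] {b : ZMod W}

lemma rc_summable (η : ℝ) (hη : 0 < η) : Summable (fun n : ℕ => residueClass b n * gw η n) := by
  refine Summable.of_nonneg_of_le (fun n => mul_nonneg (residueClass_nonneg b n) (gw_nonneg η n)) (fun n => ?_) (log_gw_summable η hη)
  exact mul_le_mul_of_nonneg_right ((residueClass_le b n).trans ArithmeticFunction.vonMangoldt_le_log) (gw_nonneg η n)

lemma dir_bounds (hb : IsUnit b) : ∃ C : ℝ, 0 ≤ C ∧ ∀ η : ℝ, 0 < η → η ≤ 1 →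
    |∑' n : ℕ, residueClass b n * gw η n - (W.totient : ℝ)⁻¹ / η| ≤ C := by
  have H {x : ℝ} (hx : 1 < x) :
      ∑' n, residueClass b n / (n : ℝ) ^ x =
        (LFunctionResidueClassAux b x).re + (W.totient : ℝ)⁻¹ / (x - 1) := by
    refine Complex.ofReal_injective ?_
    simp only [Complex.ofReal_tsum, Complex.ofReal_div, Complex.ofReal_cpow (Nat.cast_nonneg _), Complex.ofReal_natCast,
      Complex.ofReal_add, Complex.ofReal_inv, Complex.ofReal_sub, Complex.ofReal_one]
    simp_rw [← LFunctionResidueClassAux_real hb hx,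
      eqOn_LFunctionResidueClassAux hb <| Set.mem_ofPred.mpr (Complex.ofReal_re x ▸ hx), sub_add_cancel,
      LSeries, LSeries.term]
    refine tsum_congr fun n ↦ ?_
    split_ifs with hn
    · simp only [hn, residueClass_apply_zero, Complex.ofReal_zero, zero_div]
    · rfl
  have hc : ContinuousOn (fun x : ℝ ↦ (LFunctionResidueClassAux b x).re) (Set.Icc 1 2) :=
    Complex.continuous_re.continuousOn.comp (t := Set.univ) (continuousOn_LFunctionResidueClassAux b)
      (fun ⦃x⦄ a ↦ trivial) |>.comp Complex.continuous_ofReal.continuousOn fun x hx ↦ by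
        simpa only [Set.mem_ofPred_eq, Complex.ofReal_re] using hx.1
  obtain ⟨C, hC⟩ := isCompact_Icc.exists_bound_of_continuousOn hc
  refine ⟨C, le_trans (norm_nonneg _) (hC 1 (by simp)), fun η hη hη1 => ?_⟩
  have h1 := hC (1 + η) ⟨by linarith, by linarith⟩
  have h2 := H (x := 1 + η) (by linarith)
  have h3 : ∑' n : ℕ, residueClass b n * gw η n = ∑' n : ℕ, residueClass b n / (n : ℝ) ^ (1 + η) := by
    refine tsum_congr fun n => ?_
    unfold gw
    rw [Real.rpow_neg (by positivity), div_eq_mul_inv]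
  rw [h3, h2, add_sub_cancel_left, add_sub_cancel_right]
  simpa using h1

lemma dir_lower (hb : IsUnit b) (E : ℝ) (hE : 8 ≤ E) : ∃ y0 : ℕ, ∀ y : ℕ, y0 ≤ y → ∀ ℓ : ℝ, ℓ = E * Real.log y →
    ∃ X0 : ℕ, ∀ X : ℕ, X0 ≤ X → ℓ / (2 * W.totient) ≤
      ∑ n ∈ Ioc y X, if n.Prime then ArithmeticFunction.vonMangoldt n * (if (n : ZMod W) = b then gw (1 / ℓ) n else 0) else 0 := by
  obtain ⟨C, hC0, hC⟩ := dir_bounds hb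
  have hnp := summable_residueClass_non_primes_div b
  set C2 := ∑' n : ℕ, (if n.Prime then 0 else residueClass b n) / (n : ℝ) with hC2
  have hφ : (0 : ℝ) < W.totient := by exact_mod_cast Nat.totient_pos.2 (NeZero.pos W)
  set φ : ℝ := (W.totient : ℝ) with hφd
  have hC20 : 0 ≤ C2 := tsum_nonneg fun n => by
    split_ifs
    · simp
    · exact div_nonneg (residueClass_nonneg b n) (by positivity)
  refine ⟨⌈Real.exp (8 * φ * (4 * C + 1 + C2) + 1)⌉₊, fun y hy ℓ hℓ => ?_⟩
  have hy' : Real.exp (8 * φ * (4 * C + 1 + C2) + 1) ≤ y := (Nat.le_ceil _).trans (by exact_mod_cast hy)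
  have hy0 : (0 : ℝ) < y := (Real.exp_pos _).trans_le hy'
  have hL : 8 * φ * (4 * C + 1 + C2) + 1 ≤ Real.log y := (Real.le_log_iff_exp_le hy0).2 hy'
  set L := Real.log y with hLd
  have hK0 : 0 ≤ 8 * φ * (4 * C + 1 + C2) := by positivity
  have hL1 : 1 ≤ L := by linarith
  have hℓ8 : 8 * L ≤ ℓ := by rw [hℓ]; nlinarith
  have hℓ0 : 0 < ℓ := by linarith
  set η := 1 / ℓ with hη
  have hη0 : 0 < η := by positivity
  have hη1 : η ≤ 1 := by rw [hη, div_le_one hℓ0]; linarith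
  have hs := rc_summable (b := b) η hη0
  have hlow := (abs_le.1 (hC η hη0 hη1)).1
  have hup := (abs_le.1 (hC (1 / L) (by positivity) (by rw [div_le_one (by linarith)]; exact hL1))).2
  have htend := hs.hasSum.tendsto_sum_nat
  have hev := htend.eventually (lt_mem_nhds (show (∑' n : ℕ, residueClass b n * gw η n) - 1 < _ by linarith))
  obtain ⟨X1, hX1⟩ := Filter.eventually_atTop.1 hev
  refine ⟨max X1 y, fun X hX => ?_⟩
  have hXy : y ≤ X := (le_max_right _ _).trans hX
  have h1 := hX1 (X + 1) (by have := le_max_left X1 y; omega)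
  have hsplit : ∑ n ∈ range (X + 1), residueClass b n * gw η n
      = ∑ n ∈ range (y + 1), residueClass b n * gw η n + ∑ n ∈ Ioc y X, residueClass b n * gw η n := by
    rw [← sum_range_add_sum_Ico _ (by omega : y + 1 ≤ X + 1)]
    have hI : Ico (y + 1) (X + 1) = Ioc y X := by ext n; simp only [mem_Ico, mem_Ioc]; omega
    rw [hI]
  have h2 : ∑ n ∈ range (y + 1), residueClass b n * gw η n ≤ 3 * (φ⁻¹ * L + C) := by
    calc ∑ n ∈ range (y + 1), residueClass b n * gw η n
        ≤ ∑ n ∈ range (y + 1), 3 * (residueClass b n * gw (1 / L) n) := by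
          refine sum_le_sum fun n hn => ?_
          rcases Nat.eq_zero_or_pos n with rfl | hn0
          · simp
          have hn0' : (0 : ℝ) < n := by exact_mod_cast hn0
          have hny : (n : ℝ) ≤ y := by
            have : n ≤ y := by have := mem_range.1 hn; omega
            exact_mod_cast this
          have : gw η n ≤ 3 * gw (1 / L) n := by
            refine (gw_le_inv η hη0.le n).trans ?_
            have e1 : (n : ℝ) ^ (1 / L) ≤ 3 := by
              rw [Real.rpow_def_of_pos hn0']
              have : Real.log n * (1 / L) ≤ 1 := by
                rw [mul_one_div, div_le_one (by linarith)]
                exact Real.log_le_log hn0' hny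
              exact (Real.exp_le_exp.2 this).trans (by linarith [Real.exp_one_lt_d9])
            have e2 : gw (1 / L) n = 1 / (n * (n : ℝ) ^ (1 / L)) := by
              unfold gw
              rw [Real.rpow_neg hn0'.le, Real.rpow_add hn0', Real.rpow_one, one_div ((n : ℝ) * _)]
            have e3 : (0 : ℝ) < (n : ℝ) ^ (1 / L) := by positivity
            rw [e2, mul_one_div, div_le_div_iff₀ hn0' (by positivity)]
            nlinarith
          have := mul_le_mul_of_nonneg_left this (residueClass_nonneg b n)
          linarith
      _ = 3 * ∑ n ∈ range (y + 1), residueClass b n * gw (1 / L) n := by rw [mul_sum]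
      _ ≤ 3 * ∑' n : ℕ, residueClass b n * gw (1 / L) n := by
          gcongr
          exact (rc_summable (1 / L) (by positivity)).sum_le_tsum _ (fun n _ => mul_nonneg (residueClass_nonneg b n) (gw_nonneg _ n))
      _ ≤ 3 * (φ⁻¹ * L + C) := by
          have : φ⁻¹ / (1 / L) = φ⁻¹ * L := by field_simp
          rw [this] at hup
          linarith
  have h3 : ∑ n ∈ Ioc y X, residueClass b n * gw η n
      ≤ (∑ n ∈ Ioc y X, if n.Prime then ArithmeticFunction.vonMangoldt n * (if (n : ZMod W) = b then gw η n else 0) else 0) + C2 := by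
    have h4 : ∑ n ∈ Ioc y X, (if n.Prime then 0 else residueClass b n) / (n : ℝ) ≤ C2 :=
      hnp.sum_le_tsum _ (fun n _ => by
        split_ifs
        · simp
        · exact div_nonneg (residueClass_nonneg b n) (by positivity))
    refine le_trans ?_ (add_le_add_right h4 _)
    rw [← sum_add_distrib]
    refine sum_le_sum fun n _ => ?_
    by_cases hpn : n.Prime
    · simp only [hpn, if_true, zero_div, add_zero]
      by_cases hnb : (n : ZMod W) = b
      · simp [residueClass, hnb]
      · simp [residueClass, hnb]
    · simp only [hpn, if_false, zero_add]
      have := mul_le_mul_of_nonneg_left (gw_le_inv η hη0.le n) (residueClass_nonneg b n)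
      rwa [mul_one_div] at this
  have h5 : φ⁻¹ / η = φ⁻¹ * ℓ := by rw [hη]; field_simp
  rw [h5] at hlow
  have h6 : ℓ / (2 * φ) = φ⁻¹ * ℓ / 2 := by field_simp
  rw [h6]
  have h7 : φ⁻¹ * (8 * L) ≤ φ⁻¹ * ℓ := by gcongr
  have h8 : 8 * (4 * C + 1 + C2) ≤ φ⁻¹ * L := by
    rw [le_inv_mul_iff₀ hφ]; linarith
  have h9 : φ⁻¹ * (8 * L) = 8 * (φ⁻¹ * L) := by ring
  linarith

end dirichlet
end RG

namespace RG
open Finset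

section Sbd
variable {ι : Type} [Fintype ι] [DecidableEq ι] (p : ι → ℕ) [hp : ∀ i, Fact (p i).Prime] {W y R : ℕ}

def NU (U : Finset ι) : ℕ := ∏ q ∈ U, p q
noncomputable def TU (U : Finset ι) : ℝ := ∏ q ∈ U, tt (p q)
noncomputable def SS (X : ℕ) : ℝ := ∑ U : Finset ι, if NU p U ≤ X then TU p U else 0

lemma NU_pos (U : Finset ι) : 0 < NU p U := prod_pos fun i _ => (hp i).out.pos
lemma TU_pos (U : Finset ι) : 0 < TU p U := prod_pos fun i _ => tt_pos _

lemma sup_sum (V : Finset ι) (h : Finset ι → ℝ) (h0 : ∀ U, 0 ≤ h U) :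
    ∑ U : Finset ι with V ⊆ U, h (U \ V) ≤ ∑ U : Finset ι, h U := by
  rw [← sum_image (g := fun U => U \ V) (f := h)]
  · exact sum_le_sum_of_subset_of_nonneg (subset_univ _) (fun U _ _ => h0 U)
  · intro A hA B hB hAB
    have hA' : V ⊆ A := by simpa using hA
    have hB' : V ⊆ B := by simpa using hB
    have hAB' : A \ V = B \ V := hAB
    rw [← sdiff_union_of_subset hA', ← sdiff_union_of_subset hB', hAB']

lemma NU_sdiff {U V : Finset ι} (h : V ⊆ U) : NU p U = NU p (U \ V) * NU p V := (prod_sdiff h).symm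
lemma TU_sdiff {U V : Finset ι} (h : V ⊆ U) : TU p U = TU p (U \ V) * TU p V := (prod_sdiff h).symm

lemma NU_inj (hinj : Function.Injective p) : Function.Injective (NU p) := by
  intro A B h
  have key : ∀ U : Finset ι, ∀ i, p i ∣ NU p U ↔ i ∈ U := by
    intro U i
    constructor
    · intro hd
      obtain ⟨j, hj, hd⟩ := (Prime.dvd_finset_prod_iff (hp i).out.prime _).1 hd
      have := (Nat.prime_dvd_prime_iff_eq (hp i).out (hp j).out).1 hd
      rw [hinj this]; exact hj
    · intro hi; exact dvd_prod_of_mem _ hi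
  ext i
  rw [← key A, ← key B, h]

lemma SS_ge (e : Env p W y R) (X : ℕ) (hX : X ≤ y) : W.totient * Real.log X ≤ W * SS p X := by
  have h := S_lower (univ.image p) W.primeFactors (by
    intro q hq
    obtain ⟨i, _, rfl⟩ := mem_image.1 hq
    exact (hp i).out) (fun q hq => Nat.prime_of_mem_primeFactors hq) e.disj X y hX e.cov'
  have h2 : ∑ U ∈ (univ.image p).powerset with ∏ q ∈ U, q ≤ X, ∏ q ∈ U, tt q = SS p X := by
    unfold SS
    rw [sum_filter]
    refine sum_nbij' (fun V => univ.filter (fun i => p i ∈ V)) (fun U => U.image p) ?_ ?_ ?_ ?_ ?_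
    · intro V _; exact mem_univ _
    · intro U _; exact mem_powerset.2 (image_subset_image (subset_univ _))
    · intro V hV
      have hV := mem_powerset.1 hV
      ext q
      simp only [mem_image, mem_filter, mem_univ, true_and]
      constructor
      · rintro ⟨i, hi, rfl⟩; exact hi
      · intro hq
        obtain ⟨i, _, rfl⟩ := mem_image.1 (hV hq)
        exact ⟨i, hq, rfl⟩
    · intro U _
      ext i
      simp [e.hinj.eq_iff]
    · intro V hV
      have hV := mem_powerset.1 hV
      have hVi : V = (univ.filter (fun i => p i ∈ V)).image p := by
        ext q
        simp only [mem_image, mem_filter, mem_univ, true_and]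
        constructor
        · intro hq
          obtain ⟨i, _, rfl⟩ := mem_image.1 (hV hq)
          exact ⟨i, hq, rfl⟩
        · rintro ⟨i, hi, rfl⟩; exact hi
      unfold NU TU
      conv_lhs => rw [hVi]
      rw [prod_image (fun a _ b _ h => e.hinj h), prod_image (fun a _ b _ h => e.hinj h)]
  rw [h2] at h
  rw [← totient_prod W e.hW0]
  have hW : (0 : ℝ) ≤ W := by positivity
  have := mul_le_mul_of_nonneg_right h hW
  linarith

lemma SS_le_inv (e : Env p W y R) (X : ℕ) :
    SS p X ≤ 2 * ∑ U : Finset ι, if NU p U ≤ X then 1 / (NU p U : ℝ) else 0 := by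
  set h : Finset ι → ℝ := fun U => if NU p U ≤ X then 1 / (NU p U : ℝ) else 0 with hh
  have h0 : ∀ U, 0 ≤ h U := fun U => by rw [hh]; dsimp only; split_ifs <;> positivity
  have hT : ∀ U, TU p U = 1 / (NU p U : ℝ) * ∑ V ∈ U.powerset, TU p V := by
    intro U
    unfold TU NU
    rw [← prod_one_add]
    push_cast
    rw [one_div, ← prod_inv_distrib, ← prod_mul_distrib]
    refine prod_congr rfl fun i _ => ?_
    have := two_le_q (p i)
    unfold tt
    have h3 : (p i : ℝ) - 1 ≠ 0 := by linarith
    field_simp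
    ring
  calc SS p X = ∑ U : Finset ι, ∑ V : Finset ι, if V ⊆ U then h U * TU p V else 0 := by
        unfold SS
        refine sum_congr rfl fun U _ => ?_
        rw [← sum_filter, hh]
        dsimp only
        split_ifs
        · rw [← mul_sum, hT U]
          congr 1
          refine sum_congr ?_ fun _ _ => rfl
          ext V; simp
        · simp
    _ = ∑ V : Finset ι, ∑ U : Finset ι with V ⊆ U, h U * TU p V := by
        rw [sum_comm]
        refine sum_congr rfl fun V _ => ?_
        rw [sum_filter]
    _ ≤ ∑ V : Finset ι, ∑ U : Finset ι with V ⊆ U, (TU p V / NU p V) * h (U \ V) := by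
        refine sum_le_sum fun V _ => sum_le_sum fun U hU => ?_
        have hVU : V ⊆ U := by simpa using hU
        have hN := NU_sdiff p hVU
        have hTV := TU_pos p V
        have hp1 := NU_pos p V
        have hp2 := NU_pos p (U \ V)
        have hp3 : (0 : ℝ) < NU p V := by exact_mod_cast hp1
        have hp4 : (0 : ℝ) < NU p (U \ V) := by exact_mod_cast hp2
        rw [hh]
        dsimp only
        by_cases hc : NU p U ≤ X
        · have hc2 : NU p (U \ V) ≤ X := (Nat.le_of_dvd (NU_pos p U) ⟨_, hN⟩).trans hc
          rw [if_pos hc, if_pos hc2, hN]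
          push_cast
          apply le_of_eq
          field_simp
        · rw [if_neg hc]
          split_ifs
          · rw [zero_mul]; positivity
          · simp
    _ ≤ ∑ V : Finset ι, (TU p V / NU p V) * ∑ U : Finset ι, h U := by
        refine sum_le_sum fun V _ => ?_
        rw [← mul_sum]
        exact mul_le_mul_of_nonneg_left (sup_sum V h h0) (div_nonneg (TU_pos p V).le (by positivity))
    _ = (∑ V : Finset ι, TU p V / NU p V) * ∑ U : Finset ι, h U := by rw [sum_mul]
    _ ≤ 2 * ∑ U : Finset ι, h U := by
        refine mul_le_mul_of_nonneg_right ?_ (sum_nonneg fun U _ => h0 U)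
        refine le_trans ?_ e.h1
        rw [prod_one_add, powerset_univ]
        refine sum_le_sum fun V _ => ?_
        unfold TU NU
        push_cast
        rw [← prod_div_distrib]
        refine prod_le_prod (fun i _ => ?_) (fun i _ => ?_)
        · exact div_nonneg (tt_pos _).le (by positivity)
        · have := two_le_q (p i)
          have ht := tt_pos (p i)
          rw [sq, div_eq_mul_one_div]
          refine mul_le_mul_of_nonneg_left ?_ ht.le
          unfold tt
          exact one_div_le_one_div_of_le (by linarith) (by linarith)

lemma cop_sum (hW : 0 < W) (X : ℕ) :
    ∑ n ∈ Ioc 0 X, (if n.Coprime W then 1 / (n : ℝ) else 0) ≤ W.totient / W * (1 + Real.log X) + 2 * W := by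
  have hT : TI W (1 * W) (fun n => if n.Coprime W then (1 : ℝ) else 0) :=
    TI.base W 1 _ dvd_rfl hW (fun n => by split_ifs <;> simp) (fun n => by simp)
  have h := hT.count hW (fun n => 1 / (n : ℝ)) 0 X (fun m n hm hn => by
    have : (0 : ℝ) < m := by exact_mod_cast hm
    exact one_div_le_one_div_of_le this (by exact_mod_cast hn)) (fun n _ => by positivity)
  have hav : av W (fun n => if n.Coprime W then (1 : ℝ) else 0) = W.totient / W := by
    unfold av
    rw [smul_eq_mul, Nat.totient_eq_card_coprime, card_filter]
    push_cast
    rw [one_div_mul_eq_div]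
    congr 1
    refine sum_congr rfl fun n _ => ?_
    simp only [Nat.coprime_comm]
  rw [hav] at h
  simp only [smul_eq_mul, Real.norm_eq_abs, one_mul] at h
  have h1 := (abs_le.1 h).2
  have h2 : ∑ n ∈ Ioc 0 X, 1 / (n : ℝ) ≤ 1 + Real.log X := by
    have := harmonic_le_one_add_log X
    rw [harmonic_eq_sum_Icc] at this
    push_cast at this
    refine le_trans (le_of_eq ?_) this
    simp only [one_div]
    rfl
  have h3 : ∑ n ∈ Ioc 0 X, 1 / (n : ℝ) * (if n.Coprime W then (1 : ℝ) else 0)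
    = ∑ n ∈ Ioc 0 X, (if n.Coprime W then 1 / (n : ℝ) else 0) := by
    refine sum_congr rfl fun n _ => by split_ifs <;> simp
  rw [h3] at h1
  have h4 : (0 : ℝ) ≤ W.totient / W := by positivity
  have h5 := mul_le_mul_of_nonneg_right h2 h4
  have h6 : (1 : ℝ) / ((0 + 1 : ℕ) : ℝ) = 1 := by norm_num
  rw [h6] at h1
  linarith

lemma SS_le (e : Env p W y R) (X : ℕ) (hX : 1 + 2 * (W : ℝ) ^ 2 ≤ Real.log X) :
    SS p X ≤ 4 * (W.totient / W) * Real.log X := by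
  refine (SS_le_inv p e X).trans ?_
  have h1 : ∑ U : Finset ι, (if NU p U ≤ X then 1 / (NU p U : ℝ) else 0)
      ≤ ∑ n ∈ Ioc 0 X, (if n.Coprime W then 1 / (n : ℝ) else 0) := by
    rw [← sum_filter, ← sum_image (s := univ.filter (fun U => NU p U ≤ X)) (g := NU p) (f := fun n : ℕ => 1 / (n : ℝ)) (fun a _ b _ h => NU_inj p e.hinj h)]
    rw [← sum_filter]
    refine sum_le_sum_of_subset_of_nonneg ?_ (fun n _ _ => by positivity)
    intro n hn
    obtain ⟨U, hU, rfl⟩ := mem_image.1 hn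
    have hU' : NU p U ≤ X := by simpa using hU
    rw [mem_filter, mem_Ioc]
    refine ⟨⟨NU_pos p U, hU'⟩, ?_⟩
    unfold NU
    exact Nat.Coprime.prod_left fun i _ => (e.hW i).symm
  have h2 := cop_sum e.hW0 X
  have hW : (1 : ℝ) ≤ W := by exact_mod_cast e.hW0
  have hT : (1 : ℝ) ≤ W.totient := by exact_mod_cast Nat.totient_pos.2 e.hW0
  have h3 : 1 / (W : ℝ) ≤ W.totient / W := by gcongr
  have h4 : W.totient / W * (1 + 2 * (W : ℝ) ^ 2) ≤ W.totient / W * Real.log X := by gcongr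
  have h5 : (1 / (W : ℝ)) * (2 * (W : ℝ) ^ 2) ≤ W.totient / W * (2 * (W : ℝ) ^ 2) := by gcongr
  have h6 : (1 / (W : ℝ)) * (2 * (W : ℝ) ^ 2) = 2 * W := by field_simp
  linarith

end Sbd
end RG

namespace RG
open Finset

section Tup
variable {V : Type} [Fintype V] {k : ℕ}

lemma expG (w h : Fin k → V → ℝ) (c : Fin k → ℝ) (hw : ∀ j v, 0 ≤ w j v) (hh : ∀ j v, 0 ≤ h j v)
    (hc : ∀ j, ∑ v, w j v * h j v ≤ c j * ∑ v, w j v) :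
    ∑ U : Fin k → V, (∏ j, w j (U j)) * ∏ j, h j (U j) ≤ (∏ j, c j) * ∏ j, ∑ v, w j v := by
  calc _ = ∑ U : Fin k → V, ∏ j, (w j (U j) * h j (U j)) := by
        refine sum_congr rfl fun U _ => ?_
        rw [prod_mul_distrib]
    _ = ∏ j, ∑ v, w j v * h j v := pi_sum_prod (X := fun _ : Fin k => V) (fun j v => w j v * h j v)
    _ ≤ ∏ j, (c j * ∑ v, w j v) :=
        prod_le_prod (fun j _ => sum_nonneg fun v _ => mul_nonneg (hw j v) (hh j v)) (fun j _ => hc j)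
    _ = _ := prod_mul_distrib

lemma exp1 (w : Fin k → V → ℝ) (h : V → ℝ) (c : ℝ) (hw : ∀ j v, 0 ≤ w j v) (hh : ∀ v, 0 ≤ h v)
    (j0 : Fin k) (hc : ∑ v, w j0 v * h v ≤ c * ∑ v, w j0 v) :
    ∑ U : Fin k → V, (∏ j, w j (U j)) * h (U j0) ≤ c * ∏ j, ∑ v, w j v := by
  have := expG w (fun j v => if j = j0 then h v else 1) (fun j => if j = j0 then c else 1) hw
    (fun j v => by split_ifs; exacts [hh v, zero_le_one]) (fun j => by
      split_ifs with h1
      · rw [h1]; exact hc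
      · simp)
  simpa [prod_ite_eq'] using this

lemma exp2 (w : Fin k → V → ℝ) (h : V → ℝ) (c : ℝ) (hw : ∀ j v, 0 ≤ w j v) (hh : ∀ v, 0 ≤ h v)
    (j0 j1 : Fin k) (h01 : j0 ≠ j1) (hc : ∀ j, ∑ v, w j v * h v ≤ c * ∑ v, w j v) :
    ∑ U : Fin k → V, (∏ j, w j (U j)) * (h (U j0) * h (U j1)) ≤ c ^ 2 * ∏ j, ∑ v, w j v := by
  have := expG w (fun j v => (if j = j0 then h v else 1) * (if j = j1 then h v else 1))
    (fun j => (if j = j0 then c else 1) * (if j = j1 then c else 1)) hw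
    (fun j v => by
      have := hh v
      split_ifs <;> simp <;> positivity) (fun j => by
      split_ifs with h1 h2 h2
      · exact absurd (h1.symm.trans h2) h01
      · simpa using hc j
      · simpa using hc j
      · simp)
  simp_rw [prod_mul_distrib] at this
  simpa only [prod_ite_eq', mem_univ, if_true, sq] using this
end Tup

section Tup2
variable {ι : Type} [Fintype ι] [DecidableEq ι] {k : ℕ}

/-- indicator of membership -/
def im (q : ι) (U : Finset ι) : ℝ := if q ∈ U then 1 else 0
lemma im_nonneg (q : ι) (U : Finset ι) : 0 ≤ im q U := by unfold im; split_ifs <;> simp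

lemma tuple_lower (w : Fin k → Finset ι → ℝ) (hw : ∀ j v, 0 ≤ w j v) (lg : Finset ι → ℝ)
    (hlg : ∀ v, 0 ≤ lg v) (c : ℝ) (t : ι → ℝ) (ht : ∀ q, 0 ≤ t q)
    (hc : ∀ j, ∑ v, w j v * lg v ≤ c * ∑ v, w j v)
    (hq : ∀ q j, ∑ v, w j v * im q v ≤ t q * ∑ v, w j v)
    (hk : 18 * k ^ 2 * ∑ q, t q ^ 2 ≤ 1) (hkc : 3 * (k * c) ≤ 1) :
    (1 / 2) * ∏ j, ∑ v, w j v ≤ ∑ U : Fin k → Finset ι, (∏ j, w j (U j)) *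
      (1 - (∑ q, ∑ j, ∑ l, if j = l then 0 else im q (U j) * im q (U l)) - (∑ j, lg (U j))
        - 2 * ∑ j, ∑ q, t q * im q (U j)) := by
  set P := ∏ j, ∑ v, w j v with hP
  have hP0 : 0 ≤ P := prod_nonneg fun j _ => sum_nonneg fun v _ => hw j v
  have e0 : ∑ U : Fin k → Finset ι, (∏ j, w j (U j)) = P :=
    pi_sum_prod (X := fun _ : Fin k => Finset ι) w
  have e1 : ∑ U : Fin k → Finset ι, (∏ j, w j (U j)) *
      (∑ q, ∑ j, ∑ l, if j = l then 0 else im q (U j) * im q (U l)) ≤ k ^ 2 * (∑ q, t q ^ 2) * P := by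
    simp_rw [mul_sum]
    rw [sum_comm]
    have : ∀ q : ι, ∑ U : Fin k → Finset ι, ∑ j, ∑ l, (∏ j, w j (U j)) *
      (if j = l then 0 else im q (U j) * im q (U l)) ≤ k ^ 2 * t q ^ 2 * P := by
      intro q
      rw [sum_comm]
      have h2 : ∀ j : Fin k, ∑ U : Fin k → Finset ι, ∑ l, (∏ j, w j (U j)) *
        (if j = l then 0 else im q (U j) * im q (U l)) ≤ k * (t q ^ 2 * P) := by
        intro j
        rw [sum_comm]
        have h3 : ∀ l : Fin k, ∑ U : Fin k → Finset ι, (∏ j, w j (U j)) *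
          (if j = l then 0 else im q (U j) * im q (U l)) ≤ t q ^ 2 * P := by
          intro l
          by_cases h : j = l
          · simp [h]; positivity
          · simp only [if_neg h]
            exact exp2 w (im q) (t q) hw (im_nonneg q) j l h (hq q)
        refine (sum_le_sum fun l _ => h3 l).trans ?_
        simp
      refine (sum_le_sum fun l _ => h2 l).trans ?_
      simp
      apply le_of_eq; ring
    refine (sum_le_sum fun q _ => this q).trans ?_
    rw [sum_mul]
  have e2 : ∑ U : Fin k → Finset ι, (∏ j, w j (U j)) * (∑ j, lg (U j)) ≤ k * c * P := by
    simp_rw [mul_sum]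
    rw [sum_comm]
    refine (sum_le_sum fun j _ => exp1 w lg c hw hlg j (hc j)).trans ?_
    simp
    apply le_of_eq; ring
  have e3 : ∑ U : Fin k → Finset ι, (∏ j, w j (U j)) * (∑ j, ∑ q, t q * im q (U j))
      ≤ k * (∑ q, t q ^ 2) * P := by
    simp_rw [mul_sum]
    rw [sum_comm]
    have : ∀ j : Fin k, ∑ U : Fin k → Finset ι, ∑ q, (∏ j, w j (U j)) * (t q * im q (U j))
        ≤ (∑ q, t q ^ 2) * P := by
      intro j
      rw [sum_comm, sum_mul]
      refine sum_le_sum fun q _ => ?_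
      have := mul_le_mul_of_nonneg_left (exp1 w (im q) (t q) hw (im_nonneg q) j (hq q j)) (ht q)
      rw [mul_sum] at this
      calc _ = _ := sum_congr rfl fun U _ => by ring
        _ ≤ _ := this
        _ = _ := by ring
    refine (sum_le_sum fun j _ => this j).trans ?_
    simp only [sum_const, card_univ, Fintype.card_fin, nsmul_eq_mul]
    rw [← mul_sum]
    apply le_of_eq; ring
  simp_rw [mul_sub, mul_one, sum_sub_distrib]
  rw [e0]
  have e4 : ∑ U : Fin k → Finset ι, (∏ j, w j (U j)) * (2 * ∑ j, ∑ q, t q * im q (U j))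
     = 2 * ∑ U : Fin k → Finset ι, (∏ j, w j (U j)) * (∑ j, ∑ q, t q * im q (U j)) := by
    rw [mul_sum]
    exact sum_congr rfl fun U _ => by ring
  rw [e4]
  have ht2 : 0 ≤ ∑ q, t q ^ 2 := sum_nonneg fun q _ => by positivity
  have hkk : (k : ℝ) ≤ k ^ 2 := by
    rcases Nat.eq_zero_or_pos k with h | h
    · simp [h]
    · have : (1 : ℝ) ≤ k := by exact_mod_cast h
      nlinarith
  have h6 : k * (∑ q, t q ^ 2) * P ≤ k ^ 2 * (∑ q, t q ^ 2) * P := by gcongr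
  have h7 := mul_le_mul_of_nonneg_right hk hP0
  have h8 := mul_le_mul_of_nonneg_right hkc hP0
  linarith

/-- classes -/
def cl (a : ι → Option (Fin k)) (j : Fin k) : Finset ι := univ.filter fun q => a q = some j

lemma mem_cl (a : ι → Option (Fin k)) (j : Fin k) (q : ι) : q ∈ cl a j ↔ a q = some j := by
  simp [cl]

lemma cl_inj : Function.Injective (cl : (ι → Option (Fin k)) → Fin k → Finset ι) := by
  intro a b h
  funext q
  have key : ∀ j, a q = some j ↔ b q = some j := fun j => by
    rw [← mem_cl, ← mem_cl, h]
  exact Option.ext fun j => key j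

lemma cl_surj (U : Fin k → Finset ι) (hU : ∀ j l, j ≠ l → Disjoint (U j) (U l)) :
    ∃ a : ι → Option (Fin k), cl a = U := by
  classical
  refine ⟨fun q => if h : ∃ j, q ∈ U j then some h.choose else none, ?_⟩
  funext j
  ext q
  rw [mem_cl]
  constructor
  · intro h
    split_ifs at h with h1
    · have := h1.choose_spec
      rw [Option.some.inj h] at this
      exact this
  · intro h
    have h1 : ∃ j, q ∈ U j := ⟨j, h⟩
    rw [dif_pos h1]
    congr 1
    by_contra hne
    exact (disjoint_left.1 (hU _ _ hne) h1.choose_spec) h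

lemma tup_le (f : (Fin k → Finset ι) → ℝ) (hf : ∀ U, 0 ≤ f U) :
    ∑ a : ι → Option (Fin k), f (cl a) ≤ ∑ U, f U := by
  rw [← sum_image (s := univ) (g := cl) (f := f) (fun a _ b _ h => cl_inj h)]
  exact sum_le_sum_of_subset_of_nonneg (subset_univ _) (fun U _ _ => hf U)

lemma tup_ge (f : (Fin k → Finset ι) → ℝ) (hf : ∀ U, 0 ≤ f U)
    (hf0 : ∀ U, f U ≠ 0 → ∀ j l, j ≠ l → Disjoint (U j) (U l)) :
    ∑ U, f U ≤ ∑ a : ι → Option (Fin k), f (cl a) := by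
  rw [← sum_image (s := univ) (g := cl) (f := f) (fun a _ b _ h => cl_inj h)]
  apply le_of_eq
  symm
  refine sum_subset (subset_univ _) (fun U _ hU => ?_)
  by_contra h
  obtain ⟨a, rfl⟩ := cl_surj U (hf0 U h)
  exact hU (mem_image_of_mem _ (mem_univ _))

lemma prod_D0 (t : ι → ℝ) (a : ι → Option (Fin k)) :
    ∏ q, D0 (t q) (a q) = ∏ j, ∏ q ∈ cl a j, t q := by
  unfold cl
  simp_rw [prod_filter]
  rw [prod_comm]
  refine prod_congr rfl fun q _ => ?_
  rcases h : a q with _ | j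
  · simp [D0]
  · simp [D0, prod_ite_eq]

lemma qa_cl (p : ι → ℕ) (a : ι → Option (Fin k)) : qa p a = ∏ j, NU p (cl a j) := by
  unfold cl NU qa
  simp_rw [prod_filter]
  rw [prod_comm]
  refine prod_congr rfl fun q _ => ?_
  rcases h : a q with _ | j
  · simp
  · simp [prod_ite_eq]
end Tup2

section gfun
/-- the one variable weight -/
noncomputable def gg (Y L m : ℕ) : ℝ := ∑ l ∈ range (L + 1), (1 / 2 : ℝ) ^ l * if m ≤ Y ^ 2 ^ l then 1 else 0

lemma seq_le (n : ℕ) (x : ℕ → ℝ) (hx : ∀ l, x l = 0 ∨ x l = 1) :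
    ∑ l ∈ range n, (1 / 2 : ℝ) ^ l * x l ≤ 2 := by
  calc _ ≤ ∑ l ∈ range n, (1 / 2 : ℝ) ^ l := by
        refine sum_le_sum fun l _ => ?_
        rcases hx l with h | h <;> rw [h] <;> simp
    _ ≤ _ := by
        rw [geom_sum_eq (by norm_num)]
        have : (0 : ℝ) < (1 / 2) ^ n := by positivity
        rw [div_le_iff_of_neg (by norm_num)]
        linarith

lemma seq_sq (n : ℕ) : ∀ (x : ℕ → ℝ) (hx : ∀ l, x l = 0 ∨ x l = 1),
    (∑ l ∈ range n, (1 / 2 : ℝ) ^ l * x l) ^ 2 ≤ 4 * ∑ l ∈ range n, (1 / 4 : ℝ) ^ l * x l := by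
  induction n with
  | zero => intro x hx; simp
  | succ n ih =>
    intro x hx
    have h0 : ∀ l, 0 ≤ x l := fun l => by rcases hx l with h | h <;> rw [h]; simp
    rcases hx 0 with h | h
    · rw [sum_range_succ', sum_range_succ', h]
      have := ih (fun l => x (l + 1)) (fun l => hx _)
      simp only [pow_succ, mul_zero, add_zero]
      have e1 : ∑ l ∈ range n, (1 / 2 : ℝ) ^ l * (1 / 2) * x (l + 1)
        = (1 / 2) * ∑ l ∈ range n, (1 / 2 : ℝ) ^ l * x (l + 1) := by
        rw [mul_sum]; exact sum_congr rfl fun _ _ => by ring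
      have e2 : ∑ l ∈ range n, (1 / 4 : ℝ) ^ l * (1 / 4) * x (l + 1)
        = (1 / 4) * ∑ l ∈ range n, (1 / 4 : ℝ) ^ l * x (l + 1) := by
        rw [mul_sum]; exact sum_congr rfl fun _ _ => by ring
      rw [e1, e2]
      nlinarith
    · have h1 := seq_le (n + 1) x hx
      have h2 : 0 ≤ ∑ l ∈ range (n + 1), (1 / 2 : ℝ) ^ l * x l :=
        sum_nonneg fun l _ => mul_nonneg (by positivity) (h0 l)
      have h3 : 1 ≤ ∑ l ∈ range (n + 1), (1 / 4 : ℝ) ^ l * x l := by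
        rw [sum_range_succ', h]
        have : 0 ≤ ∑ l ∈ range n, (1 / 4 : ℝ) ^ (l + 1) * x (l + 1) :=
          sum_nonneg fun l _ => mul_nonneg (by positivity) (h0 _)
        simp; simpa using this
      nlinarith

lemma gg_nonneg (Y L m : ℕ) : 0 ≤ gg Y L m :=
  sum_nonneg fun l _ => mul_nonneg (by positivity) (by split_ifs <;> simp)
lemma gg_le (Y L m : ℕ) : gg Y L m ≤ 2 :=
  seq_le _ (fun l => if m ≤ Y ^ 2 ^ l then 1 else 0) (fun l => by split_ifs <;> simp)
lemma gg_sq (Y L m : ℕ) : gg Y L m ^ 2 ≤ 4 * ∑ l ∈ range (L + 1), (1 / 4 : ℝ) ^ l * if m ≤ Y ^ 2 ^ l then 1 else 0 :=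
  seq_sq _ (fun l => if m ≤ Y ^ 2 ^ l then 1 else 0) (fun l => by split_ifs <;> simp)
lemma gg_anti (Y L : ℕ) {m n : ℕ} (h : m ≤ n) : gg Y L n ≤ gg Y L m := by
  unfold gg
  refine sum_le_sum fun l _ => mul_le_mul_of_nonneg_left ?_ (by positivity)
  split_ifs with h1 h2
  · rfl
  · exact absurd (h.trans h1) h2
  · simp
  · rfl
lemma gg_one_le (Y L m : ℕ) (h : m ≤ Y) : 1 ≤ gg Y L m := by
  unfold gg
  rw [sum_range_succ']
  have : 0 ≤ ∑ l ∈ range L, (1 / 2 : ℝ) ^ (l + 1) * (if m ≤ Y ^ 2 ^ (l + 1) then (1 : ℝ) else 0) :=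
    sum_nonneg fun l _ => mul_nonneg (by positivity) (by split_ifs <;> simp)
  simp only [pow_zero, pow_one, if_pos h]
  linarith
lemma gg_eq_zero (Y L m : ℕ) (hY : 1 ≤ Y) (h : Y ^ 2 ^ L < m) : gg Y L m = 0 := by
  unfold gg
  refine sum_eq_zero fun l hl => ?_
  rw [if_neg, mul_zero]
  have : 2 ^ l ≤ 2 ^ L := Nat.pow_le_pow_right (by norm_num) (by have := mem_range.1 hl; omega)
  have := Nat.pow_le_pow_right hY this
  omega
end gfun
end RG

namespace RG
open Finset

section Wt
variable {ι : Type} [Fintype ι] [DecidableEq ι] (p : ι → ℕ) [hp : ∀ i, Fact (p i).Prime] {W y R : ℕ}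

/-- weighted sum of a function of the product -/
noncomputable def ZF (f : ℕ → ℝ) : ℝ := ∑ V : Finset ι, TU p V * f (NU p V)

lemma ZF_nonneg (f : ℕ → ℝ) (hf : ∀ m, 0 ≤ f m) : 0 ≤ ZF p f :=
  sum_nonneg fun V _ => mul_nonneg (TU_pos p V).le (hf _)

lemma NU_singleton (q : ι) : NU p {q} = p q := by simp [NU]
lemma TU_singleton (q : ι) : TU p {q} = tt (p q) := by simp [TU]

lemma ZF_mem (f : ℕ → ℝ) (hf : ∀ m, 0 ≤ f m) (ha : ∀ m n, m ≤ n → f n ≤ f m) (q : ι) :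
    ∑ V : Finset ι, TU p V * f (NU p V) * im q V ≤ tt (p q) * ZF p f := by
  calc _ = ∑ V : Finset ι with {q} ⊆ V, TU p V * f (NU p V) := by
        rw [sum_filter]
        refine sum_congr rfl fun V _ => ?_
        simp [im]
    _ ≤ ∑ V : Finset ι with {q} ⊆ V, tt (p q) * (TU p (V \ {q}) * f (NU p (V \ {q}))) := by
        refine sum_le_sum fun V hV => ?_
        have hV' : {q} ⊆ V := (mem_filter.1 hV).2
        rw [TU_sdiff p hV', TU_singleton]
        have h1 := ha (NU p (V \ {q})) (NU p V) (by
          rw [NU_sdiff p hV']; exact Nat.le_mul_of_pos_right _ (NU_pos p _))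
        have := mul_le_mul_of_nonneg_left h1 (mul_pos (TU_pos p (V \ {q})) (tt_pos (p q))).le
        linarith
    _ ≤ _ := by
        rw [← mul_sum]
        exact mul_le_mul_of_nonneg_left (sup_sum {q} (fun V => TU p V * f (NU p V))
          (fun V => mul_nonneg (TU_pos p V).le (hf _))) (tt_pos _).le

/-- restricted sum -/
noncomputable def ZD (f : ℕ → ℝ) (A : Finset ι) : ℝ :=
  ∑ V : Finset ι, if Disjoint V A then TU p V * f (NU p V) else 0

lemma ZD_nonneg (f : ℕ → ℝ) (hf : ∀ m, 0 ≤ f m) (A : Finset ι) : 0 ≤ ZD p f A :=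
  sum_nonneg fun V _ => by split_ifs; exacts [mul_nonneg (TU_pos p V).le (hf _), le_rfl]

lemma ZD_ge (f : ℕ → ℝ) (hf : ∀ m, 0 ≤ f m) (ha : ∀ m n, m ≤ n → f n ≤ f m) (A : Finset ι) :
    ZF p f * (1 - ∑ q, tt (p q) * im q A) ≤ ZD p f A := by
  have h1 : ∀ V : Finset ι, TU p V * f (NU p V) - ∑ q, im q A * (TU p V * f (NU p V) * im q V)
      ≤ if Disjoint V A then TU p V * f (NU p V) else 0 := by
    intro V
    have h0 : 0 ≤ TU p V * f (NU p V) := mul_nonneg (TU_pos p V).le (hf _)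
    have hn : ∀ q, 0 ≤ im q A * (TU p V * f (NU p V) * im q V) := fun q =>
      mul_nonneg (im_nonneg _ _) (mul_nonneg h0 (im_nonneg _ _))
    split_ifs with h
    · have := sum_nonneg (s := univ) fun q _ => hn q
      linarith
    · obtain ⟨q, hq1, hq2⟩ := not_disjoint_iff.1 h
      have := single_le_sum (s := univ) (fun q _ => hn q) (mem_univ q)
      simp only [im, if_pos hq1, if_pos hq2] at this
      simp only [im]
      linarith
  have h2 := sum_le_sum (s := (univ : Finset (Finset ι))) fun V _ => h1 V
  rw [sum_sub_distrib, sum_comm] at h2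
  have h3 : ∑ q, ∑ V : Finset ι, im q A * (TU p V * f (NU p V) * im q V) ≤ ∑ q, im q A * (tt (p q) * ZF p f) := by
    refine sum_le_sum fun q _ => ?_
    rw [← mul_sum]
    exact mul_le_mul_of_nonneg_left (ZF_mem p f hf ha q) (im_nonneg _ _)
  have h4 : ∑ q, im q A * (tt (p q) * ZF p f) = ZF p f * ∑ q, tt (p q) * im q A := by
    rw [mul_sum]; exact sum_congr rfl fun _ _ => by ring
  have h5 : ZF p f = ∑ V : Finset ι, TU p V * f (NU p V) := rfl
  have h6 : ZD p f A = ∑ V : Finset ι, if Disjoint V A then TU p V * f (NU p V) else 0 := rfl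
  rw [h6]
  linarith

lemma ZD_sq (f : ℕ → ℝ) (hf : ∀ m, 0 ≤ f m) (ha : ∀ m n, m ≤ n → f n ≤ f m) (A : Finset ι) :
    ZF p f ^ 2 * (1 - 2 * ∑ q, tt (p q) * im q A) ≤ ZD p f A ^ 2 := by
  have h1 := ZD_ge p f hf ha A
  have h2 := ZD_nonneg p f hf A
  have h3 := ZF_nonneg p f hf
  have h4 : 0 ≤ ∑ q, tt (p q) * im q A := sum_nonneg fun q _ => mul_nonneg (tt_pos _).le (im_nonneg _ _)
  set s := ∑ q, tt (p q) * im q A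
  by_cases hs : s ≤ 1
  · have h5 : 0 ≤ ZF p f * (1 - s) := mul_nonneg h3 (by linarith)
    have h6 := pow_le_pow_left₀ h5 h1 2
    refine le_trans ?_ h6
    rw [mul_pow]
    exact mul_le_mul_of_nonneg_left (by nlinarith) (sq_nonneg _)
  · have : ZF p f ^ 2 * (1 - 2 * s) ≤ 0 := mul_nonpos_of_nonneg_of_nonpos (sq_nonneg _) (by linarith)
    exact this.trans (sq_nonneg _)

section bounds
variable (Y L : ℕ)

lemma ZF_ind (X : ℕ) (f : Finset ι → ℝ) : ∑ V : Finset ι, TU p V * (if NU p V ≤ X then (1 : ℝ) else 0) = SS p X := by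
  unfold SS
  exact sum_congr rfl fun V _ => by split_ifs <;> simp

lemma Z1_ge (e : Env p W y R) (hY : 1 ≤ Y) (hYy : Y ^ 2 ^ L ≤ y) :
    (L + 1) * ((W.totient / W : ℝ) * Real.log Y) ≤ ZF p (gg Y L) := by
  have h1 : ZF p (gg Y L) = ∑ l ∈ range (L + 1), (1 / 2 : ℝ) ^ l * SS p (Y ^ 2 ^ l) := by
    unfold ZF gg
    simp_rw [mul_sum]
    rw [sum_comm]
    refine sum_congr rfl fun l _ => ?_
    rw [← ZF_ind p _ (fun _ => 0), mul_sum]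
    exact sum_congr rfl fun V _ => by ring
  rw [h1]
  have h2 : ∀ l ∈ range (L + 1), (W.totient / W : ℝ) * Real.log Y ≤ (1 / 2 : ℝ) ^ l * SS p (Y ^ 2 ^ l) := by
    intro l hl
    have h3 : 2 ^ l ≤ 2 ^ L := Nat.pow_le_pow_right (by norm_num) (by have := mem_range.1 hl; omega)
    have h4 := SS_ge p e (Y ^ 2 ^ l) ((Nat.pow_le_pow_right hY h3).trans hYy)
    have hW : (0 : ℝ) < W := by exact_mod_cast e.hW0
    push_cast at h4
    rw [Real.log_pow] at h4
    push_cast at h4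
    have h5 : (W.totient / W : ℝ) * (2 ^ l * Real.log Y) ≤ SS p (Y ^ 2 ^ l) := by
      rw [div_mul_eq_mul_div, div_le_iff₀ hW]; linarith
    have h6 := mul_le_mul_of_nonneg_left h5 (show (0 : ℝ) ≤ (1 / 2) ^ l by positivity)
    refine le_trans (le_of_eq ?_) h6
    rw [one_div, inv_pow]
    field_simp
  refine le_trans (le_of_eq ?_) (sum_le_sum h2)
  simp

lemma Z2_ge (e : Env p W y R) (hYy : Y ≤ y) :
    (W.totient / W : ℝ) * Real.log Y ≤ ZF p (fun m => gg Y L m ^ 2) := by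
  have h4 := SS_ge p e Y hYy
  have hW : (0 : ℝ) < W := by exact_mod_cast e.hW0
  have h5 : (W.totient / W : ℝ) * Real.log Y ≤ SS p Y := by
    rw [div_mul_eq_mul_div, div_le_iff₀ hW]; linarith
  refine h5.trans ?_
  rw [← ZF_ind p _ (fun _ => 0)]
  refine sum_le_sum fun V _ => mul_le_mul_of_nonneg_left ?_ (TU_pos p V).le
  split_ifs with h
  · exact one_le_pow₀ (gg_one_le Y L _ h)
  · positivity

lemma SSl_le (e : Env p W y R) (hY : 1 + 2 * (W : ℝ) ^ 2 ≤ Real.log Y) (l : ℕ) :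
    SS p (Y ^ 2 ^ l) ≤ 4 * (W.totient / W) * (2 ^ l * Real.log Y) := by
  have h0 : 0 ≤ Real.log Y := le_trans (by positivity) hY
  have h1 : Real.log ((Y ^ 2 ^ l : ℕ) : ℝ) = 2 ^ l * Real.log Y := by
    push_cast; rw [Real.log_pow]; push_cast; ring
  rw [← h1]
  refine SS_le p e _ (hY.trans ?_)
  rw [h1]
  exact le_mul_of_one_le_left h0 (one_le_pow₀ (by norm_num))

lemma Z2_le (e : Env p W y R) (hY : 1 + 2 * (W : ℝ) ^ 2 ≤ Real.log Y) :
    ZF p (fun m => gg Y L m ^ 2) ≤ 32 * ((W.totient / W : ℝ) * Real.log Y) := by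
  have h0 : 0 ≤ Real.log Y := le_trans (by positivity) hY
  calc ZF p (fun m => gg Y L m ^ 2)
      ≤ ∑ V : Finset ι, TU p V * (4 * ∑ l ∈ range (L + 1), (1 / 4 : ℝ) ^ l * if NU p V ≤ Y ^ 2 ^ l then 1 else 0) :=
        sum_le_sum fun V _ => mul_le_mul_of_nonneg_left (gg_sq _ _ _) (TU_pos p V).le
    _ = 4 * ∑ l ∈ range (L + 1), (1 / 4 : ℝ) ^ l * SS p (Y ^ 2 ^ l) := by
        simp_rw [mul_sum]
        rw [sum_comm]
        refine sum_congr rfl fun l _ => ?_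
        rw [← ZF_ind p _ (fun _ => 0), mul_sum, mul_sum]
        exact sum_congr rfl fun V _ => by ring
    _ ≤ 4 * ∑ l ∈ range (L + 1), (1 / 2 : ℝ) ^ l * 1 * (4 * ((W.totient / W : ℝ) * Real.log Y)) := by
        refine mul_le_mul_of_nonneg_left (sum_le_sum fun l hl => ?_) (by norm_num)
        refine (mul_le_mul_of_nonneg_left (SSl_le p Y e hY l) (by positivity)).trans (le_of_eq ?_)
        have : (1 / 4 : ℝ) ^ l * 2 ^ l = (1 / 2) ^ l := by rw [← mul_pow]; norm_num
        rw [← this]; ring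
    _ ≤ _ := by
        rw [← sum_mul]
        have := seq_le (L + 1) (fun _ => 1) (fun _ => Or.inr rfl)
        have h5 : 0 ≤ (4 * ((W.totient / W : ℝ) * Real.log Y)) := by positivity
        have := mul_le_mul_of_nonneg_right this h5
        linarith

lemma E1_le (e : Env p W y R) (hY : 1 + 2 * (W : ℝ) ^ 2 ≤ Real.log Y) :
    ∑ V : Finset ι, TU p V * gg Y L (NU p V) ^ 2 * Real.log (NU p V)
      ≤ 16 * (L + 1) * ((W.totient / W : ℝ) * Real.log Y) * Real.log Y := by
  have h0 : 0 ≤ Real.log Y := le_trans (by positivity) hY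
  calc _ ≤ ∑ V : Finset ι, 4 * ∑ l ∈ range (L + 1), (1 / 4 : ℝ) ^ l * ((2 ^ l * Real.log Y) *
          (TU p V * if NU p V ≤ Y ^ 2 ^ l then 1 else 0)) := by
        refine sum_le_sum fun V _ => ?_
        have hN : (1 : ℝ) ≤ NU p V := by exact_mod_cast NU_pos p V
        have hl := Real.log_nonneg hN
        have hT := (TU_pos p V).le
        have h1 := mul_le_mul_of_nonneg_right (mul_le_mul_of_nonneg_left (gg_sq Y L (NU p V)) hT) hl
        refine h1.trans ?_
        rw [mul_left_comm, mul_assoc, mul_assoc, sum_mul, mul_sum]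
        refine mul_le_mul_of_nonneg_left ?_ (by norm_num)
        refine sum_le_sum fun l _ => ?_
        split_ifs with h
        · have h2 : Real.log (NU p V) ≤ 2 ^ l * Real.log Y := by
            have h1 : Real.log ((Y ^ 2 ^ l : ℕ) : ℝ) = 2 ^ l * Real.log Y := by
              push_cast; rw [Real.log_pow]; push_cast; ring
            rw [← h1]
            exact Real.log_le_log (by linarith) (by exact_mod_cast h)
          have h3 := mul_le_mul_of_nonneg_left h2 (mul_nonneg (show (0 : ℝ) ≤ (1 / 4) ^ l by positivity) hT)
          linarith
        · simp
    _ = 4 * ∑ l ∈ range (L + 1), (1 / 4 : ℝ) ^ l * ((2 ^ l * Real.log Y) * SS p (Y ^ 2 ^ l)) := by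
        simp_rw [← ZF_ind p _ (fun _ => 0), mul_sum]
        rw [sum_comm]
    _ ≤ 4 * ∑ l ∈ range (L + 1), 4 * ((W.totient / W : ℝ) * Real.log Y) * Real.log Y := by
        refine mul_le_mul_of_nonneg_left (sum_le_sum fun l hl => ?_) (by norm_num)
        have h1 : 0 ≤ (1 / 4 : ℝ) ^ l * (2 ^ l * Real.log Y) := by positivity
        have h2 := mul_le_mul_of_nonneg_left (SSl_le p Y e hY l) h1
        rw [← mul_assoc]
        refine h2.trans (le_of_eq ?_)
        have : (1 / 4 : ℝ) ^ l * 2 ^ l * 2 ^ l = 1 := by rw [← mul_pow, ← mul_pow]; norm_num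
        linear_combination (4 * (W.totient / W : ℝ) * Real.log Y * Real.log Y) * this
    _ = _ := by
        simp
        ring
end bounds
end Wt
end RG

namespace RG
open Finset

section Wt2
variable {ι : Type} [Fintype ι] [DecidableEq ι] (p : ι → ℕ) [hp : ∀ i, Fact (p i).Prime] {W y R : ℕ}
variable {k : ℕ} (Y L : ℕ)

/-- the weight on labelled tuples -/
noncomputable def GW (R : ℕ) (a : ι → Option (Fin k)) : ℝ :=
  if qa p a ≤ R then ∏ j, gg Y L (NU p (cl a j)) else 0

lemma GW_nonneg (a : ι → Option (Fin k)) : 0 ≤ GW p Y L R a := by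
  unfold GW; split_ifs
  · exact prod_nonneg fun j _ => gg_nonneg _ _ _
  · rfl

lemma GW_le (a : ι → Option (Fin k)) : GW p Y L R a ≤ 2 ^ k := by
  unfold GW; split_ifs
  · calc _ ≤ ∏ j : Fin k, (2 : ℝ) := prod_le_prod (fun j _ => gg_nonneg _ _ _) (fun j _ => gg_le _ _ _)
      _ = _ := by simp
  · positivity

lemma GW_supp (a : ι → Option (Fin k)) (h : GW p Y L R a ≠ 0) : qa p a ≤ R := by
  by_contra h1
  exact h (by unfold GW; rw [if_neg h1])

lemma GW_mono : MonoG (GW p Y L R : (ι → Option (Fin k)) → ℝ) := by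
  intro a q
  have hN : ∀ j, NU p (cl (Function.update a q none) j) ≤ NU p (cl a j) := by
    intro j
    unfold NU
    refine prod_le_prod_of_subset_of_one_le' ?_ (fun i _ _ => (hp i).out.one_lt.le)
    intro x hx
    rw [mem_cl] at hx ⊢
    by_cases h : x = q
    · rw [h] at hx; simp at hx
    · rwa [Function.update_of_ne h] at hx
  have hq : qa p (Function.update a q none) ≤ qa p a := by
    rw [qa_cl, qa_cl]
    exact prod_le_prod' fun j _ => hN j
  unfold GW
  split_ifs with h1 h2
  · exact prod_le_prod (fun j _ => gg_nonneg _ _ _) (fun j _ => gg_anti _ _ (hN j))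
  · exact absurd (hq.trans h1) h2
  · exact prod_nonneg fun j _ => gg_nonneg _ _ _
  · rfl

lemma GW_Zq : Zq (fun q => tt (p q)) (GW p Y L R : (ι → Option (Fin k)) → ℝ)
    ≤ ZF p (fun m => gg Y L m ^ 2) ^ k := by
  calc _ ≤ ∑ a : ι → Option (Fin k), ∏ j, (TU p (cl a j) * gg Y L (NU p (cl a j)) ^ 2) := by
        unfold Zq
        refine sum_le_sum fun a _ => ?_
        rw [prod_D0, prod_mul_distrib]
        refine mul_le_mul_of_nonneg_left ?_ (prod_nonneg fun j _ => (TU_pos p _).le)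
        unfold GW
        split_ifs
        · rw [prod_pow]
        · rw [zero_pow (by norm_num)]
          exact prod_nonneg fun j _ => sq_nonneg _
    _ ≤ ∑ U : Fin k → Finset ι, ∏ j, (TU p (U j) * gg Y L (NU p (U j)) ^ 2) :=
        tup_le (fun U => ∏ j, (TU p (U j) * gg Y L (NU p (U j)) ^ 2))
          (fun U => prod_nonneg fun j _ => mul_nonneg (TU_pos p _).le (sq_nonneg _))
    _ = ∏ j : Fin k, ∑ V : Finset ι, TU p V * gg Y L (NU p V) ^ 2 :=
        pi_sum_prod (X := fun _ : Fin k => Finset ι) (fun j V => TU p V * gg Y L (NU p V) ^ 2)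
    _ = _ := by
        rw [prod_const, card_univ, Fintype.card_fin]; rfl

lemma GI_ge (i : Fin k) (hY : 1 ≤ Y) (a' : ι → Option (Fin k)) (hi : cl a' i = ∅) (hR : qa p a' * Y ^ 2 ^ L ≤ R) :
    (∏ j ∈ univ.erase i, gg Y L (NU p (cl a' j))) * ZD p (gg Y L) (univ.biUnion (cl a'))
      ≤ GI i (fun q => tt (p q)) (GW p Y L R) a' := by
  set A := univ.biUnion (cl a') with hA
  have hAn : ∀ q, q ∉ A ↔ a' q = none := by
    intro q
    rw [hA, mem_biUnion]
    constructor
    · intro h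
      by_contra h2
      obtain ⟨j, hj⟩ := Option.ne_none_iff_exists'.1 h2
      exact h ⟨j, mem_univ _, (mem_cl _ _ _).2 hj⟩
    · rintro h ⟨j, _, hj⟩
      rw [mem_cl, h] at hj
      cases hj
  set S : Finset (Finset ι) := univ.filter fun V => Disjoint V A with hS
  let aV : Finset ι → (ι → Option (Fin k)) := fun V q => if q ∈ V then some i else a' q
  have hci : ∀ V, cl (aV V) i = V := by
    intro V
    ext q
    rw [mem_cl]
    simp only [aV]
    constructor
    · intro h
      by_contra hq
      rw [if_neg hq, ← mem_cl, hi] at h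
      simp at h
    · intro h; rw [if_pos h]
  have hcj : ∀ V ∈ S, ∀ j, j ≠ i → cl (aV V) j = cl a' j := by
    intro V hV j hj
    have hV : Disjoint V A := (mem_filter.1 hV).2
    ext q
    rw [mem_cl, mem_cl]
    simp only [aV]
    split_ifs with h
    · have := (hAn q).1 (disjoint_left.1 hV h)
      rw [this]
      simp only [reduceCtorEq, iff_false]
      intro h2
      exact hj (Option.some.inj h2).symm
    · rfl
  have hinj : Set.InjOn aV S := by
    intro V _ V' _ h
    rw [← hci V, ← hci V', h]
  have hker : ∀ V ∈ S, ∏ q, kap i (tt (p q)) (a' q) (aV V q) = TU p V := by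
    intro V hV
    have hV : Disjoint V A := (mem_filter.1 hV).2
    unfold TU
    rw [← prod_subset (subset_univ V)]
    · refine prod_congr rfl fun q hq => ?_
      have := (hAn q).1 (disjoint_left.1 hV hq)
      simp only [aV, if_pos hq, this, kap, if_true]
    · intro q _ hq
      simp only [aV, if_neg hq]
      rcases h : a' q with _ | j
      · rfl
      · have hji : j ≠ i := by
          rintro rfl
          rw [← mem_cl, hi] at h
          simp at h
        simp [kap, hji]
  calc _ = ∑ V ∈ S, (∏ j ∈ univ.erase i, gg Y L (NU p (cl a' j))) * (TU p V * gg Y L (NU p V)) := by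
        unfold ZD
        rw [mul_sum, hS, sum_filter]
        exact sum_congr rfl fun V _ => by split_ifs <;> simp
    _ ≤ ∑ V ∈ S, GW p Y L R (aV V) * ∏ q, kap i (tt (p q)) (a' q) (aV V q) := by
        refine sum_le_sum fun V hV => ?_
        rw [hker V hV]
        by_cases hN : NU p V ≤ Y ^ 2 ^ L
        · have hq : qa p (aV V) ≤ R := by
            refine le_trans ?_ hR
            rw [qa_cl, qa_cl, ← mul_prod_erase univ _ (mem_univ i), ← mul_prod_erase univ (fun j => NU p (cl a' j)) (mem_univ i), hci, hi]
            have : ∏ x ∈ univ.erase i, NU p (cl (aV V) x) = ∏ x ∈ univ.erase i, NU p (cl a' x) :=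
              prod_congr rfl fun j hj => by rw [hcj V hV j (ne_of_mem_erase hj)]
            rw [this]
            have h0 : NU p (∅ : Finset ι) = 1 := by simp [NU]
            rw [h0, one_mul, mul_comm]
            exact Nat.mul_le_mul_left _ hN
          unfold GW
          rw [if_pos hq, ← mul_prod_erase univ _ (mem_univ i), hci]
          have : ∏ x ∈ univ.erase i, gg Y L (NU p (cl (aV V) x)) = ∏ x ∈ univ.erase i, gg Y L (NU p (cl a' x)) :=
              prod_congr rfl fun j hj => by rw [hcj V hV j (ne_of_mem_erase hj)]
          rw [this]
          apply le_of_eq; ring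
        · rw [gg_eq_zero Y L _ hY (by omega), mul_zero, mul_zero]
          exact mul_nonneg (GW_nonneg p Y L _) (TU_pos p V).le
    _ = ∑ a ∈ S.image aV, GW p Y L R a * ∏ q, kap i (tt (p q)) (a' q) (a q) := by
        rw [sum_image hinj]
    _ ≤ _ := by
        unfold GI
        exact sum_le_sum_of_subset_of_nonneg (subset_univ _) (fun a _ _ => mul_nonneg (GW_nonneg p Y L _)
          (prod_nonneg fun q _ => kap_nonneg i (tt_pos _).le _ _))

end Wt2
end RG

namespace RG
open Finset

section Wt3
variable {ι : Type} [Fintype ι] [DecidableEq ι] (p : ι → ℕ) [hp : ∀ i, Fact (p i).Prime] {W y R : ℕ}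
variable {k : ℕ} (Y L : ℕ)

/-- good tuples -/
def good (R : ℕ) (i : Fin k) (U : Fin k → Finset ι) : Prop :=
  (∀ j l, j ≠ l → Disjoint (U j) (U l)) ∧ U i = ∅ ∧ (∏ j, NU p (U j)) * Y ^ 2 ^ L ≤ R

open Classical in
/-- good tuple contribution -/
noncomputable def fU (R : ℕ) (i : Fin k) (U : Fin k → Finset ι) : ℝ :=
  if good p Y L R i U then (∏ j, TU p (U j)) *
    ((∏ j ∈ univ.erase i, gg Y L (NU p (U j))) * ZD p (gg Y L) (univ.biUnion U)) ^ 2 else 0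

lemma fU_nonneg (i : Fin k) (U : Fin k → Finset ι) : 0 ≤ fU p Y L R i U := by
  unfold fU
  split_ifs
  · exact mul_nonneg (prod_nonneg fun j _ => (TU_pos p _).le) (sq_nonneg _)
  · rfl

lemma Zi_ge_fU (i : Fin k) (hY : 1 ≤ Y) :
    ∑ U : Fin k → Finset ι, fU p Y L R i U ≤ Zq (fun q => tt (p q)) (GI i (fun q => tt (p q)) (GW p Y L R)) := by
  refine (tup_ge (fU p Y L R i) (fU_nonneg p Y L i) (fun U hU => ?_)).trans ?_
  · by_contra h
    exact hU (by unfold fU; rw [if_neg]; exact fun h2 => h h2.1)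
  · unfold Zq
    refine sum_le_sum fun a _ => ?_
    have hD : 0 ≤ ∏ q, D0 (tt (p q)) (a q) := prod_nonneg fun q _ => D0_nonneg (tt_pos _).le _
    unfold fU
    split_ifs with h
    · rw [prod_D0]
      refine mul_le_mul_of_nonneg_left ?_ (prod_nonneg fun j _ => (TU_pos p _).le)
      refine pow_le_pow_left₀ (mul_nonneg (prod_nonneg fun j _ => gg_nonneg _ _ _)
        (ZD_nonneg p _ (gg_nonneg Y L) _)) ?_ 2
      refine GI_ge p Y L i hY a h.2.1 ?_
      rw [qa_cl]; exact h.2.2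
    · positivity

/-- tuple weights -/
noncomputable def wU (i j : Fin k) (U : Finset ι) : ℝ :=
  if j = i then (if U = ∅ then 1 else 0) else TU p U * gg Y L (NU p U) ^ 2

lemma wU_nonneg (i j : Fin k) (U : Finset ι) : 0 ≤ wU p Y L i j U := by
  unfold wU
  have := TU_pos p U
  split_ifs <;> positivity

lemma im_biUnion_le (U : Fin k → Finset ι) (q : ι) : im q (univ.biUnion U) ≤ ∑ j, im q (U j) := by
  by_cases h : q ∈ univ.biUnion U
  · obtain ⟨j, _, hj⟩ := mem_biUnion.1 h
    have := single_le_sum (s := univ) (fun j _ => im_nonneg q (U j)) (mem_univ j)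
    have h1 : im q (U j) = 1 := by simp [im, hj]
    have h2 : im q (univ.biUnion U) = 1 := by unfold im; rw [if_pos h]
    rw [h2, ← h1]; exact this
  · have h2 : im q (univ.biUnion U) = 0 := by unfold im; rw [if_neg h]
    rw [h2]; exact sum_nonneg fun j _ => im_nonneg _ _

lemma fU_ge (i : Fin k) (hY : 2 ≤ Y) (hR : Y ^ (4 * 2 ^ L) ≤ R) (U : Fin k → Finset ι) :
    ZF p (gg Y L) ^ 2 * ((∏ j, wU p Y L i j (U j)) *
      (1 - (∑ q, ∑ j, ∑ l, if j = l then 0 else im q (U j) * im q (U l))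
        - (∑ j, Real.log (NU p (U j)) / (3 / 4 * Real.log R))
        - 2 * ∑ j, ∑ q, tt (p q) * im q (U j))) ≤ fU p Y L R i U := by
  have hf0 := fU_nonneg (R := R) p Y L i U
  have hw0 : 0 ≤ ∏ j, wU p Y L i j (U j) := prod_nonneg fun j _ => wU_nonneg p Y L i j _
  have hZ : 0 ≤ ZF p (gg Y L) ^ 2 := sq_nonneg _
  have hY4 : 2 ≤ Y ^ (4 * 2 ^ L) := hY.trans (Nat.le_self_pow (by positivity) Y)
  have hR2 : (2 : ℝ) ≤ R := by exact_mod_cast hY4.trans hR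
  have hlR : 0 < Real.log R := Real.log_pos (by linarith)
  have hlg : ∀ j, 0 ≤ Real.log (NU p (U j)) := fun j => Real.log_natCast_nonneg _
  have hc0 : 0 ≤ ∑ q, ∑ j, ∑ l, if j = l then 0 else im q (U j) * im q (U l) := by
    refine sum_nonneg fun q _ => sum_nonneg fun j _ => sum_nonneg fun l _ => ?_
    split_ifs
    · rfl
    · exact mul_nonneg (im_nonneg _ _) (im_nonneg _ _)
  have hl0 : 0 ≤ ∑ j, Real.log (NU p (U j)) / (3 / 4 * Real.log R) :=
    sum_nonneg fun j _ => div_nonneg (hlg j) (by positivity)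
  have ht0 : 0 ≤ ∑ j, ∑ q, tt (p q) * im q (U j) :=
    sum_nonneg fun j _ => sum_nonneg fun q _ => mul_nonneg (tt_pos _).le (im_nonneg _ _)
  by_cases hi : U i = ∅
  swap
  · have : ∏ j, wU p Y L i j (U j) = 0 := prod_eq_zero (mem_univ i) (by simp [wU, hi])
    rw [this]; simpa using hf0
  by_cases hpd : ∀ j l, j ≠ l → Disjoint (U j) (U l)
  swap
  · push Not at hpd
    obtain ⟨j, l, hjl, hd⟩ := hpd
    obtain ⟨q, h1, h2⟩ := not_disjoint_iff.1 hd
    have : 1 ≤ ∑ q, ∑ j, ∑ l, if j = l then 0 else im q (U j) * im q (U l) := by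
      have a0 : ∀ q j l, 0 ≤ if j = l then 0 else im q (U j) * im q (U l) := by
        intro q j l
        split_ifs
        · rfl
        · exact mul_nonneg (im_nonneg _ _) (im_nonneg _ _)
      calc (1 : ℝ) = if j = l then 0 else im q (U j) * im q (U l) := by simp [hjl, im, h1, h2]
        _ ≤ ∑ l, if j = l then 0 else im q (U j) * im q (U l) :=
            single_le_sum (f := fun l => if j = l then 0 else im q (U j) * im q (U l)) (fun l _ => a0 q j l) (mem_univ l)
        _ ≤ ∑ j, ∑ l, if j = l then 0 else im q (U j) * im q (U l) :=
            single_le_sum (f := fun j => ∑ l, if j = l then 0 else im q (U j) * im q (U l))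
              (fun j _ => sum_nonneg fun l _ => a0 q j l) (mem_univ j)
        _ ≤ _ :=
            single_le_sum (f := fun q => ∑ j, ∑ l, if j = l then 0 else im q (U j) * im q (U l))
              (fun q _ => sum_nonneg fun j _ => sum_nonneg fun l _ => a0 q j l) (mem_univ q)
    refine le_trans (mul_nonpos_of_nonneg_of_nonpos hZ (mul_nonpos_of_nonneg_of_nonpos hw0 ?_)) hf0
    linarith
  by_cases hsz : (∏ j, NU p (U j)) * Y ^ 2 ^ L ≤ R
  swap
  · have : 1 ≤ ∑ j, Real.log (NU p (U j)) / (3 / 4 * Real.log R) := by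
      rw [← sum_div, le_div_iff₀ (by positivity), one_mul]
      have h1 : Real.log (((∏ j, NU p (U j)) * Y ^ 2 ^ L : ℕ) : ℝ) =
          (∑ j, Real.log (NU p (U j))) + 2 ^ L * Real.log Y := by
        push_cast
        rw [Real.log_mul, Real.log_prod, Real.log_pow]
        · push_cast; ring
        · intro j _
          have := NU_pos p (U j)
          positivity
        · refine prod_ne_zero_iff.2 fun j _ => ?_
          have := NU_pos p (U j)
          positivity
        · positivity
      have h2 : Real.log R ≤ Real.log (((∏ j, NU p (U j)) * Y ^ 2 ^ L : ℕ) : ℝ) :=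
        Real.log_le_log (by linarith) (by exact_mod_cast (not_le.1 hsz).le)
      have h3 : 4 * 2 ^ L * Real.log Y ≤ Real.log R := by
        have : Real.log ((Y ^ (4 * 2 ^ L) : ℕ) : ℝ) = 4 * 2 ^ L * Real.log Y := by
          push_cast; rw [Real.log_pow]; push_cast; ring
        rw [← this]
        exact Real.log_le_log (by positivity) (by exact_mod_cast hR)
      rw [h1] at h2
      linarith
    refine le_trans (mul_nonpos_of_nonneg_of_nonpos hZ (mul_nonpos_of_nonneg_of_nonpos hw0 ?_)) hf0
    linarith
  have hg : good p Y L R i U := ⟨hpd, hi, hsz⟩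
  have hw : ∏ j, wU p Y L i j (U j) = (∏ j, TU p (U j)) * (∏ j ∈ univ.erase i, gg Y L (NU p (U j))) ^ 2 := by
    rw [← mul_prod_erase univ _ (mem_univ i), ← mul_prod_erase univ (fun j => TU p (U j)) (mem_univ i), hi]
    have h1 : wU p Y L i i (∅ : Finset ι) = 1 := by simp [wU]
    have h2 : TU p (∅ : Finset ι) = 1 := by simp [TU]
    rw [h1, h2, one_mul, one_mul, ← prod_pow, ← prod_mul_distrib]
    refine prod_congr rfl fun j hj => ?_
    simp [wU, ne_of_mem_erase hj]
  unfold fU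
  rw [if_pos hg, mul_pow, ← mul_assoc (∏ j, TU p (U j)), ← hw]
  rw [mul_left_comm]
  refine mul_le_mul_of_nonneg_left ?_ hw0
  refine le_trans (mul_le_mul_of_nonneg_left ?_ hZ)
    (ZD_sq p (gg Y L) (gg_nonneg Y L) (fun m n h => gg_anti Y L h) (univ.biUnion U))
  have h9 : ∑ q, tt (p q) * im q (univ.biUnion U) ≤ ∑ j, ∑ q, tt (p q) * im q (U j) := by
    rw [sum_comm]
    refine sum_le_sum fun q _ => ?_
    rw [← mul_sum]
    exact mul_le_mul_of_nonneg_left (im_biUnion_le U q) (tt_pos _).le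
  linarith

lemma wU_sum (i j : Fin k) : ∑ V, wU p Y L i j V = if j = i then 1 else ZF p (fun m => gg Y L m ^ 2) := by
  unfold wU
  split_ifs
  · simp
  · rfl

lemma gg2_anti (Y L : ℕ) : ∀ m n, m ≤ n → gg Y L n ^ 2 ≤ gg Y L m ^ 2 := fun m n h =>
  pow_le_pow_left₀ (gg_nonneg _ _ _) (gg_anti Y L h) 2

theorem weights (e : Env p W y R) (k L : ℕ) (hk0 : 0 < k) (hL : 2 ^ L ≤ k) (Y : ℕ) (hRY : R = Y ^ (64 * k * (L + 1)))
    (hY : 1 + 2 * (W : ℝ) ^ 2 ≤ Real.log Y) (hkt : 18 * (k : ℝ) ^ 2 * ∑ q, tt (p q) ^ 2 ≤ 1) :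
    ∃ G : (ι → Option (Fin k)) → ℝ, (∀ a, 0 ≤ G a) ∧ MonoG G ∧ (∀ a, G a ≤ 2 ^ k) ∧
      (∀ a, G a ≠ 0 → qa p a ≤ R) ∧ ∀ i,
        1 ≤ Zq (fun q => tt (p q)) (GI i (fun q => tt (p q)) G) ∧
        Zq (fun q => tt (p q)) G * ((L + 1) * (W.totient / W) * Real.log R)
          ≤ 4096 * k * Zq (fun q => tt (p q)) (GI i (fun q => tt (p q)) G) := by
  refine ⟨GW p Y L R, GW_nonneg p Y L, GW_mono p Y L, GW_le p Y L, GW_supp p Y L, fun i => ?_⟩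
  set Z := Zq (fun q => tt (p q)) (GI i (fun q => tt (p q)) (GW p Y L R)) with hZ
  set Z1 := ZF p (gg Y L) with hZ1
  set Z2 := ZF p (fun m => gg Y L m ^ 2) with hZ2
  have hW1 : (1 : ℝ) ≤ W := by exact_mod_cast e.hW0
  have hlY : 0 < Real.log Y := lt_of_lt_of_le (by positivity) hY
  have hlY1 : 1 < Real.log Y := by nlinarith
  have hY2 : 2 ≤ Y := by
    by_contra h
    have : Y = 0 ∨ Y = 1 := by omega
    rcases this with h | h <;> rw [h] at hlY <;> simp at hlY
  have hLk : 4 * 2 ^ L ≤ 64 * k * (L + 1) := by nlinarith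
  have hR4 : Y ^ (4 * 2 ^ L) ≤ R := by rw [hRY]; exact Nat.pow_le_pow_right (by omega) hLk
  have hYLR : Y ^ 2 ^ L ≤ y := ((Nat.pow_le_pow_right (by omega) (by omega)).trans hR4).trans e.R_le_y
  have hYy : Y ≤ y := (Nat.le_self_pow (by positivity) Y).trans hYLR
  set Dl := (W.totient / W : ℝ) * Real.log Y with hDl
  have hD1 : 1 / (W : ℝ) ≤ W.totient / W := by
    have : (1 : ℝ) ≤ W.totient := by exact_mod_cast Nat.totient_pos.2 e.hW0
    gcongr
  have hDl2 : 2 ≤ Dl := by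
    have h1 : 1 / (W : ℝ) * (1 + 2 * (W : ℝ) ^ 2) ≤ Dl := by rw [hDl]; gcongr
    have h2 : 1 / (W : ℝ) * (1 + 2 * (W : ℝ) ^ 2) = 1 / W + 2 * W := by field_simp
    have : 0 < 1 / (W : ℝ) := by positivity
    linarith
  have b1 : (L + 1) * Dl ≤ Z1 := Z1_ge p Y L e (by omega) hYLR
  have b2 : Dl ≤ Z2 := Z2_ge p Y L e hYy
  have b3 : Z2 ≤ 32 * Dl := Z2_le p Y L e hY
  have b4 := E1_le p Y L e hY
  have hlR : Real.log R = 64 * k * (L + 1) * Real.log Y := by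
    rw [hRY]; push_cast; rw [Real.log_pow]; push_cast; ring
  have hkR : (1 : ℝ) ≤ k := by exact_mod_cast hk0
  have hL0 : (0 : ℝ) ≤ L := Nat.cast_nonneg L
  have hlR0 : 0 < Real.log R := by rw [hlR]; positivity
  have hmain := tuple_lower (wU p Y L i) (wU_nonneg p Y L i)
    (fun V => Real.log (NU p V) / (3 / 4 * Real.log R))
    (fun V => div_nonneg (Real.log_natCast_nonneg _) (by positivity)) (1 / (3 * k)) (fun q => tt (p q))
    (fun q => (tt_pos _).le) (fun j => by
      rw [wU_sum]
      split_ifs with h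
      · have : ∑ v, wU p Y L i j v * (Real.log (NU p v) / (3 / 4 * Real.log R)) = 0 := by
          refine sum_eq_zero fun V _ => ?_
          unfold wU
          rw [if_pos h]
          split_ifs with h2
          · rw [h2]; simp [NU]
          · simp
        rw [this]; positivity
      · simp_rw [← mul_div_assoc]
        rw [← sum_div, div_le_iff₀ (by positivity)]
        have h3 : ∑ v, wU p Y L i j v * Real.log (NU p v) =
          ∑ V : Finset ι, TU p V * gg Y L (NU p V) ^ 2 * Real.log (NU p V) :=
          sum_congr rfl fun V _ => by unfold wU; rw [if_neg h]
        rw [h3]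
        refine b4.trans ?_
        rw [hlR]
        have h4 : 1 / (3 * (k : ℝ)) * Z2 * (3 / 4 * (64 * k * (L + 1) * Real.log Y)) = 16 * (L + 1) * Z2 * Real.log Y := by
          field_simp; ring
        rw [h4]
        gcongr) (fun q j => by
      rw [wU_sum]
      split_ifs with h
      · have : ∑ v, wU p Y L i j v * im q v = 0 := by
          refine sum_eq_zero fun V _ => ?_
          unfold wU
          rw [if_pos h]
          split_ifs with h2
          · rw [h2]; simp [im]
          · simp
        rw [this, mul_one]; exact (tt_pos _).le
      · have h3 : ∑ v, wU p Y L i j v * im q v =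
          ∑ V : Finset ι, TU p V * gg Y L (NU p V) ^ 2 * im q V :=
          sum_congr rfl fun V _ => by unfold wU; rw [if_neg h]
        rw [h3]
        exact ZF_mem p (fun m => gg Y L m ^ 2) (fun m => sq_nonneg _) (gg2_anti Y L) q) hkt
      (by apply le_of_eq; field_simp)
  have hprod : ∏ j, ∑ v, wU p Y L i j v = Z2 ^ (k - 1) := by
    rw [← mul_prod_erase univ _ (mem_univ i)]
    rw [wU_sum, if_pos rfl, one_mul]
    rw [prod_congr rfl (fun j hj => by rw [wU_sum, if_neg (ne_of_mem_erase hj)] : ∀ j ∈ univ.erase i, ∑ v, wU p Y L i j v = Z2)]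
    rw [prod_const, card_erase_of_mem (mem_univ i), card_univ, Fintype.card_fin]
  rw [hprod] at hmain
  have hZge : Z1 ^ 2 * (1 / 2 * Z2 ^ (k - 1)) ≤ Z := by
    refine le_trans ?_ (Zi_ge_fU p Y L i (by omega))
    refine (mul_le_mul_of_nonneg_left hmain (sq_nonneg Z1)).trans ?_
    rw [mul_sum]
    exact sum_le_sum fun U _ => fU_ge p Y L i hY2 hR4 U
  have hZ2p : 1 ≤ Z2 ^ (k - 1) := one_le_pow₀ (by linarith)
  have hZ1sq : ((L + 1) * Dl) ^ 2 ≤ Z1 ^ 2 := pow_le_pow_left₀ (by positivity) b1 2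
  have hLD : 2 ≤ (L + 1) * Dl := by nlinarith
  constructor
  · nlinarith
  · have h1 := GW_Zq (R := R) p Y L (k := k)
    have h2 : Z2 ^ k = Z2 * Z2 ^ (k - 1) := by
      rw [← pow_succ', Nat.sub_add_cancel hk0]
    calc _ ≤ (32 * Dl * Z2 ^ (k - 1)) * ((L + 1) * (W.totient / W) * Real.log R) := by
          refine mul_le_mul_of_nonneg_right ?_ (by positivity)
          refine h1.trans ?_
          rw [← hZ2, h2]
          exact mul_le_mul_of_nonneg_right b3 (by linarith)
      _ = 4096 * k * (((L + 1) * Dl) ^ 2 * (1 / 2 * Z2 ^ (k - 1))) := by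
          rw [hlR, hDl]; ring
      _ ≤ 4096 * k * (Z1 ^ 2 * (1 / 2 * Z2 ^ (k - 1))) := by
          refine mul_le_mul_of_nonneg_left (mul_le_mul_of_nonneg_right hZ1sq (by linarith)) (by positivity)
      _ ≤ _ := mul_le_mul_of_nonneg_left hZge (by positivity)
end Wt3
end RG

namespace RG
open Finset

section pp
local notation "Λv" => ArithmeticFunction.vonMangoldt

lemma pp_point (y X n : ℕ) (hn : n ∈ Ioc y X) (h1 : ¬ n.Prime) (h2 : ∀ q : ℕ, q.Prime → q ∣ n → y < q) :
    Λv n / n ≤ ∑ m ∈ Ioc y X, ∑ j ∈ Ico 2 (X + 1), if m ^ j = n then Real.log m / (m : ℝ) ^ j else 0 := by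
  have h0 : ∀ m j : ℕ, 0 ≤ if m ^ j = n then Real.log m / (m : ℝ) ^ j else 0 := by
    intro m j
    split_ifs
    · exact div_nonneg (Real.log_natCast_nonneg m) (by positivity)
    · rfl
  by_cases hp : IsPrimePow n
  · rw [isPrimePow_nat_iff] at hp
    obtain ⟨q, j, hq, hj, rfl⟩ := hp
    have hj2 : 2 ≤ j := by
      by_contra hj1
      have : j = 1 := by omega
      rw [this, pow_one] at h1
      exact h1 hq
    have hyq : y < q := h2 q hq (dvd_pow_self q (by omega))
    have hX := (mem_Ioc.1 hn).2
    have hqX : q ≤ X := (Nat.le_self_pow (by omega) q).trans hX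
    have hjX : j < X + 1 := by have := Nat.lt_pow_self (n := j) hq.one_lt; omega
    calc Λv (q ^ j) / ((q ^ j : ℕ) : ℝ) = if q ^ j = q ^ j then Real.log q / (q : ℝ) ^ j else 0 := by
          rw [if_pos rfl, ArithmeticFunction.vonMangoldt_apply_pow (by omega),
            ArithmeticFunction.vonMangoldt_apply_prime hq]
          push_cast; rfl
      _ ≤ ∑ i ∈ Ico 2 (X + 1), if q ^ i = q ^ j then Real.log q / (q : ℝ) ^ i else 0 :=
          single_le_sum (f := fun i => if q ^ i = q ^ j then Real.log q / (q : ℝ) ^ i else 0)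
            (fun i _ => h0 q i) (mem_Ico.2 ⟨hj2, hjX⟩)
      _ ≤ _ := single_le_sum (f := fun m => ∑ i ∈ Ico 2 (X + 1), if m ^ i = q ^ j then Real.log m / (m : ℝ) ^ i else 0)
            (fun m _ => sum_nonneg fun i _ => h0 m i) (mem_Ioc.2 ⟨hyq, hqX⟩)
  · rw [ArithmeticFunction.vonMangoldt_eq_zero_iff.2 hp, zero_div]
    exact sum_nonneg fun m _ => sum_nonneg fun j _ => h0 m j

lemma pp_tail (y X : ℕ) (hy : 2 ≤ y) (c : ℕ → ℝ) (hc : ∀ n ∈ Ioc y X, c n ≠ 0 →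
      ¬ n.Prime ∧ (∀ q : ℕ, q.Prime → q ∣ n → y < q) ∧ c n ≤ Λv n / n) :
    ∑ n ∈ Ioc y X, c n ≤ 32 / √y := by
  have hy0 : (0 : ℝ) < y := by positivity
  calc ∑ n ∈ Ioc y X, c n ≤ ∑ n ∈ Ioc y X, ∑ m ∈ Ioc y X, ∑ j ∈ Ico 2 (X + 1),
        if m ^ j = n then Real.log m / (m : ℝ) ^ j else 0 := by
        refine sum_le_sum fun n hn => ?_
        by_cases h : c n = 0
        · rw [h]
          refine sum_nonneg fun m _ => sum_nonneg fun j _ => ?_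
          split_ifs
          · exact div_nonneg (Real.log_natCast_nonneg m) (by positivity)
          · rfl
        · obtain ⟨h1, h2, h3⟩ := hc n hn h
          exact h3.trans (pp_point y X n hn h1 h2)
    _ = ∑ m ∈ Ioc y X, ∑ j ∈ Ico 2 (X + 1), ∑ n ∈ Ioc y X, if m ^ j = n then Real.log m / (m : ℝ) ^ j else 0 := by
        rw [sum_comm]
        refine sum_congr rfl fun m _ => sum_comm
    _ ≤ ∑ m ∈ Ioc y X, ∑ j ∈ Ico 2 (X + 1), Real.log m / (m : ℝ) ^ j := by
        refine sum_le_sum fun m _ => sum_le_sum fun j _ => ?_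
        rw [sum_ite_eq]
        split_ifs
        · rfl
        · exact div_nonneg (Real.log_natCast_nonneg m) (by positivity)
    _ ≤ ∑ m ∈ Ioc y X, (2 / √y) * (Real.log m * gw (1 / 2) m) := by
        refine sum_le_sum fun m hm => ?_
        have hm' := (mem_Ioc.1 hm).1
        have hmy : (y : ℝ) ≤ m := by exact_mod_cast hm'.le
        have hm2 : (2 : ℝ) ≤ m := by exact_mod_cast (hy.trans hm'.le)
        have hl := Real.log_natCast_nonneg m
        have h1 : ∑ j ∈ Ico 2 (X + 1), Real.log m / (m : ℝ) ^ j = Real.log m * ∑ j ∈ Ico 2 (X + 1), (1 / (m : ℝ)) ^ j := by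
          rw [mul_sum]
          exact sum_congr rfl fun j _ => by rw [one_div, inv_pow]; rfl
        have h2 : (1 / (m : ℝ)) ≤ 1 / 2 := one_div_le_one_div_of_le (by norm_num) hm2
        have h3 := geom_sum_Ico_le_of_lt_one (x := 1 / (m : ℝ)) (by positivity) (by linarith) (m := 2) (n := X + 1)
        have h4 : (1 / (m : ℝ)) ^ 2 / (1 - 1 / m) ≤ 2 * (1 / (m : ℝ)) ^ 2 := by
          rw [div_le_iff₀ (by linarith)]
          nlinarith [sq_nonneg (1 / (m : ℝ))]
        have h5 : (1 / (m : ℝ)) ^ 2 ≤ 1 / √y * gw (1 / 2) m := by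
          have h6 : (1 / (m : ℝ)) ^ 2 = 1 / √m * gw (1 / 2) m := by
            unfold gw
            rw [Real.sqrt_eq_rpow, one_div, one_div, ← Real.rpow_neg (by linarith), ← Real.rpow_add (by linarith), inv_pow, ← Real.rpow_natCast, ← Real.rpow_neg (by linarith)]
            norm_num
          rw [h6]
          refine mul_le_mul_of_nonneg_right ?_ (gw_nonneg _ _)
          exact one_div_le_one_div_of_le (Real.sqrt_pos.2 hy0) (Real.sqrt_le_sqrt hmy)
        rw [h1]
        have h7 := mul_le_mul_of_nonneg_left ((h3.trans h4).trans (mul_le_mul_of_nonneg_left h5 (by norm_num))) hl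
        refine h7.trans (le_of_eq ?_)
        ring
    _ ≤ 2 / √y * 16 := by
        rw [← mul_sum]
        refine mul_le_mul_of_nonneg_left ?_ (by positivity)
        refine (sum_log_gw_le (1 / 2) (by norm_num) y X (by omega)).trans ?_
        norm_num
    _ = _ := by ring
end pp

section FIb
variable {ι : Type} [Fintype ι] [DecidableEq ι] {p : ι → ℕ} [hp : ∀ i, Fact (p i).Prime] {W y R : ℕ}

local notation "Λv" => ArithmeticFunction.vonMangoldt

lemma FI_abs_le {k : ℕ} (i : Fin k) (h1 : ∏ q, (1 + k * tt (p q) ^ 2) ≤ 2) (G : (ι → Option (Fin k)) → ℝ)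
    (hG : ∀ a, 0 ≤ G a) (hGM : ∀ a, G a ≤ R) (hGR : ∀ a, G a ≠ 0 → qa p a ≤ R) (σ : ι → Option (Fin k)) :
    FI i (fun q => tt (p q)) G σ ^ 2 ≤ 4 * (R : ℝ) ^ 8 := by
  have h2 := K_bound p R h1 G R (by positivity) hGM hGR
  have h3 : |FI i (fun q => tt (p q)) G σ| ≤ 2 * (R : ℝ) ^ 4 := by
    calc _ ≤ ∑ a, |G a * ∏ q, ui i (tt (p q)) (a q) (σ q)| := abs_sum_le_sum_abs _ _
      _ ≤ ∑ a, G a * qa p a := by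
          refine sum_le_sum fun a _ => ?_
          rw [abs_mul, abs_of_nonneg (hG a), abs_prod]
          refine mul_le_mul_of_nonneg_left ?_ (hG a)
          have h5 : ∏ q, |ui i (tt (p q)) (a q) (σ q)| ≤ 1 :=
            prod_le_one (fun q _ => abs_nonneg _) (fun q _ => ui_abs i _ (tt_pos _).le (tt_le_one _) _ _)
          refine h5.trans ?_
          exact_mod_cast qa_pos p a
      _ ≤ _ := h2
      _ = _ := by ring
  rw [← sq_abs]
  calc _ ≤ (2 * (R : ℝ) ^ 4) ^ 2 := pow_le_pow_left₀ (abs_nonneg _) h3 2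
    _ = _ := by ring

theorem main_i (e : Env p W y R) [NeZero W] (J B : ℕ) (hyJ : y = 2 ^ 2 ^ J) (hyR : y = R ^ 1024) (hp2 : ∀ i, 2 < p i)
    (hpy : ∀ i, p i ≤ y) {k : ℕ} (i : Fin k) (r : ∀ q, Fin k → ZMod (p q)) (hr : ∀ q, Function.Injective (r q))
    (hi : ∀ q, r q i = 0) (G : (ι → Option (Fin k)) → ℝ) (hG : ∀ a, 0 ≤ G a) (hm : MonoG G)
    (hGM : ∀ a, G a ≤ R) (hGR : ∀ a, G a ≠ 0 → qa p a ≤ R)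
    (h1k : ∏ q, (1 + k * tt (p q) ^ 2) ≤ 2) (h2k : ∑ q, (k * tt (p q)) ^ 2 ≤ 1 / 2)
    (δ : ℝ) (hδ : ∀ q, k * tt (p q) ≤ δ) (hδ0 : 0 ≤ δ) (hδ1 : δ ≤ 1) (E : ℝ) (hE : 8 ≤ E)
    (ε : ℝ) (hε : 4 * ((1 / 4 : ℝ) ^ B * Real.exp 64) ≤ ε) (hε1 : ε ≤ 1) (hyB : 8 * B + 19 ≤ y)
    (hcon : 180 * 1024 ^ 2 * √δ * E ^ 2 + 8 * ε * E + 3073 * (8 * B + 18) ^ 2 / E ≤ 1 / 16)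
    (b : ZMod W) (hb : IsUnit b) (X : ℕ) (hX : y ^ (8 * B + 18) ≤ X) (ℓ : ℝ) (hℓ : ℓ = E * Real.log y)
    (Z : ℝ) (hZ : Z = Zq (fun q => tt (p q)) (GI i (fun q => tt (p q)) G)) (hZ1 : 1 ≤ Z)
    (hdir : ℓ / (2 * W.totient) ≤ ∑ n ∈ Ioc y X, if n.Prime then Λv n * (if (n : ZMod W) = b then gw (1 / ℓ) n else 0) else 0)
    (htail : ∑ n ∈ Ioc X (X ^ 2), Real.log n * gw (1 / ℓ) n ≤ ℓ / (32 * W.totient)) :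
    Z * (ℓ / (8 * W.totient)) ≤ ∑ n ∈ Ioc y X, if n.Prime then Λv n * (if (n : ZMod W) = b then
        FI i (fun q => tt (p q)) G (sv p r (rs p n)) ^ 2 * gw (1 / ℓ) n else 0) else 0 := by
  have hcore := coreT e J B hyJ hyR hp2 hpy i r hr hi G hG hm hGM hGR h1k δ hδ hδ0 hδ1 E (by linarith) ε hε hε1 hyB
    b hb X hX ℓ hℓ Z hZ hZ1
  set t : ι → ℝ := fun q => tt (p q) with ht
  have ht0 : ∀ q, 0 ≤ t q := fun q => (tt_pos _).le
  have hk1 : ∀ q, k * t q ≤ 1 := fun q => (hδ q).trans hδ1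
  have hR2 := e.hR
  have hRy := e.R_le_y
  have hy2 : 2 ≤ y := hR2.trans hRy
  have hφ : (1 : ℝ) ≤ W.totient := by exact_mod_cast Nat.totient_pos.2 e.hW0
  have hly : 1 / 2 ≤ Real.log y := by
    have h1 : Real.log 2 ≤ Real.log y := Real.log_le_log (by norm_num) (by exact_mod_cast hy2)
    have := Real.log_two_gt_d9
    linarith
  have hℓ1 : 1 ≤ ℓ := by rw [hℓ]; nlinarith
  have hη : 0 ≤ 1 / ℓ := by positivity
  set μ := Ei i t (fun σ => FI i t G σ ^ 2) with hμ
  have hμ1 : 1 / 2 * Z ≤ μ := by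
    refine le_trans ?_ (mu_ge i t ht0 hk1 G hG hm)
    rw [← hZ]
    exact mul_le_mul_of_nonneg_right (by linarith) (by linarith)
  -- primes are rough
  have hrough : ∀ n ∈ Ioc y X, n.Prime → rho p n = 1 := by
    intro n hn hnp
    refine rho_one p fun j hj => ?_
    rw [rs_zero_iff] at hj
    have := (Nat.prime_dvd_prime_iff_eq (hp j).out hnp).1 hj
    have h3 := hpy j
    have h4 := (mem_Ioc.1 hn).1
    omega
  have hs1 : ℓ / (2 * W.totient) ≤ ∑ n ∈ Ioc y X, rho p n * Λv n * (if (n : ZMod W) = b then gw (1 / ℓ) n else 0) := by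
    refine hdir.trans (sum_le_sum fun n hn => ?_)
    split_ifs with h1 h2 h2
    · rw [hrough n hn h1, one_mul]
    · simp
    · exact mul_nonneg (mul_nonneg (rho_nonneg p n) ArithmeticFunction.vonMangoldt_nonneg) (gw_nonneg _ _)
    · simp
  have hpp : ∑ n ∈ Ioc y X, rho p n * Λv n * (if (n : ZMod W) = b then FI i t G (sv p r (rs p n)) ^ 2 * gw (1 / ℓ) n else 0)
      ≤ (∑ n ∈ Ioc y X, if n.Prime then Λv n * (if (n : ZMod W) = b then
        FI i t G (sv p r (rs p n)) ^ 2 * gw (1 / ℓ) n else 0) else 0) + 4 * (R : ℝ) ^ 8 * (32 / √y) := by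
    have h5 := pp_tail y X hy2 (fun n => if n.Prime then 0 else if (n : ZMod W) = b then rho p n * Λv n / n else 0) (by
      intro n hn hne
      by_cases h1 : n.Prime
      · simp [h1] at hne
      by_cases h2 : (n : ZMod W) = b
      swap
      · simp [h1, h2] at hne
      simp only [if_neg h1, if_pos h2] at hne ⊢
      have hρ : rho p n ≠ 0 := fun h => hne (by rw [h]; simp)
      refine ⟨h1, fun q hq hqn => ?_, ?_⟩
      · by_contra hqy
        rcases e.cov q hq (by omega) with h3 | ⟨j, hj⟩
        · rw [← h2] at hb
          rw [ZMod.isUnit_iff_coprime] at hb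
          exact Nat.not_coprime_of_dvd_of_dvd hq.one_lt hqn h3 hb
        · exact rho_ne p hρ j ((rs_zero_iff p n j).2 (hj ▸ hqn))
      · have h6 := mul_le_mul_of_nonneg_right (rho_le_one p n)
          (div_nonneg (ArithmeticFunction.vonMangoldt_nonneg (n := n)) (Nat.cast_nonneg (α := ℝ) n))
        rw [one_mul, ← mul_div_assoc] at h6
        exact h6)
    have h6 := mul_le_mul_of_nonneg_left h5 (show (0 : ℝ) ≤ 4 * (R : ℝ) ^ 8 by positivity)
    refine le_trans ?_ (add_le_add le_rfl h6)
    rw [mul_sum, ← sum_add_distrib]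
    refine sum_le_sum fun n hn => ?_
    have hF := FI_abs_le i h1k G hG hGM hGR (sv p r (rs p n))
    split_ifs with h2 h1 h1
    · rw [hrough n hn h1]; simp
    · rw [zero_add]
      have h7 := mul_le_mul hF (gw_le_inv (1 / ℓ) hη n) (gw_nonneg _ _) (by positivity)
      have h8 := mul_le_mul_of_nonneg_left h7 (mul_nonneg (rho_nonneg p n) (ArithmeticFunction.vonMangoldt_nonneg (n := n)))
      refine h8.trans (le_of_eq ?_)
      ring
    · simp
    · simp
  have hsm : 4 * (R : ℝ) ^ 8 * (32 / √y) ≤ ℓ / (32 * W.totient) := by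
    have h1 : √(y : ℝ) = (R : ℝ) ^ 512 := by
      rw [hyR]; push_cast
      rw [show (R : ℝ) ^ 1024 = ((R : ℝ) ^ 512) ^ 2 by rw [← pow_mul]]
      exact Real.sqrt_sq (by positivity)
    have hRr : (2 : ℝ) ≤ R := by exact_mod_cast hR2
    have h2 : (W.totient : ℝ) ≤ R := by exact_mod_cast (Nat.totient_le W).trans e.hWR
    have h3 : 4 * (R : ℝ) ^ 8 * (32 / √y) ≤ 1 / (32 * R) := by
      rw [h1, ← mul_div_assoc, div_le_div_iff₀ (by positivity) (by positivity), one_mul]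
      have h4 : (R : ℝ) ^ 512 = R ^ 9 * R ^ 503 := by rw [← pow_add]
      have h5 : (2 : ℝ) ^ 12 ≤ R ^ 503 :=
        (pow_le_pow_left₀ (by norm_num) hRr 12).trans (pow_le_pow_right₀ (by linarith) (by norm_num))
      rw [h4]
      have h6 := mul_le_mul_of_nonneg_left h5 (show (0 : ℝ) ≤ R ^ 9 by positivity)
      refine le_trans (le_of_eq ?_) h6
      ring
    refine h3.trans ?_
    gcongr
  set T : ℝ := (W.totient : ℝ) with hT
  have hT0 : 0 < T := by linarith
  set q := ℓ / T with hq
  have hq0 : 0 ≤ q := by positivity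
  have e1 : ℓ / (2 * T) = q / 2 := by rw [hq]; field_simp
  have e2 : ℓ / (8 * T) = q / 8 := by rw [hq]; field_simp
  have e3 : ℓ / (32 * T) = q / 32 := by rw [hq]; field_simp
  rw [e1] at hs1
  rw [e2]
  rw [e3] at hsm htail
  have hZq : 0 ≤ Z * q := mul_nonneg (by linarith) hq0
  have a1 : 1 / 2 * Z * (q / 2) ≤ μ * ∑ n ∈ Ioc y X, rho p n * Λv n * (if (n : ZMod W) = b then gw (1 / ℓ) n else 0) :=
    mul_le_mul hμ1 hs1 (by positivity) (le_trans (by positivity) hμ1)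
  have a2 := mul_le_mul_of_nonneg_left (mul_le_mul_of_nonneg_right hcon hq0) (show 0 ≤ Z by linarith)
  have a3 := mul_le_mul_of_nonneg_left htail (show 0 ≤ Z by linarith)
  have a4 : q / 32 ≤ Z * (q / 32) := le_mul_of_one_le_left (by positivity) hZ1
  linarith
end FIb
end RG

namespace RG
open Finset

section fin
local notation "Λv" => ArithmeticFunction.vonMangoldt
variable {ι : Type} [Fintype ι] [DecidableEq ι] {p : ι → ℕ} [hp : ∀ i, Fact (p i).Prime] {W y R : ℕ}

lemma log_gw_small (η : ℝ) (hη : 0 ≤ η) (N R : ℕ) (hR : 2 ≤ R) (hN : R ^ 40 ≤ N) :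
    2 * (4 * (R : ℝ) ^ 9) * (Real.log (N + 1 : ℕ) * gw η (N + 1)) ≤ 1 := by
  have hR' : (2 : ℝ) ≤ R := by exact_mod_cast hR
  have h0 : (0 : ℝ) < (N + 1 : ℕ) := by positivity
  have hg := gw_le_inv η hη (N + 1)
  have hg0 := gw_nonneg η (N + 1)
  set x : ℝ := ((N + 1 : ℕ) : ℝ) with hx
  have hx1 : (R : ℝ) ^ 40 ≤ x := by rw [hx]; exact_mod_cast hN.trans (Nat.le_succ N)
  have hs : (R : ℝ) ^ 20 ≤ √x := by
    apply Real.le_sqrt_of_sq_le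
    rw [← pow_mul]; exact hx1
  have hsp : 0 < √x := Real.sqrt_pos.2 h0
  have hl : Real.log x ≤ 2 * √x := by
    have h1 := Real.log_le_sub_one_of_pos hsp
    have h2 : Real.log √x = Real.log x / 2 := Real.log_sqrt h0.le
    linarith
  have hl0 : 0 ≤ Real.log x := by rw [hx]; exact Real.log_natCast_nonneg _
  have h3 : Real.log x * gw η (N + 1) ≤ 2 * √x * (1 / x) := by
    refine mul_le_mul hl ?_ hg0 (by positivity)
    simpa using hg
  have h4 : 2 * √x * (1 / x) = 2 / √x := by
    have := Real.mul_self_sqrt h0.le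
    field_simp
    nlinarith
  rw [h4] at h3
  have h5 : 2 / √x ≤ 2 / (R : ℝ) ^ 20 := by
    apply div_le_div_of_nonneg_left (by norm_num) (by positivity) hs
  have h6 : (16 : ℝ) ≤ R ^ 11 := by
    calc (16 : ℝ) ≤ 2 ^ 11 := by norm_num
      _ ≤ _ := pow_le_pow_left₀ (by norm_num) hR' _
  calc 2 * (4 * (R : ℝ) ^ 9) * (Real.log x * gw η (N + 1)) ≤ 2 * (4 * (R : ℝ) ^ 9) * (2 / (R : ℝ) ^ 20) :=
        mul_le_mul_of_nonneg_left (h3.trans h5) (by positivity)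
    _ = 16 / (R : ℝ) ^ 11 := by field_simp; norm_num
    _ ≤ 1 := by rw [div_le_one (by positivity)]; exact h6

lemma upper (e : Env p W y R) [NeZero W] {k : ℕ} (r : ∀ q, Fin k → ZMod (p q)) (hr : ∀ q, Function.Injective (r q))
    (G : (ι → Option (Fin k)) → ℝ) (hG : ∀ a, 0 ≤ G a)
    (hGM : ∀ a, G a ≤ R) (hGR : ∀ a, G a ≠ 0 → qa p a ≤ R)
    (h1k : ∏ q, (1 + k * tt (p q) ^ 2) ≤ 2) (hk1 : ∀ q, k * tt (p q) ≤ 1)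
    (b : ZMod W) (N X : ℕ) (hN : R ^ 40 ≤ N) (ℓ : ℝ) (hℓ : 1 ≤ ℓ) :
    ∑ n ∈ Ioc N X, (if (n : ZMod W) = b then FF (fun q => tt (p q)) G (sv p r (rs p n)) ^ 2 else 0) *
      (Real.log n * gw (1 / ℓ) n) ≤ 8 * Zq (fun q => tt (p q)) G * ℓ ^ 2 / W + 1 := by
  have hR := e.hR
  have hW1 : (1 : ℝ) ≤ W := by exact_mod_cast e.hW0
  have hWR : (W : ℝ) ≤ R := by exact_mod_cast e.hWR
  have hη : 0 < 1 / ℓ := by positivity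
  set t : ι → ℝ := fun q => tt (p q) with ht
  have ht0 : ∀ q, 0 ≤ t q := fun q => (tt_pos _).le
  have ht1 : ∀ q, t q ≤ 1 := fun q => tt_le_one _
  have hN3 : 3 ≤ N := by
    have : 2 ^ 40 ≤ R ^ 40 := Nat.pow_le_pow_left hR _
    have h2 : 3 ≤ 2 ^ 40 := by norm_num
    omega
  have hNpos : 0 < W * ∏ i, p i := Nat.mul_pos e.hW0 (prod_pos fun i _ => (hp i).out.pos)
  have hT := FF_TI p (W * ∏ i, p i) (dvd_mul_left _ _) r G hG
  have hK := K_bound p R h1k G R (by positivity) hGM hGR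
  have hK0 := hT.nonneg
  have h3 := (ind_TI (W * ∏ i, p i) W (dvd_mul_right _ _) b).mul (hT.mul hT)
  have hcnt := h3.count hNpos (fun n => Real.log n * gw (1 / ℓ) n) N X
    (fun m n hm hmn => log_gw_anti _ hη.le m n (by omega) hmn)
    (fun n hn => mul_nonneg (Real.log_natCast_nonneg n) (gw_nonneg _ _))
  have hav : av (W * ∏ i, p i) (fun n => (if (n : ZMod W) = b then (1 : ℝ) else 0) *
      (FF t G (sv p r (rs p n)) * FF t G (sv p r (rs p n)))) ≤ 2 * Zq t G / W := by
    have h4 := av_crt p e.hinj W e.hW b (fun x => FF t G (sv p r x) ^ 2)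
    have h5 : (fun n : ℕ => (if (n : ZMod W) = b then (1 : ℝ) else 0) *
      (FF t G (sv p r (rs p n)) * FF t G (sv p r (rs p n)))) = (fun n : ℕ => if (n : ZMod W) = b then FF t G (sv p r (rs p n)) ^ 2 else 0) := by
      funext n
      split_ifs
      · ring
      · ring
    rw [h5, h4]
    have h6 := avx_wf p r hr (fun σ => FF t G σ ^ 2)
    have h7 : avx p (fun x => FF t G (sv p r x) ^ 2) ≤ 2 * Zq t G := by
      refine (le_of_eq h6).trans ((full_le t ht0 ht1 hk1 G).trans ?_)
      exact mul_le_mul_of_nonneg_right h1k (Zq_nonneg _ ht0 _)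
    rw [smul_eq_mul, one_div, inv_mul_eq_div]
    exact div_le_div_of_nonneg_right h7 (by positivity)
  set A := av (W * ∏ i, p i) (fun n => (if (n : ZMod W) = b then (1 : ℝ) else 0) *
      (FF t G (sv p r (rs p n)) * FF t G (sv p r (rs p n)))) with hA
  have hlg := sum_log_gw_le (1 / ℓ) hη N X (by omega)
  have hlg0 : 0 ≤ ∑ n ∈ Ioc N X, Real.log n * gw (1 / ℓ) n := sum_nonneg fun n _ =>
    mul_nonneg (Real.log_natCast_nonneg n) (gw_nonneg _ _)
  have h8 : 4 / (1 / ℓ) ^ 2 = 4 * ℓ ^ 2 := by field_simp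
  rw [h8] at hlg
  have hZ0 := Zq_nonneg t ht0 G
  have h9 : (∑ n ∈ Ioc N X, Real.log n * gw (1 / ℓ) n) * A ≤ 4 * ℓ ^ 2 * (2 * Zq t G / W) := by
    calc _ ≤ (∑ n ∈ Ioc N X, Real.log n * gw (1 / ℓ) n) * (2 * Zq t G / W) := mul_le_mul_of_nonneg_left hav hlg0
      _ ≤ _ := mul_le_mul_of_nonneg_right hlg (by positivity)
  have h10 : 2 * (W * ((∑ a, G a * qa p a) * ∑ a, G a * qa p a)) * (Real.log (N + 1 : ℕ) * gw (1 / ℓ) (N + 1)) ≤ 1 := by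
    refine le_trans ?_ (log_gw_small (1 / ℓ) hη.le N R hR hN)
    refine mul_le_mul_of_nonneg_right ?_ (mul_nonneg (Real.log_natCast_nonneg _) (gw_nonneg _ _))
    refine mul_le_mul_of_nonneg_left ?_ (by norm_num)
    calc (W : ℝ) * ((∑ a, G a * qa p a) * ∑ a, G a * qa p a) ≤ R * ((R * (2 * R ^ 3)) * (R * (2 * R ^ 3))) := by
          refine mul_le_mul hWR (mul_le_mul hK hK hK0 (hK0.trans hK)) (mul_nonneg hK0 hK0) (by positivity)
      _ = _ := by ring
  have h12 : ∑ n ∈ Ioc N X, (if (n : ZMod W) = b then FF t G (sv p r (rs p n)) ^ 2 else 0) *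
      (Real.log n * gw (1 / ℓ) n) = ∑ n ∈ Ioc N X, (Real.log n * gw (1 / ℓ) n) * ((if (n : ZMod W) = b then (1 : ℝ) else 0) *
      (FF t G (sv p r (rs p n)) * FF t G (sv p r (rs p n)))) := by
    refine sum_congr rfl fun n _ => ?_
    split_ifs
    · ring
    · ring
  rw [h12]
  have h13 : 4 * ℓ ^ 2 * (2 * Zq t G / W) = 8 * Zq t G * ℓ ^ 2 / W := by ring
  have h14 : ∑ n ∈ Ioc N X, (Real.log n * gw (1 / ℓ) n) * ((if (n : ZMod W) = b then (1 : ℝ) else 0) *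
      (FF t G (sv p r (rs p n)) * FF t G (sv p r (rs p n)))) - (∑ n ∈ Ioc N X, Real.log n * gw (1 / ℓ) n) * A ≤ 1 := by
    refine le_trans (le_abs_self _) ?_
    have := hcnt.trans h10
    simpa only [Real.norm_eq_abs, smul_eq_mul] using this
  linarith

end fin
end RG

namespace RG
open Finset

section fin
local notation "Λv" => ArithmeticFunction.vonMangoldt
variable {ι : Type} [Fintype ι] [DecidableEq ι] {p : ι → ℕ} [hp : ∀ i, Fact (p i).Prime] {W y R : ℕ}

lemma sv_shift {k : ℕ} (h : Fin k → ℕ) (hinj : ∀ q, Function.Injective (fun j => (h j : ZMod (p q)))) (i : Fin k) (n : ℕ) :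
    sv p (fun q j => (h i : ZMod (p q)) - h j) (rs p (n + h i)) = sv p (fun q j => - (h j : ZMod (p q))) (rs p n) := by
  funext q
  refine Option.ext fun j => ?_
  have h1 : Function.Injective (fun j => (h i : ZMod (p q)) - h j) := fun a b hab => hinj q (by simpa using hab)
  have h2 : Function.Injective (fun j => - (h j : ZMod (p q))) := fun a b hab => hinj q (by simpa using hab)
  have := rst_eq_some _ h1 (rs p (n + h i) q) j
  have h3 := rst_eq_some _ h2 (rs p n q) j
  unfold sv
  rw [this, h3]
  simp only [rs]
  push_cast
  constructor
  · intro h; linear_combination h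
  · intro h; linear_combination h

lemma shift_sum {k : ℕ} (h : Fin k → ℕ) (hinj : ∀ q, Function.Injective (fun j => (h j : ZMod (p q)))) (i : Fin k)
    (hpy : ∀ i, p i ≤ y) (H : ℕ) (hH : h i ≤ H) (hyH : 2 * H < y) (b : ZMod W) (X : ℕ)
    (G : (ι → Option (Fin k)) → ℝ) (η : ℝ) (hη : 0 ≤ η) :
    (∑ n ∈ Ioc y X, if n.Prime then Λv n * (if (n : ZMod W) = b + h i then
        FI i (fun q => tt (p q)) G (sv p (fun q j => (h i : ZMod (p q)) - h j) (rs p n)) ^ 2 * gw η n else 0) else 0)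
    ≤ ∑ n ∈ Ioc (y - H) X, if (n + h i).Prime then (if (n : ZMod W) = b then
        FF (fun q => tt (p q)) G (sv p (fun q j => - (h j : ZMod (p q))) (rs p n)) ^ 2 else 0) * (2 * (Real.log n * gw η n)) else 0 := by
  set g : ℕ → ℝ := fun n => if (n + h i).Prime then (if (n : ZMod W) = b then
        FF (fun q => tt (p q)) G (sv p (fun q j => - (h j : ZMod (p q))) (rs p n)) ^ 2 else 0) * (2 * (Real.log n * gw η n)) else 0 with hg
  have hg0 : ∀ n, 0 ≤ g n := by
    intro n
    simp only [hg]
    have := mul_nonneg (Real.log_natCast_nonneg n) (gw_nonneg η n)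
    split_ifs
    · positivity
    · simp
    · rfl
  calc _ ≤ ∑ n ∈ Ioc y X, g (n - h i) := by
        refine sum_le_sum fun m hm => ?_
        obtain ⟨n, rfl⟩ : ∃ n, m = n + h i := ⟨m - h i, by have := (mem_Ioc.1 hm).1; omega⟩
        rw [Nat.add_sub_cancel]
        have hm1 := (mem_Ioc.1 hm).1
        simp only [hg]
        split_ifs with h1 h2 h3 h3
        · rw [sv_shift h hinj i n, ← FF_eq_FI i]
          · rw [ArithmeticFunction.vonMangoldt_apply_prime h1]
            have hn1 : 1 ≤ n := by omega
            have hl : Real.log (n + h i : ℕ) ≤ 2 * Real.log n := by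
              rw [show 2 * Real.log n = Real.log ((n ^ 2 : ℕ) : ℝ) by push_cast; rw [Real.log_pow]; norm_num]
              apply Real.log_le_log
              · exact_mod_cast h1.pos
              · have : n + h i ≤ n ^ 2 := by nlinarith [show h i < n by omega, show 1 ≤ n by omega, Nat.zero_le (h i)]
                exact_mod_cast this
            have hgw : gw η (n + h i) ≤ gw η n := gw_anti η hη n _ (by omega) (by omega)
            have hsq := sq_nonneg (FF (fun q => tt (p q)) G (sv p (fun q j => - (h j : ZMod (p q))) (rs p n)))
            calc _ ≤ 2 * Real.log n * (FF (fun q => tt (p q)) G (sv p (fun q j => - (h j : ZMod (p q))) (rs p n)) ^ 2 * gw η n) := by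
                  refine mul_le_mul hl (mul_le_mul_of_nonneg_left hgw hsq) (mul_nonneg hsq (gw_nonneg _ _)) ?_
                  have := Real.log_natCast_nonneg n
                  linarith
              _ = _ := by ring
          · intro q hq
            have h2' : Function.Injective (fun j => - (h j : ZMod (p q))) := fun a b hab => hinj q (by simpa using hab)
            have h4 : rst (fun j => - (h j : ZMod (p q))) (rs p n q) = some i := hq
            rw [rst_eq_some _ h2'] at h4
            have h5 : rs p (n + h i) q = 0 := by
              simp only [rs] at h4 ⊢
              push_cast
              rw [h4]; ring
            rw [rs_zero_iff] at h5
            have := (Nat.prime_dvd_prime_iff_eq (hp q).out h1).1 h5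
            have h3 := hpy q
            omega
        · exfalso
          apply h3
          have : ((n + h i : ℕ) : ZMod W) = n + h i := by push_cast; rfl
          rw [this] at h2
          exact add_right_cancel h2
        · rw [mul_zero]
          have := mul_nonneg (Real.log_natCast_nonneg n) (gw_nonneg η n)
          positivity
        · simp
        · rfl
    _ = ∑ n ∈ (Ioc y X).image (fun n => n - h i), g n := by
        rw [sum_image]
        intro a ha b hb hab
        simp only [coe_Ioc, Set.mem_Ioc] at ha hb
        dsimp only at hab
        omega
    _ ≤ _ := by
        refine sum_le_sum_of_subset_of_nonneg ?_ (fun n _ _ => hg0 n)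
        intro n hn
        obtain ⟨m, hm, rfl⟩ := mem_image.1 hn
        rw [mem_Ioc] at hm ⊢
        omega

theorem twoprimes (e : Env p W y R) [NeZero W] (J B : ℕ) (hyJ : y = 2 ^ 2 ^ J) (hyR : y = R ^ 1024) (hp2 : ∀ i, 2 < p i)
    (hpy : ∀ i, p i ≤ y) (k L : ℕ) (hk0 : 0 < k) (hL : 2 ^ L ≤ k) (Y : ℕ) (hRY : R = Y ^ (64 * k * (L + 1)))
    (hY : 1 + 2 * (W : ℝ) ^ 2 ≤ Real.log Y) (hkt : 18 * (k : ℝ) ^ 2 * ∑ q, tt (p q) ^ 2 ≤ 1)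
    (hkR : 2 ^ k ≤ R)
    (h1k : ∏ q, (1 + k * tt (p q) ^ 2) ≤ 2) (h2k : ∑ q, (k * tt (p q)) ^ 2 ≤ 1 / 2)
    (δ : ℝ) (hδ : ∀ q, k * tt (p q) ≤ δ) (hδ0 : 0 ≤ δ) (hδ1 : δ ≤ 1) (E : ℝ) (hE : 8 ≤ E)
    (ε : ℝ) (hε : 4 * ((1 / 4 : ℝ) ^ B * Real.exp 64) ≤ ε) (hε1 : ε ≤ 1) (hyB : 8 * B + 19 ≤ y)
    (hcon : 180 * 1024 ^ 2 * √δ * E ^ 2 + 8 * ε * E + 3073 * (8 * B + 18) ^ 2 / E ≤ 1 / 16)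
    (hLE : 2 ^ 30 * E ≤ L + 1)
    (h : Fin k → ℕ) (hinj : ∀ q, Function.Injective (fun j => (h j : ZMod (p q))))
    (H : ℕ) (hH : ∀ i, h i ≤ H) (hyH : 2 * H < y)
    (b : ZMod W) (hb : ∀ i, IsUnit (b + h i)) (X : ℕ) (hX : y ^ (8 * B + 18) ≤ X) (ℓ : ℝ) (hℓ : ℓ = E * Real.log y)
    (hdir : ∀ i, ℓ / (2 * W.totient) ≤ ∑ n ∈ Ioc y X, if n.Prime then Λv n * (if (n : ZMod W) = b + h i then gw (1 / ℓ) n else 0) else 0)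
    (htail : ∑ n ∈ Ioc X (X ^ 2), Real.log n * gw (1 / ℓ) n ≤ ℓ / (32 * W.totient)) :
    ∃ n ∈ Ioc (y - H) X, (n : ZMod W) = b ∧ ∃ i j, i ≠ j ∧ (n + h i).Prime ∧ (n + h j).Prime := by
  obtain ⟨G, hG, hm, hG2, hGR, hGi⟩ := weights p e k L hk0 hL Y hRY hY hkt
  have hGM : ∀ a, G a ≤ R := fun a => (hG2 a).trans (by exact_mod_cast hkR)
  by_contra hno
  push Not at hno
  have hR := e.hR
  have hRr : (2 : ℝ) ≤ R := by exact_mod_cast hR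
  have hW1 : (1 : ℝ) ≤ W := by exact_mod_cast e.hW0
  have hφ : (1 : ℝ) ≤ W.totient := by exact_mod_cast Nat.totient_pos.2 e.hW0
  have hφW : (W.totient : ℝ) ≤ W := by exact_mod_cast Nat.totient_le W
  have hly : Real.log y = 1024 * Real.log R := by
    rw [hyR]; push_cast; rw [Real.log_pow]; norm_num
  have hlY0 : 0 ≤ Real.log Y := Real.log_natCast_nonneg _
  have hlRY : Real.log Y ≤ Real.log R := by
    rw [hRY]; push_cast; rw [Real.log_pow]
    have : (1 : ℝ) ≤ (64 * k * (L + 1) : ℕ) := by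
      have : 1 ≤ 64 * k * (L + 1) := Nat.mul_pos (by omega) (by omega)
      exact_mod_cast this
    nlinarith
  have hlR : 0 < Real.log R := Real.log_pos (by linarith)
  have hlW : 1 + 2 * (W : ℝ) ^ 2 ≤ Real.log R := hY.trans hlRY
  have hℓR : ℓ = 1024 * E * Real.log R := by rw [hℓ, hly]; ring
  have hℓW : 8192 * (1 + 2 * (W : ℝ) ^ 2) ≤ ℓ := by
    rw [hℓR]; nlinarith
  have hℓ1 : 1 ≤ ℓ := by nlinarith
  have hη : 0 ≤ 1 / ℓ := by positivity
  set t : ι → ℝ := fun q => tt (p q) with ht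
  have ht0 : ∀ q, 0 ≤ t q := fun q => (tt_pos _).le
  have hZ0 := Zq_nonneg t ht0 G
  have hmain := fun i => main_i e J B hyJ hyR hp2 hpy i (fun q j => (h i : ZMod (p q)) - h j)
    (fun q a b hab => hinj q (by simpa using hab)) (fun q => by simp) G hG hm hGM hGR h1k h2k δ hδ hδ0 hδ1 E hE ε hε hε1 hyB
    hcon (b + h i) (hb i) X hX ℓ hℓ _ rfl (hGi i).1 (hdir i) htail
  have hsh := fun i => (hmain i).trans (shift_sum h hinj i hpy H (hH i) hyH b X G (1 / ℓ) hη)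
  have hsum := sum_le_sum (s := (univ : Finset (Fin k))) fun i _ => hsh i
  have hNR : R ^ 40 ≤ y - H := by
    have h1 : R ^ 40 * 2 ≤ y := by
      calc R ^ 40 * 2 ≤ R ^ 40 * R := Nat.mul_le_mul_left _ hR
        _ = R ^ 41 := (pow_succ _ _).symm
        _ ≤ R ^ 1024 := Nat.pow_le_pow_right (by omega) (by norm_num)
        _ = y := hyR.symm
    omega
  have hup := upper e (fun q j => - (h j : ZMod (p q))) (fun q a b hab => hinj q (by simpa using hab)) G hG hGM hGR h1k
    (fun q => (hδ q).trans hδ1) b (y - H) X hNR ℓ hℓ1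
  have hR1 : ∑ i, ∑ n ∈ Ioc (y - H) X, (if (n + h i).Prime then (if (n : ZMod W) = b then
        FF (fun q => tt (p q)) G (sv p (fun q j => - (h j : ZMod (p q))) (rs p n)) ^ 2 else 0) * (2 * (Real.log n * gw (1 / ℓ) n)) else 0)
      ≤ 2 * ∑ n ∈ Ioc (y - H) X, (if (n : ZMod W) = b then FF (fun q => tt (p q)) G (sv p (fun q j => - (h j : ZMod (p q))) (rs p n)) ^ 2 else 0) *
      (Real.log n * gw (1 / ℓ) n) := by
    rw [sum_comm, mul_sum]
    refine sum_le_sum fun n hn => ?_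
    have hlg := mul_nonneg (Real.log_natCast_nonneg n) (gw_nonneg (1 / ℓ) n)
    by_cases hnb : (n : ZMod W) = b
    · simp only [hnb, if_true]
      set v := FF (fun q => tt (p q)) G (sv p (fun q j => - (h j : ZMod (p q))) (rs p n)) ^ 2 * (2 * (Real.log n * gw (1 / ℓ) n)) with hv
      have hv0 : 0 ≤ v := by positivity
      have hle : ∑ i, (if (n + h i).Prime then v else 0) ≤ v := by
        by_cases hex : ∃ i, (n + h i).Prime
        · obtain ⟨i, hi⟩ := hex
          rw [sum_eq_single i]
          · rw [if_pos hi]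
          · intro j _ hj
            rw [if_neg (hno n hn hnb i j hj.symm hi)]
          · simp
        · push Not at hex
          rw [sum_eq_zero]
          · exact hv0
          · intro i _; rw [if_neg (hex i)]
      refine hle.trans (le_of_eq ?_)
      rw [hv]; ring
    · simp [hnb]
  have hlow : ∀ i, ℓ / (16 * W.totient) + Zq t G * (L + 1) * Real.log R * ℓ / (65536 * k * W)
      ≤ Zq t (GI i t G) * (ℓ / (8 * W.totient)) := by
    intro i
    obtain ⟨h1, h2⟩ := hGi i
    have hk' : (0 : ℝ) < k := by exact_mod_cast hk0
    have h3 : Zq t G * (L + 1) * Real.log R * ℓ / (65536 * k * W) = (Zq t G * ((L + 1) * (W.totient / W) * Real.log R)) * (ℓ / (65536 * k * W.totient)) := by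
      field_simp
    have h4 : (Zq t G * ((L + 1) * (W.totient / W) * Real.log R)) * (ℓ / (65536 * k * W.totient)) ≤ 4096 * k * Zq t (GI i t G) * (ℓ / (65536 * k * W.totient)) :=
      mul_le_mul_of_nonneg_right h2 (by positivity)
    have h5 : 4096 * k * Zq t (GI i t G) * (ℓ / (65536 * k * W.totient)) = Zq t (GI i t G) * (ℓ / (16 * W.totient)) := by
      field_simp; norm_num
    have h6 : 1 * (ℓ / (16 * W.totient)) ≤ Zq t (GI i t G) * (ℓ / (16 * W.totient)) :=
      mul_le_mul_of_nonneg_right h1 (by positivity)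
    have h7 : Zq t (GI i t G) * (ℓ / (8 * W.totient)) = 2 * (Zq t (GI i t G) * (ℓ / (16 * W.totient))) := by
      field_simp; norm_num
    rw [h3, h7]
    linarith
  have hlow' := sum_le_sum (s := (univ : Finset (Fin k))) fun i _ => hlow i
  rw [sum_const, card_univ, Fintype.card_fin, nsmul_eq_mul] at hlow'
  have hfin := (hlow'.trans hsum).trans (hR1.trans (mul_le_mul_of_nonneg_left hup (by norm_num)))
  have hk' : (1 : ℝ) ≤ k := by exact_mod_cast hk0
  have f1 : 2 < ℓ / (16 * W.totient) := by
    rw [lt_div_iff₀ (by positivity)]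
    nlinarith
  have f2 : k * (Zq t G * (L + 1) * Real.log R * ℓ / (65536 * k * W)) = Zq t G * ℓ / W * ((L + 1) * Real.log R / 65536) := by
    field_simp
  have f3 : 16 * ℓ ≤ (L + 1) * Real.log R / 65536 := by
    rw [hℓR]
    have := mul_le_mul_of_nonneg_right hLE hlR.le
    linarith
  have f4 : Zq t G * ℓ / W * (16 * ℓ) ≤ Zq t G * ℓ / W * ((L + 1) * Real.log R / 65536) :=
    mul_le_mul_of_nonneg_left f3 (by positivity)
  have f5 : 2 * (8 * Zq t G * ℓ ^ 2 / W + 1) = Zq t G * ℓ / W * (16 * ℓ) + 2 := by ring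
  have f6 : ℓ / (16 * W.totient) ≤ k * (ℓ / (16 * W.totient)) := le_mul_of_one_le_left (by positivity) hk'
  rw [mul_add, f2, f5] at hfin
  linarith

end fin
end RG

namespace RG
open Finset

lemma choose_B : ∃ B : ℕ, 8 * (4 * ((1 / 4 : ℝ) ^ B * Real.exp 64)) * (2 ^ 18 * (8 * B + 18) ^ 2) ≤ 1 / 64 := by
  have h := tendsto_pow_const_mul_const_pow_of_abs_lt_one 2 (r := 1 / 4) (by rw [abs_of_pos] <;> norm_num)
  set C : ℝ := 32 * Real.exp 64 * 2 ^ 18 * 676 with hC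
  have hC0 : 0 < C := by positivity
  have h1 := h.eventually (gt_mem_nhds (show (0 : ℝ) < 1 / 64 / C by positivity))
  obtain ⟨B, h2, hB⟩ := (h1.and (Filter.eventually_ge_atTop 1)).exists
  refine ⟨B, ?_⟩
  have hB' : (1 : ℝ) ≤ B := by exact_mod_cast hB
  rw [lt_div_iff₀ hC0] at h2
  have h3 : (8 * (B : ℝ) + 18) ^ 2 ≤ 676 * B ^ 2 := by nlinarith
  calc 8 * (4 * ((1 / 4 : ℝ) ^ B * Real.exp 64)) * (2 ^ 18 * (8 * B + 18) ^ 2)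
      ≤ 8 * (4 * ((1 / 4 : ℝ) ^ B * Real.exp 64)) * (2 ^ 18 * (676 * B ^ 2)) := by
        refine mul_le_mul_of_nonneg_left ?_ (by positivity)
        exact mul_le_mul_of_nonneg_left h3 (by norm_num)
    _ = B ^ 2 * (1 / 4) ^ B * C := by rw [hC]; ring
    _ ≤ _ := h2.le

lemma sum_sq_tail (w y : ℕ) (hw : 2 ≤ w) : ∑ q ∈ Ioc w y, tt q ^ 2 ≤ 2 / w := by
  have key : ∀ y, w ≤ y → ∑ q ∈ Ioc w y, tt q ^ 2 ≤ 1 / ((w : ℝ) - 1) - 1 / ((y : ℝ) - 1) := by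
    intro y hy
    induction y, hy using Nat.le_induction with
    | base => simp
    | succ n hn ih =>
      rw [← Finset.insert_Ioc_right_eq_Ioc_add_one (by omega), sum_insert (by simp)]
      have hn' : (2 : ℝ) ≤ n := by exact_mod_cast hw.trans hn
      have : tt (n + 1) ^ 2 ≤ 1 / ((n : ℝ) - 1) - 1 / (((n + 1 : ℕ) : ℝ) - 1) := by
        unfold tt
        push_cast
        rw [show (n : ℝ) + 1 - 1 = n by ring, div_sub_div _ _ (by linarith) (by linarith), div_pow,
          div_le_div_iff₀ (by nlinarith) (by nlinarith)]
        nlinarith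
      linarith
  have hw' : (2 : ℝ) ≤ w := by exact_mod_cast hw
  rcases le_total w y with h | h
  · have hy : (2 : ℝ) ≤ y := by exact_mod_cast hw.trans h
    have h1 := key y h
    have h2 : 0 ≤ 1 / ((y : ℝ) - 1) := one_div_nonneg.2 (by linarith)
    have h3 : 1 / ((w : ℝ) - 1) ≤ 2 / w := by
      rw [div_le_div_iff₀ (by linarith) (by linarith)]; linarith
    linarith
  · rw [Ioc_eq_empty (by omega), sum_empty]; positivity

lemma tail_small (f : ℕ → ℝ) (hf : Summable f) (c : ℝ) (hc : 0 < c) : ∃ X0 : ℕ, ∀ X, X0 ≤ X → ∀ Y, ∑ n ∈ Ioc X Y, f n ≤ c := by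
  obtain ⟨s, hs⟩ := summable_iff_vanishing_norm.1 hf c hc
  refine ⟨s.sup id, fun X hX Y => ?_⟩
  refine (le_abs_self _).trans (hs (Ioc X Y) ?_).le
  rw [disjoint_left]
  intro n hn hns
  have h1 : n ≤ s.sup id := le_sup (f := id) hns
  have := (mem_Ioc.1 hn).1
  omega

lemma exp_id (J L a : ℕ) : ((2 ^ 2 ^ J) ^ (64 * 2 ^ L * 2 ^ a)) ^ 1024 = 2 ^ 2 ^ (J + (6 + L + a) + 10) := by
  rw [← pow_mul, ← pow_mul]
  have : 2 ^ J * (64 * 2 ^ L * 2 ^ a * 1024) = 2 ^ (J + (6 + L + a) + 10) := by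
    rw [pow_add, pow_add, pow_add, pow_add]; ring
  rw [this]

set_option maxHeartbeats 1600000 in
theorem maynard_two : ∃ k : ℕ, 0 < k ∧ ∀ h : Fin k → ℕ, Function.Injective h → ∃ w0 : ℕ, ∀ w, w0 ≤ w → ∀ b0 : ℕ,
    (∀ i, (b0 + h i).Coprime (primorial w)) → ∀ N : ℕ, ∃ n, N < n ∧ n ≡ b0 [MOD primorial w] ∧
      ∃ i j, i ≠ j ∧ (n + h i).Prime ∧ (n + h j).Prime := by
  obtain ⟨B, hB⟩ := choose_B
  set ε : ℝ := 4 * ((1 / 4 : ℝ) ^ B * Real.exp 64) with hε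
  have hε0 : 0 < ε := by positivity
  obtain ⟨E, hE⟩ : ∃ E : ℝ, E = 2 ^ 18 * (8 * B + 18) ^ 2 := ⟨_, rfl⟩
  rw [← hE] at hB
  have hE8 : 8 ≤ E := by
    rw [hE]
    have h18 : (8 : ℝ) ≤ 2 ^ 18 := by norm_num
    have : (0 : ℝ) ≤ B := Nat.cast_nonneg _
    have h1 : (1 : ℝ) ≤ (8 * B + 18) ^ 2 := by nlinarith
    nlinarith
  have hε1 : ε ≤ 1 := by nlinarith
  clear_value ε
  obtain ⟨En, hEn⟩ := exists_nat_ge E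
  obtain ⟨a, ha⟩ : ∃ a : ℕ, 2 ^ 30 * En < 2 ^ a := pow_unbounded_of_one_lt _ (by norm_num)
  obtain ⟨L, hL⟩ : ∃ L : ℕ, L + 1 = 2 ^ a := ⟨2 ^ a - 1, Nat.sub_add_cancel Nat.one_le_two_pow⟩
  obtain ⟨k, hk⟩ : ∃ k : ℕ, k = 2 ^ L := ⟨_, rfl⟩
  have hk0 : 0 < k := by rw [hk]; positivity
  have hkr : (1 : ℝ) ≤ k := by exact_mod_cast hk0
  refine ⟨k, hk0, fun h hinj => ?_⟩
  set s : ℝ := 1 / (64 * 180 * 1024 ^ 2 * E ^ 2) with hs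
  have hs0 : 0 < s := by positivity
  set δ : ℝ := s ^ 2 with hδ
  have hδ0 : 0 < δ := by positivity
  have hs1 : s ≤ 1 := by
    rw [hs, div_le_one (by positivity)]
    nlinarith
  have hδ1 : δ ≤ 1 := by rw [hδ]; nlinarith
  have hsδ : √δ = s := by rw [hδ]; exact Real.sqrt_sq hs0.le
  have hcon : 180 * 1024 ^ 2 * √δ * E ^ 2 + 8 * ε * E + 3073 * (8 * B + 18) ^ 2 / E ≤ 1 / 16 := by
    have h1 : 180 * 1024 ^ 2 * √δ * E ^ 2 = 1 / 64 := by
      rw [hsδ, hs]; field_simp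
    have h2 : 3073 * (8 * (B : ℝ) + 18) ^ 2 / E = 3073 / 2 ^ 18 := by
      rw [hE]; field_simp
    rw [h1, h2]
    have : (3073 : ℝ) / 2 ^ 18 ≤ 1 / 64 := by norm_num
    linarith
  obtain ⟨H, hH⟩ : ∃ H, ∀ i, h i ≤ H := ⟨univ.sup h, fun i => le_sup (mem_univ i)⟩
  obtain ⟨w1, hw1⟩ := exists_nat_ge (k / δ)
  refine ⟨2 + H + w1 + 36 * k ^ 2, fun w hw b0 hb0 N => ?_⟩
  have hw2 : 2 ≤ w := by omega
  have hwH : H ≤ w := by omega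
  have hwr : (2 : ℝ) ≤ w := by exact_mod_cast hw2
  have hwδ : k / δ ≤ w := hw1.trans (by exact_mod_cast (by omega : w1 ≤ w))
  have hwk : 36 * (k : ℝ) ^ 2 ≤ w := by exact_mod_cast (by omega : 36 * k ^ 2 ≤ w)
  have hW0 := primorial_pos w
  set W := primorial w with hW
  have : NeZero W := ⟨hW0.ne'⟩
  set b : ZMod W := (b0 : ZMod W) with hb
  have hbu : ∀ i, IsUnit (b + h i) := by
    intro i
    have := (ZMod.isUnit_iff_coprime (b0 + h i) W).2 (hb0 i)
    push_cast at this
    exact this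
  have hdl := fun i => dir_lower (hbu i) E hE8
  choose y0 hy0 using hdl
  obtain ⟨K2, hK2⟩ : ∃ K2 : ℕ, 2 ^ k = K2 := ⟨_, rfl⟩
  obtain ⟨J, hJ⟩ : ∃ J : ℕ, J = W + K2 + ∑ i, y0 i + (8 * B + 19) + (N + 2 * H + 1) + 4 * (1 + 2 * W ^ 2) := ⟨_, rfl⟩
  obtain ⟨Y, hYJ⟩ : ∃ Y : ℕ, Y = 2 ^ 2 ^ J := ⟨_, rfl⟩
  obtain ⟨R, hRY⟩ : ∃ R : ℕ, R = Y ^ (64 * k * (L + 1)) := ⟨_, rfl⟩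
  obtain ⟨y, hyR⟩ : ∃ y : ℕ, y = R ^ 1024 := ⟨_, rfl⟩
  have hJY : J ≤ Y := by
    rw [hYJ]
    exact (Nat.lt_two_pow_self).le.trans (Nat.lt_two_pow_self).le
  have hYR : Y ≤ R := by
    rw [hRY]; exact Nat.le_self_pow (by positivity) Y
  have hRy : R ≤ y := by
    rw [hyR]; exact Nat.le_self_pow (by norm_num) R
  have hyJ : y = 2 ^ 2 ^ (J + (6 + L + a) + 10) := by
    rw [hyR, hRY, hYJ, hL, hk]
    exact exp_id J L a
  have hY : 1 + 2 * (W : ℝ) ^ 2 ≤ Real.log Y := by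
    rw [hYJ]; push_cast; rw [Real.log_pow]
    have h1 := Real.log_two_gt_d9
    have h2 : (J : ℝ) ≤ (2 ^ J : ℕ) := by exact_mod_cast (Nat.lt_two_pow_self).le
    have h3 : 4 * (1 + 2 * (W : ℝ) ^ 2) ≤ J := by exact_mod_cast (by omega : 4 * (1 + 2 * W ^ 2) ≤ J)
    have h4 : ((2 ^ J : ℕ) : ℝ) * (1 / 4) ≤ ((2 ^ J : ℕ) : ℝ) * Real.log 2 :=
      mul_le_mul_of_nonneg_left (by linarith) (Nat.cast_nonneg _)
    push_cast at h2 h4 ⊢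
    linarith
  set ℓ : ℝ := E * Real.log y with hℓ
  have hy1 : 1 < y := by omega
  have hℓ0 : 0 < ℓ := mul_pos (by linarith) (Real.log_pos (by exact_mod_cast hy1))
  have hX0 := fun i => hy0 i y (by
    have : y0 i ≤ ∑ i, y0 i := single_le_sum (fun _ _ => Nat.zero_le _) (mem_univ i)
    omega) ℓ rfl
  choose X0 hX0 using hX0
  have hφ : (0 : ℝ) < W.totient := by exact_mod_cast Nat.totient_pos.2 hW0
  obtain ⟨X1, hX1⟩ := tail_small _ (log_gw_summable (1 / ℓ) (by positivity)) (ℓ / (32 * W.totient)) (by positivity)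
  obtain ⟨X, hX⟩ : ∃ X : ℕ, X = y ^ (8 * B + 18) + ∑ i, X0 i + X1 := ⟨_, rfl⟩
  let ι : Type := {q // q ∈ (Ioc w y).filter Nat.Prime}
  let p : ι → ℕ := Subtype.val
  have : ∀ i, Fact (p i).Prime := fun i => ⟨(mem_filter.1 i.2).2⟩
  have hpw : ∀ i, w < p i := fun i => (mem_Ioc.1 (mem_filter.1 i.2).1).1
  have hpy : ∀ i, p i ≤ y := fun i => (mem_Ioc.1 (mem_filter.1 i.2).1).2
  have hsq : ∑ q, tt (p q) ^ 2 ≤ 2 / w := by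
    calc ∑ q, tt (p q) ^ 2 = ∑ q ∈ (Ioc w y).filter Nat.Prime, tt q ^ 2 :=
          sum_coe_sort ((Ioc w y).filter Nat.Prime) (fun q => tt q ^ 2)
      _ ≤ ∑ q ∈ Ioc w y, tt q ^ 2 := sum_le_sum_of_subset_of_nonneg (filter_subset _ _) (fun _ _ _ => sq_nonneg _)
      _ ≤ _ := sum_sq_tail w y hw2
  have hkw : 18 * (k : ℝ) ^ 2 * (2 / w) ≤ 1 := by
    rw [mul_div_assoc', div_le_one (by linarith)]; linarith
  have hkt : 18 * (k : ℝ) ^ 2 * ∑ q, tt (p q) ^ 2 ≤ 1 :=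
    (mul_le_mul_of_nonneg_left hsq (by positivity)).trans hkw
  have hs0' : 0 ≤ ∑ q, tt (p q) ^ 2 := sum_nonneg fun _ _ => sq_nonneg _
  have h1k : ∏ q, (1 + k * tt (p q) ^ 2) ≤ 2 := by
    calc ∏ q, (1 + k * tt (p q) ^ 2) ≤ ∏ q, Real.exp (k * tt (p q) ^ 2) := by
          refine prod_le_prod (fun q _ => by positivity) fun q _ => ?_
          rw [add_comm]; exact Real.add_one_le_exp _
      _ = Real.exp (k * ∑ q, tt (p q) ^ 2) := by rw [← Real.exp_sum, mul_sum]
      _ ≤ Real.exp (1 / 18) := by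
          refine Real.exp_le_exp.2 ?_
          nlinarith
      _ ≤ Real.exp (Real.log 2) := by
          refine Real.exp_le_exp.2 ?_
          have := Real.log_two_gt_d9
          linarith
      _ = 2 := Real.exp_log (by norm_num)
  have h2k : ∑ q, (k * tt (p q)) ^ 2 ≤ 1 / 2 := by
    simp_rw [mul_pow]
    rw [← mul_sum]
    linarith
  have e : Env p W y R := by
    refine ⟨Subtype.val_injective, fun i => ?_, fun q hq hqy => ?_, ?_, ?_, ?_, hW0, hyR.symm.le⟩
    · refine Nat.Coprime.symm ((Nat.Prime.coprime_iff_not_dvd (mem_filter.1 i.2).2).2 fun hd => ?_)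
      have h1 := (Nat.Prime.dvd_primorial_iff (mem_filter.1 i.2).2).1 hd
      have h2 := (mem_Ioc.1 (mem_filter.1 i.2).1).1
      omega
    · by_cases hqw : q ≤ w
      · left; exact (Nat.Prime.dvd_primorial_iff hq).2 hqw
      · right; exact ⟨⟨q, mem_filter.2 ⟨mem_Ioc.2 ⟨by omega, hqy⟩, hq⟩⟩, rfl⟩
    · refine le_trans (prod_le_prod (fun q _ => by positivity) fun q _ => ?_) h1k
      nlinarith [sq_nonneg (tt (p q))]
    · omega
    · omega
  have htt : ∀ q, k * tt (p q) ≤ δ := by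
    intro q
    have h1 : (w : ℝ) + 1 ≤ p q := by exact_mod_cast hpw q
    have h2 : tt (p q) ≤ 1 / w := by
      unfold tt
      exact one_div_le_one_div_of_le (by linarith) (by linarith)
    have h3 : (k : ℝ) ≤ w * δ := by rwa [div_le_iff₀ hδ0] at hwδ
    calc k * tt (p q) ≤ k * (1 / w) := mul_le_mul_of_nonneg_left h2 (by linarith)
      _ = k / w := by ring
      _ ≤ δ := by rw [div_le_iff₀ (by linarith)]; linarith
  have hinj' : ∀ q, Function.Injective (fun j => (h j : ZMod (p q))) := by
    intro q i j hij
    dsimp only at hij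
    rw [ZMod.natCast_eq_natCast_iff'] at hij
    have h1 := hH i
    have h2 := hH j
    have h3 := hpw q
    rw [Nat.mod_eq_of_lt (by omega), Nat.mod_eq_of_lt (by omega)] at hij
    exact hinj hij
  obtain ⟨n, hn, hnb, i, j, hij, hi, hj⟩ := twoprimes e _ B hyJ hyR (fun i => lt_of_le_of_lt hw2 (hpw i)) hpy k L hk0 hk.ge Y hRY hY hkt
    (by rw [hK2]; omega) h1k h2k δ htt hδ0.le hδ1 E hE8 ε hε.ge hε1 (by omega) hcon (by
      have h1 : (L : ℝ) + 1 = 2 ^ a := by exact_mod_cast hL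
      have h2 : (2 : ℝ) ^ 30 * En < 2 ^ a := by exact_mod_cast ha
      rw [h1]; linarith)
    h hinj' H hH (by omega) b hbu X (by omega) ℓ rfl (fun i => hX0 i X (by
      have : X0 i ≤ ∑ i, X0 i := single_le_sum (fun _ _ => Nat.zero_le _) (mem_univ i)
      omega)) (hX1 X (by omega) _)
  refine ⟨n, ?_, (ZMod.natCast_eq_natCast_iff _ _ _).1 hnb, i, j, hij, hi, hj⟩
  have := (mem_Ioc.1 hn).1
  omega

end RG

namespace RG
open Finset

lemma residue_exists (k Q : ℕ) (hQ : ∀ q, q.Prime → q ≤ k → q ∣ Q) (S : ℕ) (hS : S = 2 * Q * k) (q : ℕ) (hq : q.Prime) :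
    ∃ a : ℕ, (∀ j : Fin k, ¬ q ∣ a + 2 * Q * j) ∧
      ∀ u, u < S → (∀ j : Fin k, u ≠ 2 * Q * j) → Nat.nth Nat.Prime (S + u) = q → q ∣ a + u := by
  by_cases hex : ∃ u, u < S ∧ (∀ j : Fin k, u ≠ 2 * Q * j) ∧ Nat.nth Nat.Prime (S + u) = q
  · obtain ⟨u, huS, huj, huq⟩ := hex
    have hqS : S + u + 2 ≤ q := by rw [← huq]; exact Nat.add_two_le_nth_prime _
    refine ⟨q - u, fun j hd => ?_, fun v hv hvj hvq => ?_⟩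
    · have hj : 2 * Q * (j : ℕ) ≤ S := by rw [hS]; exact Nat.mul_le_mul_left _ j.2.le
      set x := 2 * Q * (j : ℕ) with hx
      have hne := huj j
      obtain ⟨c, hc⟩ := hd
      rcases Nat.lt_or_ge c 1 with h | h
      · have : c = 0 := by omega
        subst this
        omega
      · rcases Nat.lt_or_ge c 2 with h2 | h2
        · have : c = 1 := by omega
          subst this
          omega
        · have : q * 2 ≤ q * c := Nat.mul_le_mul_left _ h2
          omega
    · have h1 : S + v = S + u := Nat.nth_injective Nat.infinite_setOfPred_prime (hvq.trans huq.symm)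
      have : v = u := by omega
      subst this
      rw [Nat.sub_add_cancel (by omega)]
  · have hv : ∀ a, ∀ u, u < S → (∀ j : Fin k, u ≠ 2 * Q * j) → Nat.nth Nat.Prime (S + u) = q → q ∣ a + u :=
      fun a u h1 h2 h3 => absurd ⟨u, h1, h2, h3⟩ hex
    by_cases hqk : q ≤ k
    · refine ⟨1, fun j hd => ?_, hv 1⟩
      have h1 : q ∣ 2 * Q * (j : ℕ) := ((hQ q hq hqk).mul_left 2).mul_right _
      have h2 := (Nat.dvd_add_left h1).1 hd
      exact hq.one_lt.ne' (Nat.dvd_one.1 h2)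
    · have : Fact q.Prime := ⟨hq⟩
      obtain ⟨z, hz⟩ : ∃ z : ZMod q, z ∉ univ.image (fun j : Fin k => - ((2 * Q * (j : ℕ) : ℕ) : ZMod q)) := by
        by_contra hcon
        push Not at hcon
        have h1 : (univ : Finset (ZMod q)) ⊆ univ.image (fun j : Fin k => - ((2 * Q * (j : ℕ) : ℕ) : ZMod q)) := fun z _ => hcon z
        have h2 := (card_le_card h1).trans card_image_le
        rw [card_univ, ZMod.card, card_univ, Fintype.card_fin] at h2
        omega
      refine ⟨z.val, fun j hd => hz ?_, hv _⟩
      rw [← ZMod.natCast_eq_zero_iff] at hd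
      refine mem_image.2 ⟨j, mem_univ _, ?_⟩
      rw [Nat.cast_add, ZMod.natCast_zmod_val] at hd
      exact (eq_neg_of_add_eq_zero_left hd).symm

lemma crt_exists (k Q : ℕ) (hQ : ∀ q, q.Prime → q ≤ k → q ∣ Q) (S : ℕ) (hS : S = 2 * Q * k) (w : ℕ)
    (hw : Nat.nth Nat.Prime (2 * S) ≤ w) :
    ∃ b : ℕ, (∀ j : Fin k, (b + 2 * Q * j).Coprime (primorial w)) ∧
      ∀ u, u < S → (∀ j : Fin k, u ≠ 2 * Q * j) → ∃ q, q.Prime ∧ q ≤ w ∧ q ∣ b + u := by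
  have hres := fun q : {q : ℕ // q.Prime} => residue_exists k Q hQ S hS q.1 q.2
  choose a ha1 ha2 using hres
  let a' : ℕ → ℕ := fun q => if h : q.Prime then a ⟨q, h⟩ else 0
  have ha' : ∀ q (h : q.Prime), a' q = a ⟨q, h⟩ := fun q h => dif_pos h
  obtain ⟨b, hb⟩ := Nat.chineseRemainderOfFinset a' id ((range (w + 1)).filter Nat.Prime)
    (fun i hi => (mem_filter.1 hi).2.ne_zero) (by
      intro x hx y hy hxy
      simp only [coe_filter, Set.mem_setOf] at hx hy
      exact (Nat.coprime_primes hx.2 hy.2).2 hxy)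
  have hb' : ∀ q (h : q.Prime), q ≤ w → b ≡ a ⟨q, h⟩ [MOD q] := by
    intro q h hqw
    have := hb q (mem_filter.2 ⟨mem_range.2 (by omega), h⟩)
    rwa [ha' q h] at this
  refine ⟨b, fun j => ?_, fun u huS huj => ?_⟩
  · refine Nat.Coprime.symm (Nat.Coprime.symm ?_)
    refine Nat.coprime_of_dvd fun q hq hd1 hd2 => ?_
    have hqw := (Nat.Prime.dvd_primorial_iff hq).1 hd2
    refine ha1 ⟨q, hq⟩ j ?_
    exact ((hb' q hq hqw).add_right _).dvd_iff (dvd_refl _) |>.1 hd1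
  · have hq := Nat.prime_nth_prime (S + u)
    have hqw : Nat.nth Nat.Prime (S + u) ≤ w :=
      le_trans ((Nat.nth_monotone Nat.infinite_setOfPred_prime) (by omega)) hw
    refine ⟨_, hq, hqw, ?_⟩
    exact ((hb' _ hq hqw).add_right _).dvd_iff (dvd_refl _) |>.2 (ha2 ⟨_, hq⟩ u huS huj rfl)

lemma gaps (k : ℕ) (hk : ∀ h : Fin k → ℕ, Function.Injective h → ∃ w0 : ℕ, ∀ w, w0 ≤ w → ∀ b0 : ℕ,
    (∀ i, (b0 + h i).Coprime (primorial w)) → ∀ N : ℕ, ∃ n, N < n ∧ n ≡ b0 [MOD primorial w] ∧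
      ∃ i j, i ≠ j ∧ (n + h i).Prime ∧ (n + h j).Prime) (Q : ℕ) (hQ0 : 0 < Q) (hQ : ∀ q, q.Prime → q ≤ k → q ∣ Q) :
    ∃ d, 0 < d ∧ {n : ℕ | Nat.nth Nat.Prime (n + 1) - Nat.nth Nat.Prime n = 2 * (Q * d)}.Infinite := by
  by_contra hcon
  push Not at hcon
  have hfin : (⋃ d ∈ Finset.Icc 1 k, {n : ℕ | Nat.nth Nat.Prime (n + 1) - Nat.nth Nat.Prime n = 2 * (Q * d)}).Finite := by
    refine Set.Finite.biUnion (Finset.finite_toSet _) fun d hd => ?_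
    exact hcon d (by have := Finset.mem_Icc.1 (Finset.mem_coe.1 hd); omega)
  obtain ⟨N, hN⟩ := hfin.bddAbove
  obtain ⟨w0, hw0⟩ := hk (fun j => 2 * Q * (j : ℕ)) (fun i j hij => by
    have : 2 * Q * (i : ℕ) = 2 * Q * (j : ℕ) := hij
    exact Fin.ext (Nat.eq_of_mul_eq_mul_left (by omega) this))
  obtain ⟨b, hb1, hb2⟩ := crt_exists k Q hQ _ rfl (w0 + Nat.nth Nat.Prime (2 * (2 * Q * k))) (by omega)
  set w := w0 + Nat.nth Nat.Prime (2 * (2 * Q * k)) with hw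
  obtain ⟨n, hnN, hnb, i, j, hij, hi, hj⟩ := hw0 w (by omega) b hb1 (Nat.nth Nat.Prime N + w)
  wlog hlt : i < j generalizing i j
  · exact this j i hij.symm hj hi (lt_of_le_of_ne (not_lt.1 hlt) hij.symm)
  -- the next prime
  have hlt' : 2 * Q * (i : ℕ) < 2 * Q * (j : ℕ) := Nat.mul_lt_mul_of_pos_left hlt (by omega)
  set P := n + 2 * Q * (i : ℕ) with hP
  have hP1 : Nat.nth Nat.Prime (Nat.count Nat.Prime P) = P := Nat.nth_count hi
  set x := Nat.count Nat.Prime P with hx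
  have hPx : P < Nat.nth Nat.Prime (x + 1) := by
    rw [← hP1]; exact Nat.nth_strictMono Nat.infinite_setOfPred_prime (Nat.lt_succ_self _)
  have hxj : Nat.nth Nat.Prime (x + 1) ≤ n + 2 * Q * (j : ℕ) := by
    have h1 : x < Nat.count Nat.Prime (n + 2 * Q * (j : ℕ)) := Nat.count_strict_mono hi (by omega)
    calc _ ≤ Nat.nth Nat.Prime (Nat.count Nat.Prime (n + 2 * Q * (j : ℕ))) := Nat.nth_monotone Nat.infinite_setOfPred_prime h1
      _ = _ := Nat.nth_count hj
  have hpr := Nat.prime_nth_prime (x + 1)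
  obtain ⟨u, hu⟩ : ∃ u, Nat.nth Nat.Prime (x + 1) = n + u := ⟨Nat.nth Nat.Prime (x + 1) - n, by omega⟩
  rw [hu] at hPx hxj hpr
  have hjS : 2 * Q * (j : ℕ) < 2 * Q * k := Nat.mul_lt_mul_of_pos_left j.2 (by omega)
  have hgood : ∃ l : Fin k, u = 2 * Q * l := by
    by_contra hno
    push Not at hno
    obtain ⟨q, hq, hqw, hqd⟩ := hb2 u (by omega) hno
    have hqW := (Nat.Prime.dvd_primorial_iff hq).2 hqw
    have hd : q ∣ n + u := ((hnb.of_dvd hqW).add_right u).dvd_iff (dvd_refl _) |>.2 hqd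
    have := (Nat.prime_dvd_prime_iff_eq hq hpr).1 hd
    omega
  obtain ⟨l, hl⟩ := hgood
  have hil : (i : ℕ) < l := by
    have : 2 * Q * (i : ℕ) < 2 * Q * (l : ℕ) := by omega
    exact lt_of_mul_lt_mul_left this (Nat.zero_le _)
  have hxN : N < x := by
    have h1 : Nat.nth Nat.Prime N < Nat.nth Nat.Prime x := by rw [hP1]; omega
    exact (Nat.nth_strictMono Nat.infinite_setOfPred_prime).lt_iff_lt.1 h1
  have hmem : x ∈ (⋃ d ∈ Finset.Icc 1 k, {n : ℕ | Nat.nth Nat.Prime (n + 1) - Nat.nth Nat.Prime n = 2 * (Q * d)}) := by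
    refine Set.mem_biUnion (x := (l : ℕ) - i) (Finset.mem_coe.2 (Finset.mem_Icc.2 ⟨by omega, by have := l.2; omega⟩)) ?_
    change Nat.nth Nat.Prime (x + 1) - Nat.nth Nat.Prime x = 2 * (Q * ((l : ℕ) - i))
    rw [hu, hP1, hl, hP, ← mul_assoc, Nat.mul_sub]
    omega
  have := hN hmem
  omega

end RG

/-- For every real `c > 0`, there are infinitely many `m` all of whose
prime factors exceed `c` such that `(p_{n+1} - p_n)/2 = m - 1`, i.e.,
`p_{n+1} - p_n = 2 * (m - 1)`, for infinitely many `n`. -/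
theorem rough_numbers_shifted_halved_gaps (c : ℝ) (hc : 0 < c) :
    {m : ℕ | (∀ p : ℕ, p.Prime → p ∣ m → c < (p : ℝ)) ∧
      {n : ℕ | Nat.nth Nat.Prime (n + 1) - Nat.nth Nat.Prime n
        = 2 * (m - 1)}.Infinite}.Infinite := by
  obtain ⟨k, hk0, hk⟩ := RG.maynard_two
  refine Set.infinite_of_forall_exists_gt fun M => ?_
  have hfac : ∀ q : ℕ, q.Prime → q ≤ k + ⌈c⌉₊ → q ∣ (k + ⌈c⌉₊).factorial * (M + 1) := fun q hq hle =>
    (Nat.dvd_factorial hq.pos hle).mul_right _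
  set Q := (k + ⌈c⌉₊).factorial * (M + 1) with hQ
  have hQM : M + 1 ≤ Q := Nat.le_mul_of_pos_left _ (Nat.factorial_pos _)
  obtain ⟨d, hd0, hd⟩ := RG.gaps k hk Q (by omega) (fun q hq hqk => hfac q hq (by omega))
  have hQd : Q ≤ Q * d := Nat.le_mul_of_pos_right _ hd0
  refine ⟨Q * d + 1, ⟨fun q hq hqd => ?_, ?_⟩, by omega⟩
  · by_contra hle
    have h1 : q ≤ ⌈c⌉₊ := by exact_mod_cast (not_lt.1 hle).trans (Nat.le_ceil c)
    have h2 : q ∣ Q * d := (hfac q hq (by omega)).mul_right d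
    have h3 := (Nat.dvd_add_right h2).1 hqd
    exact hq.one_lt.ne' (Nat.dvd_one.1 h3)
  · rw [Nat.add_sub_cancel]
    exact hd
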